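/- (Stable branching rule for GL_n ⊂ Sp_{2n}, polarization.) Let μ⁺, μ⁻, λ be non-negative integer partitions each with at most ⌊n/2⌋ parts. Then [V^λ_(2n), F^{(μ⁺,μ⁻)}_(n)] = Σ c^γ_{μ⁺μ⁻} c^λ_{γ, 2δ}, the sum over all pairs of non-negative integer partitions (γ, δ), where 2δ runs over even partitions. -/

import Mathlib

open scoped BigOperators TensorProduct
open Matrix

noncomputable section

def IsPartition (f : ℕ → ℕ) : Prop :=
  (∀ ⦃i j : ℕ⦄, i ≤ j → f j ≤ f i) ∧ ∃ N, f N = 0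

def Ptn : Type := {f : ℕ → ℕ // IsPartition f}

def plen (f : ℕ → ℕ) : ℕ := sInf {k | f k = 0}

def conj (f : ℕ → ℕ) : ℕ → ℕ := fun i => Set.ncard {j | i < f j}

def double (f : ℕ → ℕ) : ℕ → ℕ := fun i => 2 * f i

def InSkew (l m : ℕ → ℕ) (i j : ℕ) : Prop := m i ≤ j ∧ j < l i

def IsLRTableau (l m nu : ℕ → ℕ) (T : ℕ → ℕ → ℕ) : Prop :=
  (∀ i, m i ≤ l i) ∧
  (∀ i j, T i j ≠ 0 ↔ InSkew l m i j) ∧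
  (∀ i j k, InSkew l m i j → InSkew l m i k → j ≤ k → T i j ≤ T i k) ∧
  (∀ i k j, InSkew l m i j → InSkew l m k j → i < k → T i j < T k j) ∧
  (∀ r, Set.ncard {p : ℕ × ℕ | T p.1 p.2 = r + 1} = nu r) ∧
  (∀ i j r, Set.ncard {p : ℕ × ℕ | (p.1 < i ∨ (p.1 = i ∧ j ≤ p.2)) ∧ T p.1 p.2 = r + 2}
          ≤ Set.ncard {p : ℕ × ℕ | (p.1 < i ∨ (p.1 = i ∧ j ≤ p.2)) ∧ T p.1 p.2 = r + 1})

def lrCoeff (l m nu : ℕ → ℕ) : ℕ := Set.ncard {T : ℕ → ℕ → ℕ | IsLRTableau l m nu T}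

section Reps

variable {G : Type*} [Group G] {V W : Type*}
  [AddCommGroup V] [Module ℂ V] [AddCommGroup W] [Module ℂ W]

def IsSubrep (ρ : Representation ℂ G V) (U : Submodule ℂ V) : Prop :=
  ∀ g : G, ∀ x ∈ U, ρ g x ∈ U

def IsIrreducibleRep (ρ : Representation ℂ G V) : Prop :=
  Nontrivial V ∧ ∀ U : Submodule ℂ V, IsSubrep ρ U → U = ⊥ ∨ U = ⊤

def equivariantMaps (π : Representation ℂ G W) (ρ : Representation ℂ G V) :
    Submodule ℂ (W →ₗ[ℂ] V) where
  carrier := {f | ∀ g : G, f ∘ₗ (π g) = (ρ g) ∘ₗ f}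
  add_mem' := by
    intro f h hf hh g
    simp only [Set.mem_setOf_eq] at *
    rw [LinearMap.add_comp, LinearMap.comp_add, hf g, hh g]
  zero_mem' := by
    intro g
    simp only [Set.mem_setOf_eq, LinearMap.zero_comp, LinearMap.comp_zero]
  smul_mem' := by
    intro c f hf g
    simp only [Set.mem_setOf_eq] at *
    rw [LinearMap.smul_comp, LinearMap.comp_smul, hf g]

def repMult (ρ : Representation ℂ G V) (π : Representation ℂ G W) : ℕ :=
  Module.finrank ℂ (equivariantMaps π ρ)

end Reps

def IsUpperUni {N : ℕ} (A : Matrix (Fin N) (Fin N) ℂ) : Prop :=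
  (∀ i, A i i = 1) ∧ ∀ i j : Fin N, (j : ℕ) < (i : ℕ) → A i j = 0

def IsGLHW (n : ℕ) (a : Fin n → ℤ) {V : Type*} [AddCommGroup V] [Module ℂ V]
    (ρ : Representation ℂ (GL (Fin n) ℂ) V) : Prop :=
  IsIrreducibleRep ρ ∧ FiniteDimensional ℂ V ∧
  ∃ v : V, v ≠ 0 ∧
    (∀ g : GL (Fin n) ℂ, IsUpperUni (g : Matrix (Fin n) (Fin n) ℂ) → ρ g v = v) ∧
    (∀ (g : GL (Fin n) ℂ) (d : Fin n → ℂ),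
      (g : Matrix (Fin n) (Fin n) ℂ) = Matrix.diagonal d →
      ρ g v = (∏ i, d i ^ (a i)) • v)

def polyWeight (n : ℕ) (lam : ℕ → ℕ) : Fin n → ℤ := fun i => (lam (i : ℕ) : ℤ)

def ratWeight (n : ℕ) (lp lm : ℕ → ℕ) : Fin n → ℤ :=
  fun i => (lp (i : ℕ) : ℤ) - (lm (n - 1 - (i : ℕ)) : ℤ)

def formGroup {ι : Type*} [Fintype ι] [DecidableEq ι] (S : Matrix ι ι ℂ) :
    Subgroup (GL ι ℂ) where
  carrier := {g | (g : Matrix ι ι ℂ)ᵀ * S * (g : Matrix ι ι ℂ) = S}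
  one_mem' := by
    simp [Matrix.transpose_one]
  mul_mem' := by
    intro a b ha hb
    set A : Matrix ι ι ℂ := (a : Matrix ι ι ℂ) with hA
    set B : Matrix ι ι ℂ := (b : Matrix ι ι ℂ) with hB
    have ha' : Aᵀ * S * A = S := ha
    have hb' : Bᵀ * S * B = S := hb
    show ((↑(a * b) : Matrix ι ι ℂ))ᵀ * S * (↑(a * b) : Matrix ι ι ℂ) = S
    have hab : (↑(a * b) : Matrix ι ι ℂ) = A * B := Units.val_mul a b
    rw [hab, Matrix.transpose_mul]
    calc Bᵀ * Aᵀ * S * (A * B) = Bᵀ * (Aᵀ * S * A) * B := by noncomm_ring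
    _ = S := by rw [ha', hb']
  inv_mem' := by
    intro a ha
    set A : Matrix ι ι ℂ := (a : Matrix ι ι ℂ) with hA
    have ha' : Aᵀ * S * A = S := ha
    set C : Matrix ι ι ℂ := ((a⁻¹ : GL ι ℂ) : Matrix ι ι ℂ) with hC
    show Cᵀ * S * C = S
    have hac : A * C = 1 := by
      rw [hA, hC, ← Units.val_mul, mul_inv_cancel, Units.val_one]
    calc Cᵀ * S * C = Cᵀ * (Aᵀ * S * A) * C := by rw [ha']
    _ = (A * C)ᵀ * S * (A * C) := by rw [Matrix.transpose_mul]; noncomm_ring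
    _ = S := by rw [hac]; simp [Matrix.transpose_one]

def symForm (n : ℕ) : Matrix (Fin n) (Fin n) ℂ :=
  Matrix.of fun i j => if (i : ℕ) + (j : ℕ) = n - 1 then 1 else 0

def sympForm (n : ℕ) : Matrix (Fin (2 * n)) (Fin (2 * n)) ℂ :=
  Matrix.of fun i j =>
    if (i : ℕ) + (j : ℕ) = 2 * n - 1 then (if (i : ℕ) < n then 1 else -1) else 0

def OGL (n : ℕ) : Subgroup (GL (Fin n) ℂ) := formGroup (symForm n)

def SpGL (n : ℕ) : Subgroup (GL (Fin (2 * n)) ℂ) := formGroup (sympForm n)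

/-- The matrix of a distinguished reflection (an element of `O_n(ℂ)` of determinant `-1`
fixing the highest weight vectors of the representations `E^mu_(n)` for
`ℓ(mu) < n/2`): for odd `n`, the reflection negating the middle basis vector; for even
`n`, the permutation swapping the two middle basis vectors. -/
def reflMatrix (n : ℕ) : Matrix (Fin n) (Fin n) ℂ :=
  Matrix.of fun i j =>
    if 2 * (i : ℕ) + 1 = n ∧ i = j then -1
    else if (2 * (i : ℕ) = n ∧ 2 * (j : ℕ) + 2 = n) ∨ (2 * (i : ℕ) + 2 = n ∧ 2 * (j : ℕ) = n)
      then 1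
    else if i = j ∧ ¬(2 * (i : ℕ) = n ∨ 2 * (i : ℕ) + 2 = n) then 1
    else 0

/-- The partition associated to `mu` (with `(mu')_1 + (mu')_2 ≤ n`): the first column
length `(mu')_1` is replaced by `n - (mu')_1`.  One has `E^{assoc n mu} = E^mu ⊗ det`. -/
def assocPtn (n : ℕ) (mu : ℕ → ℕ) : ℕ → ℕ :=
  conj (fun j => if j = 0 then n - conj mu 0 else conj mu j)

/-- `v` is a highest weight vector of weight `mu` for (the identity component of)
`O_n(ℂ)`: it is fixed by all upper triangular unipotent elements, and the diagonal
torus elements of determinant one act via the character attached to `mu`. -/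
def IsOHWvec (n : ℕ) (mu : ℕ → ℕ) {V : Type*} [AddCommGroup V] [Module ℂ V]
    (ρ : Representation ℂ (OGL n) V) (v : V) : Prop :=
  (∀ g : OGL n, IsUpperUni ((g : GL (Fin n) ℂ) : Matrix (Fin n) (Fin n) ℂ) → ρ g v = v) ∧
  (∀ (g : OGL n) (d : Fin n → ℂ),
    ((g : GL (Fin n) ℂ) : Matrix (Fin n) (Fin n) ℂ) = Matrix.diagonal d →
    (∏ i, d i) = 1 →
    ρ g v = (∏ i, d i ^ (mu (i : ℕ))) • v)

/-- `ρ` is the irreducible rational representation `E^mu_(n)` of the complex orthogonal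
group `O_n(ℂ)`, indexed by a partition `mu` with `(mu')_1 + (mu')_2 ≤ n`. -/
def IsOIrrep (n : ℕ) (mu : ℕ → ℕ) {V : Type*} [AddCommGroup V] [Module ℂ V]
    (ρ : Representation ℂ (OGL n) V) : Prop :=
  IsIrreducibleRep ρ ∧ FiniteDimensional ℂ V ∧
  (if 2 * conj mu 0 ≤ n then
    ∃ v : V, v ≠ 0 ∧ IsOHWvec n mu ρ v ∧
      (2 * conj mu 0 = n ∨
        ∀ g : OGL n, ((g : GL (Fin n) ℂ) : Matrix (Fin n) (Fin n) ℂ) = reflMatrix n →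
          ρ g v = v)
  else
    ∃ v : V, v ≠ 0 ∧ IsOHWvec n (assocPtn n mu) ρ v ∧
      (∀ g : OGL n, ((g : GL (Fin n) ℂ) : Matrix (Fin n) (Fin n) ℂ) = reflMatrix n →
        ρ g v = - v))

/-- `ρ` is the irreducible rational representation `V^mu_(2n)` of `Sp_{2n}(ℂ)` with
highest weight `mu` (a partition with at most `n` parts). -/
def IsSpHW (n : ℕ) (mu : ℕ → ℕ) {V : Type*} [AddCommGroup V] [Module ℂ V]
    (ρ : Representation ℂ (SpGL n) V) : Prop :=
  IsIrreducibleRep ρ ∧ FiniteDimensional ℂ V ∧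
  ∃ v : V, v ≠ 0 ∧
    (∀ g : SpGL n,
      IsUpperUni ((g : GL (Fin (2 * n)) ℂ) : Matrix (Fin (2 * n)) (Fin (2 * n)) ℂ) →
      ρ g v = v) ∧
    (∀ (g : SpGL n) (d : Fin (2 * n) → ℂ),
      ((g : GL (Fin (2 * n)) ℂ) : Matrix (Fin (2 * n)) (Fin (2 * n)) ℂ) = Matrix.diagonal d →
      ρ g v = (∏ i, d i ^ (mu (i : ℕ))) • v)


/-- `φ` is the polarization embedding of `GL_n` into a subgroup `K` of `GL_{2n}(ℂ)`
(with respect to the polarization `ℂ^{2n} ≅ ℂ^n ⊕ (ℂ^n)*` adapted to the split form):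
`g` acts by `g` on the first summand and by the dual (inverse transpose) action on the
second. -/
def IsPolarizationEmbed (n : ℕ) {K : Subgroup (GL (Fin (2 * n)) ℂ)}
    (φ : GL (Fin n) ℂ →* K) : Prop :=
  ∀ (g : GL (Fin n) ℂ) (i j : Fin (2 * n)),
    ((φ g : GL (Fin (2 * n)) ℂ) : Matrix (Fin (2 * n)) (Fin (2 * n)) ℂ) i j =
      if hi : (i : ℕ) < n then
        (if hj : (j : ℕ) < n then
          (↑g : Matrix (Fin n) (Fin n) ℂ) ⟨(i : ℕ), hi⟩ ⟨(j : ℕ), hj⟩ else 0)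
      else
        (if hj : (j : ℕ) < n then 0
         else (↑(g⁻¹) : Matrix (Fin n) (Fin n) ℂ)
            ⟨2 * n - 1 - (j : ℕ), by have := j.isLt; omega⟩
            ⟨2 * n - 1 - (i : ℕ), by have := i.isLt; omega⟩)

open Module (finrank End Dual)

/-- Square complex matrices of size `k`. -/
abbrev Mt (k : ℕ) : Type := Matrix (Fin k) (Fin k) ℂ

/-! ### Functions of a natural number that agree with a polynomial -/

def PolyFn (f : ℕ → ℂ) : Prop := ∃ p : Polynomial ℂ, ∀ m : ℕ, f m = p.eval (m : ℂ)

namespace PolyFn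

lemma const (c : ℂ) : PolyFn fun _ => c := ⟨Polynomial.C c, by simp⟩

lemma natCast : PolyFn fun m => (m : ℂ) := ⟨Polynomial.X, by simp⟩

lemma add {f g : ℕ → ℂ} (hf : PolyFn f) (hg : PolyFn g) : PolyFn fun m => f m + g m := by
  obtain ⟨p, hp⟩ := hf
  obtain ⟨q, hq⟩ := hg
  exact ⟨p + q, fun m => by simp [hp, hq]⟩

lemma mul {f g : ℕ → ℂ} (hf : PolyFn f) (hg : PolyFn g) : PolyFn fun m => f m * g m := by
  obtain ⟨p, hp⟩ := hf
  obtain ⟨q, hq⟩ := hg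
  exact ⟨p * q, fun m => by simp [hp, hq]⟩

lemma pow {f : ℕ → ℂ} (hf : PolyFn f) (a : ℕ) : PolyFn fun m => f m ^ a := by
  obtain ⟨p, hp⟩ := hf
  exact ⟨p ^ a, fun m => by simp [hp]⟩

lemma sum {ι : Type*} (s : Finset ι) {f : ι → ℕ → ℂ} (hf : ∀ i ∈ s, PolyFn (f i)) :
    PolyFn fun m => ∑ i ∈ s, f i m := by
  classical
  induction s using Finset.induction_on with
  | empty => simpa using const 0
  | insert a s ha ih =>
    simp only [Finset.sum_insert ha]
    exact (hf a (by simp)).add (ih fun i hi => hf i (by simp [hi]))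

lemma prod {ι : Type*} (s : Finset ι) {f : ι → ℕ → ℂ} (hf : ∀ i ∈ s, PolyFn (f i)) :
    PolyFn fun m => ∏ i ∈ s, f i m := by
  classical
  induction s using Finset.induction_on with
  | empty => simpa using const 1
  | insert a s ha ih =>
    simp only [Finset.prod_insert ha]
    exact (hf a (by simp)).mul (ih fun i hi => hf i (by simp [hi]))

lemma choose_pow (a j : ℕ) : PolyFn fun m => (((m ^ a).choose j : ℕ) : ℂ) := by
  refine ⟨(Polynomial.C ((j.factorial : ℂ)⁻¹) * descPochhammer ℂ j).comp (Polynomial.X ^ a),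
    fun m => ?_⟩
  show (((m ^ a).choose j : ℕ) : ℂ) = _
  rw [Nat.cast_choose_eq_descPochhammer_div ℂ]
  simp [div_eq_inv_mul]

lemma eq_zero_of_eventually {p : Polynomial ℂ} (h : ∀ m : ℕ, 1 ≤ m → p.eval (m : ℂ) = 0) :
    p = 0 := by
  refine Polynomial.eq_zero_of_infinite_isRoot p ?_
  refine Set.Infinite.mono (s := (fun m : ℕ => (m : ℂ)) '' Set.Ici 1) ?_ ?_
  · rintro _ ⟨m, hm, rfl⟩
    exact h m hm
  · exact (Set.Ici_infinite 1).image (Nat.cast_injective.injOn)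

/-- A polynomial function constant on positive integers is constant. -/
lemma eq_of_const {f : ℕ → ℂ} (hf : PolyFn f) (c : ℂ) (h : ∀ m, 1 ≤ m → f m = c) (m : ℕ) :
    f m = c := by
  obtain ⟨p, hp⟩ := hf
  have : p - Polynomial.C c = 0 := eq_zero_of_eventually fun m hm => by
    simp [← hp, h m hm]
  rw [hp, sub_eq_zero.1 this]
  simp

/-- If a product of polynomial functions vanishes and the second factor does not vanish at `0`,
then the first factor vanishes. -/
lemma eq_zero_of_mul {f g : ℕ → ℂ} (hf : PolyFn f) (hg : PolyFn g)
    (h : ∀ m, f m * g m = 0) (h0 : g 0 ≠ 0) (m : ℕ) : f m = 0 := by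
  obtain ⟨p, hp⟩ := hf
  obtain ⟨q, hq⟩ := hg
  have : p * q = 0 := eq_zero_of_eventually fun m hm => by
    simp [← hp, ← hq, h m]
  rcases mul_eq_zero.1 this with h1 | h1
  · simp [hp, h1]
  · exact absurd (by simp [hq, h1]) h0

end PolyFn

section Unipotent

variable {V : Type*} [AddCommGroup V] [Module ℂ V] [FiniteDimensional ℂ V]

lemma isNilpotent_sub_one_of_forall_eigenvalue (X : End ℂ V)
    (h : ∀ z : ℂ, X.HasEigenvalue z → z = 1) : IsNilpotent (X - 1) := by
  have hs : (minpoly ℂ X).Splits := IsAlgClosed.splits _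
  have hr : (minpoly ℂ X).roots = Multiset.replicate (minpoly ℂ X).roots.card 1 := by
    refine Multiset.eq_replicate_card.2 fun z hz => h z ?_
    exact Module.End.hasEigenvalue_of_isRoot ((Polynomial.mem_roots'.1 hz).2)
  have hm := hs.eq_prod_roots_of_monic (minpoly.monic (Algebra.IsIntegral.isIntegral X))
  rw [hr] at hm
  have := minpoly.aeval ℂ X
  rw [hm] at this
  simp at this
  exact ⟨_, this⟩

lemma one_param_pow {M : Type*} [Monoid M] {X : ℂ → M} (hadd : ∀ s t, X (s + t) = X s * X t)
    (h0 : X 0 = 1) (t : ℂ) (m : ℕ) : X (m * t) = X t ^ m := by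
  induction m with
  | zero => simp [h0]
  | succ m ih => rw [pow_succ, ← ih, ← hadd]; push_cast; ring_nf

lemma one_param_unipotent {X : ℂ → End ℂ V} (hadd : ∀ s t, X (s + t) = X s * X t)
    (h0 : X 0 = 1) {C C' : End ℂ V} (h1 : C * C' = 1) (h2 : C' * C = 1) {q : ℕ}
    (hq : 2 ≤ q) (hc : ∀ t, C * X t * C' = X (q * t)) (t : ℂ) : IsNilpotent (X t - 1) := by
  classical
  have hpow : ∀ t (m : ℕ), X (m * t) = X t ^ m := one_param_pow hadd h0
  have hne : ∀ t z, (X t).HasEigenvalue z → z ≠ 0 := by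
    rintro t z hz rfl
    obtain ⟨v, hv⟩ := hz.exists_hasEigenvector
    have hv1 : X t v = 0 := by simpa using hv.apply_eq_smul
    have : X (-t) (X t v) = v := by
      rw [← Module.End.mul_apply, ← hadd]; simp [h0]
    exact hv.2 (by rw [← this, hv1, map_zero])
  have hstep : ∀ t z, (X t).HasEigenvalue z → (X t).HasEigenvalue (z ^ q) := by
    intro t z hz
    obtain ⟨v, hv⟩ := hz.exists_hasEigenvector
    refine Module.End.hasEigenvalue_of_hasEigenvector (x := C' v) ⟨?_, ?_⟩
    · rw [Module.End.mem_eigenspace_iff]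
      have e1 : C (X t (C' v)) = z ^ q • v := by
        have := LinearMap.congr_fun (hc t) v
        rw [hpow] at this
        simpa [hv.pow_apply] using this
      calc X t (C' v) = (C' * C) (X t (C' v)) := by rw [h2]; rfl
        _ = C' (z ^ q • v) := by rw [← e1]; rfl
        _ = _ := by rw [map_smul]
    · intro h
      apply hv.2
      have : (C * C') v = 0 := by rw [Module.End.mul_apply, h, map_zero]
      rwa [h1] at this
  have hiter : ∀ t z, (X t).HasEigenvalue z → ∀ i : ℕ, (X t).HasEigenvalue (z ^ q ^ i) := by
    intro t z hz i
    induction i with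
    | zero => simpa using hz
    | succ i ih => rw [pow_succ, pow_mul]; exact hstep t _ ih
  set d := finrank ℂ V
  set M : ℕ := ∏ j ∈ Finset.range (d + 1), ∏ i ∈ Finset.range j, (q ^ j - q ^ i) with hM
  have hlt : ∀ i j, i < j → q ^ i < q ^ j := fun i j h => Nat.pow_lt_pow_right (by omega) h
  have hMpos : M ≠ 0 := by
    rw [hM, Finset.prod_ne_zero_iff]
    intro j _
    rw [Finset.prod_ne_zero_iff]
    intro i hi
    have := hlt i j (Finset.mem_range.1 hi)
    omega
  have hroot : ∀ t z, (X t).HasEigenvalue z → z ^ M = 1 := by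
    intro t z hz
    have hmaps : ∀ i ∈ Finset.range (d + 1), z ^ q ^ i ∈ (X t).charpoly.roots.toFinset := by
      intro i _
      rw [Multiset.mem_toFinset, Polynomial.mem_roots (LinearMap.charpoly_monic _).ne_zero]
      exact (Module.End.hasEigenvalue_iff_isRoot_charpoly _ _).1 (hiter t z hz i)
    have hcard : (X t).charpoly.roots.toFinset.card < (Finset.range (d + 1)).card := by
      rw [Finset.card_range]
      refine Nat.lt_succ_of_le ((Multiset.toFinset_card_le _).trans ?_)
      refine (Polynomial.card_roots' _).trans ?_
      rw [LinearMap.charpoly_natDegree]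
    obtain ⟨i, hi, j, hj, hij, he⟩ :=
      Finset.exists_ne_map_eq_of_card_lt_of_maps_to hcard hmaps
    wlog hlt' : i < j generalizing i j
    · exact this j hj i hi hij.symm he.symm (by omega)
    have hz1 : z ^ (q ^ j - q ^ i) = 1 := by
      have e : z ^ q ^ i * z ^ (q ^ j - q ^ i) = z ^ q ^ i * 1 := by
        rw [← pow_add, mul_one, he]; congr 1; have := hlt i j hlt'; omega
      exact mul_left_cancel₀ (pow_ne_zero _ (hne t z hz)) e
    have hdvd : (q ^ j - q ^ i) ∣ M :=
      (Finset.dvd_prod_of_mem (fun i => q ^ j - q ^ i) (Finset.mem_range.2 hlt')).trans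
        (Finset.dvd_prod_of_mem (fun j => ∏ i ∈ Finset.range j, (q ^ j - q ^ i)) hj)
    obtain ⟨e, he⟩ := hdvd
    rw [he, pow_mul, hz1, one_pow]
  refine isNilpotent_sub_one_of_forall_eigenvalue _ fun z hz => ?_
  have hMC : (M : ℂ) ≠ 0 := by exact_mod_cast hMpos
  have hXt : X t = X (t / M) ^ M := by rw [← hpow]; congr 1; field_simp
  -- every eigenvalue of a power is a power of an eigenvalue
  have : z ∈ spectrum ℂ (X (t / M) ^ M) := by
    rw [← hXt]; exact Module.End.hasEigenvalue_iff_mem_spectrum.1 hz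
  have hVn : Nontrivial V := by
    obtain ⟨v, hv⟩ := hz.exists_hasEigenvector
    exact ⟨⟨v, 0, hv.2⟩⟩
  rw [spectrum.map_pow_of_pos (𝕜 := ℂ) _ (Nat.pos_of_ne_zero hMpos)] at this
  obtain ⟨w, hw, rfl⟩ := this
  exact hroot _ _ (Module.End.hasEigenvalue_iff_mem_spectrum.2 hw)

lemma polyFn_of_isNilpotent {X : End ℂ V} (h : IsNilpotent (X - 1)) (a : ℕ)
    (ξ : Dual ℂ V) (y : V) : PolyFn fun m => ξ ((X ^ (m ^ a)) y) := by
  obtain ⟨d, hd⟩ := h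
  have key : ∀ e : ℕ, X ^ e = ∑ j ∈ Finset.range d, (e.choose j : ℂ) • (X - 1) ^ j := by
    intro e
    have h1 : X ^ e = ∑ j ∈ Finset.range (e + d + 1), (e.choose j : ℂ) • (X - 1) ^ j := by
      have : X = (X - 1) + 1 := by simp
      conv_lhs => rw [this]
      rw [(Commute.one_right (X - 1)).add_pow]
      simp only [one_pow, mul_one]
      rw [show e + d + 1 = (e + 1) + d by ring, Finset.sum_range_add _ (e + 1) d]
      rw [Finset.sum_eq_zero (s := Finset.range d), add_zero]
      · refine Finset.sum_congr rfl fun j _ => ?_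
        rw [← nsmul_eq_mul', Nat.cast_smul_eq_nsmul]
      · intro j _
        rw [Nat.choose_eq_zero_of_lt (by omega)]; simp
    rw [h1, show e + d + 1 = d + (e + 1) by ring, Finset.sum_range_add _ d (e + 1)]
    rw [Finset.sum_eq_zero (s := Finset.range (e + 1)), add_zero]
    intro j _
    rw [pow_add, hd, zero_mul, smul_zero]
  simp only [key, LinearMap.sum_apply, map_sum, LinearMap.smul_apply, map_smul, smul_eq_mul]
  exact PolyFn.sum _ fun j _ => (PolyFn.choose_pow a j).mul (PolyFn.const _)

end Unipotent

/-! ### Commuting operators -/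

section Commuting

variable {ι V : Type*} [AddCommGroup V] [Module ℂ V] [FiniteDimensional ℂ V]

/-- If pairwise commuting operators have a common nonzero left null functional, they have a common
nonzero null vector. -/
lemma exists_common_kernel (N : ι → End ℂ V) (hN : ∀ i j, N i * N j = N j * N i)
    (ξ : Dual ℂ V) (hξ : ξ ≠ 0) (h : ∀ i x, ξ (N i x) = 0) :
    ∃ v, v ≠ 0 ∧ ∀ i, N i v = 0 := by
  have hcomm : ∀ i j x, N i (N j x) = N j (N i x) := fun i j x => LinearMap.congr_fun (hN i j) x
  -- a minimal stable subspace on which the functional does not vanish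
  obtain ⟨W, ⟨hWst, x₀, hx₀, hξx₀⟩, hmin⟩ := WellFounded.has_min
    (wellFounded_lt (α := Submodule ℂ V))
    {W | (∀ i, ∀ x ∈ W, N i x ∈ W) ∧ ∃ x ∈ W, ξ x ≠ 0} ⟨⊤, by simp, by
      by_contra hc
      push Not at hc
      exact hξ (LinearMap.ext fun x => hc x trivial)⟩
  have hpowc : ∀ i j (m : ℕ) x, N i ((N j ^ m) x) = (N j ^ m) (N i x) := fun i j m x =>
    LinearMap.congr_fun (Commute.pow_right (show Commute (N i) (N j) from hN i j) m) x
  have hnil : ∀ i, ∃ m : ℕ, ∀ x ∈ W, (N i ^ m) x = 0 := by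
    intro i
    obtain ⟨m, hm1, hm2⟩ := ((((N i).restrict (hWst i)).eventually_isCompl_ker_pow_range_pow).and
      (Filter.eventually_ge_atTop 1)).exists
    have hr : ∀ x : W, ((((N i).restrict (hWst i)) ^ m) x : V) = (N i ^ m) x := by
      intro x
      rw [Module.End.pow_restrict]; rfl
    refine ⟨m, ?_⟩
    set W' : Submodule ℂ V := W ⊓ LinearMap.ker (N i ^ m) with hW'
    have hle : W' ≤ W := inf_le_left
    have hmem : ¬ W' < W := hmin W' ⟨?_, ?_⟩
    · have : W' = W := by
        rcases lt_or_eq_of_le hle with h1 | h1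
        · exact absurd h1 hmem
        · exact h1
      intro x hx
      rw [← this] at hx
      exact hx.2
    · intro j x hx
      refine ⟨hWst j x hx.1, ?_⟩
      have h2 : (N i ^ m) x = 0 := hx.2
      show (N i ^ m) (N j x) = 0
      rw [← hpowc, h2, map_zero]
    · have := hm1.sup_eq_top
      have hx : (⟨x₀, hx₀⟩ : W) ∈ (⊤ : Submodule ℂ W) := trivial
      rw [← this] at hx
      obtain ⟨a, ha, b, ⟨c, hc⟩, hab⟩ := Submodule.mem_sup.1 hx
      refine ⟨a, ⟨a.2, ?_⟩, ?_⟩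
      · show (N i ^ m) a = 0
        rw [← hr, LinearMap.mem_ker.1 ha]; rfl
      · have hb : ξ b = 0 := by
          rw [← hc, hr]
          obtain ⟨m', rfl⟩ : ∃ m', m = m' + 1 := ⟨m - 1, by omega⟩
          rw [pow_succ', Module.End.mul_apply]
          exact h i _
        have hab' : (a : V) + b = x₀ := congrArg Subtype.val hab
        rw [← hab', map_add, hb, add_zero] at hξx₀
        exact hξx₀
  -- a minimal nonzero stable subspace of `W`
  have hx₀0 : x₀ ≠ 0 := by rintro rfl; simp at hξx₀
  obtain ⟨U, ⟨hUst, hUW, u, hu, hu0⟩, hUmin⟩ := WellFounded.has_min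
    (wellFounded_lt (α := Submodule ℂ V))
    {U | (∀ i, ∀ x ∈ U, N i x ∈ U) ∧ U ≤ W ∧ ∃ x ∈ U, x ≠ 0} ⟨W, hWst, le_rfl, x₀, hx₀, hx₀0⟩
  refine ⟨u, hu0, fun i => ?_⟩
  by_contra hne
  have hlt : U.map (N i) ≤ U := by
    rintro _ ⟨x, hx, rfl⟩
    exact hUst i x hx
  have hnot : ¬ U.map (N i) < U := hUmin _ ⟨?_, hlt.trans hUW, N i u, ⟨u, hu, rfl⟩, hne⟩
  · have heq : U.map (N i) = U := (lt_or_eq_of_le hlt).resolve_left hnot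
    have hp : ∀ m : ℕ, U.map (N i ^ m) = U := by
      intro m
      induction m with
      | zero => simp [Module.End.one_eq_id]
      | succ m ih => rw [pow_succ', Module.End.mul_eq_comp, Submodule.map_comp, ih, heq]
    obtain ⟨m, hm⟩ := hnil i
    have hu' : u ∈ U.map (N i ^ m) := by rw [hp]; exact hu
    obtain ⟨x, hx, hxu⟩ := hu'
    exact hu0 (by rw [← hxu, hm x (hUW hx)])
  · rintro j _ ⟨x, hx, rfl⟩
    rw [hcomm]
    exact ⟨N j x, hUst j x hx, rfl⟩

lemma exists_common_dual_kernel (N : ι → End ℂ V) (hN : ∀ i j, N i * N j = N j * N i)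
    (v : V) (hv : v ≠ 0) (h : ∀ i, N i v = 0) :
    ∃ ξ : Dual ℂ V, ξ ≠ 0 ∧ ∀ i x, ξ (N i x) = 0 := by
  obtain ⟨ξ, h1, h2⟩ := exists_common_kernel (V := Dual ℂ V)
    (fun i => Module.Dual.transpose (R := ℂ) (N i)) (by
      intro i j
      ext f x
      have := LinearMap.congr_fun (hN j i) x
      simp only [Module.End.mul_apply] at this
      simp [Module.Dual.transpose_apply, this])
    (Module.Dual.eval ℂ V v) (by
      intro h0
      apply hv
      exact (Module.forall_dual_apply_eq_zero_iff ℂ v).1 fun f => by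
        simpa using LinearMap.congr_fun h0 f)
    (by intro i f; simp [Module.Dual.transpose_apply, h i])
  refine ⟨ξ, h1, fun i x => ?_⟩
  simpa [Module.Dual.transpose_apply] using LinearMap.congr_fun (h2 i) x

end Commuting

/-! ### Groups with a big cell -/

/-- The elements of a family of one-parameter subgroups. -/
def rootElts {G : Type*} (X : Set (ℂ → G)) : Set G := {g | ∃ x ∈ X, ∃ t, g = x t}

/-- The submonoid generated by a family of one-parameter subgroups. -/
abbrev rootMon {G : Type*} [Group G] (X : Set (ℂ → G)) : Submonoid G :=
  Submonoid.closure (rootElts X)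

/-- Algebraic curves `ℕ → G` built from torus elements and one-parameter subgroups. -/
inductive PathIn {G : Type*} [Group G] (T : Subgroup G) (X : Set (ℂ → G)) : (ℕ → G) → Prop
  | const {t : G} (ht : t ∈ T) : PathIn T X fun _ => t
  | root {x : ℂ → G} (hx : x ∈ X) (a : ℕ) (t : ℂ) : PathIn T X fun m => x ((m : ℂ) ^ a * t)
  | mul {P Q : ℕ → G} (hP : PathIn T X P) (hQ : PathIn T X Q) : PathIn T X fun m => P m * Q m

structure CellData (G : Type*) [Group G] where
  T : Subgroup G
  c : ℕ → G
  Lo : Set (ℂ → G)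
  Up : Set (ℂ → G)
  δ : G → ℂ
  comm : ∀ s ∈ T, ∀ t ∈ T, s * t = t * s
  hc : ∀ m, c m ∈ T
  add : ∀ x ∈ Lo ∪ Up, ∀ s t, x (s + t) = x s * x t
  lo_conj : ∀ x ∈ Lo, ∃ a, 1 ≤ a ∧ ∀ m, 1 ≤ m → ∀ t, c m * x t * (c m)⁻¹ = x ((m : ℂ) ^ a * t)
  up_conj : ∀ x ∈ Up, ∃ a, 1 ≤ a ∧ ∀ m, 1 ≤ m → ∀ t, (c m)⁻¹ * x t * c m = x ((m : ℂ) ^ a * t)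
  gen : Submonoid.closure ((T : Set G) ∪ rootElts (Lo ∪ Up)) = ⊤
  δ_poly : ∀ P, PathIn T (Lo ∪ Up) P → PolyFn fun m => δ (P m)
  δ_T : ∀ t ∈ T, δ t ≠ 0
  cell : ∀ g, δ g ≠ 0 → ∃ l ∈ rootMon Lo, ∃ t ∈ T,
    ∃ u ∈ rootMon Up, g = l * t * u

namespace CellData

variable {G : Type*} [Group G] (C : CellData G)

abbrev Path (P : ℕ → G) : Prop := PathIn C.T (C.Lo ∪ C.Up) P

/-- Functions on the group that are polynomial along every path. -/
def PathPoly (f : G → ℂ) : Prop := ∀ P, C.Path P → PolyFn fun m => f (P m)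

lemma root_zero {x : ℂ → G} (hx : x ∈ C.Lo ∪ C.Up) : x 0 = 1 := by
  have := C.add x hx 0 0
  rw [add_zero] at this
  exact left_eq_mul.1 this

lemma exists_path (g : G) : ∃ P, C.Path P ∧ P 1 = g ∧ P 0 ∈ C.T := by
  have hg : g ∈ Submonoid.closure ((C.T : Set G) ∪ rootElts (C.Lo ∪ C.Up)) := by
    rw [C.gen]; trivial
  induction hg using Submonoid.closure_induction with
  | mem g hg =>
    rcases hg with hg | ⟨x, hx, t, rfl⟩
    · exact ⟨_, .const hg, rfl, hg⟩
    · refine ⟨_, .root hx 1 t, by simp, ?_⟩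
      simp [C.root_zero hx, one_mem]
  | one => exact ⟨_, .const (one_mem C.T), rfl, one_mem _⟩
  | mul g h _ _ ihg ihh =>
    obtain ⟨P, hP, rfl, hP0⟩ := ihg
    obtain ⟨Q, hQ, rfl, hQ0⟩ := ihh
    exact ⟨_, hP.mul hQ, rfl, mul_mem hP0 hQ0⟩

/-- A function polynomial along paths and vanishing on the big cell is zero. -/
lemma density {f : G → ℂ} (hf : C.PathPoly f) (h : ∀ g, C.δ g ≠ 0 → f g = 0) (g : G) : f g = 0 := by
  obtain ⟨P, hP, rfl, hP0⟩ := C.exists_path g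
  refine PolyFn.eq_zero_of_mul (hf P hP) (C.δ_poly P hP) (fun m => ?_) (C.δ_T _ hP0) 1
  by_cases h0 : C.δ (P m) = 0
  · rw [h0, mul_zero]
  · rw [h _ h0, zero_mul]

variable {V : Type*} [AddCommGroup V] [Module ℂ V] (ρ : Representation ℂ G V)

/-- Torus weight spaces. -/
def Wt (χ : G → ℂ) : Submodule ℂ V where
  carrier := {v | ∀ t ∈ C.T, ρ t v = χ t • v}
  add_mem' := fun ha hb t ht => by rw [map_add, ha t ht, hb t ht, smul_add]
  zero_mem' := fun t _ => by simp
  smul_mem' := fun c v hv t ht => by rw [map_smul, hv t ht, smul_comm]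

/-- Highest weight vectors. -/
def HW (χ : G → ℂ) : Submodule ℂ V where
  carrier := {v | (∀ x ∈ C.Up, ∀ s, ρ (x s) v = v) ∧ v ∈ C.Wt ρ χ}
  add_mem' := fun ha hb =>
    ⟨fun x hx s => by rw [map_add, ha.1 x hx, hb.1 x hx], add_mem ha.2 hb.2⟩
  zero_mem' := ⟨fun x _ s => by simp, zero_mem _⟩
  smul_mem' := fun c v hv =>
    ⟨fun x hx s => by rw [map_smul, hv.1 x hx], Submodule.smul_mem _ _ hv.2⟩

variable {C ρ}

lemma mem_Wt {χ : G → ℂ} {v : V} : v ∈ C.Wt ρ χ ↔ ∀ t ∈ C.T, ρ t v = χ t • v := Iff.rfl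

lemma mem_HW {χ : G → ℂ} {v : V} :
    v ∈ C.HW ρ χ ↔ (∀ x ∈ C.Up, ∀ s, ρ (x s) v = v) ∧ ∀ t ∈ C.T, ρ t v = χ t • v := Iff.rfl

lemma up_word_fix {χ : G → ℂ} {v : V} (hv : v ∈ C.HW ρ χ) {u : G}
    (hu : u ∈ rootMon C.Up) : ρ u v = v := by
  induction hu using Submonoid.closure_induction with
  | mem g hg => obtain ⟨x, hx, t, rfl⟩ := hg; exact hv.1 x hx t
  | one => simp
  | mul g h _ _ ihg ihh => rw [map_mul, Module.End.mul_apply, ihh, ihg]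

variable (C ρ)

/-- Left highest weight functionals: fixed by the lower subgroups and of torus weight `χ`. -/
def IsCoHW (χ : G → ℂ) (ξ : Dual ℂ V) : Prop :=
  (∀ x ∈ C.Lo, ∀ s v, ξ (ρ (x s) v) = ξ v) ∧ ∀ t ∈ C.T, ∀ v, ξ (ρ t v) = χ t * ξ v

variable {C ρ}

lemma lo_word_fix {χ : G → ℂ} {ξ : Dual ℂ V} (hξ : C.IsCoHW ρ χ ξ) {l : G}
    (hl : l ∈ rootMon C.Lo) (v : V) : ξ (ρ l v) = ξ v := by
  induction hl using Submonoid.closure_induction generalizing v with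
  | mem g hg => obtain ⟨x, hx, t, rfl⟩ := hg; exact hξ.1 x hx t v
  | one => simp
  | mul g h _ _ ihg ihh => rw [map_mul, Module.End.mul_apply, ihg, ihh]

section FD

variable [FiniteDimensional ℂ V]

lemma unipotent {x : ℂ → G} (hx : x ∈ C.Lo ∪ C.Up) (t : ℂ) : IsNilpotent (ρ (x t) - 1) := by
  have hadd : ∀ s t, ρ (x (s + t)) = ρ (x s) * ρ (x t) := fun s t => by
    rw [C.add x hx, map_mul]
  have h0 : ρ (x 0) = 1 := by rw [C.root_zero hx, map_one]
  have h1 : ∀ g : G, ρ g * ρ g⁻¹ = 1 := fun g => by rw [← map_mul]; simp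
  have h2 : ∀ g : G, ρ g⁻¹ * ρ g = 1 := fun g => by rw [← map_mul]; simp
  have hq : ∀ a, 1 ≤ a → 2 ≤ 2 ^ a := fun a ha => by
    calc 2 = 2 ^ 1 := rfl
      _ ≤ 2 ^ a := Nat.pow_le_pow_right (by omega) ha
  rcases hx with hx | hx
  · obtain ⟨a, ha, hconj⟩ := C.lo_conj x hx
    refine one_param_unipotent (X := fun t => ρ (x t)) hadd h0 (h1 (C.c 2)) (h2 (C.c 2)) (hq a ha)
      (fun t => ?_) t
    rw [← map_mul, ← map_mul, hconj 2 (by omega)]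
    push_cast; rfl
  · obtain ⟨a, ha, hconj⟩ := C.up_conj x hx
    refine one_param_unipotent (X := fun t => ρ (x t)) hadd h0 (h2 (C.c 2)) (h1 (C.c 2)) (hq a ha)
      (fun t => ?_) t
    rw [← map_mul, ← map_mul, hconj 2 (by omega)]
    push_cast; rfl

/-- Matrix coefficients of finite-dimensional representations are polynomial along paths. -/
lemma coeff_pathPoly (ξ : Dual ℂ V) (v : V) : C.PathPoly fun g => ξ (ρ g v) := by
  intro P hP
  induction hP generalizing ξ v with
  | const ht => exact PolyFn.const _
  | @root x hx a t =>
    have : ∀ m : ℕ, ρ (x ((m : ℂ) ^ a * t)) = ρ (x t) ^ (m ^ a) := by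
      intro m
      have := one_param_pow (X := fun t => ρ (x t)) (fun s t => by
        rw [C.add x hx, map_mul]) (by rw [C.root_zero hx, map_one]) t (m ^ a)
      rw [← this]; push_cast; rfl
    simp only [this]
    exact polyFn_of_isNilpotent (unipotent hx t) a ξ v
  | @mul P Q hP hQ ihP ihQ =>
    let b := Module.finBasis ℂ V
    have : ∀ m, ξ (ρ (P m * Q m) v) = ∑ i, ξ (ρ (P m) (b i)) * b.coord i (ρ (Q m) v) := by
      intro m
      rw [map_mul, Module.End.mul_apply]
      conv_lhs => rw [← b.sum_repr (ρ (Q m) v)]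
      simp only [map_sum, map_smul, smul_eq_mul, Module.Basis.coord_apply]
      exact Finset.sum_congr rfl fun i _ => mul_comm _ _
    simp only [this]
    exact PolyFn.sum _ fun i _ => (ihP ξ (b i)).mul (ihQ (b.coord i) v)

lemma χ_mul_inv {χ : G → ℂ} {v : V} (hv : v ∈ C.Wt ρ χ) (hv0 : v ≠ 0) {t : G} (ht : t ∈ C.T) :
    χ t * χ t⁻¹ = 1 := by
  have h1 := mem_Wt.1 hv t ht
  have h2 := mem_Wt.1 hv t⁻¹ (inv_mem ht)
  have h3 : ρ t (ρ t⁻¹ v) = v := by rw [← Module.End.mul_apply, ← map_mul]; simp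
  rw [h2, map_smul, h1, smul_smul] at h3
  have h4 : (χ t⁻¹ * χ t - 1) • v = 0 := by rw [sub_smul, h3, one_smul, sub_self]
  have := (smul_eq_zero.1 h4).resolve_right hv0
  linear_combination this

lemma word_aux (c : ℕ → G) (hcT : ∀ m, c m ∈ C.T) (X : Set (ℂ → G)) (hX : X ⊆ C.Lo ∪ C.Up)
    (hconj : ∀ x ∈ X, ∃ a, 1 ≤ a ∧ ∀ m, 1 ≤ m → ∀ t, c m * x t * (c m)⁻¹ = x ((m : ℂ) ^ a * t))
    {χ : G → ℂ} {v : V} (hv : v ∈ C.Wt ρ χ) {ξ : Dual ℂ V}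
    (hξ : ∀ t ∈ C.T, ∀ v, ξ (ρ t v) = χ t * ξ v) {l : G}
    (hl : l ∈ rootMon X) : ξ (ρ l v) = ξ v := by
  rcases eq_or_ne v 0 with rfl | hv0
  · simp
  have : ∃ P, C.Path P ∧ P 0 = 1 ∧ ∀ m, 1 ≤ m → P m = c m * l * (c m)⁻¹ := by
    induction hl using Submonoid.closure_induction with
    | mem g hg =>
      obtain ⟨x, hx, t, rfl⟩ := hg
      obtain ⟨a, ha, h⟩ := hconj x hx
      refine ⟨_, .root (hX hx) a t, ?_, fun m hm => (h m hm t).symm⟩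
      simp [show a ≠ 0 by omega, C.root_zero (hX hx)]
    | one => exact ⟨_, .const (one_mem _), rfl, fun m _ => by simp⟩
    | mul g h _ _ ihg ihh =>
      obtain ⟨P, hP, hP0, hP1⟩ := ihg
      obtain ⟨Q, hQ, hQ0, hQ1⟩ := ihh
      refine ⟨_, hP.mul hQ, by simp [hP0, hQ0], fun m hm => ?_⟩
      simp only [hP1 m hm, hQ1 m hm]
      group
  obtain ⟨P, hP, hP0, hP1⟩ := this
  have key := PolyFn.eq_of_const (coeff_pathPoly (ρ := ρ) ξ v P hP) (ξ (ρ l v)) (fun m hm => by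
    simp only
    rw [hP1 m hm, map_mul, map_mul, Module.End.mul_apply, Module.End.mul_apply, hξ _ (hcT m),
      mem_Wt.1 hv _ (inv_mem (hcT m)), map_smul, map_smul, smul_eq_mul, ← mul_assoc,
      χ_mul_inv hv hv0 (hcT m), one_mul]) 0
  rw [← key, hP0]; simp

lemma lo_word {χ : G → ℂ} {v : V} (hv : v ∈ C.Wt ρ χ) {ξ : Dual ℂ V}
    (hξ : ∀ t ∈ C.T, ∀ v, ξ (ρ t v) = χ t * ξ v) {l : G}
    (hl : l ∈ rootMon C.Lo) : ξ (ρ l v) = ξ v :=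
  word_aux C.c C.hc C.Lo (Set.subset_union_left) C.lo_conj hv hξ hl

lemma up_word {χ : G → ℂ} {v : V} (hv : v ∈ C.Wt ρ χ) {ξ : Dual ℂ V}
    (hξ : ∀ t ∈ C.T, ∀ v, ξ (ρ t v) = χ t * ξ v) {u : G}
    (hu : u ∈ rootMon C.Up) : ξ (ρ u v) = ξ v :=
  word_aux (fun m => (C.c m)⁻¹) (fun m => inv_mem (C.hc m)) C.Up (Set.subset_union_right)
    (by simpa using C.up_conj) hv hξ hu

lemma sub_smul_comm (χ : G → ℂ) {s t : G} (hs : s ∈ C.T) (ht : t ∈ C.T) :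
    (ρ s - χ s • 1) * (ρ t - χ t • 1) = (ρ t - χ t • 1) * (ρ s - χ s • 1) := by
  have : ρ s * ρ t = ρ t * ρ s := by rw [← map_mul, ← map_mul, C.comm s hs t ht]
  simp only [sub_mul, mul_sub, this, smul_mul_assoc, mul_smul_comm, one_mul, mul_one]
  rw [smul_sub, smul_sub, smul_comm (χ t) (χ s)]; abel

/-- Weights occur in the representation and its dual simultaneously. -/
lemma exists_dual_weight {χ : G → ℂ} {v : V} (hv : v ∈ C.Wt ρ χ) (hv0 : v ≠ 0) :
    ∃ ξ : Dual ℂ V, ξ ≠ 0 ∧ ∀ t ∈ C.T, ∀ v, ξ (ρ t v) = χ t * ξ v := by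
  obtain ⟨ξ, h1, h2⟩ := exists_common_dual_kernel (fun t : C.T => ρ t - χ t • 1)
    (fun s t => sub_smul_comm χ s.2 t.2) v hv0 (by intro t; simp [mem_Wt.1 hv t t.2])
  refine ⟨ξ, h1, fun t ht x => ?_⟩
  have := h2 ⟨t, ht⟩ x
  simpa [sub_eq_zero] using this

lemma exists_weight_of_dual {χ : G → ℂ} {ξ : Dual ℂ V} (hξ : ξ ≠ 0)
    (h : ∀ t ∈ C.T, ∀ v, ξ (ρ t v) = χ t * ξ v) : ∃ v, v ≠ 0 ∧ v ∈ C.Wt ρ χ := by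
  obtain ⟨v, h1, h2⟩ := exists_common_kernel (fun t : C.T => ρ t - χ t • 1)
    (fun s t => sub_smul_comm χ s.2 t.2) ξ hξ (by intro t x; simp [h t t.2])
  refine ⟨v, h1, fun t ht => ?_⟩
  have := h2 ⟨t, ht⟩
  simpa [sub_eq_zero] using this

/-- The value of a matrix coefficient on the big cell. -/
lemma coeff_cell {χ : G → ℂ} {v : V} (hv : v ∈ C.HW ρ χ) {ξ : Dual ℂ V}
    (hξ : ∀ t ∈ C.T, ∀ v, ξ (ρ t v) = χ t * ξ v) {l t u : G}
    (hl : l ∈ rootMon C.Lo) (ht : t ∈ C.T)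
    (hu : u ∈ rootMon C.Up) : ξ (ρ (l * t * u) v) = χ t * ξ v := by
  rw [map_mul, map_mul, Module.End.mul_apply, Module.End.mul_apply, up_word_fix hv hu,
    mem_Wt.1 hv.2 t ht, map_smul, map_smul, lo_word hv.2 hξ hl, smul_eq_mul]

end FD

end CellData

/-! ### Subrepresentations and complete reducibility -/

section Subreps

variable {G : Type*} [Group G] {V W : Type*} [AddCommGroup V] [Module ℂ V]
  [AddCommGroup W] [Module ℂ W] {ρ : Representation ℂ G V} {π : Representation ℂ G W}

def subRep (ρ : Representation ℂ G V) (U : Submodule ℂ V) (hU : IsSubrep ρ U) :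
    Representation ℂ G U where
  toFun g := (ρ g).restrict (hU g)
  map_one' := by ext; simp
  map_mul' g h := by ext; simp

@[simp] lemma subRep_apply (U : Submodule ℂ V) (hU : IsSubrep ρ U) (g : G) (x : U) :
    ((subRep ρ U hU g x : U) : V) = ρ g x := rfl

lemma IsSubrep.map_subtype {U : Submodule ℂ V} {hU : IsSubrep ρ U} {U₁ : Submodule ℂ U}
    (h : IsSubrep (subRep ρ U hU) U₁) : IsSubrep ρ (U₁.map U.subtype) := by
  rintro g _ ⟨x, hx, rfl⟩
  exact ⟨_, h g x hx, rfl⟩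

lemma IsSubrep.comap_subtype {U U₁ : Submodule ℂ V} (hU : IsSubrep ρ U)
    (h : IsSubrep ρ U₁) : IsSubrep (subRep ρ U hU) (U₁.comap U.subtype) :=
  fun g x hx => h g x hx

lemma IsSubrep.inf {U U₁ : Submodule ℂ V} (hU : IsSubrep ρ U) (h : IsSubrep ρ U₁) :
    IsSubrep ρ (U ⊓ U₁) := fun g x hx => ⟨hU g x hx.1, h g x hx.2⟩

lemma isSubrep_span_orbit (v : V) : IsSubrep ρ (Submodule.span ℂ (Set.range fun g => ρ g v)) := by
  intro g x hx
  induction hx using Submodule.span_induction with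
  | mem x hx =>
    obtain ⟨h, rfl⟩ := hx
    exact Submodule.subset_span ⟨g * h, by simp [map_mul]⟩
  | zero => simp
  | add x y _ _ hx hy => rw [map_add]; exact add_mem hx hy
  | smul c x _ hx => rw [map_smul]; exact Submodule.smul_mem _ _ hx

lemma mem_span_orbit (v : V) : v ∈ Submodule.span ℂ (Set.range fun g => ρ g v) :=
  Submodule.subset_span ⟨1, by simp⟩

lemma IsIrreducibleRep.span_orbit (h : IsIrreducibleRep ρ) {v : V} (hv : v ≠ 0) :
    Submodule.span ℂ (Set.range fun g => ρ g v) = ⊤ :=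
  (h.2 _ (isSubrep_span_orbit v)).resolve_left fun h0 =>
    hv ((Submodule.mem_bot ℂ).1 (h0 ▸ mem_span_orbit (ρ := ρ) v))

/-- In an irreducible representation a nonzero functional does not vanish on any full orbit. -/
lemma IsIrreducibleRep.eq_zero_of_coeff (h : IsIrreducibleRep ρ) {ξ : Dual ℂ V}
    (hξ : ξ ≠ 0) {v : V} (hv : ∀ g, ξ (ρ g v) = 0) : v = 0 := by
  by_contra hv0
  apply hξ
  refine LinearMap.ext fun x => ?_
  have hx : x ∈ Submodule.span ℂ (Set.range fun g => ρ g v) := by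
    rw [h.span_orbit hv0]; trivial
  induction hx using Submodule.span_induction with
  | mem x hx => obtain ⟨g, rfl⟩ := hx; exact hv g
  | zero => simp
  | add x y _ _ hx hy => simp [hx, hy]
  | smul c x _ hx => simp [hx]

/-- Complete reducibility. -/
def SS (ρ : Representation ℂ G V) : Prop :=
  ∀ U, IsSubrep ρ U → ∃ U', IsSubrep ρ U' ∧ IsCompl U U'

lemma SS.sub (h : SS ρ) (U : Submodule ℂ V) (hU : IsSubrep ρ U) : SS (subRep ρ U hU) := by
  intro U₁ hU₁
  obtain ⟨U', hU', hc⟩ := h (U₁.map U.subtype) (IsSubrep.map_subtype (ρ := ρ) (hU := hU) hU₁)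
  refine ⟨U'.comap U.subtype, hU.comap_subtype hU', ?_, ?_⟩
  · rw [Submodule.disjoint_def]
    intro x hx hx'
    have := (Submodule.disjoint_def.1 hc.1) x ⟨x, hx, rfl⟩ hx'
    exact Subtype.ext this
  · rw [codisjoint_iff, eq_top_iff]
    intro x _
    have hx : (x : V) ∈ U₁.map U.subtype ⊔ U' := by rw [hc.sup_eq_top]; trivial
    obtain ⟨_, ⟨a, ha, rfl⟩, b, hb, hab⟩ := Submodule.mem_sup.1 hx
    have hbU : b ∈ U := by
      have : b = x - a := by rw [← hab]; simp
      rw [this]; exact sub_mem x.2 a.2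
    refine Submodule.mem_sup.2 ⟨a, ha, ⟨b, hbU⟩, hb, Subtype.ext hab⟩

lemma SS.of_equiv (e : V ≃ₗ[ℂ] W) (he : ∀ g x, e (ρ g x) = π g (e x)) (h : SS ρ) : SS π := by
  intro U hU
  obtain ⟨U', hU', hc⟩ := h (U.comap e.toLinearMap) (fun g x hx => by
    show e (ρ g x) ∈ U
    rw [he]; exact hU g _ hx)
  refine ⟨U'.map e.toLinearMap, ?_, ?_⟩
  · rintro g _ ⟨x, hx, rfl⟩
    exact ⟨ρ g x, hU' g x hx, he g x⟩
  · have := hc.map (Submodule.orderIsoMapComap e)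
    have h2 : (Submodule.orderIsoMapComap e) (U.comap e.toLinearMap) = U :=
      Submodule.map_comap_eq_of_surjective e.surjective U
    rw [h2] at this
    exact this

lemma proj_equivariant {U U' : Submodule ℂ V} (hU : IsSubrep ρ U) (hU' : IsSubrep ρ U')
    (hc : IsCompl U U') (g : G) (x : V) :
    U.projectionOnto U' hc (ρ g x) = subRep ρ U hU g (U.projectionOnto U' hc x) := by
  have hx : x ∈ U ⊔ U' := by rw [hc.sup_eq_top]; trivial
  obtain ⟨a, ha, b, hb, rfl⟩ := Submodule.mem_sup.1 hx
  have h1 : U.projectionOnto U' hc a = ⟨a, ha⟩ := Submodule.projectionOnto_apply_left hc ⟨a, ha⟩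
  have h2 : U.projectionOnto U' hc (ρ g a) = ⟨ρ g a, hU g a ha⟩ :=
    Submodule.projectionOnto_apply_left hc ⟨ρ g a, hU g a ha⟩
  have h3 : U.projectionOnto U' hc b = 0 := Submodule.projectionOnto_apply_right hc ⟨b, hb⟩
  have h4 : U.projectionOnto U' hc (ρ g b) = 0 :=
    Submodule.projectionOnto_apply_right hc ⟨ρ g b, hU' g b hb⟩
  simp only [map_add, h1, h2, h3, h4, add_zero]
  rfl

end Subreps

namespace CellData

variable {G : Type*} [Group G] {C : CellData G}
  {V V' : Type*} [AddCommGroup V] [Module ℂ V] {ρ : Representation ℂ G V}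
  [AddCommGroup V'] [Module ℂ V'] {ρ' : Representation ℂ G V'}
  [FiniteDimensional ℂ V] [FiniteDimensional ℂ V'] {χ χ' : G → ℂ}

lemma pathPoly_sub_mul {f g : G → ℂ} (hf : C.PathPoly f) (hg : C.PathPoly g) (a b : ℂ) :
    C.PathPoly fun x => f x * a - g x * b := by
  intro P hP
  have := ((hf P hP).mul (PolyFn.const a)).add ((hg P hP).mul (PolyFn.const (-b)))
  refine Eq.mp (congrArg PolyFn (funext fun m => ?_)) this
  ring

/-- Matrix coefficients attached to the same weight are proportional. -/
lemma coeff_unique {v : V} (hv : v ∈ C.HW ρ χ) {ξ : Dual ℂ V}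
    (hξ : ∀ t ∈ C.T, ∀ v, ξ (ρ t v) = χ t * ξ v) {v' : V'} (hv' : v' ∈ C.HW ρ' χ)
    {ξ' : Dual ℂ V'} (hξ' : ∀ t ∈ C.T, ∀ v, ξ' (ρ' t v) = χ t * ξ' v) (g : G) :
    ξ (ρ g v) * ξ' v' = ξ' (ρ' g v') * ξ v := by
  rw [← sub_eq_zero]
  refine C.density (pathPoly_sub_mul (coeff_pathPoly ξ v) (coeff_pathPoly ξ' v') (ξ' v') (ξ v))
    (fun g hg => ?_) g
  obtain ⟨l, hl, t, ht, u, hu, rfl⟩ := C.cell g hg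
  simp only [coeff_cell hv hξ hl ht hu, coeff_cell hv' hξ' hl ht hu]
  ring

lemma coeff_ne_zero {v : V} (hv : v ∈ C.HW ρ χ)
    (hgen : Submodule.span ℂ (Set.range fun g => ρ g v) = ⊤) {ξ : Dual ℂ V} (hξ0 : ξ ≠ 0)
    (hξ : ∀ t ∈ C.T, ∀ v, ξ (ρ t v) = χ t * ξ v) : ξ v ≠ 0 := by
  intro h0
  have hz : ∀ g, ξ (ρ g v) = 0 := C.density (coeff_pathPoly ξ v) (fun g hg => by
    obtain ⟨l, hl, t, ht, u, hu, rfl⟩ := C.cell g hg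
    rw [coeff_cell hv hξ hl ht hu, h0, mul_zero])
  apply hξ0
  refine LinearMap.ext fun x => ?_
  have hx : x ∈ Submodule.span ℂ (Set.range fun g => ρ g v) := by rw [hgen]; trivial
  induction hx using Submodule.span_induction with
  | mem x hx => obtain ⟨g, rfl⟩ := hx; exact hz g
  | zero => simp
  | add x y _ _ hx hy => simp [hx, hy]
  | smul c x _ hx => simp [hx]

lemma isCoHW_of_weight {v : V} (hv : v ∈ C.HW ρ χ)
    (hgen : Submodule.span ℂ (Set.range fun g => ρ g v) = ⊤) {ξ : Dual ℂ V}
    (hξ : ∀ t ∈ C.T, ∀ v, ξ (ρ t v) = χ t * ξ v) : C.IsCoHW ρ χ ξ := by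
  refine ⟨fun x hx s y => ?_, hξ⟩
  have key : ∀ g, ξ (ρ (x s) (ρ g v)) = ξ (ρ g v) := by
    intro g
    have h1 : C.PathPoly fun g => (ξ ∘ₗ ρ (x s)) (ρ g v) := coeff_pathPoly _ _
    have := C.density (pathPoly_sub_mul h1 (coeff_pathPoly (ρ := ρ) ξ v) 1 1) (fun g hg => by
      obtain ⟨l, hl, t, ht, u, hu, rfl⟩ := C.cell g hg
      have hl' : x s * l ∈ rootMon C.Lo :=
        mul_mem (Submonoid.subset_closure ⟨x, hx, s, rfl⟩) hl
      have e1 := coeff_cell hv hξ hl' ht hu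
      have e2 := coeff_cell hv hξ hl ht hu
      rw [mul_assoc, mul_assoc, ← mul_assoc l, map_mul, Module.End.mul_apply, ← e2] at e1
      simp only [LinearMap.comp_apply, e1, sub_self]) g
    simpa [sub_eq_zero] using this
  have hy : y ∈ Submodule.span ℂ (Set.range fun g => ρ g v) := by rw [hgen]; trivial
  induction hy using Submodule.span_induction with
  | mem y hy => obtain ⟨g, rfl⟩ := hy; exact key g
  | zero => simp
  | add x y _ _ hx hy => simp [hx, hy]
  | smul c x _ hx => simp [hx]

/-- Two irreducible representations with the same highest weight are isomorphic. -/
theorem exists_equiv (hρ : IsIrreducibleRep ρ) (hρ' : IsIrreducibleRep ρ') {v : V} {v' : V'}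
    (hv : v ∈ C.HW ρ χ) (hv0 : v ≠ 0) (hv' : v' ∈ C.HW ρ' χ) (hv0' : v' ≠ 0) :
    ∃ e : V ≃ₗ[ℂ] V', (∀ g x, e (ρ g x) = ρ' g (e x)) ∧ e v = v' := by
  obtain ⟨ξ, hξ0, hξ⟩ := exists_dual_weight hv.2 hv0
  obtain ⟨ξ', hξ0', hξ'⟩ := exists_dual_weight hv'.2 hv0'
  have hne := coeff_ne_zero hv (hρ.span_orbit hv0) hξ0 hξ
  have hne' := coeff_ne_zero hv' (hρ'.span_orbit hv0') hξ0' hξ'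
  set W : Submodule ℂ (V × V') := Submodule.span ℂ (Set.range fun g => (ρ g v, ρ' g v')) with hW
  have hst : ∀ g, ∀ p ∈ W, (ρ g p.1, ρ' g p.2) ∈ W := by
    intro g p hp
    induction hp using Submodule.span_induction with
    | mem x hx =>
      obtain ⟨h, rfl⟩ := hx
      exact Submodule.subset_span ⟨g * h, by simp [map_mul]⟩
    | zero => simp only [Prod.fst_zero, Prod.snd_zero, map_zero]; exact zero_mem W
    | add x y _ _ hx hy => simpa using add_mem hx hy
    | smul c x _ hx => simpa using Submodule.smul_mem _ c hx
  have hrel : ∀ p ∈ W, ξ p.1 * ξ' v' = ξ' p.2 * ξ v := by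
    intro p hp
    induction hp using Submodule.span_induction with
    | mem x hx => obtain ⟨h, rfl⟩ := hx; exact coeff_unique hv hξ hv' hξ' h
    | zero => simp
    | add x y _ _ hx hy => simp only [Prod.fst_add, Prod.snd_add, map_add, add_mul, hx, hy]
    | smul c x _ hx => simp only [Prod.smul_fst, Prod.smul_snd, map_smul, smul_eq_mul, mul_assoc, hx]
  have h1 : ∀ p ∈ W, p.1 = 0 → p.2 = 0 := by
    intro p hp h0
    refine hρ'.eq_zero_of_coeff hξ0' fun g => ?_
    have := hrel _ (hst g p hp)
    simp only [h0, map_zero, zero_mul] at this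
    exact (mul_eq_zero.1 this.symm).resolve_right hne
  have h2 : ∀ p ∈ W, p.2 = 0 → p.1 = 0 := by
    intro p hp h0
    refine hρ.eq_zero_of_coeff hξ0 fun g => ?_
    have := hrel _ (hst g p hp)
    simp only [h0, map_zero, zero_mul] at this
    exact (mul_eq_zero.1 this).resolve_right hne'
  have hb1 : Function.Bijective ((LinearMap.fst ℂ V V').domRestrict W) := by
    constructor
    · rw [← LinearMap.ker_eq_bot, LinearMap.ker_eq_bot']
      rintro ⟨p, hp⟩ h0
      exact Subtype.ext (Prod.ext h0 (h1 p hp h0))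
    · rw [← LinearMap.range_eq_top, eq_top_iff, ← hρ.span_orbit hv0, Submodule.span_le]
      rintro _ ⟨g, rfl⟩
      exact ⟨⟨_, Submodule.subset_span ⟨g, rfl⟩⟩, rfl⟩
  have hb2 : Function.Bijective ((LinearMap.snd ℂ V V').domRestrict W) := by
    constructor
    · rw [← LinearMap.ker_eq_bot, LinearMap.ker_eq_bot']
      rintro ⟨p, hp⟩ h0
      exact Subtype.ext (Prod.ext (h2 p hp h0) h0)
    · rw [← LinearMap.range_eq_top, eq_top_iff, ← hρ'.span_orbit hv0', Submodule.span_le]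
      rintro _ ⟨g, rfl⟩
      exact ⟨⟨_, Submodule.subset_span ⟨g, rfl⟩⟩, rfl⟩
  set e1 := LinearEquiv.ofBijective _ hb1
  set e2 := LinearEquiv.ofBijective _ hb2
  have he : ∀ p (hp : p ∈ W), (e1.symm.trans e2) p.1 = p.2 := by
    intro p hp
    have : e1.symm p.1 = ⟨p, hp⟩ := by rw [LinearEquiv.symm_apply_eq]; rfl
    rw [LinearEquiv.trans_apply, this]; rfl
  refine ⟨e1.symm.trans e2, fun g x => ?_, he (v, v') (Submodule.subset_span ⟨1, by simp⟩)⟩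
  obtain ⟨⟨p, hp⟩, hpx⟩ := e1.surjective x
  have hpx' : p.1 = x := hpx
  rw [← hpx', he p hp]
  exact he _ (hst g p hp)

/-- A representation with a faithful left highest weight functional is irreducible. -/
theorem irreducible_of_coHW [Nontrivial V] (hss : SS ρ) {ξ : Dual ℂ V}
    (hξ : C.IsCoHW ρ χ ξ) (hf : ∀ y, (∀ g, ξ (ρ g y) = 0) → y = 0) :
    IsIrreducibleRep ρ ∧ ∃ v, v ∈ C.HW ρ χ ∧ v ≠ 0 := by
  have hval : ∀ x, x ∈ C.Wt ρ χ → ∀ l ∈ rootMon C.Lo, ∀ t ∈ C.T,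
      ∀ u ∈ rootMon C.Up, ξ (ρ (l * t * u) x) = χ t * ξ x := by
    intro x hx l hl t ht u hu
    rw [map_mul, map_mul, Module.End.mul_apply, Module.End.mul_apply, lo_word_fix hξ hl, hξ.2 t ht,
      up_word hx hξ.2 hu]
  have hlin : ∀ x x', x ∈ C.Wt ρ χ → x' ∈ C.Wt ρ χ → ξ x' • x = ξ x • x' := by
    intro x x' hx hx'
    rw [← sub_eq_zero]
    refine hf _ (C.density (coeff_pathPoly ξ _) fun g hg => ?_)
    obtain ⟨l, hl, t, ht, u, hu, rfl⟩ := C.cell g hg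
    rw [map_sub, map_sub, map_smul, map_smul, map_smul, map_smul, hval x hx l hl t ht u hu,
      hval x' hx' l hl t ht u hu]
    simp only [smul_eq_mul]; ring
  have hne : ∀ x, x ∈ C.Wt ρ χ → x ≠ 0 → ξ x ≠ 0 := by
    intro x hx hx0 h0
    refine hx0 (hf _ (C.density (coeff_pathPoly ξ _) fun g hg => ?_))
    obtain ⟨l, hl, t, ht, u, hu, rfl⟩ := C.cell g hg
    rw [hval x hx l hl t ht u hu, h0, mul_zero]
  have hup : ∀ x, x ∈ C.Wt ρ χ → x ∈ C.HW ρ χ := by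
    refine fun x hx => ⟨fun y hy s => ?_, hx⟩
    rw [← sub_eq_zero]
    refine hf _ (C.density (coeff_pathPoly ξ _) fun g hg => ?_)
    obtain ⟨l, hl, t, ht, u, hu, rfl⟩ := C.cell g hg
    have hu' : u * y s ∈ rootMon C.Up :=
      mul_mem hu (Submonoid.subset_closure ⟨y, hy, s, rfl⟩)
    have := hval x hx l hl t ht _ hu'
    rw [← mul_assoc, map_mul, Module.End.mul_apply] at this
    rw [map_sub, map_sub, this, hval x hx l hl t ht u hu, sub_self]
  have hex : ∀ U, IsSubrep ρ U → U ≠ ⊥ → ∃ x ∈ U, x ≠ 0 ∧ x ∈ C.Wt ρ χ := by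
    intro U hU hU0
    obtain ⟨y, hy, hy0⟩ := Submodule.exists_mem_ne_zero_of_ne_bot hU0
    obtain ⟨x, hx0, hx⟩ := exists_weight_of_dual (ρ := subRep ρ U hU) (ξ := ξ ∘ₗ U.subtype) (by
      intro h0
      refine hy0 (hf y fun g => ?_)
      exact LinearMap.congr_fun h0 ⟨ρ g y, hU g y hy⟩) (fun t ht v => hξ.2 t ht v)
    exact ⟨x, x.2, fun h => hx0 (Subtype.ext h), fun t ht => congrArg Subtype.val (hx t ht)⟩
  refine ⟨⟨inferInstance, fun U hU => ?_⟩, ?_⟩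
  · by_contra hcon
    push Not at hcon
    obtain ⟨U', hU', hc⟩ := hss U hU
    obtain ⟨x, hx, hx0, hxw⟩ := hex U hU hcon.1
    obtain ⟨x', hx', hx0', hxw'⟩ := hex U' hU' (by
      rintro rfl
      exact hcon.2 (by simpa using hc.sup_eq_top))
    have h1 := hlin x x' hxw hxw'
    have h2 : ξ x' • x = 0 := (Submodule.disjoint_def.1 hc.1) _ (Submodule.smul_mem _ _ hx)
      (h1 ▸ Submodule.smul_mem _ _ hx')
    exact (smul_ne_zero (hne x' hxw' hx0') hx0) h2
  · obtain ⟨x, -, hx0, hx⟩ := hex ⊤ (fun _ _ _ => trivial) top_ne_bot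
    exact ⟨x, hup x hx, hx0⟩

/-- Uniqueness of highest weights and highest weight vectors. -/
theorem hw_unique (hρ : IsIrreducibleRep ρ) {v v' : V} (hv : v ∈ C.HW ρ χ) (hv0 : v ≠ 0)
    (hv' : v' ∈ C.HW ρ χ') (hv0' : v' ≠ 0) :
    (∀ t ∈ C.T, χ t = χ' t) ∧ ∃ c : ℂ, v' = c • v := by
  obtain ⟨ξ, hξ0, hξ⟩ := exists_dual_weight hv.2 hv0
  have hne := coeff_ne_zero hv (hρ.span_orbit hv0) hξ0 hξ
  have hco := isCoHW_of_weight hv (hρ.span_orbit hv0) hξ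
  have hzero : ∀ w, (∀ u ∈ rootMon C.Up, ρ u w = w) → ξ w = 0 → w = 0 := by
    intro w hw h0
    refine hρ.eq_zero_of_coeff hξ0 (C.density (coeff_pathPoly ξ _) fun g hg => ?_)
    obtain ⟨l, hl, t, ht, u, hu, rfl⟩ := C.cell g hg
    rw [map_mul, map_mul, Module.End.mul_apply, Module.End.mul_apply, hw u hu,
      lo_word_fix hco hl, hξ t ht, h0, mul_zero]
  have hne' : ξ v' ≠ 0 := fun h0 => hv0' (hzero v' (fun u hu => up_word_fix hv' hu) h0)
  constructor
  · intro t ht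
    have h1 := hξ t ht v'
    rw [mem_Wt.1 hv'.2 t ht, map_smul, smul_eq_mul] at h1
    exact (mul_right_cancel₀ hne' h1).symm
  · refine ⟨ξ v' / ξ v, ?_⟩
    rw [← sub_eq_zero]
    refine hzero _ (fun u hu => ?_) ?_
    · rw [map_sub, map_smul, up_word_fix hv' hu, up_word_fix hv hu]
    · rw [map_sub, map_smul, smul_eq_mul]; field_simp; ring

/-- A completely reducible representation generated by a highest weight vector is irreducible. -/
theorem irreducible_of_generated (hss : SS ρ) {v : V} (hv : v ∈ C.HW ρ χ) (hv0 : v ≠ 0)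
    (hgen : Submodule.span ℂ (Set.range fun g => ρ g v) = ⊤) : IsIrreducibleRep ρ := by
  have htop : ∀ U, IsSubrep ρ U → v ∈ U → U = ⊤ := by
    intro U hU hvU
    rw [eq_top_iff, ← hgen, Submodule.span_le]
    rintro _ ⟨g, rfl⟩
    exact hU g v hvU
  -- a functional of weight `χ` supported on a nonzero direct summand
  have hfun : ∀ U U', IsSubrep ρ U → IsSubrep ρ U' → IsCompl U U' → v ∉ U' →
      ∃ ξ : Dual ℂ V, ξ v ≠ 0 ∧ (∀ t ∈ C.T, ∀ v, ξ (ρ t v) = χ t * ξ v) ∧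
        ∀ x ∈ U', ξ x = 0 := by
    intro U U' hU hU' hc hvU'
    set a := U.projectionOnto U' hc v with ha
    have ha0 : a ≠ 0 := fun h0 => hvU' ((Submodule.projectionOnto_apply_eq_zero_iff hc).1 h0)
    have haW : a ∈ C.Wt (subRep ρ U hU) χ := by
      intro t ht
      rw [ha, ← proj_equivariant hU hU' hc, mem_Wt.1 hv.2 t ht, map_smul]
    obtain ⟨ξ, hξ0, hξ⟩ := exists_dual_weight haW ha0
    have hw : ∀ t ∈ C.T, ∀ v, (ξ ∘ₗ U.projectionOnto U' hc) (ρ t v) =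
        χ t * (ξ ∘ₗ U.projectionOnto U' hc) v := by
      intro t ht v
      rw [LinearMap.comp_apply, proj_equivariant hU hU' hc, hξ t ht]; rfl
    refine ⟨ξ ∘ₗ U.projectionOnto U' hc, coeff_ne_zero hv hgen ?_ hw, hw, fun x hx => ?_⟩
    · intro h0
      apply hξ0
      refine LinearMap.ext fun x => ?_
      have := LinearMap.congr_fun h0 x
      rwa [LinearMap.comp_apply, Submodule.projectionOnto_apply_left hc x] at this
    · rw [LinearMap.comp_apply, (Submodule.projectionOnto_apply_eq_zero_iff hc).2 hx, map_zero]
  refine ⟨⟨v, 0, hv0⟩, fun U hU => ?_⟩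
  obtain ⟨U', hU', hc⟩ := hss U hU
  by_cases h1 : v ∈ U
  · exact Or.inr (htop U hU h1)
  by_cases h2 : v ∈ U'
  · left
    have := htop U' hU' h2
    subst this
    simpa using hc.inf_eq_bot
  exfalso
  obtain ⟨ξ, a1, a2, a3⟩ := hfun U U' hU hU' hc h2
  obtain ⟨ξ', b1, b2, b3⟩ := hfun U' U hU' hU hc.symm h1
  have hrel : ∀ x, ξ x * ξ' v = ξ' x * ξ v := by
    intro x
    have hx : x ∈ Submodule.span ℂ (Set.range fun g => ρ g v) := by rw [hgen]; trivial
    induction hx using Submodule.span_induction with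
    | mem x hx => obtain ⟨g, rfl⟩ := hx; exact coeff_unique hv a2 hv b2 g
    | zero => simp
    | add x y _ _ hx hy => simp only [map_add, add_mul, hx, hy]
    | smul c x _ hx => simp only [map_smul, smul_eq_mul, mul_assoc, hx]
  have hx : v ∈ U ⊔ U' := by rw [hc.sup_eq_top]; trivial
  obtain ⟨a, ha, b, hb, hab⟩ := Submodule.mem_sup.1 hx
  have e1 : ξ a = ξ v := by rw [← hab, map_add, a3 b hb, add_zero]
  have := hrel a
  rw [e1, b3 a ha, zero_mul] at this
  exact (mul_ne_zero a1 b1) this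

/-- Multiplicities are dimensions of spaces of highest weight vectors. -/
theorem repMult_eq_finrank_HW (hss : SS ρ) (hρ' : IsIrreducibleRep ρ') {v' : V'}
    (hv' : v' ∈ C.HW ρ' χ) (hv0' : v' ≠ 0) :
    repMult ρ ρ' = finrank ℂ (C.HW ρ χ) := by
  have hmem : ∀ f ∈ equivariantMaps ρ' ρ, f v' ∈ C.HW ρ χ := by
    intro f hf
    have hf' : ∀ g x, f (ρ' g x) = ρ g (f x) := fun g x => LinearMap.congr_fun (hf g) x
    refine ⟨fun x hx s => ?_, fun t ht => ?_⟩
    · rw [← hf', hv'.1 x hx]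
    · rw [← hf', mem_Wt.1 hv'.2 t ht, map_smul]
  let Φ : equivariantMaps ρ' ρ →ₗ[ℂ] C.HW ρ χ :=
    { toFun := fun f => ⟨f.1 v', hmem f.1 f.2⟩
      map_add' := fun f g => rfl
      map_smul' := fun c f => rfl }
  refine LinearEquiv.finrank_eq (LinearEquiv.ofBijective Φ ⟨?_, ?_⟩)
  · rw [← LinearMap.ker_eq_bot, LinearMap.ker_eq_bot']
    rintro ⟨f, hf⟩ h0
    have h0' : f v' = 0 := congrArg Subtype.val h0
    refine Subtype.ext (LinearMap.ext fun x => ?_)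
    have hx : x ∈ Submodule.span ℂ (Set.range fun g => ρ' g v') := by
      rw [hρ'.span_orbit hv0']; trivial
    show f x = 0
    induction hx using Submodule.span_induction with
    | mem x hx =>
      obtain ⟨g, rfl⟩ := hx
      have := LinearMap.congr_fun (hf g) v'
      simp only [LinearMap.comp_apply, h0', map_zero] at this
      exact this
    | zero => simp
    | add x y _ _ hx hy => simp [hx, hy]
    | smul c x _ hx => simp [hx]
  · rintro ⟨w, hw⟩
    rcases eq_or_ne w 0 with rfl | hw0
    · exact ⟨0, rfl⟩
    set U := Submodule.span ℂ (Set.range fun g => ρ g w) with hUdef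
    have hU : IsSubrep ρ U := isSubrep_span_orbit w
    have hwU : w ∈ U := mem_span_orbit w
    have hwH : (⟨w, hwU⟩ : U) ∈ C.HW (subRep ρ U hU) χ :=
      ⟨fun x hx s => Subtype.ext (hw.1 x hx s), fun t ht => Subtype.ext (hw.2 t ht)⟩
    have hw0' : (⟨w, hwU⟩ : U) ≠ 0 := fun h => hw0 (congrArg Subtype.val h)
    have hirr : IsIrreducibleRep (subRep ρ U hU) := by
      refine irreducible_of_generated (hss.sub U hU) hwH hw0' ?_
      apply Submodule.map_injective_of_injective U.injective_subtype
      rw [Submodule.map_span, ← Set.range_comp, Submodule.map_top, Submodule.range_subtype]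
      rfl
    obtain ⟨e, he, hev⟩ := exists_equiv hρ' hirr hv' hv0' hwH hw0'
    refine ⟨⟨U.subtype ∘ₗ e.toLinearMap, fun g => LinearMap.ext fun x => ?_⟩, Subtype.ext ?_⟩
    · simp [he]
    · show ((e v' : U) : V) = w
      rw [hev]

end CellData

/-! ### Complete reducibility of algebra actions (unitarian trick) -/

section Unitarian

variable {G : Type*} [Group G] {𝒜 : Type*} [CommRing 𝒜] [Algebra ℂ 𝒜] {ι : Type*} [Fintype ι]

/-- The span of the monomials of degree `D` in a finite family. -/
def monoSpan (z : ι → 𝒜) (D : ℕ) : Submodule ℂ 𝒜 :=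
  Submodule.span ℂ (Set.range fun I : Fin D → ι => ∏ a, z (I a))

instance (z : ι → 𝒜) (D : ℕ) : FiniteDimensional ℂ (monoSpan z D) :=
  FiniteDimensional.span_of_finite ℂ (Set.finite_range _)

/-- The linear action on the span of `z` is closed under conjugate transposition. -/
def StarClosed (ρ : Representation ℂ G 𝒜) (z : ι → 𝒜) : Prop :=
  ∀ g, ∃ τ : Matrix ι ι ℂ, (∀ j, ρ g (z j) = ∑ i, τ i j • z i) ∧
    ∃ g', ∀ j, ρ g' (z j) = ∑ i, (τᴴ) i j • z i

variable [DecidableEq ι]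

theorem exists_isCompl_of_starClosed (ρ : Representation ℂ G 𝒜)
    (hmul : ∀ g a b, ρ g (a * b) = ρ g a * ρ g b) (hone : ∀ g, ρ g 1 = 1) (z : ι → 𝒜)
    (hz : StarClosed ρ z) (D : ℕ) {U : Submodule ℂ 𝒜} (hU : IsSubrep ρ U)
    (hUM : U ≤ monoSpan z D) : SS (subRep ρ U hU) := by
  classical
  let Φ : EuclideanSpace ℂ (Fin D → ι) →ₗ[ℂ] 𝒜 :=
    { toFun := fun x => ∑ I, x I • ∏ a, z (I a)
      map_add' := fun x y => by simp [add_smul, Finset.sum_add_distrib]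
      map_smul' := fun c x => by simp [Finset.smul_sum, smul_smul] }
  have hΦ : ∀ x, Φ x = ∑ I, x I • ∏ a, z (I a) := fun x => rfl
  have hrange : ∀ u ∈ monoSpan z D, ∃ x, Φ x = u := by
    intro u hu
    have : monoSpan z D ≤ LinearMap.range Φ := by
      rw [monoSpan, Submodule.span_le]
      rintro _ ⟨I, rfl⟩
      exact ⟨EuclideanSpace.single I 1, by simp [hΦ, ite_smul]⟩
    exact this hu
  let A : Matrix ι ι ℂ → Matrix (Fin D → ι) (Fin D → ι) ℂ :=
    fun τ => of fun I J => ∏ a, τ (I a) (J a)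
  have hprod : ∀ g (s : Finset (Fin D)) (f : Fin D → 𝒜), ρ g (∏ a ∈ s, f a) = ∏ a ∈ s, ρ g (f a) := by
    intro g s f
    induction s using Finset.induction_on with
    | empty => simp [hone]
    | insert a s ha ih => rw [Finset.prod_insert ha, Finset.prod_insert ha, hmul, ih]
  have hinner : ∀ g (τ : Matrix ι ι ℂ), (∀ j, ρ g (z j) = ∑ i, τ i j • z i) →
      ∀ x, ρ g (Φ x) = Φ (toEuclideanLin (A τ) x) := by
    intro g τ h x
    simp only [hΦ, map_sum, map_smul, hprod, h, Finset.prod_univ_sum, Fintype.piFinset_univ]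
    simp only [Matrix.toLpLin_apply, mulVec, dotProduct, A, of_apply,
      Finset.sum_smul, Finset.smul_sum]
    rw [Finset.sum_comm]
    refine Finset.sum_congr rfl fun I _ => Finset.sum_congr rfl fun J _ => ?_
    rw [mul_comm, mul_smul]
    congr 1
    rw [Finset.prod_smul]
  intro U₁ hU₁
  set K₁ : Submodule ℂ (EuclideanSpace ℂ (Fin D → ι)) := (U₁.map U.subtype).comap Φ with hK₁
  set K : Submodule ℂ (EuclideanSpace ℂ (Fin D → ι)) := U.comap Φ with hK
  have hU₁' : IsSubrep ρ (U₁.map U.subtype) := IsSubrep.map_subtype hU₁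
  set K' : Submodule ℂ (EuclideanSpace ℂ (Fin D → ι)) := K₁ᗮ ⊓ K with hK'
  have hst : ∀ g, ∀ x ∈ K', ∃ y ∈ K', Φ y = ρ g (Φ x) := by
    intro g x hx
    obtain ⟨τ, hτ, g', hg'⟩ := hz g
    refine ⟨toEuclideanLin (A τ) x, ⟨?_, ?_⟩, (hinner g τ hτ x).symm⟩
    · intro y hy
      have hA : A τᴴ = (A τ)ᴴ := by
        ext I J; simp [A, Matrix.conjTranspose_apply]
      have h1 : toEuclideanLin (A τ)ᴴ y ∈ K₁ := by
        show Φ _ ∈ U₁.map U.subtype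
        rw [← hA, ← hinner g' _ hg']
        exact hU₁' g' _ hy
      have h2 := hx.1 _ h1
      rw [toEuclideanLin_conjTranspose_eq_adjoint, LinearMap.adjoint_inner_left] at h2
      exact h2
    · show Φ _ ∈ U
      rw [← hinner g τ hτ]
      exact hU g _ hx.2
  refine ⟨(K'.map Φ).comap U.subtype, ?_, ?_, ?_⟩
  · rintro g x ⟨y, hy, hyx⟩
    obtain ⟨w, hw, hw'⟩ := hst g y hy
    exact ⟨w, hw, by rw [hw', hyx]; rfl⟩
  · rw [Submodule.disjoint_def]
    rintro x hx ⟨y, hy, hyx⟩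
    have h1 : y ∈ K₁ := by
      show Φ y ∈ U₁.map U.subtype
      rw [hyx]; exact ⟨x, hx, rfl⟩
    have h2 : y = 0 := by
      have := hy.1 y h1
      exact inner_self_eq_zero.1 this
    apply Subtype.ext
    rw [h2, map_zero] at hyx
    exact hyx.symm
  · rw [codisjoint_iff, eq_top_iff]
    intro x _
    obtain ⟨y, hy⟩ := hrange x (hUM x.2)
    have hyK : y ∈ K := by show Φ y ∈ U; rw [hy]; exact x.2
    obtain ⟨a, ha, b, hb, hab⟩ := Submodule.exists_add_mem_mem_orthogonal (K := K₁) y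
    have haK : a ∈ K := by
      obtain ⟨u, -, hu⟩ := ha
      show Φ a ∈ U
      rw [← hu]; exact u.2
    have hbK : b ∈ K := by
      have : b = y - a := by rw [hab]; simp
      rw [this]; exact sub_mem hyK haK
    obtain ⟨u, hu, hua⟩ := ha
    refine Submodule.mem_sup.2 ⟨u, hu, ⟨Φ b, hbK⟩, ⟨b, ⟨hb, hbK⟩, rfl⟩, Subtype.ext ?_⟩
    show (u : 𝒜) + Φ b = x
    have hua' : (u : 𝒜) = Φ a := hua
    rw [hua', ← map_add, ← hab, hy]

end Unitarian

/-! ### The big cell of the general linear group -/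

section GLCell

variable {n : ℕ}

/-- Invertible diagonal matrices. -/
def dg : (Fin n → ℂˣ) →* GL (Fin n) ℂ :=
  (Units.map (Matrix.diagonalRingHom (Fin n) ℂ).toMonoidHom).comp
    (MulEquiv.piUnits.symm.toMonoidHom)

@[simp] lemma dg_val (d : Fin n → ℂˣ) :
    (dg d : Mt n) = diagonal fun i => (d i : ℂ) := rfl

/-- Elementary unipotent matrices. -/
def tv (i j : Fin n) (h : i ≠ j) (t : ℂ) : GL (Fin n) ℂ :=
  ⟨transvection i j t, transvection i j (-t),
    by rw [transvection_mul_transvection_same _ _ h]; simp,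
    by rw [transvection_mul_transvection_same _ _ h]; simp⟩

@[simp] lemma tv_val (i j : Fin n) (h : i ≠ j) (t : ℂ) :
    (tv i j h t : Mt n) = transvection i j t := rfl

lemma tv_inv_val {i j : Fin n} (h : i ≠ j) (t : ℂ) :
    (((tv i j h t)⁻¹ : GL (Fin n) ℂ) : Mt n) = transvection i j (-t) :=
  rfl

lemma tv_apply (i j : Fin n) (t : ℂ) (a b : Fin n) :
    transvection i j t a b = (if a = b then 1 else 0) + if i = a ∧ j = b then t else 0 := by
  simp [transvection, Matrix.one_apply, single_apply]

def scaleUnit (m : ℕ) : ℂˣ := if h : (m : ℂ) ≠ 0 then Units.mk0 m h else 1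

lemma scaleUnit_val {m : ℕ} (hm : 1 ≤ m) : (scaleUnit m : ℂ) = m := by
  have : (m : ℂ) ≠ 0 := by exact_mod_cast (by omega : m ≠ 0)
  simp [scaleUnit, this]

def glScale (n m : ℕ) : GL (Fin n) ℂ := dg fun i => (scaleUnit m)⁻¹ ^ (n - (i : ℕ))

def glLo (n : ℕ) : Set (ℂ → GL (Fin n) ℂ) := {x | ∃ i j, ∃ h : j < i, x = tv i j h.ne'}

def glUp (n : ℕ) : Set (ℂ → GL (Fin n) ℂ) := {x | ∃ i j, ∃ h : i < j, x = tv i j h.ne}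

/-- The leading `s × s` block, completed by the identity. -/
def trunc (s : ℕ) (g : Mt n) : Mt n :=
  of fun i j => if (i : ℕ) < s ∧ (j : ℕ) < s then g i j else if i = j then 1 else 0

lemma trunc_apply (s : ℕ) (g : Mt n) (i j : Fin n) :
    trunc s g i j = if (i : ℕ) < s ∧ (j : ℕ) < s then g i j else if i = j then 1 else 0 := rfl

/-- Leading principal minors. -/
def minor (s : ℕ) (g : Mt n) : ℂ := (trunc s g).det

lemma trunc_mul_of_lower (s : ℕ) {l : Mt n} (hl : ∀ i j, i < j → l i j = 0)
    (g : Mt n) : trunc s (l * g) = trunc s l * trunc s g := by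
  ext i j
  simp only [Matrix.mul_apply, trunc_apply]
  by_cases hi : (i : ℕ) < s
  · by_cases hj : (j : ℕ) < s
    · simp only [hi, hj, and_self, if_true, true_and, and_true]
      refine Finset.sum_congr rfl fun k _ => ?_
      by_cases hk : (k : ℕ) < s
      · simp [hk]
      · rw [hl i k (by rw [Fin.lt_def]; omega)]
        have : i ≠ k := by rintro rfl; exact hk hi
        simp [hk, this]
    · have hij : i ≠ j := by rintro rfl; exact hj hi
      simp only [hj, and_false, if_false, hij, hi, true_and]
      symm
      refine Finset.sum_eq_zero fun k _ => ?_
      by_cases hk : k = j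
      · subst hk; simp [hj, hij]
      · simp [hk]
  · simp only [hi, false_and, if_false]
    rw [Finset.sum_eq_single i]
    · simp [hi]
    · intro b _ hb; simp [Ne.symm hb]
    · simp

lemma trunc_transpose (s : ℕ) (g : Mt n) : trunc s gᵀ = (trunc s g)ᵀ := by
  ext i j
  simp only [transpose_apply, trunc_apply]
  simp only [and_comm, eq_comm]

lemma minor_transpose (s : ℕ) (g : Mt n) : minor s gᵀ = minor s g := by
  rw [minor, trunc_transpose, det_transpose, minor]

lemma minor_lower {s : ℕ} {l : Mt n} (hl : ∀ i j, i < j → l i j = 0) :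
    minor s l = ∏ i : Fin n, if (i : ℕ) < s then l i i else 1 := by
  rw [minor, Matrix.det_of_isLowerTriangular _ (fun i j hij => ?_)]
  · refine Finset.prod_congr rfl fun i _ => ?_
    simp [trunc_apply]
  · have hij' : i < j := hij
    rw [trunc_apply, hl i j hij', if_neg hij'.ne]; simp

lemma minor_mul_of_lower (s : ℕ) {l : Mt n} (hl : ∀ i j, i < j → l i j = 0)
    (g : Mt n) : minor s (l * g) = minor s l * minor s g := by
  rw [minor, trunc_mul_of_lower s hl, Matrix.det_mul]; rfl

lemma minor_mul_of_upper (s : ℕ) {u : Mt n} (hu : ∀ i j, j < i → u i j = 0)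
    (g : Mt n) : minor s (g * u) = minor s g * minor s u := by
  rw [← minor_transpose, transpose_mul, minor_mul_of_lower s (l := uᵀ) (fun i j h => hu j i h),
    minor_transpose, minor_transpose, mul_comm]

def glDelta (g : Mt n) : ℂ := ∏ s ∈ Finset.range (n + 1), minor s g

/-- Lower unitriangular matrices. -/
def IsLowerUni (A : Mt n) : Prop :=
  (∀ i, A i i = 1) ∧ ∀ i j : Fin n, i < j → A i j = 0

lemma isUpperUni_transpose {A : Mt n} : IsUpperUni Aᵀ ↔ IsLowerUni A := by
  constructor
  · exact fun h => ⟨h.1, fun i j hij => h.2 j i hij⟩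
  · exact fun h => ⟨h.1, fun i j hij => h.2 j i hij⟩

lemma IsLowerUni.one : IsLowerUni (1 : Mt n) :=
  ⟨fun i => by simp, fun i j h => by simp [h.ne]⟩

lemma IsLowerUni.mul {A B : Mt n} (hA : IsLowerUni A) (hB : IsLowerUni B) :
    IsLowerUni (A * B) := by
  constructor
  · intro i
    rw [Matrix.mul_apply, Finset.sum_eq_single i]
    · rw [hA.1, hB.1, mul_one]
    · intro k _ hk
      rcases lt_or_gt_of_ne hk with h | h
      · rw [hB.2 k i h, mul_zero]
      · rw [hA.2 i k h, zero_mul]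
    · simp
  · intro i j hij
    rw [Matrix.mul_apply]
    refine Finset.sum_eq_zero fun k _ => ?_
    by_cases h : i < k
    · rw [hA.2 i k h, zero_mul]
    · rw [hB.2 k j (lt_of_le_of_lt (not_lt.1 h) hij), mul_zero]

lemma IsUpperUni.mul {A B : Mt n} (hA : IsUpperUni A) (hB : IsUpperUni B) :
    IsUpperUni (A * B) := by
  rw [← transpose_transpose (A * B), isUpperUni_transpose, transpose_mul]
  exact (isUpperUni_transpose.1 (by simpa using hB)).mul (isUpperUni_transpose.1 (by simpa using hA))

lemma IsLowerUni.minor_eq {A : Mt n} (hA : IsLowerUni A) (s : ℕ) :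
    minor s A = 1 := by
  rw [minor_lower hA.2]; simp [hA.1]

lemma IsUpperUni.minor_eq {A : Mt n} (hA : IsUpperUni A) (s : ℕ) :
    minor s A = 1 := by
  rw [← minor_transpose]
  exact (isUpperUni_transpose.1 (by simpa using hA)).minor_eq s

lemma tv_lower {i j : Fin n} (h : j < i) (t : ℂ) : IsLowerUni (transvection i j t) := by
  constructor
  · intro a
    rw [tv_apply, if_pos rfl, if_neg (by rintro ⟨h1, h2⟩; exact h.ne (h2.trans h1.symm)), add_zero]
  · intro a b hab
    rw [tv_apply, if_neg hab.ne, if_neg, add_zero]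
    rintro ⟨rfl, rfl⟩; exact lt_asymm h hab

lemma tv_upper {i j : Fin n} (h : i < j) (t : ℂ) : IsUpperUni (transvection i j t) := by
  have : (transvection i j t)ᵀᵀ = transvection i j t := rfl
  rw [← this, isUpperUni_transpose, show (transvection i j t)ᵀ = transvection j i t by
    ext a b; simp [tv_apply, and_comm, eq_comm]]
  exact tv_lower h t

lemma lo_closure_lower {l : GL (Fin n) ℂ} (hl : l ∈ rootMon (glLo n)) :
    IsLowerUni (l : Mt n) := by
  induction hl using Submonoid.closure_induction with
  | mem g hg => obtain ⟨_, ⟨i, j, h, rfl⟩, t, rfl⟩ := hg; exact tv_lower h t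
  | one => exact IsLowerUni.one
  | mul g h _ _ ihg ihh => rw [Units.val_mul]; exact ihg.mul ihh

lemma up_closure_upper {u : GL (Fin n) ℂ} (hu : u ∈ rootMon (glUp n)) :
    IsUpperUni (u : Mt n) := by
  induction hu using Submonoid.closure_induction with
  | mem g hg => obtain ⟨_, ⟨i, j, h, rfl⟩, t, rfl⟩ := hg; exact tv_upper h t
  | one => exact ⟨fun i => by simp, fun i j hij => by simp [(Fin.lt_def.2 hij).ne']⟩
  | mul g h _ _ ihg ihh => rw [Units.val_mul]; exact ihg.mul ihh

/-- `g` can be reduced to `g'` by lower row and upper column operations. -/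
def Reduces (g g' : GL (Fin n) ℂ) : Prop :=
  ∃ l ∈ rootMon (glLo n), ∃ u ∈ rootMon (glUp n),
    g = l * g' * u

lemma Reduces.refl (g : GL (Fin n) ℂ) : Reduces g g := ⟨1, one_mem _, 1, one_mem _, by simp⟩

lemma Reduces.trans {a b c : GL (Fin n) ℂ} (h₁ : Reduces a b) (h₂ : Reduces b c) : Reduces a c := by
  obtain ⟨l, hl, u, hu, rfl⟩ := h₁
  obtain ⟨l', hl', u', hu', rfl⟩ := h₂
  exact ⟨l * l', mul_mem hl hl', u' * u, mul_mem hu' hu, by group⟩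

lemma tv_mul_neg (i j : Fin n) (h : i ≠ j) (t : ℂ) : tv i j h (-t) * tv i j h t = 1 := by
  ext1
  rw [Units.val_mul, tv_val, tv_val, transvection_mul_transvection_same _ _ h]; simp

lemma reduces_row (g : GL (Fin n) ℂ) {i j : Fin n} (h : j < i) (t : ℂ) :
    Reduces g (tv i j h.ne' t * g) :=
  ⟨tv i j h.ne' (-t), Submonoid.subset_closure ⟨_, ⟨i, j, h, rfl⟩, -t, rfl⟩, 1, one_mem _, by
    rw [← mul_assoc, tv_mul_neg, one_mul, mul_one]⟩

lemma reduces_col (g : GL (Fin n) ℂ) {i j : Fin n} (h : i < j) (t : ℂ) :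
    Reduces g (g * tv i j h.ne t) := by
  refine ⟨1, one_mem _, tv i j h.ne (-t), Submonoid.subset_closure ⟨_, ⟨i, j, h, rfl⟩, -t, rfl⟩, ?_⟩
  have := tv_mul_neg i j h.ne (-t)
  rw [neg_neg] at this
  rw [one_mul, mul_assoc, this, mul_one]

lemma Reduces.minor {g g' : GL (Fin n) ℂ} (h : Reduces g g') (s : ℕ) :
    minor s (g : Mt n) = minor s (g' : Mt n) := by
  obtain ⟨l, hl, u, hu, rfl⟩ := h
  rw [Units.val_mul, Units.val_mul, minor_mul_of_upper s (up_closure_upper hu).2,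
    minor_mul_of_lower s (lo_closure_lower hl).2, (lo_closure_lower hl).minor_eq,
    (up_closure_upper hu).minor_eq, one_mul, mul_one]

/-- Off-diagonal entries with an index below `s` vanish. -/
def Cleared (s : ℕ) (g : Mt n) : Prop :=
  ∀ i j : Fin n, i ≠ j → ((i : ℕ) < s ∨ (j : ℕ) < s) → g i j = 0

lemma tv_mul_apply' (i j : Fin n) (t : ℂ) (g : Mt n) (a b : Fin n) :
    (transvection i j t * g) a b = g a b + if a = i then t * g j b else 0 := by
  by_cases h : a = i
  · subst h; simp [transvection, add_mul]
  · simp [h]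

lemma mul_tv_apply' (i j : Fin n) (t : ℂ) (g : Mt n) (a b : Fin n) :
    (g * transvection i j t) a b = g a b + if b = j then t * g a i else 0 := by
  by_cases h : b = j
  · subst h; simp [transvection, mul_add, mul_comm]
  · simp [h]

lemma clear_column (g : GL (Fin n) ℂ) (s : Fin n) (hs : Cleared s (g : Mt n))
    (h0 : (g : Mt n) s s ≠ 0) (r : ℕ) :
    ∃ g', Reduces g g' ∧ Cleared s (g' : Mt n) ∧
      (g' : Mt n) s s ≠ 0 ∧
      ∀ i : Fin n, s < i → (i : ℕ) < r → (g' : Mt n) i s = 0 := by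
  induction r with
  | zero => exact ⟨g, Reduces.refl g, hs, h0, fun i _ h => absurd h (by omega)⟩
  | succ r ih =>
    obtain ⟨g', h1, h2, h3, h4⟩ := ih
    by_cases hr : (s : ℕ) < r ∧ r < n
    · set i : Fin n := ⟨r, hr.2⟩ with hi
      have hsi : s < i := hr.1
      have hsi' : (s : ℕ) < i := hsi
      set t := -((g' : Mt n) i s / (g' : Mt n) s s)
      refine ⟨_, h1.trans (reduces_row g' hsi t), ?_, ?_, ?_⟩
      · intro a b hab h
        rw [Units.val_mul, tv_val, tv_mul_apply', h2 a b hab h, zero_add]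
        split_ifs with hai
        · subst hai
          rw [h2 s b ?_ (Or.inr ?_), mul_zero]
          · rintro rfl
            rcases h with h | h
            · omega
            · omega
          · rcases h with h | h
            · omega
            · exact h
        · rfl
      · rw [Units.val_mul, tv_val, tv_mul_apply', if_neg hsi.ne, add_zero]; exact h3
      · intro a ha har
        rw [Units.val_mul, tv_val, tv_mul_apply']
        split_ifs with hai
        · subst hai; simp only [t]; field_simp; ring
        · rw [add_zero]
          refine h4 a ha ?_
          have : (a : ℕ) ≠ r := fun h => hai (Fin.ext h)
          omega
    · refine ⟨g', h1, h2, h3, fun i hi hir => ?_⟩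
      have : (s : ℕ) < i := hi
      have := i.2
      exact h4 i hi (by omega)

lemma clear_row (g : GL (Fin n) ℂ) (s : Fin n) (hs : Cleared s (g : Mt n))
    (h0 : (g : Mt n) s s ≠ 0)
    (hcol : ∀ i : Fin n, s < i → (g : Mt n) i s = 0) (r : ℕ) :
    ∃ g', Reduces g g' ∧ Cleared s (g' : Mt n) ∧
      (g' : Mt n) s s ≠ 0 ∧
      (∀ i : Fin n, s < i → (g' : Mt n) i s = 0) ∧
      ∀ i : Fin n, s < i → (i : ℕ) < r → (g' : Mt n) s i = 0 := by
  induction r with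
  | zero => exact ⟨g, Reduces.refl g, hs, h0, hcol, fun i _ h => absurd h (by omega)⟩
  | succ r ih =>
    obtain ⟨g', h1, h2, h3, h5, h4⟩ := ih
    by_cases hr : (s : ℕ) < r ∧ r < n
    · set i : Fin n := ⟨r, hr.2⟩ with hi
      have hsi : s < i := hr.1
      have hsi' : (s : ℕ) < i := hsi
      set t := -((g' : Mt n) s i / (g' : Mt n) s s)
      refine ⟨_, h1.trans (reduces_col g' hsi t), ?_, ?_, ?_, ?_⟩
      · intro a b hab h
        rw [Units.val_mul, tv_val, mul_tv_apply', h2 a b hab h, zero_add]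
        split_ifs with hai
        · subst hai
          rw [h2 a s ?_ (Or.inl ?_), mul_zero]
          · rintro rfl
            rcases h with h | h
            · omega
            · omega
          · rcases h with h | h
            · exact h
            · omega
        · rfl
      · rw [Units.val_mul, tv_val, mul_tv_apply', if_neg hsi.ne, add_zero]; exact h3
      · intro a ha
        rw [Units.val_mul, tv_val, mul_tv_apply', if_neg hsi.ne, add_zero]; exact h5 a ha
      · intro a ha har
        rw [Units.val_mul, tv_val, mul_tv_apply']
        split_ifs with hai
        · subst hai; simp only [t]; field_simp; ring
        · rw [add_zero]
          refine h4 a ha ?_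
          have : (a : ℕ) ≠ r := fun h => hai (Fin.ext h)
          omega
    · refine ⟨g', h1, h2, h3, h5, fun i hi hir => ?_⟩
      have : (s : ℕ) < i := hi
      have := i.2
      exact h4 i hi (by omega)

lemma exists_cleared (g : GL (Fin n) ℂ) (hg : ∀ s ≤ n, minor s (g : Mt n) ≠ 0)
    (s : ℕ) (hs : s ≤ n) :
    ∃ g', Reduces g g' ∧ Cleared s (g' : Mt n) := by
  induction s with
  | zero => exact ⟨g, Reduces.refl g, fun i j _ h => by omega⟩
  | succ s ih =>
    obtain ⟨g₁, h1, h2⟩ := ih (by omega)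
    set σ : Fin n := ⟨s, hs⟩
    have h0 : (g₁ : Mt n) σ σ ≠ 0 := by
      have hm := hg (s + 1) hs
      rw [h1.minor, _root_.minor] at hm
      have hd : trunc (s + 1) (g₁ : Mt n) = diagonal fun i : Fin n =>
          if (i : ℕ) < s + 1 then (g₁ : Mt n) i i else 1 := by
        ext i j
        rw [trunc_apply, diagonal_apply]
        by_cases hij : i = j
        · subst hij; simp
        · simp only [hij, if_false, ite_eq_right_iff, and_imp]
          intro hi hj
          have : (i : ℕ) ≠ j := fun h => hij (Fin.ext h)
          exact h2 i j hij (by omega)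
      rw [hd, det_diagonal, Finset.prod_ne_zero_iff] at hm
      simpa [σ] using hm σ (Finset.mem_univ _)
    obtain ⟨g₂, a1, a2, a3, a4⟩ := clear_column g₁ σ h2 h0 n
    obtain ⟨g₃, b1, b2, b3, b4, b5⟩ := clear_row g₂ σ a2 a3 (fun i hi => a4 i hi i.2) n
    refine ⟨g₃, (h1.trans a1).trans b1, fun i j hij h => ?_⟩
    by_cases hlt : (i : ℕ) < s ∨ (j : ℕ) < s
    · exact b2 i j hij hlt
    · have hne : (i : ℕ) ≠ j := fun h => hij (Fin.ext h)
      rcases h with h | h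
      · have : i = σ := Fin.ext (by simp [σ]; omega)
        subst this
        exact b5 j (Fin.lt_def.2 (by simp only [σ] at *; omega)) j.2
      · have : j = σ := Fin.ext (by simp [σ]; omega)
        subst this
        exact b4 i (Fin.lt_def.2 (by simp only [σ] at *; omega))

lemma exists_dg_of_offdiag {g : GL (Fin n) ℂ}
    (h : ∀ i j, i ≠ j → (g : Mt n) i j = 0) : ∃ d, g = dg d := by
  have hd : (g : Mt n) =
      diagonal fun i => (g : Mt n) i i := by
    ext i j
    rw [diagonal_apply]
    split_ifs with hij
    · rw [hij]
    · exact h i j hij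
  have hdet : (g : Mt n).det ≠ 0 :=
    ((isUnit_iff_isUnit_det _).1 g.isUnit).ne_zero
  rw [hd, det_diagonal, Finset.prod_ne_zero_iff] at hdet
  exact ⟨fun i => Units.mk0 _ (hdet i (Finset.mem_univ _)), Units.ext hd⟩

theorem gl_cell {g : GL (Fin n) ℂ} (hg : glDelta (g : Mt n) ≠ 0) :
    ∃ l ∈ rootMon (glLo n), ∃ t ∈ (dg (n := n)).range,
      ∃ u ∈ rootMon (glUp n), g = l * t * u := by
  rw [glDelta, Finset.prod_ne_zero_iff] at hg
  obtain ⟨g', ⟨l, hl, u, hu, h⟩, h2⟩ :=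
    exists_cleared g (fun s hs => hg s (Finset.mem_range.2 (by omega))) n le_rfl
  obtain ⟨d, rfl⟩ := exists_dg_of_offdiag fun i j hij => h2 i j hij (Or.inl i.2)
  exact ⟨l, hl, _, ⟨d, rfl⟩, u, hu, h⟩

theorem gl_generated :
    Submonoid.closure (((dg (n := n)).range : Set (GL (Fin n) ℂ)) ∪ rootElts (glLo n ∪ glUp n))
      = ⊤ := by
  rw [eq_top_iff]
  intro g _
  have key : ∀ M : Mt n, M.det ≠ 0 → ∀ g : GL (Fin n) ℂ,
      (g : Mt n) = M → g ∈ Submonoid.closure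
        (((dg (n := n)).range : Set (GL (Fin n) ℂ)) ∪ rootElts (glLo n ∪ glUp n)) := by
    intro M hM
    refine diagonal_transvection_induction_of_det_ne_zero
      (P := fun M => ∀ g : GL (Fin n) ℂ,
        (g : Mt n) = M → g ∈ Submonoid.closure
        (((dg (n := n)).range : Set (GL (Fin n) ℂ)) ∪ rootElts (glLo n ∪ glUp n))) M hM ?_ ?_ ?_
    · intro D _ g hg
      obtain ⟨d, rfl⟩ := exists_dg_of_offdiag (g := g) fun i j hij => by
        rw [hg, diagonal_apply_ne _ hij]
      exact Submonoid.subset_closure (Or.inl ⟨d, rfl⟩)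
    · intro t g hg
      refine Submonoid.subset_closure (Or.inr ?_)
      have hgt : g = tv t.i t.j t.hij t.c := Units.ext hg
      rcases lt_or_gt_of_ne t.hij with h | h
      · exact ⟨_, Or.inr ⟨t.i, t.j, h, rfl⟩, t.c, hgt⟩
      · exact ⟨_, Or.inl ⟨t.i, t.j, h, rfl⟩, t.c, hgt⟩
    · intro A B hA hB ihA ihB g hg
      have h1 : g = GeneralLinearGroup.mkOfDetNeZero A hA *
          GeneralLinearGroup.mkOfDetNeZero B hB := Units.ext hg
      rw [h1]
      exact mul_mem (ihA _ rfl) (ihB _ rfl)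
  exact key _ ((isUnit_iff_isUnit_det _).1 g.isUnit).ne_zero g rfl

lemma det_polyFn {ι : Type*} [Fintype ι] [DecidableEq ι] {M : ℕ → Matrix ι ι ℂ}
    (h : ∀ i j, PolyFn fun m => M m i j) : PolyFn fun m => (M m).det := by
  simp only [det_apply]
  refine PolyFn.sum _ fun σ _ => ?_
  have := (PolyFn.const ((Equiv.Perm.sign σ : ℤ) : ℂ)).mul
    (PolyFn.prod Finset.univ fun i _ => h (σ i) i)
  refine Eq.mp (congrArg PolyFn (funext fun m => ?_)) this
  rw [Units.smul_def, zsmul_eq_mul]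

lemma glDelta_polyFn {M : ℕ → Mt n}
    (h : ∀ i j, PolyFn fun m => M m i j) : PolyFn fun m => glDelta (M m) := by
  refine PolyFn.prod _ fun s _ => det_polyFn fun i j => ?_
  simp only [trunc_apply]
  split_ifs
  · exact h i j
  · exact PolyFn.const 1
  · exact PolyFn.const 0

lemma exists_eq_tv {x : ℂ → GL (Fin n) ℂ} (hx : x ∈ glLo n ∪ glUp n) :
    ∃ i j : Fin n, ∃ h, x = tv i j h := by
  rcases hx with ⟨i, j, h, rfl⟩ | ⟨i, j, h, rfl⟩
  · exact ⟨i, j, h.ne', rfl⟩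
  · exact ⟨i, j, h.ne, rfl⟩

lemma gl_path_polyFn {P : ℕ → GL (Fin n) ℂ} (hP : PathIn (dg (n := n)).range (glLo n ∪ glUp n) P)
    (i j : Fin n) : PolyFn fun m => (P m : Mt n) i j := by
  induction hP generalizing i j with
  | const ht => exact PolyFn.const _
  | @root x hx a t =>
    obtain ⟨i', j', h, rfl⟩ := exists_eq_tv hx
    simp only [tv_val, tv_apply]
    refine (PolyFn.const _).add ?_
    split_ifs
    · exact (PolyFn.natCast.pow a).mul (PolyFn.const t)
    · exact PolyFn.const 0
  | mul hP hQ ihP ihQ =>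
    simp only [Units.val_mul, Matrix.mul_apply]
    exact PolyFn.sum _ fun k _ => (ihP i k).mul (ihQ k j)

lemma dg_conj_tv (d : Fin n → ℂˣ) (i j : Fin n) (h : i ≠ j) (t : ℂ) :
    dg d * tv i j h t * (dg d)⁻¹ = tv i j h (d i * (d j : ℂ)⁻¹ * t) := by
  rw [mul_inv_eq_iff_eq_mul]
  ext a b
  simp only [Units.val_mul, dg_val, tv_val, diagonal_mul, mul_diagonal, tv_apply]
  by_cases hab : a = b
  · subst hab
    have : ¬ (i = a ∧ j = a) := by rintro ⟨rfl, rfl⟩; exact h rfl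
    simp [this]
  · by_cases hc : i = a ∧ j = b
    · obtain ⟨rfl, rfl⟩ := hc
      simp [hab]; field_simp
    · simp [hab, hc]

/-- The big cell of `GL n`. -/
def glCell (n : ℕ) : CellData (GL (Fin n) ℂ) where
  T := (dg (n := n)).range
  c := glScale n
  Lo := glLo n
  Up := glUp n
  δ g := glDelta (g : Mt n)
  comm := by
    rintro _ ⟨a, rfl⟩ _ ⟨b, rfl⟩
    rw [← map_mul, mul_comm, map_mul]
  hc m := ⟨_, rfl⟩
  add := by
    intro x hx s t
    obtain ⟨i, j, h, rfl⟩ := exists_eq_tv hx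
    ext1
    rw [Units.val_mul, tv_val, tv_val, tv_val, transvection_mul_transvection_same _ _ h]
  lo_conj := by
    rintro _ ⟨i, j, h, rfl⟩
    have h' : (j : ℕ) < i := h
    refine ⟨i - j, by omega, fun m hm t => ?_⟩
    rw [glScale, dg_conj_tv]
    congr 2
    have hm0 : (m : ℂ) ≠ 0 := by exact_mod_cast (by omega : m ≠ 0)
    push_cast
    rw [scaleUnit_val hm, show n - (j : ℕ) = (n - i) + (i - j) by have := i.2; omega, pow_add]
    field_simp
    rw [one_div, inv_pow, inv_mul_cancel₀ (pow_ne_zero _ hm0)]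
  up_conj := by
    rintro _ ⟨i, j, h, rfl⟩
    have h' : (i : ℕ) < j := h
    refine ⟨j - i, by omega, fun m hm t => ?_⟩
    have hinv : (glScale n m)⁻¹ = dg fun i => (scaleUnit m) ^ (n - (i : ℕ)) := by
      rw [glScale, ← map_inv]; congr 1
    rw [← inv_inv (glScale n m), hinv, inv_inv, dg_conj_tv]
    congr 2
    have hm0 : (m : ℂ) ≠ 0 := by exact_mod_cast (by omega : m ≠ 0)
    push_cast
    rw [scaleUnit_val hm, show n - (i : ℕ) = (n - j) + (j - i) by have := j.2; omega, pow_add]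
    field_simp
  gen := gl_generated
  δ_poly P hP := glDelta_polyFn fun i j => gl_path_polyFn hP i j
  δ_T := by
    rintro _ ⟨d, rfl⟩
    rw [glDelta, Finset.prod_ne_zero_iff]
    intro s _
    rw [minor_lower (fun i j h => by simp [h.ne]), Finset.prod_ne_zero_iff]
    intro i _
    split_ifs
    · simp
    · simp
  cell g hg := gl_cell hg

lemma inv_mem_up_closure {u : GL (Fin n) ℂ} (hu : u ∈ rootMon (glUp n)) :
    u⁻¹ ∈ rootMon (glUp n) := by
  induction hu using Submonoid.closure_induction with
  | mem g hg =>
    obtain ⟨_, ⟨i, j, h, rfl⟩, t, rfl⟩ := hg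
    rw [← eq_inv_of_mul_eq_one_left (tv_mul_neg i j h.ne t)]
    exact Submonoid.subset_closure ⟨_, ⟨i, j, h, rfl⟩, -t, rfl⟩
  | one => rw [inv_one]; exact one_mem _
  | mul g h _ _ ihg ihh => rw [_root_.mul_inv_rev]; exact mul_mem ihh ihg

/-- Every unitriangular matrix is a product of elementary ones. -/
lemma mem_up_closure {g : GL (Fin n) ℂ} (hg : IsUpperUni (g : Mt n)) :
    g ∈ rootMon (glUp n) := by
  obtain ⟨l, hl, _, ⟨d, rfl⟩, u, hu, rfl⟩ := gl_cell (g := g) (by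
    rw [glDelta, Finset.prod_ne_zero_iff]
    intro s _
    rw [hg.minor_eq]; exact one_ne_zero)
  have hl' := lo_closure_lower hl
  have hu' := up_closure_upper hu
  have key : l * dg d = 1 := by
    have h1 : IsUpperUni ((l * dg d : GL (Fin n) ℂ) : Mt n) := by
      rw [show l * dg d = l * dg d * u * u⁻¹ by group, Units.val_mul]
      exact hg.mul (up_closure_upper (inv_mem_up_closure hu))
    ext i j
    rw [Units.val_one, Matrix.one_apply]
    split_ifs with hij
    · rw [← hij]; exact h1.1 i
    · rcases lt_or_gt_of_ne hij with h | h
      · rw [Units.val_mul, dg_val, mul_diagonal, hl'.2 i j h, zero_mul]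
      · exact h1.2 i j h
  rw [key, one_mul]; exact hu

end GLCell

/-! ### The big cell of the symplectic group -/

section SpCell

variable {n : ℕ}

/-- The coordinates adapted to the polarization. -/
def polEquiv (n : ℕ) : Fin n ⊕ Fin n ≃ Fin (2 * n) where
  toFun := Sum.elim (fun i => ⟨i, by have := i.2; omega⟩)
    (fun j => ⟨2 * n - 1 - j, by have := j.2; omega⟩)
  invFun i := if h : (i : ℕ) < n then Sum.inl ⟨i, h⟩
    else Sum.inr ⟨2 * n - 1 - i, by have := i.2; omega⟩
  left_inv := by
    rintro (i | j)
    · simp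
    · have := j.2
      have h : ¬ (2 * n - 1 - (j : ℕ) < n) := by omega
      refine (dif_neg h).trans ?_
      refine congrArg Sum.inr (Fin.ext ?_); simp; omega
  right_inv := by
    intro i
    by_cases h : (i : ℕ) < n
    · simp [h]
    · have := i.2
      simp only [h, dif_neg, not_false_iff, Sum.elim_inr]
      ext; simp; omega

@[simp] lemma polEquiv_inl (i : Fin n) : ((polEquiv n (Sum.inl i) : Fin (2 * n)) : ℕ) = i := rfl

@[simp] lemma polEquiv_inr (i : Fin n) :
    ((polEquiv n (Sum.inr i) : Fin (2 * n)) : ℕ) = 2 * n - 1 - i := rfl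

abbrev BlockMat (n : ℕ) := Matrix (Fin n ⊕ Fin n) (Fin n ⊕ Fin n) ℂ

def stdJ (n : ℕ) : BlockMat n := fromBlocks 0 1 (-1) 0

lemma sympForm_submatrix : (sympForm n).submatrix (polEquiv n) (polEquiv n) = stdJ n := by
  ext i j
  rw [submatrix_apply]
  change (if ((polEquiv n i : Fin (2 * n)) : ℕ) + (polEquiv n j : Fin (2 * n)) = 2 * n - 1 then
    (if ((polEquiv n i : Fin (2 * n)) : ℕ) < n then (1 : ℂ) else -1) else 0) = _
  rcases i with i | i <;> rcases j with j | j
  · have := i.2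
    have := j.2
    rw [if_neg (by simp only [polEquiv_inl]; omega)]; rfl
  · have := i.2
    have := j.2
    change _ = (1 : Mt n) i j
    by_cases h : i = j
    · subst h
      rw [if_pos (by simp only [polEquiv_inl, polEquiv_inr]; omega),
        if_pos (by simp only [polEquiv_inl]; omega), Matrix.one_apply_eq]
    · have : (i : ℕ) ≠ j := fun h' => h (Fin.ext h')
      rw [if_neg (by simp only [polEquiv_inl, polEquiv_inr]; omega), Matrix.one_apply_ne h]
  · have := i.2
    have := j.2
    change _ = -(1 : Mt n) i j
    by_cases h : i = j
    · subst h
      rw [if_pos (by simp only [polEquiv_inl, polEquiv_inr]; omega),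
        if_neg (by simp only [polEquiv_inr]; omega), Matrix.one_apply_eq]
    · have : (i : ℕ) ≠ j := fun h' => h (Fin.ext h')
      rw [if_neg (by simp only [polEquiv_inl, polEquiv_inr]; omega), Matrix.one_apply_ne h, neg_zero]
  · have := i.2
    have := j.2
    rw [if_neg (by simp only [polEquiv_inr]; omega)]; rfl

/-- The matrix of a symplectic transformation in polarized coordinates. -/
def blk (g : SpGL n) : BlockMat n :=
  ((g : GL (Fin (2 * n)) ℂ) : Mt (2 * n)).submatrix
    (polEquiv n) (polEquiv n)

lemma blk_mul (g h : SpGL n) : blk (g * h) = blk g * blk h := by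
  rw [blk, blk, blk, submatrix_mul_equiv]; rfl

lemma blk_one : blk (1 : SpGL n) = 1 := by
  rw [blk]; exact submatrix_one_equiv _

lemma blk_injective : Function.Injective (blk (n := n)) := by
  intro g h hgh
  refine Subtype.ext (Units.ext ?_)
  ext i j
  have := congrFun (congrFun hgh ((polEquiv n).symm i)) ((polEquiv n).symm j)
  simpa [blk] using this

lemma blk_symp (g : SpGL n) : (blk g)ᵀ * stdJ n * blk g = stdJ n := by
  have h : ((g : GL (Fin (2 * n)) ℂ) : Matrix _ _ ℂ)ᵀ * sympForm n *
    ((g : GL (Fin (2 * n)) ℂ) : Matrix _ _ ℂ) = sympForm n := g.2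
  rw [← sympForm_submatrix, blk, transpose_submatrix, submatrix_mul_equiv,
    submatrix_mul_equiv, h]

lemma stdJ_mul_self : stdJ n * stdJ n = -1 := by
  rw [stdJ, fromBlocks_multiply]
  simp [← fromBlocks_one, fromBlocks_neg]

lemma mul_of_symp {M : BlockMat n} (hM : Mᵀ * stdJ n * M = stdJ n) :
    (-(stdJ n * Mᵀ * stdJ n)) * M = 1 := by
  rw [neg_mul, mul_assoc (stdJ n), mul_assoc (stdJ n), hM, stdJ_mul_self, neg_neg]

lemma submatrix_symm_mul (M N : BlockMat n) :
    M.submatrix (polEquiv n).symm (polEquiv n).symm * N.submatrix (polEquiv n).symm (polEquiv n).symm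
      = (M * N).submatrix (polEquiv n).symm (polEquiv n).symm := submatrix_mul_equiv ..

/-- Symplectic transformations from their matrices. -/
def mkSp (M : BlockMat n) (hM : Mᵀ * stdJ n * M = stdJ n) : SpGL n :=
  ⟨⟨M.submatrix (polEquiv n).symm (polEquiv n).symm,
    (-(stdJ n * Mᵀ * stdJ n)).submatrix (polEquiv n).symm (polEquiv n).symm,
    by rw [submatrix_symm_mul, _root_.mul_eq_one_comm.1 (mul_of_symp hM)]
       exact submatrix_one_equiv _,
    by rw [submatrix_symm_mul, mul_of_symp hM]
       exact submatrix_one_equiv _⟩, by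
    change (M.submatrix (polEquiv n).symm (polEquiv n).symm)ᵀ * sympForm n *
      M.submatrix (polEquiv n).symm (polEquiv n).symm = sympForm n
    have : sympForm n = (stdJ n).submatrix (polEquiv n).symm (polEquiv n).symm := by
      rw [← sympForm_submatrix]; simp
    rw [this, transpose_submatrix, submatrix_symm_mul, submatrix_symm_mul, hM]⟩

@[simp] lemma blk_mkSp (M : BlockMat n) (hM : Mᵀ * stdJ n * M = stdJ n) : blk (mkSp M hM) = M := by
  simp [blk, mkSp]

lemma symp_blocks {A B C D : Mt n} :
    (fromBlocks A B C D)ᵀ * stdJ n * fromBlocks A B C D = stdJ n ↔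
      Aᵀ * C = Cᵀ * A ∧ Aᵀ * D - Cᵀ * B = 1 ∧ Bᵀ * D = Dᵀ * B := by
  rw [stdJ, fromBlocks_transpose, fromBlocks_multiply, fromBlocks_multiply, fromBlocks_inj]
  simp only [mul_zero, zero_add, add_zero, mul_neg, mul_one, neg_mul]
  constructor
  · rintro ⟨h1, h2, -, h4⟩
    refine ⟨?_, ?_, ?_⟩
    · rw [neg_add_eq_zero] at h1; exact h1.symm
    · rw [← h2]; abel
    · rw [neg_add_eq_zero] at h4; exact h4.symm
  · rintro ⟨h1, h2, h3⟩
    refine ⟨by rw [h1]; abel, by rw [← h2]; abel, ?_, by rw [h3]; abel⟩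
    have := congrArg transpose h2
    simp only [transpose_sub, transpose_mul, transpose_transpose, transpose_one] at this
    rw [← this]; abel

lemma symp_polarized (g : GL (Fin n) ℂ) :
    (fromBlocks (g : Mt n) 0 0
      ((g⁻¹ : GL (Fin n) ℂ) : Mt n)ᵀ)ᵀ * stdJ n *
      fromBlocks (g : Mt n) 0 0
      ((g⁻¹ : GL (Fin n) ℂ) : Mt n)ᵀ = stdJ n := by
  rw [symp_blocks]
  refine ⟨by simp, ?_, by simp⟩
  rw [← transpose_mul, ← Units.val_mul]; simp

/-- The polarized embedding of the general linear group. -/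
def spPhi (n : ℕ) : GL (Fin n) ℂ →* SpGL n where
  toFun g := mkSp (fromBlocks (g : Mt n) 0 0
      ((g⁻¹ : GL (Fin n) ℂ) : Mt n)ᵀ) (symp_polarized g)
  map_one' := blk_injective (by rw [blk_mkSp, blk_one]; simp)
  map_mul' g h := blk_injective (by
    rw [blk_mul, blk_mkSp, blk_mkSp, blk_mkSp, fromBlocks_multiply]
    simp [transpose_mul])

@[simp] lemma blk_spPhi (g : GL (Fin n) ℂ) :
    blk (spPhi n g) = fromBlocks (g : Mt n) 0 0
      ((g⁻¹ : GL (Fin n) ℂ) : Mt n)ᵀ := blk_mkSp _ (symp_polarized g)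

lemma eq_spPhi {φ : GL (Fin n) ℂ →* SpGL n} (hφ : IsPolarizationEmbed n φ) : φ = spPhi n := by
  ext1 g
  refine blk_injective ?_
  rw [blk_spPhi]
  ext i j
  rw [blk, submatrix_apply, hφ]
  have hn : ∀ i : Fin n, ¬ (((polEquiv n (Sum.inr i) : Fin (2 * n)) : ℕ) < n) := fun i => by
    have := i.2
    rw [polEquiv_inr]; omega
  have hl : ∀ i : Fin n, ((polEquiv n (Sum.inl i) : Fin (2 * n)) : ℕ) < n := fun i => i.2
  have hr : ∀ (i : Fin n) h,
      (⟨2 * n - 1 - ((polEquiv n (Sum.inr i) : Fin (2 * n)) : ℕ), h⟩ : Fin n) = i := fun i h => by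
    have := i.2
    ext; simp only [polEquiv_inr]; omega
  rcases i with i | i <;> rcases j with j | j
  · rw [dif_pos (hl i), dif_pos (hl j)]; rfl
  · rw [dif_pos (hl i), dif_neg (hn j)]; rfl
  · rw [dif_neg (hn i), dif_pos (hl j)]; rfl
  · rw [dif_neg (hn i), dif_neg (hn j), hr, hr]; rfl

/-- Lower unipotent elements, with lower left block the symmetrization of `S`. -/
def nLo (S : Mt n) : SpGL n :=
  mkSp (fromBlocks 1 0 (S + Sᵀ) 1) (by rw [symp_blocks]; simp [add_comm])

/-- Upper unipotent elements, with upper right block the symmetrization of `S`. -/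
def nUp (S : Mt n) : SpGL n :=
  mkSp (fromBlocks 1 (S + Sᵀ) 0 1) (by rw [symp_blocks]; simp [add_comm])

@[simp] lemma blk_nLo (S : Mt n) :
    blk (nLo S) = fromBlocks 1 0 (S + Sᵀ) 1 := blk_mkSp _ _

@[simp] lemma blk_nUp (S : Mt n) :
    blk (nUp S) = fromBlocks 1 (S + Sᵀ) 0 1 := blk_mkSp _ _

lemma nLo_add (S S' : Mt n) : nLo (S + S') = nLo S * nLo S' :=
  blk_injective (by
    rw [blk_mul, blk_nLo, blk_nLo, blk_nLo, fromBlocks_multiply]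
    simp [add_add_add_comm])

lemma nUp_add (S S' : Mt n) : nUp (S + S') = nUp S * nUp S' :=
  blk_injective (by
    rw [blk_mul, blk_nUp, blk_nUp, blk_nUp, fromBlocks_multiply]
    simp only [mul_one, one_mul, mul_zero, zero_mul, add_zero, zero_add, transpose_add]
    congr 1; abel)

lemma nLo_zero : nLo (0 : Mt n) = 1 := blk_injective (by simp [blk_one])

lemma nUp_zero : nUp (0 : Mt n) = 1 := blk_injective (by simp [blk_one])

def spLo (n : ℕ) : Set (ℂ → SpGL n) :=
  {x | ∃ y ∈ glLo n, x = fun t => spPhi n (y t)} ∪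
    {x | ∃ i j, x = fun t => nLo (single i j t)}

def spUp (n : ℕ) : Set (ℂ → SpGL n) :=
  {x | ∃ y ∈ glUp n, x = fun t => spPhi n (y t)} ∪
    {x | ∃ i j, x = fun t => nUp (single i j t)}

lemma nLo_mem (S : Mt n) : nLo S ∈ rootMon (spLo n) := by
  induction S using Matrix.induction_on' with
  | h_zero => rw [nLo_zero]; exact one_mem _
  | h_add p q hp hq => rw [nLo_add]; exact mul_mem hp hq
  | h_std_basis i j x => exact Submonoid.subset_closure ⟨_, Or.inr ⟨i, j, rfl⟩, x, rfl⟩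

lemma nUp_mem (S : Mt n) : nUp S ∈ rootMon (spUp n) := by
  induction S using Matrix.induction_on' with
  | h_zero => rw [nUp_zero]; exact one_mem _
  | h_add p q hp hq => rw [nUp_add]; exact mul_mem hp hq
  | h_std_basis i j x => exact Submonoid.subset_closure ⟨_, Or.inr ⟨i, j, rfl⟩, x, rfl⟩

lemma spPhi_mem_closure {X : Set (ℂ → GL (Fin n) ℂ)} {Y : Set (ℂ → SpGL n)}
    (h : ∀ y ∈ X, (fun t => spPhi n (y t)) ∈ Y) {l : GL (Fin n) ℂ}
    (hl : l ∈ rootMon X) : spPhi n l ∈ rootMon Y := by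
  refine (Submonoid.closure_le (S := (rootMon Y).comap (spPhi n))).2 ?_ hl
  rintro _ ⟨y, hy, t, rfl⟩
  exact Submonoid.subset_closure ⟨_, h y hy, t, rfl⟩

lemma spPhi_lo_mem {l : GL (Fin n) ℂ} (hl : l ∈ rootMon (glLo n)) :
    spPhi n l ∈ rootMon (spLo n) :=
  spPhi_mem_closure (fun y hy => Or.inl ⟨y, hy, rfl⟩) hl

lemma spPhi_up_mem {l : GL (Fin n) ℂ} (hl : l ∈ rootMon (glUp n)) :
    spPhi n l ∈ rootMon (spUp n) :=
  spPhi_mem_closure (fun y hy => Or.inl ⟨y, hy, rfl⟩) hl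

lemma exists_nLo_of_isSymm {W : Mt n} (hW : Wᵀ = W) :
    ∃ S, S + Sᵀ = W := by
  refine ⟨(1 / 2 : ℂ) • W, ?_⟩
  rw [transpose_smul, hW, ← add_smul]; norm_num

lemma blk_eq_blocks (g : SpGL n) : blk g =
    fromBlocks (blk g).toBlocks₁₁ (blk g).toBlocks₁₂ (blk g).toBlocks₂₁ (blk g).toBlocks₂₂ :=
  (fromBlocks_toBlocks _).symm

/-- Block Gauss decomposition. -/
lemma sp_block_cell (g : SpGL n) (h : (blk g).toBlocks₁₁.det ≠ 0) :
    ∃ S, ∃ a : GL (Fin n) ℂ, ∃ S', (a : Mt n) = (blk g).toBlocks₁₁ ∧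
      g = nLo S * spPhi n a * nUp S' := by
  have hs := blk_symp g
  set A := (blk g).toBlocks₁₁ with hA
  set B := (blk g).toBlocks₁₂ with hB
  set C := (blk g).toBlocks₂₁ with hC
  set D := (blk g).toBlocks₂₂ with hD
  have hg : blk g = fromBlocks A B C D := blk_eq_blocks g
  rw [hg, symp_blocks] at hs
  obtain ⟨h1, h2, h3⟩ := hs
  set a := GeneralLinearGroup.mkOfDetNeZero A h with ha
  have hav : (a : Mt n) = A := rfl
  set A' : Mt n := ((a⁻¹ : GL (Fin n) ℂ) : Mt n) with hA'
  have e1 : A * A' = 1 := by rw [← hav, hA', ← Units.val_mul]; simp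
  have e2 : A' * A = 1 := by rw [← hav, hA', ← Units.val_mul]; simp
  have e1' : A'ᵀ * Aᵀ = 1 := by rw [← transpose_mul, e1, transpose_one]
  have e2' : Aᵀ * A'ᵀ = 1 := by rw [← transpose_mul, e2, transpose_one]
  have s1 : (C * A')ᵀ = C * A' := by
    rw [transpose_mul]
    calc A'ᵀ * Cᵀ = A'ᵀ * (Cᵀ * A) * A' := by rw [mul_assoc, mul_assoc, e1, mul_one]
      _ = C * A' := by rw [← h1, ← mul_assoc, e1', one_mul]
  have hD' : D = A'ᵀ + C * A' * B := by
    calc D = A'ᵀ * (Aᵀ * D) := by rw [← mul_assoc, e1', one_mul]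
      _ = A'ᵀ * (1 + Cᵀ * B) := by rw [← h2]; congr 1; abel
      _ = A'ᵀ + (C * A')ᵀ * B := by rw [mul_add, mul_one, transpose_mul, mul_assoc]
      _ = _ := by rw [s1]
  have s2 : (A' * B)ᵀ = A' * B := by
    have h4 : Bᵀ * A'ᵀ = A' * B := by
      have h3' := h3
      rw [hD', mul_add, transpose_add, add_mul, transpose_transpose, transpose_mul, s1,
        mul_assoc Bᵀ, ← mul_assoc Bᵀ] at h3'
      simpa [mul_assoc] using h3'
    rw [transpose_mul, h4]
  obtain ⟨S, hS⟩ := exists_nLo_of_isSymm s1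
  obtain ⟨S', hS'⟩ := exists_nLo_of_isSymm s2
  refine ⟨S, a, S', rfl, blk_injective ?_⟩
  rw [blk_mul, blk_mul, blk_nLo, blk_nUp, blk_spPhi, hS, hS', hav, ← hA', hg, fromBlocks_multiply,
    fromBlocks_multiply]
  simp only [mul_zero, zero_mul, add_zero, zero_add, mul_one, one_mul]
  rw [← mul_assoc A, e1, one_mul, mul_assoc C, e2, mul_one, hD', add_comm, mul_assoc]

lemma exists_symm_det_ne_zero (A C : Mt n) (h : Aᵀ * C = Cᵀ * A)
    (hinj : ∀ x, A *ᵥ x = 0 → C *ᵥ x = 0 → x = 0) :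
    ∃ Z : Mt n, Zᵀ = Z ∧ (A + Z * C).det ≠ 0 := by
  induction hr : finrank ℂ (LinearMap.ker A.mulVecLin) using Nat.strong_induction_on
    generalizing A with
  | _ r ih =>
  by_cases hA : A.det = 0
  · obtain ⟨x, hx0, hx⟩ := Matrix.exists_mulVec_eq_zero_iff.2 hA
    have hC : C *ᵥ x ≠ 0 := fun hC => hx0 (hinj x hx hC)
    obtain ⟨y, hy⟩ : ∃ y : Fin n → ℂ, y ⬝ᵥ (C *ᵥ x) ≠ 0 := by
      by_contra! hcon
      exact hC (_root_.dotProduct_eq_zero _ fun w => by rw [dotProduct_comm]; exact hcon w)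
    set Y := vecMulVec y y with hY
    have hYt : Yᵀ = Y := by ext i j; simp [hY, vecMulVec_apply, mul_comm]
    have hYv : ∀ v, Y *ᵥ v = (y ⬝ᵥ v) • y := fun v => by
      ext i
      simp [hY, mulVec, dotProduct, vecMulVec_apply, Finset.mul_sum,
        mul_comm, mul_left_comm]
    have hker : ∀ v, (A + Y * C) *ᵥ v = 0 → y ⬝ᵥ (C *ᵥ v) = 0 ∧ A *ᵥ v = 0 := by
      intro v hv
      rw [Matrix.add_mulVec, ← mulVec_mulVec, hYv] at hv
      have h1 : (C *ᵥ x) ⬝ᵥ (A *ᵥ v) = 0 := by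
        rw [dotProduct_mulVec, ← mulVec_transpose, mulVec_mulVec, h,
          ← mulVec_mulVec, hx, mulVec_zero, zero_dotProduct]
      have h2 := congrArg (fun w => (C *ᵥ x) ⬝ᵥ w) hv
      simp only [dotProduct_add, h1, zero_add, dotProduct_smul, dotProduct_zero, smul_eq_mul,
        mul_eq_zero] at h2
      have h3 : y ⬝ᵥ (C *ᵥ v) = 0 := h2.resolve_right (by rwa [dotProduct_comm])
      refine ⟨h3, ?_⟩
      simpa [h3] using hv
    have hlt : finrank ℂ (LinearMap.ker (A + Y * C).mulVecLin) < r := by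
      rw [← hr]
      refine Submodule.finrank_lt_finrank_of_lt (lt_of_le_of_ne (fun v hv => ?_) fun heq => ?_)
      · exact (hker v hv).2
      · have : x ∈ LinearMap.ker (A + Y * C).mulVecLin := by rw [heq]; exact hx
        exact hy (hker x this).1
    obtain ⟨Z, hZ, hd⟩ := ih _ hlt (A + Y * C) (by
        rw [transpose_add, add_mul, mul_add, h, transpose_mul, hYt, mul_assoc])
      (fun v hv hcv => hinj v (hker v hv).2 hcv) rfl
    refine ⟨Z + Y, by rw [transpose_add, hZ, hYt], ?_⟩
    rwa [add_mul, add_comm (Z * C), ← add_assoc]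
  · exact ⟨0, by simp, by simpa using hA⟩

lemma exists_nUp_mul_det_ne_zero (g : SpGL n) :
    ∃ S, (blk (nUp S * g)).toBlocks₁₁.det ≠ 0 := by
  have hs := blk_symp g
  rw [blk_eq_blocks g, symp_blocks] at hs
  obtain ⟨Z, hZ, hd⟩ := exists_symm_det_ne_zero _ _ hs.1 (fun x h1 h2 => by
    have h3 : blk g *ᵥ (Sum.elim x 0) = 0 := by
      rw [blk_eq_blocks g, fromBlocks_mulVec]
      simp only [Sum.elim_comp_inl, Sum.elim_comp_inr, mulVec_zero, add_zero, h1, h2]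
      ext i; rcases i with i | i <;> rfl
    have h4 := congrArg (fun w => (-(stdJ n * (blk g)ᵀ * stdJ n)) *ᵥ w) h3
    simp only [mulVec_mulVec, mul_of_symp (blk_symp g), one_mulVec, mulVec_zero] at h4
    ext i; exact congrFun h4 (Sum.inl i))
  obtain ⟨S, hS⟩ := exists_nLo_of_isSymm hZ
  refine ⟨S, ?_⟩
  rw [blk_mul, blk_nUp, hS]
  nth_rewrite 1 [blk_eq_blocks g]
  rw [fromBlocks_multiply, toBlocks_fromBlocks₁₁, one_mul]
  exact hd

def spTorus (n : ℕ) : Subgroup (SpGL n) := ((dg (n := n)).range).map (spPhi n)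

lemma spPhi_mem_gen (a : GL (Fin n) ℂ) :
    spPhi n a ∈ Submonoid.closure ((spTorus n : Set (SpGL n)) ∪ rootElts (spLo n ∪ spUp n)) := by
  have ha : a ∈ Submonoid.closure
    (((dg (n := n)).range : Set (GL (Fin n) ℂ)) ∪ rootElts (glLo n ∪ glUp n)) := by
    rw [gl_generated]; trivial
  induction ha using Submonoid.closure_induction with
  | mem g hg =>
    refine Submonoid.subset_closure ?_
    rcases hg with hg | ⟨y, hy, t, rfl⟩
    · exact Or.inl ⟨g, hg, rfl⟩
    · refine Or.inr ⟨fun t => spPhi n (y t), ?_, t, rfl⟩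
      rcases hy with hy | hy
      · exact Or.inl (Or.inl ⟨y, hy, rfl⟩)
      · exact Or.inr (Or.inl ⟨y, hy, rfl⟩)
  | one => rw [map_one]; exact one_mem _
  | mul g h _ _ ihg ihh => rw [map_mul]; exact mul_mem ihg ihh

lemma rootElts_mono {G : Type*} {X Y : Set (ℂ → G)} (h : X ⊆ Y) : rootElts X ⊆ rootElts Y := by
  rintro _ ⟨x, hx, t, rfl⟩; exact ⟨x, h hx, t, rfl⟩

lemma sp_generated :
    Submonoid.closure ((spTorus n : Set (SpGL n)) ∪ rootElts (spLo n ∪ spUp n)) = ⊤ := by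
  rw [eq_top_iff]
  intro g _
  have hLo : ∀ S, nLo S ∈ Submonoid.closure ((spTorus n : Set (SpGL n)) ∪ rootElts (spLo n ∪ spUp n)) :=
    fun S => Submonoid.closure_mono
      ((rootElts_mono Set.subset_union_left).trans Set.subset_union_right) (nLo_mem S)
  have hUp : ∀ S, nUp S ∈ Submonoid.closure ((spTorus n : Set (SpGL n)) ∪ rootElts (spLo n ∪ spUp n)) :=
    fun S => Submonoid.closure_mono
      ((rootElts_mono Set.subset_union_right).trans Set.subset_union_right) (nUp_mem S)
  obtain ⟨S, hS⟩ := exists_nUp_mul_det_ne_zero g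
  obtain ⟨S₁, a, S₂, -, h⟩ := sp_block_cell _ hS
  have : g = nUp (-S) * (nLo S₁ * spPhi n a * nUp S₂) := by
    rw [← h, ← mul_assoc, ← nUp_add]; simp [nUp_zero]
  rw [this]
  exact mul_mem (hUp _) (mul_mem (mul_mem (hLo _) (spPhi_mem_gen a)) (hUp _))

lemma sp_path_polyFn {P : ℕ → SpGL n} (hP : PathIn (spTorus n) (spLo n ∪ spUp n) P)
    (i j : Fin n ⊕ Fin n) : PolyFn fun m => blk (P m) i j := by
  induction hP generalizing i j with
  | const ht => exact PolyFn.const _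
  | @root x hx a t =>
    have hpow : ∀ c : ℂ, PolyFn fun m : ℕ => c * ((m : ℂ) ^ a * t) := fun c =>
      (PolyFn.const c).mul ((PolyFn.natCast.pow a).mul (PolyFn.const t))
    have hnil : ∀ i' j' : Fin n, ∀ p q : Fin n,
        PolyFn fun m : ℕ => (single i' j' ((m : ℂ) ^ a * t) +
          (single i' j' ((m : ℂ) ^ a * t))ᵀ) p q := by
      intro i' j' p q
      simp only [Matrix.add_apply, transpose_apply, single_apply]
      refine PolyFn.add ?_ ?_ <;> split_ifs <;>
        first | exact PolyFn.const 0 | simpa using hpow 1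
    have hgl : ∀ y ∈ glLo n ∪ glUp n, PolyFn fun m : ℕ => blk (spPhi n (y ((m : ℂ) ^ a * t))) i j := by
      intro y hy
      obtain ⟨i', j', h, rfl⟩ := exists_eq_tv hy
      simp only [blk_spPhi, tv_inv_val, tv_val]
      rcases i with i | i <;> rcases j with j | j <;>
        simp only [fromBlocks_apply₁₁, fromBlocks_apply₁₂, fromBlocks_apply₂₁, fromBlocks_apply₂₂,
          Matrix.zero_apply, transpose_apply, tv_apply]
      · refine (PolyFn.const _).add ?_
        split_ifs
        · simpa using hpow 1
        · exact PolyFn.const 0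
      · exact PolyFn.const 0
      · exact PolyFn.const 0
      · refine (PolyFn.const _).add ?_
        split_ifs
        · simpa using hpow (-1)
        · exact PolyFn.const 0
    rcases hx with (⟨y, hy, rfl⟩ | ⟨i', j', rfl⟩) | (⟨y, hy, rfl⟩ | ⟨i', j', rfl⟩)
    · exact hgl y (Or.inl hy)
    · simp only [blk_nLo]
      rcases i with i | i <;> rcases j with j | j <;>
        first | exact PolyFn.const _ | exact hnil i' j' i j
    · exact hgl y (Or.inr hy)
    · simp only [blk_nUp]
      rcases i with i | i <;> rcases j with j | j <;>
        first | exact PolyFn.const _ | exact hnil i' j' i j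
  | mul hP hQ ihP ihQ =>
    simp only [blk_mul, Matrix.mul_apply]
    exact PolyFn.sum _ fun k _ => (ihP i k).mul (ihQ k j)

lemma dg_inv_val (d : Fin n → ℂˣ) : (((dg d)⁻¹ : GL (Fin n) ℂ) : Mt n) =
    diagonal fun i => ((d i)⁻¹ : ℂ) := by
  rw [← map_inv, dg_val]; simp

lemma diagonal_mul_single_add {d e : Fin n → ℂ} (h : ∀ i, d i * e i = 1) (i j : Fin n) (t : ℂ) :
    diagonal d * (single i j t + (single i j t)ᵀ) =
      (single i j (d i * d j * t) + (single i j (d i * d j * t))ᵀ) * diagonal e := by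
  ext a b
  simp only [diagonal_mul, mul_diagonal, Matrix.add_apply, transpose_apply, single_apply]
  split_ifs with h1 h2 h2
  · obtain ⟨rfl, rfl⟩ := h1
    obtain ⟨rfl, -⟩ := h2
    linear_combination (-2 * d i * t) * h i
  · obtain ⟨rfl, rfl⟩ := h1
    linear_combination (-d i * t) * h j
  · obtain ⟨rfl, rfl⟩ := h2
    linear_combination (-d j * t) * h i
  · simp

lemma spPhi_conj_nLo (d : Fin n → ℂˣ) (i j : Fin n) (t : ℂ) :
    spPhi n (dg d) * nLo (single i j t) * (spPhi n (dg d))⁻¹ =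
      nLo (single i j ((d i : ℂ)⁻¹ * (d j : ℂ)⁻¹ * t)) := by
  rw [mul_inv_eq_iff_eq_mul]
  refine blk_injective ?_
  simp only [blk_mul, blk_nLo, blk_spPhi, dg_inv_val, dg_val, fromBlocks_multiply, mul_zero,
    zero_mul, add_zero, zero_add, mul_one, one_mul, diagonal_transpose,
    diagonal_mul_single_add fun i => inv_mul_cancel₀ (d i).ne_zero]

lemma spPhi_conj_nUp (d : Fin n → ℂˣ) (i j : Fin n) (t : ℂ) :
    spPhi n (dg d) * nUp (single i j t) * (spPhi n (dg d))⁻¹ =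
      nUp (single i j ((d i : ℂ) * (d j : ℂ) * t)) := by
  rw [mul_inv_eq_iff_eq_mul]
  refine blk_injective ?_
  simp only [blk_mul, blk_nUp, blk_spPhi, dg_inv_val, dg_val, fromBlocks_multiply, mul_zero,
    zero_mul, add_zero, zero_add, mul_one, one_mul, diagonal_transpose,
    diagonal_mul_single_add fun i => mul_inv_cancel₀ (d i).ne_zero]

lemma minor_self (g : Mt n) : minor n g = g.det := by
  rw [minor]; congr 1; ext i j; simp [trunc_apply]

/-- The big cell of `Sp (2n)`. -/
def spCell (n : ℕ) : CellData (SpGL n) where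
  T := spTorus n
  c m := spPhi n (glScale n m)
  Lo := spLo n
  Up := spUp n
  δ g := glDelta (blk g).toBlocks₁₁
  comm := by
    rintro _ ⟨a, ha, rfl⟩ _ ⟨b, hb, rfl⟩
    rw [← map_mul, (glCell n).comm a ha b hb, map_mul]
  hc m := ⟨_, ⟨_, rfl⟩, rfl⟩
  add := by
    rintro x ((⟨y, hy, rfl⟩ | ⟨i, j, rfl⟩) | (⟨y, hy, rfl⟩ | ⟨i, j, rfl⟩)) s t
    · simp only [← map_mul, (glCell n).add y (Or.inl hy) s t]
    · simp only [← nLo_add, single_add]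
    · simp only [← map_mul, (glCell n).add y (Or.inr hy) s t]
    · simp only [← nUp_add, single_add]
  lo_conj := by
    rintro _ (⟨y, hy, rfl⟩ | ⟨i, j, rfl⟩)
    · obtain ⟨a, ha, h⟩ := (glCell n).lo_conj y hy
      refine ⟨a, ha, fun m hm t => ?_⟩
      simp only [← map_mul, ← map_inv]
      rw [← h m hm t]; rfl
    · refine ⟨(n - i) + (n - j), by have := i.2; omega, fun m hm t => ?_⟩
      simp only [glScale]
      rw [spPhi_conj_nLo]
      congr 2
      push_cast
      rw [scaleUnit_val hm, inv_pow, inv_pow, inv_inv, inv_inv, pow_add]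
  up_conj := by
    rintro _ (⟨y, hy, rfl⟩ | ⟨i, j, rfl⟩)
    · obtain ⟨a, ha, h⟩ := (glCell n).up_conj y hy
      refine ⟨a, ha, fun m hm t => ?_⟩
      simp only [← map_mul, ← map_inv]
      rw [← h m hm t]; rfl
    · refine ⟨(n - i) + (n - j), by have := i.2; omega, fun m hm t => ?_⟩
      have hinv : (glScale n m)⁻¹ = dg fun i => (scaleUnit m) ^ (n - (i : ℕ)) := by
        rw [glScale, ← map_inv]; congr 1
      have h := spPhi_conj_nUp (fun i => (scaleUnit m) ^ (n - (i : ℕ))) i j t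
      rw [← hinv, map_inv, inv_inv] at h
      simp only [h]
      congr 2
      push_cast
      rw [scaleUnit_val hm, pow_add]
  gen := sp_generated
  δ_poly P hP := glDelta_polyFn fun i j => sp_path_polyFn hP (Sum.inl i) (Sum.inl j)
  δ_T := by
    rintro _ ⟨t, ht, rfl⟩
    rw [blk_spPhi, toBlocks_fromBlocks₁₁]
    exact (glCell n).δ_T t ht
  cell g hg := by
    have hd : (blk g).toBlocks₁₁.det ≠ 0 := by
      rw [glDelta, Finset.prod_ne_zero_iff] at hg
      rw [← minor_self]
      exact hg n (Finset.mem_range.2 (by omega))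
    obtain ⟨S, a, S', ha, rfl⟩ := sp_block_cell g hd
    rw [← ha] at hg
    obtain ⟨l, hl, t, ht, u, hu, rfl⟩ := gl_cell hg
    refine ⟨nLo S * spPhi n l, mul_mem (nLo_mem S) (spPhi_lo_mem hl), spPhi n t, ⟨t, ht, rfl⟩,
      spPhi n u * nUp S', mul_mem (spPhi_up_mem hu) (nUp_mem S'), ?_⟩
    simp only [map_mul, mul_assoc]

end SpCell

/-! ### Alternants and the Pieri rule -/

section Alternants

open MvPolynomial Finset

variable {k : ℕ}

/-- Sign-reversing involutions kill sums. -/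
lemma sum_eq_zero_of_toggle {α I M : Type*} [AddCommGroup M] [IsAddTorsionFree M] (S : Finset α)
    (f : α → M) (Idx : α → I → Prop) (t : I → α → α)
    (hex : ∀ a ∈ S, ∃ i, Idx a i) (huniq : ∀ a ∈ S, ∀ i j, Idx a i → Idx a j → i = j)
    (ht : ∀ a ∈ S, ∀ i, Idx a i → t i a ∈ S ∧ Idx (t i a) i ∧ t i (t i a) = a ∧
      f a + f (t i a) = 0) : ∑ a ∈ S, f a = 0 := by
  classical
  rcases S.eq_empty_or_nonempty with rfl | ⟨a₀, ha₀⟩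
  · simp
  have : Nonempty I := ⟨(hex a₀ ha₀).choose⟩
  choose! idx hidx using hex
  refine sum_involution (fun a _ => t (idx a) a) (fun a ha => (ht a ha _ (hidx a ha)).2.2.2)
    (fun a ha h0 heq => ?_) (fun a ha => (ht a ha _ (hidx a ha)).1) (fun a ha => ?_)
  · have h := (ht a ha _ (hidx a ha)).2.2.2
    rw [heq, ← two_nsmul] at h
    exact h0 (nsmul_right_injective two_ne_zero (by simpa using h))
  · obtain ⟨h1, h2, h3, -⟩ := ht a ha _ (hidx a ha)
    rw [huniq _ h1 _ _ (hidx _ h1) h2]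
    exact h3

abbrev Pol (k : ℕ) := MvPolynomial (Fin k) ℤ

/-- The monomial with exponent `b`. -/
def mono (k : ℕ) (b : ℕ → ℕ) : Pol k := ∏ i : Fin k, X i ^ b i

/-- Alternants. -/
def alt (k : ℕ) (b : ℕ → ℕ) : Pol k := (of fun i j : Fin k => (X j ^ b i : Pol k)).det

def hom (k m : ℕ) : Pol k := ∑ e ∈ piAntidiag (range k) m, mono k e

def rho (k i : ℕ) : ℕ := k - 1 - i

/-- Action of a permutation on functions supported below `k`. -/
def permFun (w : Equiv.Perm (Fin k)) (e : ℕ → ℕ) : ℕ → ℕ :=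
  fun i => if h : i < k then e (w ⟨i, h⟩) else 0

lemma permFun_fin (w : Equiv.Perm (Fin k)) (e : ℕ → ℕ) (i : Fin k) :
    permFun w e i = e (w i) := by simp [permFun]

lemma permFun_of_le (w : Equiv.Perm (Fin k)) (e : ℕ → ℕ) {i : ℕ} (h : k ≤ i) :
    permFun w e i = 0 := dif_neg (by omega)

lemma permFun_mul (w v : Equiv.Perm (Fin k)) (e : ℕ → ℕ) :
    permFun w (permFun v e) = permFun (v * w) e := by
  ext i
  by_cases h : i < k
  · have := permFun_fin w (permFun v e) ⟨i, h⟩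
    have h2 := permFun_fin (v * w) e ⟨i, h⟩
    simp only at this h2
    rw [this, h2, permFun_fin]; rfl
  · rw [permFun_of_le _ _ (by omega), permFun_of_le _ _ (by omega)]

lemma permFun_one {e : ℕ → ℕ} (he : ∀ i, k ≤ i → e i = 0) :
    permFun (1 : Equiv.Perm (Fin k)) e = e := by
  ext i
  by_cases h : i < k
  · exact permFun_fin 1 e ⟨i, h⟩
  · rw [permFun_of_le _ _ (by omega), he i (by omega)]

lemma mem_anti {m : ℕ} {e : ℕ → ℕ} : e ∈ piAntidiag (range k) m ↔
    ∑ i : Fin k, e i = m ∧ ∀ i, k ≤ i → e i = 0 := by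
  rw [mem_piAntidiag, sum_range]
  refine and_congr Iff.rfl (forall_congr' fun i => ?_)
  rw [mem_range, ← not_imp_not, not_lt, not_not]

lemma permFun_mem {m : ℕ} (w : Equiv.Perm (Fin k)) {e : ℕ → ℕ}
    (he : e ∈ piAntidiag (range k) m) : permFun w e ∈ piAntidiag (range k) m := by
  rw [mem_anti] at *
  refine ⟨?_, fun i hi => permFun_of_le _ _ hi⟩
  simp only [permFun_fin]
  rw [← he.1]
  exact Equiv.sum_comp w fun i : Fin k => e i

lemma sum_anti_perm {M : Type*} [AddCommMonoid M] {m : ℕ} (w : Equiv.Perm (Fin k))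
    (f : (ℕ → ℕ) → M) : ∑ e ∈ piAntidiag (range k) m, f (permFun w e) =
      ∑ e ∈ piAntidiag (range k) m, f e := by
  refine sum_bij' (fun e _ => permFun w e) (fun e _ => permFun w⁻¹ e)
    (fun e he => permFun_mem w he) (fun e he => permFun_mem w⁻¹ he) ?_ ?_ (fun _ _ => rfl)
  · intro e he
    rw [permFun_mul, mul_inv_cancel, permFun_one (mem_anti.1 he).2]
  · intro e he
    rw [permFun_mul, inv_mul_cancel, permFun_one (mem_anti.1 he).2]

lemma alt_eq_sum (b : ℕ → ℕ) : alt k b =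
    ∑ w : Equiv.Perm (Fin k), (Equiv.Perm.sign w : ℤ) • mono k (permFun w b) := by
  rw [alt, det_apply]
  refine sum_congr rfl fun w _ => ?_
  rw [mono]
  simp only [permFun_fin, of_apply]
  rfl

lemma alt_congr {b b' : ℕ → ℕ} (h : ∀ i < k, b i = b' i) : alt k b = alt k b' := by
  rw [alt, alt]
  refine congrArg det (Matrix.ext fun i j => ?_)
  simp only [of_apply, h i i.2]

lemma alt_perm (w : Equiv.Perm (Fin k)) (b : ℕ → ℕ) :
    alt k (permFun w b) = (Equiv.Perm.sign w : ℤ) • alt k b := by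
  have := det_permute w (of fun i j : Fin k => (X j ^ b i : Pol k))
  rw [zsmul_eq_mul]
  refine Eq.trans ?_ this
  rw [alt]
  refine congrArg det (Matrix.ext fun i j => ?_)
  simp [permFun_fin]

lemma mono_add (b e : ℕ → ℕ) : mono k (b + e) = mono k b * mono k e := by
  simp [mono, pow_add, prod_mul_distrib]

lemma permFun_add (w : Equiv.Perm (Fin k)) (b e : ℕ → ℕ) :
    permFun w (b + e) = permFun w b + permFun w e := by
  ext i; by_cases h : i < k <;> simp [permFun, h]

lemma alt_mul_hom (b : ℕ → ℕ) (m : ℕ) : alt k b * hom k m =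
    ∑ e ∈ piAntidiag (range k) m, alt k (b + e) := by
  simp only [alt_eq_sum, hom, sum_mul, permFun_add, mono_add]
  rw [sum_comm]
  refine sum_congr rfl fun w _ => ?_
  rw [← smul_sum, ← mul_sum, smul_mul_assoc, sum_anti_perm w (mono k)]

lemma alt_swap (b b' : ℕ → ℕ) {i : ℕ} (hi : i + 1 < k) (h1 : b' i = b (i + 1))
    (h2 : b' (i + 1) = b i) (h3 : ∀ j, j ≠ i → j ≠ i + 1 → b' j = b j) :
    alt k b + alt k b' = 0 := by
  set p : Fin k := ⟨i, by omega⟩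
  set q : Fin k := ⟨i + 1, hi⟩
  have hpq : p ≠ q := by simp [p, q]
  have : alt k b' = alt k (permFun (Equiv.swap p q) b) := by
    refine alt_congr fun j hj => ?_
    have := permFun_fin (Equiv.swap p q) b ⟨j, hj⟩
    simp only at this
    rw [this]
    by_cases hjp : j = i
    · subst hjp; rw [h1, show (⟨j, hj⟩ : Fin k) = p from rfl, Equiv.swap_apply_left]
    · by_cases hjq : j = i + 1
      · subst hjq; rw [h2, show (⟨i + 1, hj⟩ : Fin k) = q from rfl, Equiv.swap_apply_right]
      · rw [h3 j hjp hjq, Equiv.swap_apply_of_ne_of_ne]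
        · exact fun h => hjp (congrArg Fin.val h)
        · exact fun h => hjq (congrArg Fin.val h)
  rw [this, alt_perm, Equiv.Perm.sign_swap hpq]
  simp

/-- `l / g` is a horizontal strip. -/
def HStrip (g l : ℕ → ℕ) : Prop := (∀ i, g i ≤ l i) ∧ ∀ i, l (i + 1) ≤ g i

/-- Horizontal strips of size `m`, as a finite set of outer shapes. -/
def strips (k : ℕ) (g : ℕ → ℕ) (m : ℕ) : Finset (ℕ → ℕ) := by
  classical exact ((piAntidiag (range k) m).filter fun e => HStrip g (g + e)).image (g + ·)

lemma mem_strips {g l : ℕ → ℕ} {m : ℕ} : l ∈ strips k g m ↔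
    HStrip g l ∧ ∑ i : Fin k, l i = ∑ i : Fin k, g i + m ∧ ∀ i, k ≤ i → l i = g i := by
  classical
  rw [strips]
  simp only [mem_image, mem_filter, mem_anti]
  constructor
  · rintro ⟨e, ⟨⟨h1, h2⟩, h3⟩, rfl⟩
    refine ⟨h3, by simp [sum_add_distrib, h1], fun i hi => by simp [h2 i hi]⟩
  · rintro ⟨h1, h2, h3⟩
    have hl : g + (l - g) = l := by ext i; have := h1.1 i; simp; omega
    refine ⟨l - g, ⟨⟨?_, fun i hi => by simp [h3 i hi]⟩, by rwa [hl]⟩, hl⟩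
    have : ∑ i : Fin k, (g i + (l - g) i) = ∑ i : Fin k, l i :=
      sum_congr rfl fun i _ => congrFun hl i
    rw [sum_add_distrib, h2] at this
    omega

lemma sum_swap_two (f f' : ℕ → ℕ) {i : ℕ} (hi : i + 1 < k) (h : f' i + f' (i + 1) = f i + f (i + 1))
    (h3 : ∀ j, j ≠ i → j ≠ i + 1 → f' j = f j) : ∑ j : Fin k, f' j = ∑ j : Fin k, f j := by
  rw [← sum_range, ← sum_range]
  have h1 : i ∈ range k := mem_range.2 (by omega)
  have h2 : i + 1 ∈ (range k).erase i := mem_erase.2 ⟨by omega, mem_range.2 hi⟩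
  rw [← add_sum_erase _ f' h1, ← add_sum_erase _ f h1, ← add_sum_erase _ f' h2,
    ← add_sum_erase _ f h2, ← add_assoc, ← add_assoc, h]
  congr 1
  refine sum_congr rfl fun j hj => ?_
  simp only [mem_erase] at hj
  exact h3 j hj.2.1 hj.1

/-- The Pieri rule for alternants. -/
theorem pieri {g : ℕ → ℕ} (hg : Antitone g) (hk : ∀ i, k ≤ i → g i = 0) (m : ℕ) :
    alt k (g + rho k) * hom k m = ∑ l ∈ strips k g m, alt k (l + rho k) := by
  classical
  rw [alt_mul_hom, strips, sum_image (fun a _ b _ h => add_left_cancel h)]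
  rw [← sum_filter_add_sum_filter_not _ (fun e => HStrip g (g + e))]
  have hcomm : ∀ e : ℕ → ℕ, g + rho k + e = g + e + rho k := fun e => by abel
  simp only [hcomm]
  rw [add_eq_left]
  let V : (ℕ → ℕ) → ℕ → Prop := fun e i => i + 1 < k ∧ g i < g (i + 1) + e (i + 1)
  let t : ℕ → (ℕ → ℕ) → ℕ → ℕ := fun i e j =>
    if j = i then g (i + 1) + e (i + 1) - g i - 1 else
      if j = i + 1 then g i + e i + 1 - g (i + 1) else e j
  refine sum_eq_zero_of_toggle _ _ (fun e i => V e i ∧ ∀ i', i < i' → ¬ V e i') t ?_ ?_ ?_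
  · intro e he
    simp only [mem_filter, mem_anti, HStrip, not_and_or, not_forall] at he
    obtain ⟨⟨-, h2⟩, h3⟩ := he
    rcases h3 with ⟨i, hi⟩ | ⟨i, hi⟩
    · simp at hi
    · have hV : V e i := by
        simp only [Pi.add_apply, not_le] at hi
        refine ⟨?_, hi⟩
        by_contra hcon
        rw [hk (i + 1) (by omega), h2 (i + 1) (by omega)] at hi
        omega
      have hb : ∀ i, V e i → i ≤ k := fun i hi => by have := hi.1; omega
      exact ⟨Nat.findGreatest (V e) k, Nat.findGreatest_spec (hb i hV) hV,
        fun i' h1 h2 => Nat.findGreatest_is_greatest h1 (hb i' h2) h2⟩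
  · rintro e _ i j ⟨h1, h2⟩ ⟨h3, h4⟩
    by_contra hne
    rcases lt_or_gt_of_ne hne with h | h
    · exact h2 j h h3
    · exact h4 i h h1
  · rintro e he i ⟨⟨hik, h1⟩, h2⟩
    have hgi : g (i + 1) ≤ g i := hg (Nat.le_succ i)
    have t1 : t i e i = g (i + 1) + e (i + 1) - g i - 1 := if_pos rfl
    have t2 : t i e (i + 1) = g i + e i + 1 - g (i + 1) := by simp [t]
    have t3 : ∀ j, j ≠ i → j ≠ i + 1 → t i e j = e j := fun j h h' => by simp [t, h, h']
    have hV : V (t i e) i := ⟨hik, by rw [t2]; omega⟩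
    simp only [mem_filter, mem_anti] at he
    refine ⟨?_, ⟨hV, fun i' hi' h => h2 i' hi' ?_⟩, ?_, ?_⟩
    · simp only [mem_filter, mem_anti]
      refine ⟨⟨?_, fun j hj => ?_⟩, fun h => ?_⟩
      · rw [← he.1.1]
        exact sum_swap_two _ _ hik (by rw [t1, t2]; omega) t3
      · rw [t3 j (by omega) (by omega)]; exact he.1.2 j hj
      · have := h.2 i
        have := hV.2
        simp only [Pi.add_apply] at *
        omega
    · refine ⟨h.1, ?_⟩
      have := h.2
      rwa [t3 (i' + 1) (by omega) (by omega)] at this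
    · ext j
      by_cases hj : j = i
      · subst hj
        have : t j (t j e) j = g (j + 1) + t j e (j + 1) - g j - 1 := if_pos rfl
        rw [this, t2]; omega
      · by_cases hj' : j = i + 1
        · subst hj'
          have : t i (t i e) (i + 1) = g i + t i e i + 1 - g (i + 1) := by simp [t]
          rw [this, t1]; omega
        · have : t i (t i e) j = t i e j := by simp [t, hj, hj']
          rw [this, t3 j hj hj']
    · refine alt_swap _ _ hik ?_ ?_ ?_
      · simp only [Pi.add_apply, t1, rho]; omega
      · simp only [Pi.add_apply, t2, rho]; omega
      · intro j h h'; simp only [Pi.add_apply, t3 j h h']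

end Alternants

/-! ### Chains of horizontal strips -/

section Chains

open MvPolynomial Finset

variable {k : ℕ}

def sz (k : ℕ) (g : ℕ → ℕ) : ℕ := ∑ i : Fin k, g i

/-- Partitions with at most `k` parts. -/
def PT (k : ℕ) (g : ℕ → ℕ) : Prop := Antitone g ∧ ∀ i, k ≤ i → g i = 0

lemma HStrip.antitone {g l : ℕ → ℕ} (h : HStrip g l) : Antitone l :=
  antitone_nat_of_succ_le fun i => (h.2 i).trans (h.1 i)

/-- Chains of `q` horizontal strips of prescribed sizes. -/
def chs (k : ℕ) (g : ℕ → ℕ) (b : ℕ → ℕ) : ℕ → Finset (ℕ → ℕ → ℕ)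
  | 0 => {fun _ => g}
  | q + 1 => by
    classical
    exact ((chs k g b q).sigma fun L => strips k (L q) (b q)).image
      fun x s => if s ≤ q then x.1 s else x.2

lemma mem_chs {g b : ℕ → ℕ} {q : ℕ} {L : ℕ → ℕ → ℕ} : L ∈ chs k g b q ↔
    L 0 = g ∧ (∀ s < q, L (s + 1) ∈ strips k (L s) (b s)) ∧ ∀ s, q ≤ s → L s = L q := by
  classical
  induction q generalizing L with
  | zero =>
    simp only [chs, mem_singleton]
    constructor
    · rintro rfl; simp
    · rintro ⟨h1, -, h3⟩; ext1 s; rw [h3 s (Nat.zero_le _), h1]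
  | succ q ih =>
    simp only [chs, mem_image, mem_sigma]
    constructor
    · rintro ⟨⟨L, l⟩, ⟨h1, h2⟩, rfl⟩
      obtain ⟨h3, h4, h5⟩ := ih.1 h1
      refine ⟨by simpa using h3, fun s hs => ?_, fun s hs => ?_⟩
      · by_cases hsq : s = q
        · subst hsq; simpa using h2
        · simp only [show s ≤ q by omega, show s + 1 ≤ q by omega, if_true]
          exact h4 s (by omega)
      · simp [show ¬ s ≤ q by omega]
    · rintro ⟨h1, h2, h3⟩
      refine ⟨⟨fun s => if s ≤ q then L s else L q, L (q + 1)⟩, ⟨ih.2 ⟨by simpa using h1,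
        fun s hs => ?_, fun s hs => ?_⟩, by simpa using h2 q (Nat.lt_succ_self q)⟩, ?_⟩
      · simp only [show s ≤ q by omega, show s + 1 ≤ q by omega, if_true]
        exact h2 s (by omega)
      · by_cases h : s ≤ q
        · simp [show s = q by omega]
        · simp [h]
      · ext1 s
        by_cases h : s ≤ q
        · simp [h]
        · simp only [h, if_false]; exact (h3 s (by omega)).symm

lemma strips_PT {g l : ℕ → ℕ} {m : ℕ} (hg : PT k g) (hl : l ∈ strips k g m) : PT k l := by
  rw [mem_strips] at hl
  exact ⟨hl.1.antitone, fun i hi => by rw [hl.2.2 i hi, hg.2 i hi]⟩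

lemma chs_PT {g b : ℕ → ℕ} {q : ℕ} {L : ℕ → ℕ → ℕ} (hg : PT k g) (hL : L ∈ chs k g b q) :
    ∀ s ≤ q, PT k (L s) := by
  rw [mem_chs] at hL
  intro s
  induction s with
  | zero => intro _; rwa [hL.1]
  | succ s ih => intro hs; exact strips_PT (ih (by omega)) (hL.2.1 s (by omega))

lemma alt_mul_prod_hom {g : ℕ → ℕ} (hg : PT k g) (b : ℕ → ℕ) (q : ℕ) :
    alt k (g + rho k) * ∏ j ∈ range q, hom k (b j) =
      ∑ L ∈ chs k g b q, alt k (L q + rho k) := by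
  classical
  induction q with
  | zero => simp [chs]
  | succ q ih =>
    rw [prod_range_succ, ← mul_assoc, ih, chs, sum_image, sum_sigma,
      sum_mul]
    · refine sum_congr rfl fun L hL => ?_
      have := chs_PT hg hL q le_rfl
      rw [pieri this.1 this.2]
      refine sum_congr rfl fun l _ => ?_
      simp
    · rintro ⟨L, l⟩ hx ⟨L', l'⟩ hy h
      simp only [coe_sigma, Set.mem_sigma_iff, mem_coe] at hx hy
      have h1 : L = L' := by
        ext1 s
        by_cases hs : s ≤ q
        · simpa [hs] using congrFun h s
        · rw [(mem_chs.1 hx.1).2.2 s (by omega), (mem_chs.1 hy.1).2.2 s (by omega)]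
          simpa using congrFun h q
      subst h1
      have h2 : l = l' := by simpa using congrFun h (q + 1)
      rw [h2]

def cont (k : ℕ) (L : ℕ → ℕ → ℕ) (s : ℕ) : ℕ := if s < k then sz k (L (s + 1)) - sz k (L s) else 0

lemma cont_of_mem {g b : ℕ → ℕ} {L : ℕ → ℕ → ℕ} (hL : L ∈ chs k g b k)
    (hb : ∀ i, k ≤ i → b i = 0) : cont k L = b := by
  ext s
  by_cases hs : s < k
  · have := (mem_strips.1 ((mem_chs.1 hL).2.1 s hs)).2.1
    simp only [cont, hs, if_true, sz, this]; omega
  · simp [cont, hs, hb s (by omega)]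

/-- Chains of `k` horizontal strips of total size `m`. -/
def chains (k : ℕ) (g : ℕ → ℕ) (m : ℕ) : Finset (ℕ → ℕ → ℕ) := by
  classical
  exact ((piAntidiag (range k) m).sigma fun c => chs k g c k).image fun x => x.2

lemma sz_chain {L : ℕ → ℕ → ℕ} (h : ∀ s < k, ∀ i, L s i ≤ L (s + 1) i) (q : ℕ) (hq : q ≤ k) :
    sz k (L q) = sz k (L 0) + ∑ s ∈ range q, cont k L s := by
  induction q with
  | zero => simp
  | succ q ih =>
    have : sz k (L q) ≤ sz k (L (q + 1)) := sum_le_sum fun i _ => h q (by omega) i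
    rw [sum_range_succ, ← add_assoc, ← ih (by omega), cont, if_pos (by omega)]
    omega

lemma mem_chains {g : ℕ → ℕ} {m : ℕ} {L : ℕ → ℕ → ℕ} : L ∈ chains k g m ↔
    L 0 = g ∧ (∀ s < k, HStrip (L s) (L (s + 1)) ∧ ∀ i, k ≤ i → L (s + 1) i = L s i) ∧
      (∀ s, k ≤ s → L s = L k) ∧ sz k (L k) = sz k g + m := by
  classical
  simp only [chains, mem_image, mem_sigma]
  constructor
  · rintro ⟨⟨c, L⟩, ⟨hc, hL⟩, rfl⟩
    simp only at hc hL ⊢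
    have h := mem_chs.1 hL
    have h2 : ∀ s < k, _ := fun s hs => mem_strips.1 (h.2.1 s hs)
    refine ⟨h.1, fun s hs => ⟨(h2 s hs).1, (h2 s hs).2.2⟩, h.2.2, ?_⟩
    rw [sz_chain (fun s hs => (h2 s hs).1.1) k le_rfl, h.1, cont_of_mem hL (mem_anti.1 hc).2,
      ← (mem_anti.1 hc).1, sum_range]
  · rintro ⟨h1, h2, h3, h4⟩
    have h5 := sz_chain (fun s hs => (h2 s hs).1.1) k le_rfl
    refine ⟨⟨cont k L, L⟩, ⟨mem_anti.2 ⟨?_, fun i hi => by simp [cont, not_lt.2 hi]⟩,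
      mem_chs.2 ⟨h1, fun s hs => mem_strips.2 ⟨(h2 s hs).1, ?_, (h2 s hs).2⟩, h3⟩⟩, rfl⟩
    · rw [← sum_range]; rw [h1] at h5; simp only; omega
    · have : sz k (L s) ≤ sz k (L (s + 1)) := sum_le_sum fun i _ => (h2 s hs).1.1 i
      simp only [cont, hs, if_true]
      simp only [sz] at *; omega

lemma sum_chains {M : Type*} [AddCommMonoid M] (g : ℕ → ℕ) (m : ℕ)
    (f : (ℕ → ℕ) → (ℕ → ℕ → ℕ) → M) :
    ∑ c ∈ piAntidiag (range k) m, ∑ L ∈ chs k g c k, f c L =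
      ∑ L ∈ chains k g m, f (cont k L) L := by
  classical
  rw [chains, sum_image, sum_sigma]
  · refine sum_congr rfl fun c hc => sum_congr rfl fun L hL => ?_
    rw [cont_of_mem hL (mem_anti.1 hc).2]
  · rintro ⟨c, L⟩ hx ⟨c', L'⟩ hy h
    simp only [coe_sigma, Set.mem_sigma_iff, mem_coe] at hx hy h
    subst h
    have : c = c' := (cont_of_mem hx.2 (mem_anti.1 hx.1).2).symm.trans
      (cont_of_mem hy.2 (mem_anti.1 hy.1).2)
    rw [this]

lemma chains_PT {g : ℕ → ℕ} {m : ℕ} {L : ℕ → ℕ → ℕ} (hg : PT k g) (hL : L ∈ chains k g m) :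
    ∀ s, PT k (L s) := by
  obtain ⟨h1, h2, h3, -⟩ := mem_chains.1 hL
  have h : ∀ s ≤ k, PT k (L s) := by
    intro s
    induction s with
    | zero => intro _; rwa [h1]
    | succ s ih =>
      intro hs
      exact ⟨(h2 s hs).1.antitone, fun i hi => by
        rw [(h2 s hs).2 i hi, (ih (by omega)).2 i hi]⟩
  intro s
  rcases le_total s k with hs | hs
  · exact h s hs
  · rw [h3 s hs]; exact h k le_rfl

/-- The sign attached to `c` relative to `ν`. -/
def eps (k : ℕ) (nu c : ℕ → ℕ) : ℤ :=
  (of fun i j : Fin k => if nu i + rho k i = c j + rho k j then (1 : ℤ) else 0).det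

lemma eps_swap (nu : ℕ → ℕ) {c c' : ℕ → ℕ} {r : ℕ} (hr : r + 1 < k)
    (h1 : c' r + 1 = c (r + 1)) (h2 : c' (r + 1) = c r + 1)
    (h3 : ∀ j, j ≠ r → j ≠ r + 1 → c' j = c j) : eps k nu c + eps k nu c' = 0 := by
  set p : Fin k := ⟨r, by omega⟩
  set q : Fin k := ⟨r + 1, hr⟩
  have hpq : p ≠ q := by simp [p, q]
  have := det_permute' (Equiv.swap p q)
    (of fun i j : Fin k => if nu i + rho k i = c j + rho k j then (1 : ℤ) else 0)
  rw [Equiv.Perm.sign_swap hpq] at this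
  have h : eps k nu c' = -eps k nu c := by
    simp only [eps]
    push_cast at this
    rw [neg_one_mul] at this
    rw [← this]
    refine congrArg det (Matrix.ext fun i j => ?_)
    simp only [of_apply, submatrix_apply, id]
    have : c' j + rho k j = c (Equiv.swap p q j) + rho k (Equiv.swap p q j) := by
      by_cases hjp : j = p
      · subst hjp; rw [Equiv.swap_apply_left]; simp only [p, q, rho]; omega
      · by_cases hjq : j = q
        · subst hjq; rw [Equiv.swap_apply_right]; simp only [p, q, rho]; omega
        · rw [Equiv.swap_apply_of_ne_of_ne hjp hjq, h3 j (fun h => hjp (Fin.ext h))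
            (fun h => hjq (Fin.ext h))]
    rw [this]
  rw [h]; ring

lemma perm_eq_one_of_strictAnti {x y : Fin k → ℕ} (hx : StrictAnti x) (hy : StrictAnti y)
    (w : Equiv.Perm (Fin k)) (h : ∀ i, x (w i) = y i) : w = 1 := by
  have hm : StrictMono w := by
    intro i j hij
    have := hy hij
    rw [← h i, ← h j] at this
    exact hx.lt_iff_gt.1 this
  have := Subsingleton.elim (hm.orderIsoOfSurjective w w.surjective) (OrderIso.refl _)
  ext i
  have := DFunLike.congr_fun this i
  simpa using congrArg Fin.val this

lemma strictAnti_add_rho {g : ℕ → ℕ} (hg : Antitone g) :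
    StrictAnti fun i : Fin k => g i + rho k i := by
  intro i j hij
  have h1 := hg hij.le
  have h2 : (i : ℕ) < j := hij
  simp only [rho]
  have := j.2
  have : g j ≤ g i := h1
  omega

open scoped Classical in
lemma eps_antitone {nu c : ℕ → ℕ} (hnu : PT k nu) (hc : PT k c) :
    eps k nu c = if c = nu then 1 else 0 := by
  split_ifs with h
  · subst h
    rw [eps]
    convert Matrix.det_one (n := Fin k) (R := ℤ)
    ext i j
    simp only [of_apply, Matrix.one_apply]
    congr 1
    exact propext (strictAnti_add_rho (k := k) hc.1).injective.eq_iff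
  · rw [eps, det_apply]
    refine sum_eq_zero fun w _ => ?_
    by_cases hw : ∀ i : Fin k, nu (w i) + rho k (w i) = c i + rho k i
    · exfalso
      have := perm_eq_one_of_strictAnti (strictAnti_add_rho hnu.1) (strictAnti_add_rho hc.1) w hw
      subst this
      apply h
      ext i
      by_cases hi : i < k
      · have := hw ⟨i, hi⟩; simp at this; exact this.symm
      · rw [hnu.2 i (by omega), hc.2 i (by omega)]
    · push Not at hw
      obtain ⟨i, hi⟩ := hw
      rw [prod_eq_zero (mem_univ i), smul_zero]
      simp [hi]

/-- Schur polynomials via the Jacobi-Trudi expansion. -/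
def schur (k : ℕ) (nu : ℕ → ℕ) : Pol k :=
  ∑ c ∈ piAntidiag (range k) (sz k nu), eps k nu c • ∏ j ∈ range k, hom k (c j)

lemma alt_mul_schur {g : ℕ → ℕ} (hg : PT k g) (nu : ℕ → ℕ) :
    alt k (g + rho k) * schur k nu =
      ∑ L ∈ chains k g (sz k nu), eps k nu (cont k L) • alt k (L k + rho k) := by
  rw [← sum_chains g (sz k nu) fun c L => eps k nu c • alt k (L k + rho k), schur, mul_sum]
  refine sum_congr rfl fun c _ => ?_
  rw [mul_smul_comm, alt_mul_prod_hom hg, smul_sum]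

/-- Number of cells in columns beyond `j`. -/
def colTail (k : ℕ) (g : ℕ → ℕ) (j : ℕ) : ℕ := ∑ i : Fin k, (g i - j)

/-- A violation of the column lattice condition. -/
def Viol (k : ℕ) (L : ℕ → ℕ → ℕ) (r j : ℕ) : Prop :=
  r + 2 ≤ k ∧ 2 * colTail k (L (r + 1)) j < colTail k (L (r + 2)) j + colTail k (L r) j

def Good (k : ℕ) (L : ℕ → ℕ → ℕ) : Prop := ∀ r j, ¬ Viol k L r j

/-- The Bender-Knuth involution on the middle shape, in columns before `j`. -/
def tog (j : ℕ) (a b c : ℕ → ℕ) : ℕ → ℕ := fun i =>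
  if j < b i then b i else
    min (min (c i) j) (if i = 0 then j else a (i - 1)) + max (c (i + 1)) (a i) - b i

section Tog

variable {a b c : ℕ → ℕ} {j : ℕ}

lemma tog_bounds (hab : HStrip a b) (hbc : HStrip b c) (i : ℕ) :
    (j < b i ∧ tog j a b c i = b i) ∨ (b i ≤ j ∧ tog j a b c i + b i =
      min (min (c i) j) (if i = 0 then j else a (i - 1)) + max (c (i + 1)) (a i) ∧
      b i ≤ min (min (c i) j) (if i = 0 then j else a (i - 1)) ∧ max (c (i + 1)) (a i) ≤ b i) := by
  by_cases h : j < b i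
  · exact Or.inl ⟨h, if_pos h⟩
  · right
    have h1 := hab.1 i
    have h2 := hbc.1 i
    have h3 := hbc.2 i
    have h4 : b i ≤ if i = 0 then j else a (i - 1) := by
      split_ifs with hi
      · omega
      · have := hab.2 (i - 1); rwa [show i - 1 + 1 = i by omega] at this
    have h5 : b i ≤ min (min (c i) j) (if i = 0 then j else a (i - 1)) :=
      le_min (le_min h2 (by omega)) h4
    have h6 : max (c (i + 1)) (a i) ≤ b i := max_le h3 h1
    refine ⟨by omega, ?_, h5, h6⟩
    rw [tog, if_neg h]
    omega

lemma tog_hstrip_left (hab : HStrip a b) (hbc : HStrip b c) : HStrip a (tog j a b c) := by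
  refine ⟨fun i => ?_, fun i => ?_⟩
  · rcases tog_bounds (j := j) hab hbc i with h | h
    · rw [h.2]; exact hab.1 i
    · have := le_max_right (c (i + 1)) (a i); omega
  · rcases tog_bounds (j := j) hab hbc (i + 1) with h | h
    · rw [h.2]; exact hab.2 i
    · have := min_le_right (min (c (i + 1)) j) (if i + 1 = 0 then j else a (i + 1 - 1))
      simp only [Nat.add_eq_zero_iff, one_ne_zero, and_false, if_false, Nat.add_sub_cancel] at *
      omega

lemma tog_hstrip_right (hab : HStrip a b) (hbc : HStrip b c) : HStrip (tog j a b c) c := by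
  refine ⟨fun i => ?_, fun i => ?_⟩
  · rcases tog_bounds (j := j) hab hbc i with h | h
    · rw [h.2]; exact hbc.1 i
    · have := min_le_left (min (c i) j) (if i = 0 then j else a (i - 1))
      have := min_le_left (c i) j
      omega
  · rcases tog_bounds (j := j) hab hbc i with h | h
    · rw [h.2]; exact hbc.2 i
    · have := le_max_left (c (i + 1)) (a i); omega

lemma tog_lt_iff (hab : HStrip a b) (hbc : HStrip b c) (i : ℕ) : j < tog j a b c i ↔ j < b i := by
  rcases tog_bounds (j := j) hab hbc i with h | h
  · rw [h.2]
  · have := min_le_left (min (c i) j) (if i = 0 then j else a (i - 1))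
    have := min_le_right (c i) j
    omega

lemma tog_sub (hab : HStrip a b) (hbc : HStrip b c) {j' : ℕ} (hj : j ≤ j') (i : ℕ) :
    tog j a b c i - j' = b i - j' := by
  have := tog_lt_iff (j := j) hab hbc i
  rcases tog_bounds (j := j) hab hbc i with h | h
  · rw [h.2]
  · omega

lemma tog_tog (hab : HStrip a b) (hbc : HStrip b c) : tog j a (tog j a b c) c = b := by
  ext i
  rcases tog_bounds (j := j) hab hbc i with h | h
  · rw [tog, if_pos ((tog_lt_iff hab hbc i).2 h.1), h.2]
  · rw [tog, if_neg ((tog_lt_iff hab hbc i).not.2 (by omega))]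
    omega

lemma tog_colTail (hab : HStrip a b) (hbc : HStrip b c) {j' : ℕ} (hj : j ≤ j') :
    colTail k (tog j a b c) j' = colTail k b j' :=
  sum_congr rfl fun i _ => tog_sub hab hbc hj i

lemma colTail_succ (g : ℕ → ℕ) (j : ℕ) :
    colTail k g j = colTail k g (j + 1) + ∑ i : Fin k, if j < g i then 1 else 0 := by
  rw [colTail, colTail, ← sum_add_distrib]
  refine sum_congr rfl fun i _ => ?_
  split_ifs <;> omega

lemma colCount_le_succ (hbc : HStrip b c) (j : ℕ) :
    (∑ i : Fin k, if j < c i then 1 else 0) ≤ 1 + ∑ i : Fin k, if j < b i then 1 else 0 := by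
  rw [← sum_range (fun i => if j < c i then 1 else 0),
    ← sum_range (fun i => if j < b i then 1 else 0)]
  cases k with
  | zero => simp
  | succ k =>
    rw [sum_range_succ', sum_range_succ, add_comm 1]
    refine add_le_add ((sum_le_sum fun i _ => ?_).trans (Nat.le_add_right _ _)) ?_
    · have := hbc.2 i
      split_ifs <;> omega
    · split_ifs <;> omega

lemma viol_key (hab : HStrip a b) (hbc : HStrip b c)
    (h1 : 2 * colTail k b j < colTail k c j + colTail k a j)
    (h2 : colTail k c (j + 1) + colTail k a (j + 1) ≤ 2 * colTail k b (j + 1)) :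
    colTail k c j + colTail k a j = 2 * colTail k b j + 1 ∧ ∀ i < k, j < b i → j < a i := by
  have ha := colTail_succ (k := k) a j
  have hb := colTail_succ (k := k) b j
  have hc := colTail_succ (k := k) c j
  have hcb := colCount_le_succ (k := k) hbc j
  have hle : ∀ i ∈ (univ : Finset (Fin k)),
      (if j < a i then 1 else 0) ≤ if j < b i then 1 else 0 := fun i _ => by
    have := hab.1 i
    split_ifs <;> omega
  have hab' := sum_le_sum hle
  refine ⟨by omega, fun i hi hji => ?_⟩
  have := (sum_eq_sum_iff_of_le hle).1 (by omega) ⟨i, hi⟩ (mem_univ _)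
  simp only [hji, if_true] at this
  by_contra hcon
  simp [hcon] at this

lemma tog_sum (hab : HStrip a b) (hbc : HStrip b c) (hc : c k = 0)
    (h1 : colTail k c j + colTail k a j = 2 * colTail k b j + 1)
    (h2 : ∀ i < k, j < b i → j < a i) :
    sz k (tog j a b c) + sz k b + 1 = sz k a + sz k c := by
  have hsplit : ∀ g : ℕ → ℕ, sz k g = colTail k g j + ∑ i ∈ range k, min (g i) j := fun g => by
    rw [sz, colTail, sum_range, ← sum_add_distrib]
    exact sum_congr rfl fun i _ => by omega
  have ht := tog_colTail (k := k) (j' := j) hab hbc le_rfl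
  let U : ℕ → ℕ := fun i => min (min (c i) j) (if i = 0 then j else a (i - 1))
  let W : ℕ → ℕ := fun i => min (max (c (i + 1)) (a i)) j
  have hpt : ∀ i ∈ range k, min (tog j a b c i) j + min (b i) j = U i + W i := by
    intro i hi
    have hi' := h2 i (mem_range.1 hi)
    simp only [U, W]
    rcases tog_bounds (j := j) hab hbc i with h | h
    · have h3 := hi' h.1
      have h4 := hbc.1 i
      have h5 : j < if i = 0 then j + 1 else a (i - 1) := by
        split_ifs with h0
        · omega
        · have := hab.2 (i - 1); rw [show i - 1 + 1 = i by omega] at this; omega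
      rw [h.2]
      split_ifs at h5 ⊢ <;> omega
    · have := tog_lt_iff (j := j) hab hbc i
      omega
  have hUW : ∀ i, U (i + 1) + W i = min (c (i + 1)) j + min (a i) j := by
    intro i
    simp only [U, W, Nat.add_eq_zero_iff, one_ne_zero, and_false, if_false, Nat.add_sub_cancel]
    omega
  have hsum : ∑ i ∈ range k, (U i + W i) =
      ∑ i ∈ range k, min (c i) j + ∑ i ∈ range k, min (a i) j := by
    have e1 := sum_range_succ U k
    have e2 := sum_range_succ' U k
    have e3 := sum_range_succ (fun i => min (c i) j) k
    have e4 := sum_range_succ' (fun i => min (c i) j) k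
    have e5 : ∑ i ∈ range k, (U (i + 1) + W i) = _ := sum_congr rfl fun i _ => hUW i
    have e6 : U k = 0 := by simp [U, hc]
    have e7 : U 0 = min (c 0) j := by simp [U]
    rw [sum_add_distrib] at e5 ⊢
    rw [sum_add_distrib] at e5
    rw [hc] at e3
    try simp only [Nat.zero_min, add_zero] at e3 e4
    omega
  have hs2 : ∑ i ∈ range k, min (tog j a b c i) j + ∑ i ∈ range k, min (b i) j = _ :=
    (sum_add_distrib.symm.trans (sum_congr rfl hpt)).trans hsum
  rw [hsplit, hsplit b, hsplit a, hsplit c, ht]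
  omega

end Tog

/-- The first violation: rightmost column, then smallest letter. -/
def FirstViol (k : ℕ) (L : ℕ → ℕ → ℕ) (x : ℕ × ℕ) : Prop :=
  Viol k L x.1 x.2 ∧ (∀ r j, x.2 < j → ¬ Viol k L r j) ∧ ∀ r < x.1, ¬ Viol k L r x.2

def togChain (x : ℕ × ℕ) (L : ℕ → ℕ → ℕ) : ℕ → ℕ → ℕ := fun s =>
  if s = x.1 + 1 then tog x.2 (L x.1) (L (x.1 + 1)) (L (x.1 + 2)) else L s

lemma colTail_eq_zero {g : ℕ → ℕ} {j : ℕ} (h : sz k g ≤ j) : colTail k g j = 0 := by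
  refine sum_eq_zero fun i _ => ?_
  have : g i ≤ sz k g := single_le_sum (f := fun i : Fin k => g i) (fun _ _ => Nat.zero_le _)
    (mem_univ i)
  omega

lemma exists_firstViol {L : ℕ → ℕ → ℕ} (h : ¬ Good k L) : ∃ x, FirstViol k L x := by
  classical
  simp only [Good, not_forall, not_not] at h
  obtain ⟨r, j, h⟩ := h
  have hb : ∀ r j, Viol k L r j → j ≤ ∑ s ∈ range (k + 1), sz k (L s) := by
    intro r j hv
    by_contra hcon
    have hle : ∀ s < k + 1, sz k (L s) ≤ j := fun s hs =>
      (single_le_sum (f := fun s => sz k (L s))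
        (fun _ _ => Nat.zero_le _) (mem_range.2 hs)).trans (by omega)
    have h1 := hle (r + 2) (by have := hv.1; omega)
    have h2 := hle r (by have := hv.1; omega)
    have := hv.2
    rw [colTail_eq_zero h1, colTail_eq_zero h2] at this
    omega
  let P : ℕ → Prop := fun j => ∃ r, Viol k L r j
  have hP : P (Nat.findGreatest P (∑ s ∈ range (k + 1), sz k (L s))) :=
    Nat.findGreatest_spec (hb r j h) ⟨r, h⟩
  refine ⟨⟨Nat.find hP, _⟩, Nat.find_spec hP, fun r' j' hj' hv => ?_,
    fun r' hr' => Nat.find_min hP hr'⟩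
  exact Nat.findGreatest_is_greatest hj' (hb r' j' hv) ⟨r', hv⟩

lemma firstViol_unique {L : ℕ → ℕ → ℕ} {x y : ℕ × ℕ} (hx : FirstViol k L x)
    (hy : FirstViol k L y) : x = y := by
  have h2 : x.2 = y.2 := by
    by_contra hne
    rcases lt_or_gt_of_ne hne with h | h
    · exact hx.2.1 _ _ h hy.1
    · exact hy.2.1 _ _ h hx.1
  have h1 : x.1 = y.1 := by
    by_contra hne
    rcases lt_or_gt_of_ne hne with h | h
    · exact hy.2.2 _ h (h2 ▸ hx.1)
    · exact hx.2.2 _ h (h2 ▸ hy.1)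
  exact Prod.ext h1 h2

lemma colTail_togChain {g : ℕ → ℕ} {m : ℕ} {L : ℕ → ℕ → ℕ} (hL : L ∈ chains k g m) {x : ℕ × ℕ}
    (hx : x.1 + 2 ≤ k) {j : ℕ} (hj : x.2 ≤ j) (s : ℕ) :
    colTail k (togChain x L s) j = colTail k (L s) j := by
  obtain ⟨-, h2, -, -⟩ := mem_chains.1 hL
  by_cases hs : s = x.1 + 1
  · subst hs
    rw [togChain, if_pos rfl]
    exact tog_colTail (h2 _ (by omega)).1 (h2 _ (by omega)).1 hj
  · rw [togChain, if_neg hs]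

lemma firstViol_togChain {g : ℕ → ℕ} {m : ℕ} {L : ℕ → ℕ → ℕ} (hL : L ∈ chains k g m) {x : ℕ × ℕ}
    (hx : FirstViol k L x) : FirstViol k (togChain x L) x := by
  have key : ∀ r j, x.2 ≤ j → (Viol k (togChain x L) r j ↔ Viol k L r j) := by
    intro r j hj
    simp only [Viol, colTail_togChain hL hx.1.1 hj]
  exact ⟨(key _ _ le_rfl).2 hx.1, fun r j hj => (key _ _ hj.le).not.2 (hx.2.1 r j hj),
    fun r hr => (key _ _ le_rfl).not.2 (hx.2.2 r hr)⟩

open scoped Classical in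
lemma eps_cont_good {g nu : ℕ → ℕ} {m : ℕ} (hnu : PT k nu) {L : ℕ → ℕ → ℕ}
    (hL : L ∈ chains k g m) (h : Good k L) :
    eps k nu (cont k L) = if cont k L = nu then 1 else 0 := by
  refine eps_antitone hnu ⟨antitone_nat_of_succ_le fun s => ?_, fun i hi => if_neg (by omega)⟩
  by_cases hs : s + 1 < k
  · have h1 := h s 0
    simp only [Viol, not_and, not_lt] at h1
    have h1 := h1 (by omega)
    have h2 := (mem_chains.1 hL).2.1
    have h3 : ∀ s < k, sz k (L s) ≤ sz k (L (s + 1)) := fun s hs =>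
      sum_le_sum fun i _ => (h2 s hs).1.1 i
    have h4 := h3 s (by omega)
    have h5 : sz k (L (s + 1)) ≤ sz k (L (s + 2)) := h3 (s + 1) (by omega)
    rw [cont, cont, if_pos hs, if_pos (by omega)]
    simp only [colTail, Nat.sub_zero] at h1
    simp only [sz, add_assoc, Nat.reduceAdd] at *
    omega
  · rw [cont, if_neg hs]; exact Nat.zero_le _

open scoped Classical in
/-- The Littlewood-Richardson rule in terms of chains. -/
theorem alt_mul_schur_good {g nu : ℕ → ℕ} (hg : PT k g) (hnu : PT k nu) :
    alt k (g + rho k) * schur k nu = ∑ L ∈ (chains k g (sz k nu)).filter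
      (fun L => Good k L ∧ cont k L = nu), alt k (L k + rho k) := by
  classical
  rw [alt_mul_schur hg, ← sum_filter_add_sum_filter_not _ (Good k)]
  have h0 : ∑ L ∈ (chains k g (sz k nu)).filter (fun L => ¬ Good k L),
      eps k nu (cont k L) • alt k (L k + rho k) = 0 := by
    refine sum_eq_zero_of_toggle _ _ (FirstViol k) togChain
      (fun L hL => exists_firstViol (mem_filter.1 hL).2)
      (fun L _ x y => firstViol_unique) ?_
    rintro L hL x hx
    rw [mem_filter] at hL
    have hx1 := hx.1.1
    have hF := firstViol_togChain hL.1 hx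
    obtain ⟨h1, h2, h3, h4⟩ := mem_chains.1 hL.1
    have hab := (h2 x.1 (by omega)).1
    have hbc : HStrip (L (x.1 + 1)) (L (x.1 + 2)) := (h2 (x.1 + 1) (by omega)).1
    have hne : ∀ s, s ≠ x.1 + 1 → togChain x L s = L s := fun s hs => if_neg hs
    have heq : togChain x L (x.1 + 1) = tog x.2 (L x.1) (L (x.1 + 1)) (L (x.1 + 2)) := if_pos rfl
    have hPT := chains_PT hg hL.1
    have hkey := viol_key hab hbc hx.1.2 (by
      have := hx.2.1 x.1 (x.2 + 1) (Nat.lt_succ_self _)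
      simp only [Viol, not_and, not_lt] at this
      exact this hx1)
    have hsum := tog_sum hab hbc ((hPT _).2 k le_rfl) hkey.1 hkey.2
    have hz : ∀ i, k ≤ i → tog x.2 (L x.1) (L (x.1 + 1)) (L (x.1 + 2)) i = 0 := fun i hi => by
      have := (tog_hstrip_right (j := x.2) hab hbc).1 i
      rw [(hPT (x.1 + 2)).2 i hi] at this
      omega
    have hmem : togChain x L ∈ chains k g (sz k nu) := by
      refine mem_chains.2 ⟨by rw [hne 0 (by omega), h1], fun s hs => ?_, fun s hs => ?_, ?_⟩
      · by_cases hs1 : s = x.1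
        · subst hs1
          rw [heq, hne _ (by omega)]
          exact ⟨tog_hstrip_left hab hbc, fun i hi => by rw [hz i hi, (hPT _).2 i hi]⟩
        · by_cases hs2 : s = x.1 + 1
          · subst hs2
            rw [heq, hne _ (by omega)]
            exact ⟨tog_hstrip_right hab hbc, fun i hi => by rw [hz i hi, (hPT _).2 i hi]⟩
          · rw [hne (s + 1) (by omega), hne _ hs2]
            exact h2 s hs
      · rw [hne _ (by omega), hne _ (by omega), h3 s hs]
      · rw [hne _ (by omega), h4]
    refine ⟨mem_filter.2 ⟨hmem, fun h => h _ _ hF.1⟩, hF, ?_, ?_⟩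
    · ext1 s
      by_cases hs : s = x.1 + 1
      · subst hs
        rw [togChain, if_pos rfl, heq, hne _ (by omega), hne _ (by omega), tog_tog hab hbc]
      · rw [togChain, if_neg hs, hne _ hs]
    · rw [hne k (by omega), ← add_smul]
      have hle1 : sz k (L x.1) ≤ sz k (L (x.1 + 1)) := sum_le_sum fun i _ => hab.1 i
      have hle2 : sz k (L (x.1 + 1)) ≤ sz k (L (x.1 + 2)) := sum_le_sum fun i _ => hbc.1 i
      have hle3 : sz k (L x.1) ≤ sz k (tog x.2 (L x.1) (L (x.1 + 1)) (L (x.1 + 2))) :=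
        sum_le_sum fun i _ => (tog_hstrip_left hab hbc).1 i
      have hle4 : sz k (tog x.2 (L x.1) (L (x.1 + 1)) (L (x.1 + 2))) ≤ sz k (L (x.1 + 2)) :=
        sum_le_sum fun i _ => (tog_hstrip_right hab hbc).1 i
      rw [eps_swap (r := x.1) nu (by omega), zero_smul]
      · rw [cont, cont, if_pos (by omega), if_pos (by omega), heq, hne _ (by omega)]
        simp only [add_assoc, Nat.reduceAdd]
        omega
      · rw [cont, cont, if_pos (by omega), if_pos (by omega), heq, hne _ (by omega)]
        simp only [add_assoc, Nat.reduceAdd]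
        omega
      · intro s hs hs'
        simp only [cont]
        rw [hne s (by omega), hne (s + 1) (by omega)]
  rw [h0, add_zero, sum_filter, sum_filter]
  refine sum_congr rfl fun L hL => ?_
  by_cases hG : Good k L
  · rw [if_pos hG, eps_cont_good hnu hL hG]
    by_cases hc : cont k L = nu <;> simp [hc, hG]
  · simp [hG]

end Chains

/-! ### Littlewood-Richardson tableaux and chains -/

section Tableaux

open MvPolynomial Finset

variable {k : ℕ}

lemma colTail_range (g : ℕ → ℕ) (j : ℕ) : colTail k g j = ∑ i ∈ range k, (g i - j) :=
  (sum_range fun i => g i - j).symm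

lemma colTail_add {x y : ℕ → ℕ} (h : ∀ i, x i ≤ y i) (j : ℕ) :
    colTail k y j = colTail k x j + ∑ i ∈ range k, ((y i - j) - (x i - j)) := by
  rw [colTail_range, colTail_range, ← sum_add_distrib]
  exact sum_congr rfl fun i _ => by have := h i; omega

lemma sum_range_trunc {f : ℕ → ℕ} {a b : ℕ} (hf : ∀ i, a ≤ i → f i = 0) (h : a ≤ b) :
    ∑ i ∈ range b, f i = ∑ i ∈ range a, f i :=
  (sum_subset (range_mono h) fun i _ hi => hf i (by simpa using hi)).symm

lemma lattice_iff {x y z : ℕ → ℕ} (hxy : HStrip x y) (hyz : HStrip y z)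
    (hz : ∀ i, k ≤ i → z i = 0) :
    (∀ j, ¬ 2 * colTail k y j < colTail k z j + colTail k x j) ↔
      ∀ i, ∑ i' ∈ range (i + 1), (z i' - y i') ≤ ∑ i' ∈ range i, (y i' - x i') := by
  have hred : ∀ j, (¬ 2 * colTail k y j < colTail k z j + colTail k x j) ↔
      ∑ i ∈ range k, ((z i - j) - (y i - j)) ≤ ∑ i ∈ range k, ((y i - j) - (x i - j)) := by
    intro j
    have h1 := colTail_add (k := k) hxy.1 j
    have h2 := colTail_add (k := k) hyz.1 j
    omega
  simp only [hred]
  have hya := hxy.antitone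
  have hza := hyz.antitone
  have hy : ∀ i, k ≤ i → y i = 0 := fun i hi => by have := hyz.1 i; rw [hz i hi] at this; omega
  constructor
  · intro h i
    have h := h (y i)
    have hB : ∑ i' ∈ range (i + 1), (z i' - y i') ≤
        ∑ i' ∈ range k, ((z i' - y i) - (y i' - y i)) := by
      have e : ∑ i' ∈ range (i + 1), (z i' - y i') =
          ∑ i' ∈ range (i + 1), ((z i' - y i) - (y i' - y i)) := by
        refine sum_congr rfl fun i' hi' => ?_
        have h1 : y i ≤ y i' := hya (by simp at hi'; omega)
        have h2 := hyz.1 i'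
        omega
      rw [e]
      rcases le_total (i + 1) k with hk | hk
      · exact sum_le_sum_of_subset (range_mono hk)
      · rw [sum_range_trunc (fun i' hi' => by rw [hz i' hi', hy i' hi', Nat.sub_self]) hk]
    have hA : ∑ i' ∈ range k, ((y i' - y i) - (x i' - y i)) ≤ ∑ i' ∈ range i, (y i' - x i') := by
      have e : ∑ i' ∈ range k, ((y i' - y i) - (x i' - y i)) ≤
          ∑ i' ∈ range i, ((y i' - y i) - (x i' - y i)) := by
        rcases le_total i k with hk | hk
        · rw [sum_range_trunc (fun i' hi' => ?_) hk]
          have : y i' ≤ y i := hya hi'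
          omega
        · exact sum_le_sum_of_subset (range_mono hk)
      exact e.trans (sum_le_sum fun i' _ => by omega)
    omega
  · intro h j
    by_cases hex : ∃ i, j < z i
    swap
    · push Not at hex
      rw [sum_eq_zero fun i _ => by have := hex i; omega]
      exact Nat.zero_le _
    · have hb : ∀ i, j < z i → i ≤ k := fun i hi => by
        by_contra hcon
        rw [hz i (by omega)] at hi; omega
      obtain ⟨i, hi, hmax⟩ : ∃ i, j < z i ∧ ∀ i', i < i' → z i' ≤ j := by
        classical
        obtain ⟨i₀, h0⟩ := hex
        exact ⟨_, Nat.findGreatest_spec (P := fun i => j < z i) (hb i₀ h0) h0, fun i' hi' => by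
          by_contra hcon
          exact Nat.findGreatest_is_greatest hi' (hb i' (by omega)) (by omega)⟩
      have hik : i + 1 ≤ k := by
        by_contra hcon
        rw [hz i (by omega)] at hi; omega
      rw [sum_range_trunc (a := i + 1) (fun i' hi' => by have := hmax i' hi'; omega) hik]
      have hy' : ∀ i', i' < i → j < y i' := fun i' hi' => by
        have h1 := hyz.2 i'
        have h2 : z i ≤ z (i' + 1) := hza (by omega)
        omega
      by_cases hx : i = 0 ∨ j ≤ x (i - 1)
      · have hx' : ∀ i', i' < i → j ≤ x i' := fun i' hi' => by
          by_cases h1 : i' = i - 1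
          · subst h1; rcases hx with hx | hx
            · omega
            · exact hx
          · have h1 := hxy.2 i'
            have := hy' (i' + 1) (by omega)
            omega
        calc ∑ i' ∈ range (i + 1), ((z i' - j) - (y i' - j))
            ≤ ∑ i' ∈ range (i + 1), (z i' - y i') := sum_le_sum fun i' _ => by omega
          _ ≤ ∑ i' ∈ range i, (y i' - x i') := h i
          _ = ∑ i' ∈ range i, ((y i' - j) - (x i' - j)) := by
            refine sum_congr rfl fun i' hi' => ?_
            have := hx' i' (by simpa using hi')
            omega
          _ ≤ _ := sum_le_sum_of_subset (range_mono (by omega))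
      · push Not at hx
        obtain ⟨p, rfl⟩ : ∃ p, i = p + 1 := ⟨i - 1, by omega⟩
        simp only [Nat.add_sub_cancel] at hx
        have h1 := h p
        have h2 : ∑ i' ∈ range (p + 1), ((z i' - j) - (y i' - j)) ≤
            ∑ i' ∈ range (p + 1), (z i' - y i') := sum_le_sum fun i' _ => by omega
        have h3 : ∑ i' ∈ range p, (y i' - x i') = ∑ i' ∈ range p, ((y i' - j) - (x i' - j)) := by
          refine sum_congr rfl fun i' hi' => ?_
          have h4 := hxy.2 i'
          have h5 := hy' (i' + 1) (by simp at hi'; omega)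
          omega
        have h6 : ∑ i' ∈ range (p + 1), ((y i' - j) - (x i' - j)) ≤
            ∑ i' ∈ range k, ((y i' - j) - (x i' - j)) :=
          sum_le_sum_of_subset (range_mono (by omega))
        have h7 := hyz.2 p
        rw [sum_range_succ] at h6
        rw [sum_range_succ]
        omega

/-- The chain `L` and the filling `T` of shape `l` encode each other. -/
def ChainRel (l : ℕ → ℕ) (L : ℕ → ℕ → ℕ) (T : ℕ → ℕ → ℕ) : Prop :=
  (∀ s i j, j < L s i ↔ j < l i ∧ T i j ≤ s) ∧ ∀ i j, l i ≤ j → T i j = 0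

lemma ChainRel.unique_left {l : ℕ → ℕ} {L L' T : ℕ → ℕ → ℕ} (h : ChainRel l L T)
    (h' : ChainRel l L' T) : L = L' := by
  ext s i
  refine eq_of_forall_lt_iff fun j => ?_
  rw [h.1, h'.1]

lemma ChainRel.unique_right {l : ℕ → ℕ} {L T T' : ℕ → ℕ → ℕ} (h : ChainRel l L T)
    (h' : ChainRel l L T') : T = T' := by
  ext i j
  by_cases hj : j < l i
  · refine le_antisymm ?_ ?_
    · exact ((h.1 _ i j).1 ((h'.1 _ i j).2 ⟨hj, le_rfl⟩)).2
    · exact ((h'.1 _ i j).1 ((h.1 _ i j).2 ⟨hj, le_rfl⟩)).2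
  · rw [h.2 i j (by omega), h'.2 i j (by omega)]

lemma ChainRel.eq_succ_iff {l : ℕ → ℕ} {L T : ℕ → ℕ → ℕ} (h : ChainRel l L T) (r i j : ℕ) :
    T i j = r + 1 ↔ L r i ≤ j ∧ j < L (r + 1) i := by
  rw [h.1, ← not_lt, h.1]
  constructor
  · intro h1
    have : j < l i := by
      by_contra hcon
      have := h.2 i j (by omega)
      omega
    omega
  · omega

lemma ncard_cells (a b : ℕ → ℕ) (i j : ℕ) :
    Set.ncard {p : ℕ × ℕ | (p.1 < i ∨ (p.1 = i ∧ j ≤ p.2)) ∧ a p.1 ≤ p.2 ∧ p.2 < b p.1} =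
      ∑ i' ∈ range i, (b i' - a i') + (b i - max (a i) j) := by
  classical
  let F : Finset (Σ _ : ℕ, ℕ) := (range (i + 1)).sigma fun i' =>
    Ico (if i' < i then a i' else max (a i) j) (b i')
  have hF : {p : ℕ × ℕ | (p.1 < i ∨ (p.1 = i ∧ j ≤ p.2)) ∧ a p.1 ≤ p.2 ∧ p.2 < b p.1} =
      (Equiv.sigmaEquivProd ℕ ℕ) '' (F : Set (Σ _ : ℕ, ℕ)) := by
    ext ⟨p, q⟩
    simp only [Set.mem_ofPred_eq, Set.mem_image, mem_coe, F, mem_sigma, mem_range, mem_Ico,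
      Sigma.exists, Equiv.sigmaEquivProd_apply, Prod.mk.injEq]
    constructor
    · rintro ⟨h1, h2, h3⟩
      refine ⟨p, q, ⟨by omega, ?_, h3⟩, rfl, rfl⟩
      split_ifs with h
      · exact h2
      · obtain ⟨rfl, h4⟩ : p = i ∧ j ≤ q := by omega
        exact max_le h2 h4
    · rintro ⟨p', q', ⟨h1, h2, h3⟩, rfl, rfl⟩
      split_ifs at h2 with h
      · exact ⟨Or.inl h, h2, h3⟩
      · obtain rfl : p' = i := by omega
        exact ⟨Or.inr ⟨rfl, (le_max_right _ _).trans h2⟩, (le_max_left _ _).trans h2, h3⟩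
  rw [hF, Set.ncard_image_of_injective _ (Equiv.injective _), Set.ncard_coe_finset,
    card_sigma, sum_range_succ]
  simp only [Nat.card_Ico, lt_irrefl, if_false]
  congr 1
  exact sum_congr rfl fun i' hi' => by rw [if_pos (mem_range.1 hi')]

lemma ncard_cells_all (a b : ℕ → ℕ) (hb : ∀ i, k ≤ i → b i = 0) :
    Set.ncard {p : ℕ × ℕ | a p.1 ≤ p.2 ∧ p.2 < b p.1} = ∑ i' ∈ range k, (b i' - a i') := by
  have := ncard_cells a b k 0
  rw [hb k le_rfl, Nat.zero_sub, add_zero] at this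
  rw [← this]
  congr 1
  ext ⟨p, q⟩
  simp only [Set.mem_ofPred_eq, zero_le, and_true]
  constructor
  · intro h
    refine ⟨?_, h⟩
    by_contra hcon
    have := hb p (by omega)
    omega
  · exact fun h => h.2

lemma ChainRel.entry_le {l m nu : ℕ → ℕ} {L T : ℕ → ℕ → ℕ} (hL : ChainRel l L T)
    (hT : IsLRTableau l m nu T) : ∀ i j, T i j ≤ i + 1 := by
  intro i
  induction i using Nat.strong_induction_on with
  | _ i ih =>
    intro j
    by_contra hcon
    obtain ⟨r, hr⟩ : ∃ r, T i j = r + 2 := ⟨T i j - 2, by omega⟩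
    have h7 := hT.2.2.2.2.2 i j r
    have h8 := (hL.eq_succ_iff (r + 1) i j).1 hr
    have e : r + 2 = r + 1 + 1 := rfl
    rw [e] at h7
    simp only [hL.eq_succ_iff] at h7
    rw [ncard_cells, ncard_cells] at h7
    have h0 : L (r + 1) i - max (L r i) j = 0 := by omega
    rw [h0, add_zero] at h7
    have h9 : 0 < ∑ i' ∈ range i, (L (r + 1) i' - L r i') := by omega
    obtain ⟨i', hi', hpos⟩ := sum_pos_iff.1 h9
    have h10 := (hL.eq_succ_iff r i' (L r i')).2 ⟨le_rfl, by omega⟩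
    have h11 := ih i' (mem_range.1 hi') (L r i')
    have := mem_range.1 hi'
    omega

lemma lattice_rows_iff (x y z : ℕ → ℕ) :
    (∀ i j, ∑ i' ∈ range i, (z i' - y i') + (z i - max (y i) j) ≤
        ∑ i' ∈ range i, (y i' - x i') + (y i - max (x i) j)) ↔
      ∀ i, ∑ i' ∈ range (i + 1), (z i' - y i') ≤ ∑ i' ∈ range i, (y i' - x i') := by
  constructor
  · intro h i
    have := h i (y i)
    rw [sum_range_succ]
    omega
  · intro h i j
    have := h i
    rw [sum_range_succ] at this
    omega

lemma isLRTableau_iff {l m nu : ℕ → ℕ} (hl : PT k l) (hm : PT k m) (hnu : PT k nu)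
    {L T : ℕ → ℕ → ℕ} (h : ChainRel l L T) :
    IsLRTableau l m nu T ↔ (L ∈ chains k m (sz k nu) ∧ Good k L ∧ cont k L = nu) ∧ L k = l := by
  have hmono : ∀ s i, L s i ≤ L (s + 1) i := fun s i => by
    by_contra hcon
    have h1 := (h.1 s i (L (s + 1) i)).1 (by omega)
    have h2 := (h.1 (s + 1) i (L (s + 1) i)).2 ⟨h1.1, by omega⟩
    omega
  have hle : ∀ s i, L s i ≤ l i := fun s i => by
    by_contra hcon
    have h1 := (h.1 s i (l i)).1 (by omega)
    omega
  have hz : ∀ s i, k ≤ i → L s i = 0 := fun s i hi => by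
    have := hle s i; rw [hl.2 i hi] at this; omega
  have hcnt : ∀ r, Set.ncard {p : ℕ × ℕ | T p.1 p.2 = r + 1} =
      ∑ i ∈ range k, (L (r + 1) i - L r i) := fun r => by
    simp only [h.eq_succ_iff]
    exact ncard_cells_all _ _ (hz (r + 1))
  have hsub : ∀ r, ∑ i ∈ range k, (L (r + 1) i - L r i) = sz k (L (r + 1)) - sz k (L r) := by
    intro r
    have : sz k (L (r + 1)) = sz k (L r) + ∑ i ∈ range k, (L (r + 1) i - L r i) := by
      rw [sz, sz, sum_range, ← sum_add_distrib]
      exact sum_congr rfl fun i _ => by have := hmono r i; omega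
    omega
  have hlat : (∀ i j r, Set.ncard {p : ℕ × ℕ | (p.1 < i ∨ (p.1 = i ∧ j ≤ p.2)) ∧ T p.1 p.2 = r + 2}
          ≤ Set.ncard {p : ℕ × ℕ | (p.1 < i ∨ (p.1 = i ∧ j ≤ p.2)) ∧ T p.1 p.2 = r + 1}) ↔
      ∀ r i, ∑ i' ∈ range (i + 1), (L (r + 2) i' - L (r + 1) i') ≤
        ∑ i' ∈ range i, (L (r + 1) i' - L r i') := by
    have e : ∀ r, r + 2 = r + 1 + 1 := fun r => rfl
    simp only [e, h.eq_succ_iff, ncard_cells]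
    constructor
    · intro hh r
      exact (lattice_rows_iff _ _ _).1 fun i j => hh i j r
    · intro hh i j r
      exact (lattice_rows_iff _ _ _).2 (hh r) i j
  constructor
  · rintro ⟨h1, h2, h3, h4, h5, h6⟩
    have h0 : L 0 = m := by
      ext i
      refine eq_of_forall_lt_iff fun j => ?_
      rw [h.1]
      have := h2 i j
      simp only [InSkew] at this
      have := h1 i
      omega
    have hst : ∀ s, HStrip (L s) (L (s + 1)) := by
      refine fun s => ⟨hmono s, fun i => ?_⟩
      by_contra hcon
      have h7 := (h.1 (s + 1) (i + 1) (L s i)).1 (by omega)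
      have h8 := h.1 s i (L s i)
      have h9 : l (i + 1) ≤ l i := hl.1 (Nat.le_succ i)
      have h10 : m (i + 1) ≤ m i := hm.1 (Nat.le_succ i)
      have h11 := h4 i (i + 1) (L s i)
      have h12 := (h2 i (L s i)).1
      simp only [InSkew] at h11 h12
      omega
    have hbound := h.entry_le ⟨h1, h2, h3, h4, h5, h6⟩
    have hstat : ∀ s, k ≤ s → L s = l := by
      intro s hs
      ext i
      refine eq_of_forall_lt_iff fun j => ?_
      rw [h.1]
      have h7 := hbound i j
      constructor
      · exact fun h => h.1
      · intro h8
        refine ⟨h8, ?_⟩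
        have : i < k := by
          by_contra hcon
          rw [hl.2 i (by omega)] at h8; omega
        omega
    have hc : cont k L = nu := by
      ext r
      by_cases hr : r < k
      · rw [cont, if_pos hr, ← hsub, ← hcnt, h5]
      · rw [cont, if_neg hr, hnu.2 r (by omega)]
    refine ⟨⟨mem_chains.2 ⟨h0, fun s _ => ⟨hst s, fun i hi => by rw [hz _ i hi, hz _ i hi]⟩,
      fun s hs => by rw [hstat s hs, hstat k le_rfl], ?_⟩, ?_, hc⟩, hstat k le_rfl⟩
    · rw [sz_chain (fun s _ => hmono s) k le_rfl, h0, hc, sum_range]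
      rfl
    · rintro r j ⟨-, hv⟩
      exact (lattice_iff (hst r) (hst (r + 1)) (hz (r + 2))).2 (hlat.1 h6 r) j hv
  · rintro ⟨⟨h1, h2, h3⟩, h4⟩
    obtain ⟨h5, h6, h7, h8⟩ := mem_chains.1 h1
    have hst : ∀ s, HStrip (L s) (L (s + 1)) := by
      intro s
      by_cases hs : s < k
      · exact (h6 s hs).1
      · rw [h7 (s + 1) (by omega), h7 s (by omega), h4]
        exact ⟨fun _ => le_rfl, fun i => hl.1 (Nat.le_succ i)⟩
    have hPT := chains_PT hm h1
    have h0 : ∀ i j, T i j ≠ 0 ↔ InSkew l m i j := by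
      intro i j
      have h9 := h.1 0 i j
      rw [h5] at h9
      have h10 := h.2 i j
      simp only [InSkew]
      have : m i ≤ l i := by rw [← h5]; exact hle 0 i
      omega
    refine ⟨fun i => by rw [← h5]; exact hle 0 i, h0, ?_, ?_, ?_, ?_⟩
    · intro i j j' hj hj' hjj
      have := (h.1 (T i j') i j').2 ⟨hj'.2, le_rfl⟩
      exact ((h.1 (T i j') i j).1 (by omega)).2
    · intro i i' j hi hi' hii
      obtain ⟨t, ht⟩ : ∃ t, T i' j = t + 1 := ⟨T i' j - 1, by have := (h0 i' j).2 hi'; omega⟩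
      obtain ⟨p, rfl⟩ : ∃ p, i' = p + 1 := ⟨i' - 1, by omega⟩
      have h9 := (h.1 (t + 1) (p + 1) j).2 ⟨hi'.2, ht.le⟩
      have h10 := (hst t).2 p
      have h11 : L t p ≤ L t i := (hPT t).1 (by omega)
      have := ((h.1 t i j).1 (by omega)).2
      omega
    · intro r
      rw [hcnt, hsub, ← h3]
      by_cases hr : r < k
      · rw [cont, if_pos hr]
      · rw [cont, if_neg hr, h7 (r + 1) (by omega), h7 r (by omega), Nat.sub_self]
    · rw [hlat]
      intro r
      by_cases hr : r + 2 ≤ k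
      · refine (lattice_iff (hst r) (hst (r + 1)) (hz (r + 2))).1 fun j hv => h2 r j ⟨hr, hv⟩
      · intro i
        rw [sum_eq_zero]
        · exact Nat.zero_le _
        · intro i' _
          rw [h7 (r + 2) (by omega), h7 (r + 1) (by omega), Nat.sub_self]

lemma exists_chainRel_of_chain {l m : ℕ → ℕ} {b : ℕ} {L : ℕ → ℕ → ℕ}
    (hL : L ∈ chains k m b) (h : L k = l) : ∃ T, ChainRel l L T := by
  classical
  obtain ⟨-, h2, h3, -⟩ := mem_chains.1 hL
  have hmono : ∀ i, Monotone fun s => L s i := fun i => monotone_nat_of_le_succ fun s => by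
    by_cases hs : s < k
    · exact (h2 s hs).1.1 i
    · rw [h3 (s + 1) (by omega), h3 s (by omega)]
  have hex : ∀ i j, j < l i → ∃ s, j < L s i := fun i j hj => ⟨k, by rwa [h]⟩
  refine ⟨fun i j => if hj : j < l i then Nat.find (hex i j hj) else 0, fun s i j => ?_,
    fun i j hj => dif_neg (by omega)⟩
  constructor
  · intro hj
    have hj' : j < l i := by
      refine lt_of_lt_of_le hj ?_
      rw [← h]
      rcases le_total s k with hs | hs
      · exact hmono i hs
      · rw [h3 s hs]
    refine ⟨hj', ?_⟩
    simp only [dif_pos hj']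
    exact Nat.find_min' _ hj
  · rintro ⟨h4, h5⟩
    simp only [dif_pos h4] at h5
    exact lt_of_lt_of_le (Nat.find_spec (hex i j h4)) (hmono i h5)

lemma exists_chainRel_of_tableau {l m nu : ℕ → ℕ} {T : ℕ → ℕ → ℕ}
    (hT : IsLRTableau l m nu T) : ∃ L, ChainRel l L T := by
  classical
  obtain ⟨h1, h2, h3, -⟩ := hT
  refine ⟨fun s i => Nat.findGreatest (fun j => ∀ j' < j, T i j' ≤ s) (l i), fun s i j => ?_,
    fun i j hj => ?_⟩
  · constructor
    · intro hj
      have hs : ∀ j' < Nat.findGreatest (fun j => ∀ j' < j, T i j' ≤ s) (l i), T i j' ≤ s :=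
        Nat.findGreatest_spec (P := fun j => ∀ j' < j, T i j' ≤ s) (Nat.zero_le (l i))
          (fun j' h => absurd h (Nat.not_lt_zero _))
      exact ⟨lt_of_lt_of_le hj (Nat.findGreatest_le _), hs j hj⟩
    · rintro ⟨hj, hs⟩
      refine Nat.lt_of_succ_le (Nat.le_findGreatest hj fun j' hj' => ?_)
      by_cases hm : m i ≤ j'
      · exact (h3 i j' j ⟨hm, by omega⟩ ⟨by omega, hj⟩ (by omega)).trans hs
      · have := (h2 i j').not.2 (fun h => hm h.1)
        omega
  · by_contra hcon
    have := ((h2 i j).1 hcon).2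
    omega

open scoped Classical in
theorem lrCoeff_eq_card {l m nu : ℕ → ℕ} (hl : PT k l) (hm : PT k m) (hnu : PT k nu) :
    lrCoeff l m nu = (((chains k m (sz k nu)).filter
      (fun L => Good k L ∧ cont k L = nu)).filter fun L => L k = l).card := by
  rw [lrCoeff, ← Set.ncard_coe_finset]
  symm
  have hmem : ∀ L, L ∈ (((chains k m (sz k nu)).filter
      (fun L => Good k L ∧ cont k L = nu)).filter fun L => L k = l) ↔
      (L ∈ chains k m (sz k nu) ∧ Good k L ∧ cont k L = nu) ∧ L k = l := by
    intro L; simp only [mem_filter]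
  refine Set.ncard_congr (fun L hL =>
    (exists_chainRel_of_chain ((hmem L).1 hL).1.1 ((hmem L).1 hL).2).choose) ?_ ?_ ?_
  · intro L hL
    exact (isLRTableau_iff hl hm hnu (exists_chainRel_of_chain ((hmem L).1 hL).1.1
      ((hmem L).1 hL).2).choose_spec).2 ((hmem L).1 hL)
  · intro L L' hL hL' heq
    have h1 := (exists_chainRel_of_chain ((hmem L).1 hL).1.1 ((hmem L).1 hL).2).choose_spec
    have h2 := (exists_chainRel_of_chain ((hmem L').1 hL').1.1 ((hmem L').1 hL').2).choose_spec
    rw [heq] at h1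
    exact h1.unique_left h2
  · intro T hT
    obtain ⟨L, hL⟩ := exists_chainRel_of_tableau hT
    have h1 := (isLRTableau_iff hl hm hnu hL).1 hT
    have h2 := (hmem L).2 h1
    refine ⟨L, h2, ?_⟩
    exact (exists_chainRel_of_chain h1.1.1 h1.2).choose_spec.unique_right hL

/-- Vanishing of Littlewood-Richardson coefficients outside the expected range. -/
lemma lrCoeff_ne_zero {l m nu : ℕ → ℕ} (hl : PT k l) (hm : Antitone m) (hnu : Antitone nu)
    (h : lrCoeff l m nu ≠ 0) : PT k m ∧ PT k nu ∧ sz k l = sz k m + sz k nu := by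
  have hne : {T : ℕ → ℕ → ℕ | IsLRTableau l m nu T}.Nonempty := by
    by_contra hcon
    rw [Set.not_nonempty_iff_eq_empty] at hcon
    exact h (by rw [lrCoeff, hcon, Set.ncard_empty])
  obtain ⟨T, hT⟩ := hne
  have hT' : IsLRTableau l m nu T := hT
  obtain ⟨L, hL⟩ := exists_chainRel_of_tableau hT
  have hmP : PT k m := ⟨hm, fun i hi => by
    have := hT.1 i; rw [hl.2 i hi] at this; omega⟩
  have hz : ∀ s i, k ≤ i → L s i = 0 := fun s i hi => by
    by_contra hcon
    have := ((hL.1 s i 0).1 (by omega)).1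
    rw [hl.2 i hi] at this; omega
  have hcnt : ∀ r, nu r = ∑ i ∈ range k, (L (r + 1) i - L r i) := fun r => by
    rw [← hT'.2.2.2.2.1 r]
    simp only [hL.eq_succ_iff]
    exact ncard_cells_all _ _ (hz (r + 1))
  have hbound := hL.entry_le hT'
  have hnuP : PT k nu := ⟨hnu, fun r hr => by
    rw [hcnt]
    refine sum_eq_zero fun i hi => ?_
    by_contra hcon
    have := (hL.eq_succ_iff r i (L r i)).2 ⟨le_rfl, by omega⟩
    have := hbound i (L r i)
    have := mem_range.1 hi
    omega⟩
  refine ⟨hmP, hnuP, ?_⟩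
  have := (isLRTableau_iff hl hmP hnuP hL).1 hT
  rw [← this.2, (mem_chains.1 this.1.1).2.2.2]

end Tableaux

/-! ### Symmetric polynomials -/

section Symmetric

open MvPolynomial Finset

variable {k : ℕ}

def ex (k : ℕ) (c : ℕ → ℕ) : Fin k →₀ ℕ := Finsupp.equivFunOnFinite.symm fun i => c i

@[simp] lemma ex_apply (c : ℕ → ℕ) (i : Fin k) : ex k c i = c i := rfl

lemma ex_eq_iff {c c' : ℕ → ℕ} : ex k c = ex k c' ↔ ∀ i : Fin k, c i = c' i := by
  simp [Finsupp.ext_iff]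

def cf (k : ℕ) (F : Pol k) (c : ℕ → ℕ) : ℤ := coeff (ex k c) F

lemma mono_eq (b : ℕ → ℕ) : mono k b = monomial (ex k b) 1 := by
  rw [mono, monomial_eq, C_1, one_mul, Finsupp.prod_fintype _ _ (fun i => pow_zero _)]
  rfl

open scoped Classical in
lemma cf_mono (b c : ℕ → ℕ) : cf k (mono k b) c = if ∀ i : Fin k, b i = c i then 1 else 0 := by
  rw [cf, mono_eq, coeff_monomial]
  congr 1
  exact propext ex_eq_iff

lemma ex_permFun (w : Equiv.Perm (Fin k)) (c : ℕ → ℕ) :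
    ex k (permFun w c) = Finsupp.mapDomain (w⁻¹ : Equiv.Perm (Fin k)) (ex k c) := by
  ext i
  rw [Finsupp.mapDomain_equiv_apply, ex_apply, permFun_fin]
  rfl

lemma cf_rename (w : Equiv.Perm (Fin k)) (F : Pol k) (c : ℕ → ℕ) :
    cf k (rename (w⁻¹ : Equiv.Perm (Fin k)) F) (permFun w c) = cf k F c := by
  rw [cf, ex_permFun, coeff_rename_mapDomain _ (Equiv.injective _)]
  rfl

lemma cf_permFun_of_isSymmetric {F : Pol k} (hF : F.IsSymmetric) (w : Equiv.Perm (Fin k)) (c : ℕ → ℕ) :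
    cf k F (permFun w c) = cf k F c := by
  conv_lhs => rw [← hF w⁻¹]
  exact cf_rename w F c

lemma rename_mono (w : Equiv.Perm (Fin k)) (b : ℕ → ℕ) :
    rename (w⁻¹ : Equiv.Perm (Fin k)) (mono k b) = mono k (permFun w b) := by
  rw [mono_eq, mono_eq, rename_monomial, ex_permFun]

lemma hom_isSymmetric (m : ℕ) : (hom k m).IsSymmetric := by
  intro w
  rw [hom, map_sum, ← sum_anti_perm w⁻¹ (mono k)]
  refine sum_congr rfl fun e _ => ?_
  have := rename_mono w⁻¹ e
  rwa [inv_inv] at this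

lemma isSymmetric_prod {I : Type*} (s : Finset I) (f : I → Pol k)
    (h : ∀ i ∈ s, (f i).IsSymmetric) : (∏ i ∈ s, f i).IsSymmetric := by
  intro w
  rw [map_prod]
  exact prod_congr rfl fun i hi => h i hi w

lemma isSymmetric_sum {I : Type*} (s : Finset I) (f : I → Pol k)
    (h : ∀ i ∈ s, (f i).IsSymmetric) : (∑ i ∈ s, f i).IsSymmetric := by
  intro w
  rw [map_sum]
  exact sum_congr rfl fun i hi => h i hi w

lemma schur_isSymmetric (nu : ℕ → ℕ) : (schur k nu).IsSymmetric := by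
  refine isSymmetric_sum _ _ fun c _ w => ?_
  rw [map_zsmul, isSymmetric_prod _ _ (fun j _ => hom_isSymmetric (c j)) w]

lemma rename_alt (w : Equiv.Perm (Fin k)) (b : ℕ → ℕ) :
    rename w (alt k b) = (Equiv.Perm.sign w : ℤ) • alt k b := by
  have := det_permute' w (of fun i j : Fin k => (X j ^ b i : Pol k))
  rw [zsmul_eq_mul]
  refine Eq.trans ?_ this
  rw [alt]
  change (rename w : Pol k →ₐ[ℤ] Pol k).toRingHom _ = _
  rw [RingHom.map_det]
  refine congrArg det (Matrix.ext fun i j => ?_)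
  simp

lemma eps_eq_sum (nu c : ℕ → ℕ) : eps k nu c = ∑ w : Equiv.Perm (Fin k), (Equiv.Perm.sign w : ℤ) *
    if ∀ i : Fin k, permFun w (nu + rho k) i = (c + rho k) i then 1 else 0 := by
  rw [eps, det_apply]
  refine sum_congr rfl fun w _ => ?_
  rw [Units.smul_def, smul_eq_mul]
  congr 1
  simp only [of_apply, permFun_fin, Pi.add_apply, Fintype.prod_ite_zero, prod_const_one]

lemma cf_alt (nu c : ℕ → ℕ) : cf k (alt k (nu + rho k)) (c + rho k) = eps k nu c := by
  classical
  rw [eps_eq_sum, alt_eq_sum, cf, coeff_sum]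
  refine sum_congr rfl fun w _ => ?_
  rw [coeff_smul, smul_eq_mul]
  have := cf_mono (k := k) (permFun w (nu + rho k)) (c + rho k)
  rw [cf] at this
  rw [this]

/-- The functional extracting the multiplicity of a Schur polynomial. -/
def multOf (k : ℕ) (nu : ℕ → ℕ) (F : Pol k) : ℤ :=
  ∑ c ∈ piAntidiag (range k) (sz k nu), eps k nu c * cf k F c

lemma multOf_sub (nu : ℕ → ℕ) (F F' : Pol k) :
    multOf k nu (F - F') = multOf k nu F - multOf k nu F' := by
  simp only [multOf, cf, coeff_sub, mul_sub, sum_sub_distrib]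

lemma multOf_sum {I : Type*} (s : Finset I) (nu : ℕ → ℕ) (F : I → Pol k) :
    multOf k nu (∑ i ∈ s, F i) = ∑ i ∈ s, multOf k nu (F i) := by
  simp only [multOf, cf, coeff_sum, mul_sum]
  exact sum_comm

lemma cf_mono_mul (b d : ℕ → ℕ) (F : Pol k) : cf k (mono k b * F) d =
    if ∀ i : Fin k, b i ≤ d i then cf k F (d - b) else 0 := by
  rw [cf, mono_eq, coeff_monomial_mul', one_mul]
  have : ex k b ≤ ex k d ↔ ∀ i : Fin k, b i ≤ d i := Iff.rfl
  simp only [this]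
  have h2 : ex k d - ex k b = ex k (d - b) := by ext i; simp
  rw [h2]
  split_ifs <;> rfl

lemma cf_congr {F : Pol k} {c c' : ℕ → ℕ} (h : ∀ i : Fin k, c i = c' i) : cf k F c = cf k F c' := by
  rw [cf, cf, ex_eq_iff.2 h]

lemma sz_permFun (w : Equiv.Perm (Fin k)) (e : ℕ → ℕ) : sz k (permFun w e) = sz k e := by
  simp only [sz, permFun_fin]
  exact Equiv.sum_comp w fun i : Fin k => e i

lemma cf_alt_mul {F : Pol k} (hF : F.IsSymmetric) (nu : ℕ → ℕ) :
    cf k (alt k (rho k) * F) (nu + rho k) = multOf k nu F := by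
  classical
  simp only [multOf, eps_eq_sum, sum_mul]
  rw [sum_comm, alt_eq_sum, sum_mul, cf, coeff_sum,
    ← Equiv.sum_comp (Equiv.inv (Equiv.Perm (Fin k)))]
  refine sum_congr rfl fun w _ => ?_
  simp only [Equiv.inv_apply, Equiv.Perm.sign_inv, smul_mul_assoc, coeff_smul, smul_eq_mul]
  simp only [mul_assoc, ← mul_sum]
  congr 1
  have h1 := cf_mono_mul (permFun w⁻¹ (rho k)) (nu + rho k) F
  rw [cf] at h1
  rw [h1]
  have hiff : (∀ i : Fin k, permFun w⁻¹ (rho k) i ≤ (nu + rho k) i) ↔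
      ∀ i : Fin k, rho k i ≤ permFun w (nu + rho k) i := by
    simp only [permFun_fin]
    constructor
    · intro h i; simpa using h (w i)
    · intro h i; simpa using h (w⁻¹ i)
  by_cases hle : ∀ i : Fin k, rho k i ≤ permFun w (nu + rho k) i
  · rw [if_pos (hiff.2 hle), ← cf_permFun_of_isSymmetric hF w]
    set c₀ : ℕ → ℕ := fun i => if i < k then permFun w (nu + rho k) i - rho k i else 0
    have hc₀ : ∀ i : Fin k, c₀ i = permFun w (nu + rho k) i - rho k i := fun i => if_pos i.2
    rw [sum_eq_single c₀]
    · rw [if_pos, one_mul]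
      · refine cf_congr fun i => ?_
        rw [hc₀, permFun_fin, permFun_fin, Pi.sub_apply, permFun_fin]
        simp
      · intro i
        have := hle i
        rw [Pi.add_apply, hc₀]; omega
    · intro c hc hne
      rw [if_neg, zero_mul]
      intro h
      apply hne
      ext i
      by_cases hi : i < k
      · have h2 := h ⟨i, hi⟩
        simp only [Pi.add_apply] at h2
        simp only [c₀, hi, if_true, h2, Nat.add_sub_cancel]
      · rw [(mem_anti.1 hc).2 i (by omega)]; simp [c₀, hi]
    · intro h
      exfalso
      refine h (mem_anti.2 ⟨?_, fun i hi => if_neg (by omega)⟩)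
      have h2 := sz_permFun w (nu + rho k)
      have h3 : ∑ i : Fin k, (c₀ i + rho k i) = sz k (permFun w (nu + rho k)) :=
        sum_congr rfl fun i _ => by rw [hc₀]; have := hle i; omega
      rw [h2, sum_add_distrib, sz] at h3
      simp only [Pi.add_apply, sum_add_distrib] at h3
      rw [sz]; omega
  · rw [if_neg (fun h => hle (hiff.1 h))]
    symm
    refine sum_eq_zero fun c _ => ?_
    rw [if_neg, zero_mul]
    intro h
    apply hle
    intro i
    rw [h i]
    simp

lemma alt_rho_ne_zero : alt k (rho k) ≠ 0 := by
  intro h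
  have h1 := cf_alt (k := k) 0 0
  rw [eps_antitone (k := k) (nu := 0) (c := 0) ⟨fun _ _ _ => le_rfl, fun _ _ => rfl⟩
    ⟨fun _ _ _ => le_rfl, fun _ _ => rfl⟩, if_pos rfl, zero_add, h] at h1
  simp [cf] at h1

lemma eq_zero_of_multOf {F : Pol k} (hF : F.IsSymmetric)
    (h : ∀ nu, PT k nu → multOf k nu F = 0) : F = 0 := by
  have hA : alt k (rho k) * F = 0 := by
    have hanti : ∀ (w : Equiv.Perm (Fin k)) c, (Equiv.Perm.sign w : ℤ) *
        cf k (alt k (rho k) * F) (permFun w c) = cf k (alt k (rho k) * F) c := by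
      intro w c
      rw [← cf_rename w (alt k (rho k) * F) c, map_mul, hF w⁻¹, rename_alt, Equiv.Perm.sign_inv,
        smul_mul_assoc, cf, cf, coeff_smul, smul_eq_mul]
    ext d
    rw [coeff_zero]
    set c : ℕ → ℕ := fun i => if h : i < k then d ⟨i, h⟩ else 0
    have hd : d = ex k c := by ext i; simp [c]
    rw [hd]
    change cf k _ c = 0
    let w : Equiv.Perm (Fin k) := Tuple.sort (fun i => OrderDual.toDual (d i))
    have hw : Antitone fun i : Fin k => permFun w c i := by
      have := Tuple.monotone_sort (fun i => OrderDual.toDual (d i))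
      intro i j hij
      have h1 := this hij
      simp only [permFun_fin]
      simpa [c] using h1
    rw [← hanti w, mul_eq_zero]
    right
    set b := permFun w c
    have hbk : ∀ i, k ≤ i → b i = 0 := fun i hi => permFun_of_le _ _ hi
    by_cases hs : ∃ i, i + 1 < k ∧ b i = b (i + 1)
    · obtain ⟨i, hi, hb⟩ := hs
      have hne : (⟨i, by omega⟩ : Fin k) ≠ ⟨i + 1, hi⟩ := by simp
      have h1 := hanti (Equiv.swap ⟨i, by omega⟩ ⟨i + 1, hi⟩) b
      rw [Equiv.Perm.sign_swap hne] at h1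
      have h2 : permFun (Equiv.swap (⟨i, by omega⟩ : Fin k) ⟨i + 1, hi⟩) b = b := by
        ext j
        by_cases hj : j < k
        · have h3 := permFun_fin (Equiv.swap (⟨i, by omega⟩ : Fin k) ⟨i + 1, hi⟩) b ⟨j, hj⟩
          simp only at h3
          rw [h3]
          rw [Equiv.swap_apply_def]
          split_ifs with h4 h5
          · simp only [Fin.mk.injEq] at h4; subst h4; exact hb.symm
          · simp only [Fin.mk.injEq] at h5; subst h5; exact hb
          · rfl
        · rw [permFun_of_le _ _ (by omega), hbk j (by omega)]
      rw [h2] at h1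
      push_cast at h1
      linarith
    · push Not at hs
      have hlt : ∀ i, i + 1 < k → b (i + 1) < b i := fun i hi =>
        lt_of_le_of_ne (hw (show (⟨i, by omega⟩ : Fin k) ≤ ⟨i + 1, hi⟩ from Nat.le_succ i))
          (hs i hi).symm
      have hge : ∀ i < k, rho k i ≤ b i := by
        have key : ∀ m i, i + m + 1 = k → m ≤ b i := by
          intro m
          induction m with
          | zero => intro _ _; exact Nat.zero_le _
          | succ m ih =>
            intro i hi
            have h1 := ih (i + 1) (by omega)
            have h2 := hlt i (by omega)
            omega
        intro i hi
        exact key _ i (by simp only [rho]; omega)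
      set nu : ℕ → ℕ := b - rho k
      have hnu : PT k nu := by
        refine ⟨antitone_nat_of_succ_le fun i => ?_, fun i hi => by simp [nu, hbk i hi]⟩
        simp only [nu, Pi.sub_apply]
        by_cases hi : i + 1 < k
        · have := hlt i hi
          have := hge i (by omega)
          simp only [rho] at *
          omega
        · rw [hbk (i + 1) (by omega)]; omega
      rw [← h nu hnu, ← cf_alt_mul hF]
      refine cf_congr fun i => ?_
      have := hge i i.2
      simp only [nu, Pi.add_apply, Pi.sub_apply]
      omega
  exact (mul_eq_zero.1 hA).resolve_left alt_rho_ne_zero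

/-- The chain of truncations of `ν`. -/
lemma good_from_zero {nu : ℕ → ℕ} {L : ℕ → ℕ → ℕ} (hL : L ∈ chains k 0 (sz k nu))
    (hG : Good k L) (hc : cont k L = nu) : ∀ s ≤ k, L s = fun i => if i < s then nu i else 0 := by
  obtain ⟨h1, h2, h3, h4⟩ := mem_chains.1 hL
  have hPT := chains_PT (g := 0) ⟨fun _ _ _ => le_rfl, fun _ _ => rfl⟩ hL
  have hzero : ∀ s ≤ k, ∀ i, s ≤ i → L s i = 0 := by
    intro s
    induction s with
    | zero => intro _ i _; rw [h1]; rfl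
    | succ s ih =>
      intro hs i hi
      obtain ⟨i, rfl⟩ : ∃ p, i = p + 1 := ⟨i - 1, by omega⟩
      have h5 := (h2 s (by omega)).1.2 i
      have h6 := ih (by omega) i (by omega)
      omega
  have hstep : ∀ s, s + 1 ≤ k → ∀ i < s, L (s + 1) i = L s i := by
    intro s
    induction s with
    | zero => intro _ i hi; omega
    | succ s ih =>
      intro hs i hi
      have ih := ih (by omega)
      have hv := hG s (L (s + 1) s)
      simp only [Viol, not_and, not_lt] at hv
      have hv := hv (by omega)
      have e1 : colTail k (L (s + 1)) (L (s + 1) s) = colTail k (L s) (L (s + 1) s) := by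
        refine sum_congr rfl fun i _ => ?_
        rcases lt_trichotomy (i : ℕ) s with h | h | h
        · rw [ih _ h]
        · rw [h, hzero s (by omega) s le_rfl]; omega
        · rw [hzero (s + 1) (by omega) _ h, hzero s (by omega) _ h.le]
      have hle : ∀ i ∈ (univ : Finset (Fin k)), L (s + 1) i - L (s + 1) s ≤
          L (s + 2) i - L (s + 1) s := fun i _ => by
        have : L (s + 1) i ≤ L (s + 2) i := (h2 (s + 1) (by omega)).1.1 i
        omega
      have e2 := (sum_eq_sum_iff_of_le hle).1 (by
        have := sum_le_sum hle
        simp only [colTail] at *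
        omega) ⟨i, by omega⟩ (mem_univ _)
      simp only at e2
      have h5 : L (s + 1) i ≤ L (s + 2) i := (h2 (s + 1) (by omega)).1.1 i
      have h6 : L (s + 1) s ≤ L (s + 1) i := (hPT (s + 1)).1 (by omega)
      have e3 : s + 1 + 1 = s + 2 := rfl
      rw [e3]
      omega
  intro s
  induction s with
  | zero => intro _; rw [h1]; ext i; simp
  | succ s ih =>
    intro hs
    have ih := ih (by omega)
    have hval : L (s + 1) s = nu s := by
      rw [← hc]
      simp only [cont]
      rw [if_pos (by omega), sz, sz, ← sum_range, ← sum_range]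
      have hs' : s ∈ range k := mem_range.2 (by omega)
      rw [← add_sum_erase _ _ hs', ← add_sum_erase _ (L s) hs',
        hzero s (by omega) s le_rfl]
      have : ∑ x ∈ (range k).erase s, L (s + 1) x = ∑ x ∈ (range k).erase s, L s x := by
        refine sum_congr rfl fun i hi => ?_
        rcases lt_trichotomy i s with h | h | h
        · exact hstep s (by omega) i h
        · exact absurd h (ne_of_mem_erase hi)
        · rw [hzero (s + 1) (by omega) _ h, hzero s (by omega) _ h.le]
      omega
    ext i
    rcases lt_trichotomy i s with h | h | h
    · rw [hstep s (by omega) i h, ih]; simp only; rw [if_pos h, if_pos (by omega)]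
    · subst h; rw [hval, if_pos (by omega)]
    · rw [hzero (s + 1) (by omega) i h, if_neg (by omega)]

lemma sum_trunc (nu : ℕ → ℕ) (f : ℕ → ℕ → ℕ) (hf : ∀ i, f 0 i = 0) {s : ℕ} (hs : s ≤ k) :
    ∑ i : Fin k, f (if (i : ℕ) < s then nu i else 0) i = ∑ i ∈ range s, f (nu i) i := by
  rw [← sum_range fun i => f (if i < s then nu i else 0) i,
    ← sum_subset (range_subset_range.2 hs) (fun i _ hi => by
      rw [if_neg (by simpa using hi), hf])]
  exact sum_congr rfl fun i hi => by rw [if_pos (mem_range.1 hi)]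

lemma alt_rho_mul_schur {nu : ℕ → ℕ} (hnu : PT k nu) :
    alt k (rho k) * schur k nu = alt k (nu + rho k) := by
  classical
  have h0 : PT k 0 := ⟨fun _ _ _ => le_rfl, fun _ _ => rfl⟩
  have := alt_mul_schur_good h0 hnu
  rw [zero_add] at this
  rw [this]
  set L₀ : ℕ → ℕ → ℕ := fun s i => if i < s then nu i else 0 with hL₀
  have hLk : ∀ s, k ≤ s → L₀ s = nu := fun s hs => by
    ext i
    simp only [hL₀]
    split_ifs with h
    · rfl
    · exact (hnu.2 i (by omega)).symm
  have hsz : ∀ s ≤ k, sz k (L₀ s) = ∑ i ∈ range s, nu i := fun s hs =>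
    sum_trunc nu (fun a _ => a) (fun _ => rfl) hs
  have hct : ∀ s ≤ k, ∀ j, colTail k (L₀ s) j = ∑ i ∈ range s, (nu i - j) := fun s hs j =>
    sum_trunc nu (fun a _ => a - j) (fun _ => Nat.zero_sub j) hs
  have hcont : cont k L₀ = nu := by
    ext s
    rw [cont]
    split_ifs with h
    · rw [hsz (s + 1) h, hsz s h.le, sum_range_succ]; omega
    · exact (hnu.2 s (by omega)).symm
  have hgood : Good k L₀ := by
    rintro r j ⟨hr, hv⟩
    rw [hct _ (by omega), hct _ (by omega), hct _ (by omega)] at hv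
    simp only [sum_range_succ] at hv
    have : nu (r + 1) ≤ nu r := hnu.1 (Nat.le_succ r)
    omega
  have hmem : L₀ ∈ chains k 0 (sz k nu) := by
    refine mem_chains.2 ⟨by ext i; simp [hL₀], fun s hs => ⟨⟨fun i => ?_, fun i => ?_⟩, fun i hi => ?_⟩,
      fun s hs => by rw [hLk s hs, hLk k le_rfl], by rw [hLk k le_rfl]; simp [sz]⟩
    · simp only [hL₀]; split_ifs <;> omega
    · have : nu (i + 1) ≤ nu i := hnu.1 (Nat.le_succ i)
      simp only [hL₀]; split_ifs <;> omega
    · simp only [hL₀]; rw [if_neg (by omega), if_neg (by omega)]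
  rw [sum_eq_single_of_mem L₀ (mem_filter.2 ⟨hmem, hgood, hcont⟩), hLk k le_rfl]
  intro L hL hne
  obtain ⟨hL, hG, hc⟩ := mem_filter.1 hL
  exfalso
  apply hne
  have h1 := good_from_zero hL hG hc
  ext1 s
  rcases le_total s k with h | h
  · exact h1 s h
  · rw [(mem_chains.1 hL).2.2.1 s h, h1 k le_rfl, hLk s h]
    exact hLk k le_rfl

lemma multOf_schur {nu kp : ℕ → ℕ} (hnu : PT k nu) (hkp : PT k kp) [Decidable (nu = kp)] :
    multOf k nu (schur k kp) = if nu = kp then 1 else 0 := by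
  rw [← cf_alt_mul (schur_isSymmetric kp), alt_rho_mul_schur hkp, cf_alt]
  classical
  convert eps_antitone hkp hnu

lemma eq_sum_schur {G : Pol k} (hG : G.IsSymmetric) (E : Finset (ℕ → ℕ)) (hE : ∀ nu ∈ E, PT k nu)
    (h1 : ∀ nu, PT k nu → nu ∈ E → multOf k nu G = 1)
    (h0 : ∀ nu, PT k nu → nu ∉ E → multOf k nu G = 0) : G = ∑ nu ∈ E, schur k nu := by
  classical
  rw [← sub_eq_zero]
  refine eq_zero_of_multOf (hG.sub (isSymmetric_sum _ _ fun nu _ => schur_isSymmetric nu)) ?_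
  intro nu hnu
  rw [multOf_sub, multOf_sum, sum_congr rfl fun x hx => multOf_schur hnu (hE x hx)]
  rw [sum_ite_eq]
  split_ifs with h
  · rw [h1 nu hnu h, sub_self]
  · rw [h0 nu hnu h, sub_self]

lemma multOf_schur_mul {g m l : ℕ → ℕ} (hg : PT k g) (hm : PT k m) (hl : PT k l) :
    multOf k l (schur k g * schur k m) = lrCoeff l g m := by
  classical
  rw [← cf_alt_mul ((schur_isSymmetric g).mul (schur_isSymmetric m)), ← mul_assoc,
    alt_rho_mul_schur hg, alt_mul_schur_good hg hm, lrCoeff_eq_card hl hg hm, cf, coeff_sum,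
    card_filter, Nat.cast_sum]
  refine sum_congr rfl fun L hL => ?_
  have := cf_alt (k := k) (L k) l
  rw [cf] at this
  rw [this, eps_antitone (chains_PT hg (mem_filter.1 hL).1 k) hl]
  simp [eq_comm]

end Symmetric

/-! ### Linear substitutions in polynomial rings -/

section Subst

open MvPolynomial

variable {σ : Type*} [Fintype σ] [DecidableEq σ]

/-- Composition of polynomial functions with a linear map. -/
def lsubst (L : (σ → ℂ) →ₗ[ℂ] (σ → ℂ)) : MvPolynomial σ ℂ →ₐ[ℂ] MvPolynomial σ ℂ :=
  aeval fun i => ∑ j, L (Pi.single j 1) i • X j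

@[simp] lemma eval_lsubst (L : (σ → ℂ) →ₗ[ℂ] (σ → ℂ)) (x : σ → ℂ) (p : MvPolynomial σ ℂ) :
    eval x (lsubst L p) = eval (L x) p := by
  have h : (eval x : MvPolynomial σ ℂ →+* ℂ).comp (lsubst L : MvPolynomial σ ℂ →ₐ[ℂ] _).toRingHom =
      eval (L x) := by
    refine MvPolynomial.ringHom_ext (fun r => ?_) fun i => ?_
    · simp [lsubst]
    · have := congrFun (LinearMap.pi_apply_eq_sum_univ L x) i
      simp only [Finset.sum_apply, Pi.smul_apply, smul_eq_mul] at this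
      simp only [lsubst, RingHom.comp_apply, AlgHom.toRingHom_eq_coe, RingHom.coe_coe, aeval_X,
        map_sum, smul_eval, eval_X, this]
      refine Finset.sum_congr rfl fun j _ => ?_
      rw [mul_comm]
      have h1 : (Pi.single j 1 : σ → ℂ) = fun i => if j = i then 1 else 0 := by
        ext a
        simp [Pi.single_apply, eq_comm]
      rw [h1]
  exact RingHom.congr_fun h p

lemma coeff_lsubst_diag (L : (σ → ℂ) →ₗ[ℂ] (σ → ℂ)) (c : σ → ℂ) (hL : ∀ x i, L x i = c i * x i)
    (m : σ →₀ ℕ) (p : MvPolynomial σ ℂ) :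
    coeff m (lsubst L p) = (∏ i, c i ^ m i) * coeff m p := by
  have hX : ∀ i, (∑ j, L (Pi.single j 1) i • X j : MvPolynomial σ ℂ) = c i • X i := by
    intro i
    rw [Finset.sum_eq_single i]
    · rw [hL]; simp
    · intro j _ hj
      rw [hL, Pi.single_eq_of_ne hj.symm, mul_zero, zero_smul]
    · simp
  induction p using MvPolynomial.induction_on' with
  | add p q hp hq => rw [map_add, coeff_add, hp, hq, coeff_add, mul_add]
  | monomial u a =>
    have : lsubst L (monomial u a) = (∏ i, c i ^ u i) • monomial u a := by
      rw [lsubst, aeval_monomial]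
      simp only [hX, smul_pow]
      rw [Finsupp.prod_fintype _ _ (by simp), monomial_eq, Finsupp.prod_fintype _ _ (by simp),
        algebraMap_eq]
      simp only [smul_eq_C_mul, Finset.prod_mul_distrib, map_prod]
      ring
    rw [this, coeff_smul, smul_eq_mul, coeff_monomial]
    split_ifs with h
    · rw [h]
    · simp

end Subst

/-! ### The ring of polynomials in two matrices and a symmetric matrix -/

section Ring

open MvPolynomial

variable {k : ℕ}

abbrev Vr (k : ℕ) : Type := (Fin k × Fin k) ⊕ (Fin k × Fin k) ⊕ Sym2 (Fin k)

abbrev Rg (k : ℕ) : Type := MvPolynomial (Vr k) ℂ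

def mA (x : Vr k → ℂ) : Mt k := of fun i j => x (Sum.inl (i, j))
def mB (x : Vr k → ℂ) : Mt k := of fun i j => x (Sum.inr (Sum.inl (i, j)))
def mS (x : Vr k → ℂ) : Mt k := of fun i j => x (Sum.inr (Sum.inr s(i, j)))

/-- The point with given matrices; the last one is symmetrized. -/
def pt (A B S : Mt k) : Vr k → ℂ := Sum.elim (fun a => A a.1 a.2) (Sum.elim (fun a => B a.1 a.2)
  (Sym2.lift ⟨fun i j => (S i j + S j i) / 2, fun i j => by simp only [add_comm]⟩))

@[simp] lemma mA_pt (A B S : Mt k) : mA (pt A B S) = A := rfl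
@[simp] lemma mB_pt (A B S : Mt k) : mB (pt A B S) = B := rfl

lemma mS_pt {A B S : Mt k} (hS : Sᵀ = S) : mS (pt A B S) = S := by
  ext i j
  have : S j i = S i j := congrFun (congrFun hS i) j
  simp [mS, pt, this]

lemma mS_symm (x : Vr k → ℂ) : (mS x)ᵀ = mS x := by
  ext i j
  simp [mS, Sym2.eq_swap]

lemma pt_self (x : Vr k → ℂ) : pt (mA x) (mB x) (mS x) = x := by
  ext a
  rcases a with a | a | a
  · rfl
  · rfl
  · induction a using Sym2.ind with
    | _ i j => simp [pt, mS, Sym2.eq_swap (a := j)]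

lemma pt_add (A B S A' B' S' : Mt k) :
    pt (A + A') (B + B') (S + S') = pt A B S + pt A' B' S' := by
  ext a
  rcases a with a | a | a
  · rfl
  · rfl
  · induction a using Sym2.ind with
    | _ i j => simp [pt]; ring

lemma pt_smul (c : ℂ) (A B S : Mt k) : pt (c • A) (c • B) (c • S) = c • pt A B S := by
  ext a
  rcases a with a | a | a
  · rfl
  · rfl
  · induction a using Sym2.ind with
    | _ i j => simp [pt]; ring

lemma mA_add (x y : Vr k → ℂ) : mA (x + y) = mA x + mA y := rfl
lemma mB_add (x y : Vr k → ℂ) : mB (x + y) = mB x + mB y := rfl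
lemma mS_add (x y : Vr k → ℂ) : mS (x + y) = mS x + mS y := rfl

lemma mA_smul (c : ℂ) (x : Vr k → ℂ) : mA (c • x) = c • mA x := rfl
lemma mB_smul (c : ℂ) (x : Vr k → ℂ) : mB (c • x) = c • mB x := rfl
lemma mS_smul (c : ℂ) (x : Vr k → ℂ) : mS (c • x) = c • mS x := rfl

lemma pt_ext {x y : Vr k → ℂ} (h1 : mA x = mA y) (h2 : mB x = mB y) (h3 : mS x = mS y) :
    x = y := by
  rw [← pt_self x, h1, h2, h3, pt_self]

/-- The simultaneous action `(A, B, S) ↦ (gᵀ A h, gᵀ B l, gᵀ S g)` on points. -/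
def tri (g h l : Mt k) : (Vr k → ℂ) →ₗ[ℂ] (Vr k → ℂ) where
  toFun x := pt (gᵀ * mA x * h) (gᵀ * mB x * l) (gᵀ * mS x * g)
  map_add' x y := by
    simp only [mA_add, mB_add, mS_add, Matrix.mul_add, Matrix.add_mul, pt_add]
  map_smul' c x := by
    simp only [mA_smul, mB_smul, mS_smul, Matrix.mul_smul, Matrix.smul_mul, pt_smul,
      RingHom.id_apply]

@[simp] lemma mA_tri (g h l : Mt k) (x : Vr k → ℂ) : mA (tri g h l x) = gᵀ * mA x * h := rfl
@[simp] lemma mB_tri (g h l : Mt k) (x : Vr k → ℂ) : mB (tri g h l x) = gᵀ * mB x * l := rfl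
@[simp] lemma mS_tri (g h l : Mt k) (x : Vr k → ℂ) : mS (tri g h l x) = gᵀ * mS x * g :=
  mS_pt (by simp [transpose_mul, mS_symm, Matrix.mul_assoc])

lemma tri_tri (g h l g' h' l' : Mt k) (x : Vr k → ℂ) :
    tri g' h' l' (tri g h l x) = tri (g * g') (h * h') (l * l') x := by
  apply pt_ext <;> simp [transpose_mul, Matrix.mul_assoc]

lemma tri_one (x : Vr k → ℂ) : tri 1 1 1 x = x := by
  apply pt_ext <;> simp

def triAct (g h l : Mt k) : Rg k →ₐ[ℂ] Rg k := lsubst (tri g h l)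

@[simp] lemma eval_triAct (g h l : Mt k) (x : Vr k → ℂ) (p : Rg k) :
    eval x (triAct g h l p) = eval (tri g h l x) p := eval_lsubst _ _ _

lemma triAct_triAct (g h l g' h' l' : Mt k) (p : Rg k) :
    triAct g h l (triAct g' h' l' p) = triAct (g * g') (h * h') (l * l') p := by
  apply MvPolynomial.funext
  intro x
  simp only [eval_triAct, tri_tri]

lemma triAct_one (p : Rg k) : triAct 1 1 1 p = p := by
  apply MvPolynomial.funext
  intro x
  simp only [eval_triAct, tri_one]

def act1 (k : ℕ) : Representation ℂ (GL (Fin k) ℂ) (Rg k) where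
  toFun g := (triAct (g : Mt k) 1 1).toLinearMap
  map_one' := LinearMap.ext fun p => by simpa using triAct_one p
  map_mul' g h := LinearMap.ext fun p => by simp [triAct_triAct]

def act2 (k : ℕ) : Representation ℂ (GL (Fin k) ℂ) (Rg k) where
  toFun g := (triAct 1 (g : Mt k) 1).toLinearMap
  map_one' := LinearMap.ext fun p => by simpa using triAct_one p
  map_mul' g h := LinearMap.ext fun p => by simp [triAct_triAct]

def act3 (k : ℕ) : Representation ℂ (GL (Fin k) ℂ) (Rg k) where
  toFun g := (triAct 1 1 (g : Mt k)).toLinearMap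
  map_one' := LinearMap.ext fun p => by simpa using triAct_one p
  map_mul' g h := LinearMap.ext fun p => by simp [triAct_triAct]

lemma act1_apply (g : GL (Fin k) ℂ) (p : Rg k) : act1 k g p = triAct (g : Mt k) 1 1 p := rfl
lemma act2_apply (g : GL (Fin k) ℂ) (p : Rg k) : act2 k g p = triAct 1 (g : Mt k) 1 p := rfl
lemma act3_apply (g : GL (Fin k) ℂ) (p : Rg k) : act3 k g p = triAct 1 1 (g : Mt k) p := rfl

lemma act12_comm (g h : GL (Fin k) ℂ) (p : Rg k) :
    act1 k g (act2 k h p) = act2 k h (act1 k g p) := by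
  simp [act1_apply, act2_apply, triAct_triAct]

lemma act13_comm (g h : GL (Fin k) ℂ) (p : Rg k) :
    act1 k g (act3 k h p) = act3 k h (act1 k g p) := by
  simp [act1_apply, act3_apply, triAct_triAct]

lemma act23_comm (g h : GL (Fin k) ℂ) (p : Rg k) :
    act2 k g (act3 k h p) = act3 k h (act2 k g p) := by
  simp [act2_apply, act3_apply, triAct_triAct]

/-! #### Weights -/

/-- The multiplicity of `i` in an unordered pair. -/
def smult (i : Fin k) : Sym2 (Fin k) → ℕ :=
  Sym2.lift ⟨fun a b => (if a = i then 1 else 0) + if b = i then 1 else 0,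
    fun a b => by simp only [add_comm]⟩

def wt1 (m : Vr k →₀ ℕ) (i : ℕ) : ℕ := if h : i < k then
  ∑ j, m (Sum.inl (⟨i, h⟩, j)) + (∑ j, m (Sum.inr (Sum.inl (⟨i, h⟩, j))) +
    ∑ s, smult ⟨i, h⟩ s * m (Sum.inr (Sum.inr s))) else 0

def wt2 (m : Vr k →₀ ℕ) (j : ℕ) : ℕ := if h : j < k then ∑ i, m (Sum.inl (i, ⟨j, h⟩)) else 0

def wt3 (m : Vr k →₀ ℕ) (j : ℕ) : ℕ := if h : j < k then ∑ i, m (Sum.inr (Sum.inl (i, ⟨j, h⟩)))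
  else 0

lemma wt1_fin (m : Vr k →₀ ℕ) (i : Fin k) : wt1 m i = ∑ j, m (Sum.inl (i, j)) +
    (∑ j, m (Sum.inr (Sum.inl (i, j))) + ∑ s, smult i s * m (Sum.inr (Sum.inr s))) := dif_pos i.2

lemma wt2_fin (m : Vr k →₀ ℕ) (j : Fin k) : wt2 m j = ∑ i, m (Sum.inl (i, j)) := dif_pos j.2

lemma wt3_fin (m : Vr k →₀ ℕ) (j : Fin k) : wt3 m j = ∑ i, m (Sum.inr (Sum.inl (i, j))) :=
  dif_pos j.2

lemma coeff_triAct_diag (t u v : Fin k → ℂ) (m : Vr k →₀ ℕ) (p : Rg k) :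
    coeff m (triAct (diagonal t) (diagonal u) (diagonal v) p) =
      (∏ i : Fin k, t i ^ wt1 m i) * (∏ i : Fin k, u i ^ wt2 m i) * (∏ i : Fin k, v i ^ wt3 m i) *
        coeff m p := by
  set c : Vr k → ℂ := Sum.elim (fun a => t a.1 * u a.2) (Sum.elim (fun a => t a.1 * v a.2)
    (fun s => ∏ i, t i ^ smult i s))
  have hS : ∀ a b : Fin k, ∏ i, t i ^ smult i s(a, b) = t a * t b := by
    intro a b
    simp only [smult, Sym2.lift_mk, pow_add, Finset.prod_mul_distrib, pow_ite, pow_one, pow_zero,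
      Finset.prod_ite_eq, Finset.mem_univ, if_true]
  rw [triAct, coeff_lsubst_diag _ c]
  · congr 1
    rw [Fintype.prod_sum_type, Fintype.prod_sum_type]
    simp only [c, Sum.elim_inl, Sum.elim_inr, mul_pow, Finset.prod_mul_distrib, wt1_fin, wt2_fin,
      wt3_fin, pow_add, Fintype.prod_prod_type, ← Finset.prod_pow_eq_pow_sum, ← pow_mul,
      ← Finset.prod_pow]
    rw [Finset.prod_comm (f := fun (x x_1 : Fin k) => u x_1 ^ m (Sum.inl (x, x_1))),
      Finset.prod_comm (f := fun (x x_1 : Fin k) => v x_1 ^ m (Sum.inr (Sum.inl (x, x_1)))),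
      Finset.prod_comm (f := fun (s : Sym2 (Fin k)) i => t i ^ (smult i s * m (Sum.inr (Sum.inr s))))]
    ring
  · intro x a
    rcases a with ⟨i, j⟩ | ⟨i, j⟩ | s
    · change mA (tri (diagonal t) (diagonal u) (diagonal v) x) i j = _
      rw [mA_tri, diagonal_transpose, mul_diagonal, diagonal_mul]
      simp [c, mA]; ring
    · change mB (tri (diagonal t) (diagonal u) (diagonal v) x) i j = _
      rw [mB_tri, diagonal_transpose, mul_diagonal, diagonal_mul]
      simp [c, mB]; ring
    · induction s using Sym2.ind with
      | _ i j =>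
        change mS (tri (diagonal t) (diagonal u) (diagonal v) x) i j = _
        simp only [mS_tri, diagonal_transpose, mul_diagonal, diagonal_mul, c, Sum.elim_inr, hS]
        simp [mS]; ring

def dA (m : Vr k →₀ ℕ) : ℕ := ∑ a, m (Sum.inl a)
def dB (m : Vr k →₀ ℕ) : ℕ := ∑ a, m (Sum.inr (Sum.inl a))
def dS (m : Vr k →₀ ℕ) : ℕ := ∑ a, m (Sum.inr (Sum.inr a))

lemma sz_wt2 (m : Vr k →₀ ℕ) : sz k (wt2 m) = dA m := by
  simp only [sz, wt2_fin, dA, Fintype.sum_prod_type]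
  exact Finset.sum_comm

lemma sz_wt3 (m : Vr k →₀ ℕ) : sz k (wt3 m) = dB m := by
  simp only [sz, wt3_fin, dB, Fintype.sum_prod_type]
  exact Finset.sum_comm

lemma sum_smult (s : Sym2 (Fin k)) : ∑ i, smult i s = 2 := by
  induction s using Sym2.ind with
  | _ a b => simp [smult, Finset.sum_add_distrib]

lemma sz_wt1 (m : Vr k →₀ ℕ) : sz k (wt1 m) = dA m + dB m + 2 * dS m := by
  simp only [sz, wt1_fin, dA, dB, dS, Fintype.sum_prod_type, Finset.sum_add_distrib]
  rw [Finset.sum_comm (f := fun i s => smult i s * m (Sum.inr (Sum.inr s)))]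
  simp only [← Finset.sum_mul, sum_smult, ← Finset.mul_sum]
  ring

end Ring

/-! ### Weights of polynomial representations of the general linear group -/

namespace CellData

section General

variable {G : Type*} [Group G] {C : CellData G} {V W : Type*} [AddCommGroup V] [Module ℂ V]
  [AddCommGroup W] [Module ℂ W] {ρ : Representation ℂ G V} {π : Representation ℂ G W} {χ : G → ℂ}

lemma finrank_map_subtype_eq (U : Submodule ℂ V) (P : Submodule ℂ U) (Q : Submodule ℂ V)
    (h : ∀ x : U, x ∈ P ↔ (x : V) ∈ Q) :
    finrank ℂ P = finrank ℂ (U ⊓ Q : Submodule ℂ V) := by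
  have : P.map U.subtype = U ⊓ Q := by
    ext x
    constructor
    · rintro ⟨y, hy, rfl⟩
      exact ⟨y.2, (h y).1 hy⟩
    · rintro ⟨h1, h2⟩
      exact ⟨⟨x, h1⟩, (h _).2 h2, rfl⟩
  rw [← this]
  exact (Submodule.equivMapOfInjective U.subtype U.injective_subtype P).finrank_eq

lemma finrank_Wt_subRep {U : Submodule ℂ V} (hU : IsSubrep ρ U) :
    finrank ℂ (C.Wt (subRep ρ U hU) χ) =
      finrank ℂ (U ⊓ C.Wt ρ χ : Submodule ℂ V) := by
  refine finrank_map_subtype_eq U _ _ fun x => ?_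
  simp only [mem_Wt, Subtype.ext_iff, subRep_apply, Submodule.coe_smul]

lemma finrank_HW_subRep {U : Submodule ℂ V} (hU : IsSubrep ρ U) :
    finrank ℂ (C.HW (subRep ρ U hU) χ) =
      finrank ℂ (U ⊓ C.HW ρ χ : Submodule ℂ V) := by
  refine finrank_map_subtype_eq U _ _ fun x => ?_
  simp only [mem_HW, Subtype.ext_iff, subRep_apply, Submodule.coe_smul]

lemma finrank_eq_of_mem_iff {P : Submodule ℂ V} {Q : Submodule ℂ W} (e : V ≃ₗ[ℂ] W)
    (h : ∀ y, e y ∈ Q ↔ y ∈ P) : finrank ℂ P = finrank ℂ Q := by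
  have : P.map (e : V →ₗ[ℂ] W) = Q := by
    ext x
    obtain ⟨y, rfl⟩ := e.surjective x
    rw [Submodule.mem_map_equiv, e.symm_apply_apply, h]
  rw [← this]
  exact (LinearEquiv.finrank_map_eq e _).symm

lemma finrank_Wt_equiv (e : V ≃ₗ[ℂ] W) (he : ∀ g x, e (ρ g x) = π g (e x)) :
    finrank ℂ (C.Wt ρ χ) = finrank ℂ (C.Wt π χ) :=
  finrank_eq_of_mem_iff e fun y => by
    simp only [mem_Wt, ← he, ← map_smul, e.injective.eq_iff]

lemma finrank_isCompl {U U' : Submodule ℂ V} [FiniteDimensional ℂ V] (hc : IsCompl U U')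
    (Q : Submodule ℂ V) (h : ∀ u ∈ U, ∀ u' ∈ U', u + u' ∈ Q → u ∈ Q) :
    finrank ℂ Q = finrank ℂ (U ⊓ Q : Submodule ℂ V) +
      finrank ℂ (U' ⊓ Q : Submodule ℂ V) := by
  rw [← Submodule.finrank_sup_add_finrank_inf_eq]
  have h1 : (U ⊓ Q) ⊔ (U' ⊓ Q) = Q := by
    refine le_antisymm (sup_le inf_le_right inf_le_right) fun x hx => ?_
    have hx' : x ∈ U ⊔ U' := by rw [hc.sup_eq_top]; trivial
    obtain ⟨u, hu, u', hu', rfl⟩ := Submodule.mem_sup.1 hx'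
    have := h u hu u' hu' hx
    refine Submodule.add_mem_sup ⟨hu, this⟩ ⟨hu', ?_⟩
    simpa using sub_mem hx this
  have h2 : (U ⊓ Q) ⊓ (U' ⊓ Q) = ⊥ := by
    rw [eq_bot_iff, ← hc.inf_eq_bot]
    exact inf_le_inf inf_le_left inf_le_left
  rw [h1, h2]
  simp

lemma eq_zero_of_isCompl {U U' : Submodule ℂ V} (hc : IsCompl U U') {a b : V} (ha : a ∈ U)
    (hb : b ∈ U') (h : a + b = 0) : a = 0 := by
  have : a ∈ U ⊓ U' := ⟨ha, by rw [eq_neg_of_add_eq_zero_left h]; exact neg_mem hb⟩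
  rwa [hc.inf_eq_bot, Submodule.mem_bot] at this

lemma finrank_Wt_isCompl [FiniteDimensional ℂ V] {U U' : Submodule ℂ V} (hc : IsCompl U U')
    (hU : IsSubrep ρ U) (hU' : IsSubrep ρ U') :
    finrank ℂ (C.Wt ρ χ) = finrank ℂ (C.Wt (subRep ρ U hU) χ) +
      finrank ℂ (C.Wt (subRep ρ U' hU') χ) := by
  rw [finrank_Wt_subRep, finrank_Wt_subRep]
  refine finrank_isCompl hc _ fun u hu u' hu' h t ht => ?_
  have := h t ht
  rw [← sub_eq_zero]
  refine eq_zero_of_isCompl hc (sub_mem (hU t u hu) (U.smul_mem _ hu))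
    (sub_mem (hU' t u' hu') (U'.smul_mem (χ t) hu')) ?_
  rw [map_add, smul_add] at this
  rw [← sub_eq_zero] at this
  rw [← this]
  abel

lemma finrank_HW_isCompl [FiniteDimensional ℂ V] {U U' : Submodule ℂ V} (hc : IsCompl U U')
    (hU : IsSubrep ρ U) (hU' : IsSubrep ρ U') :
    finrank ℂ (C.HW ρ χ) = finrank ℂ (C.HW (subRep ρ U hU) χ) +
      finrank ℂ (C.HW (subRep ρ U' hU') χ) := by
  rw [finrank_HW_subRep, finrank_HW_subRep]
  refine finrank_isCompl hc _ fun u hu u' hu' h => ?_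
  have key : ∀ g : G, ∀ c : ℂ, ρ g (u + u') = c • (u + u') → ρ g u = c • u := by
    intro g c hg
    rw [← sub_eq_zero]
    refine eq_zero_of_isCompl hc (sub_mem (hU g u hu) (U.smul_mem _ hu))
      (sub_mem (hU' g u' hu') (U'.smul_mem c hu')) ?_
    rw [map_add, smul_add, ← sub_eq_zero] at hg
    rw [← hg]
    abel
  refine mem_HW.2 ⟨fun x hx s => ?_, fun t ht => key _ _ ((mem_HW.1 h).2 t ht)⟩
  simpa using key (x s) 1 (by simpa using (mem_HW.1 h).1 x hx s)

lemma finrank_HW_irreducible [FiniteDimensional ℂ V] {χ' : G → ℂ} (hρ : IsIrreducibleRep ρ) {v : V}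
    (hv : v ∈ C.HW ρ χ) (hv0 : v ≠ 0) [Decidable (∀ t ∈ C.T, χ t = χ' t)] :
    finrank ℂ (C.HW ρ χ') = if ∀ t ∈ C.T, χ t = χ' t then 1 else 0 := by
  split_ifs with h
  · have hv' : v ∈ C.HW ρ χ' := mem_HW.2 ⟨(mem_HW.1 hv).1, fun t ht => by
      rw [← h t ht]; exact (mem_HW.1 hv).2 t ht⟩
    refine finrank_eq_one (⟨v, hv'⟩ : C.HW ρ χ') (by simpa [Subtype.ext_iff] using hv0) fun w => ?_
    by_cases hw : (w : V) = 0
    · exact ⟨0, by rw [zero_smul]; exact Subtype.ext hw.symm⟩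
    · obtain ⟨-, c, hc⟩ := hw_unique hρ hv' hv0 w.2 hw
      exact ⟨c, Subtype.ext hc.symm⟩
  · have : C.HW ρ χ' = ⊥ := by
      rw [eq_bot_iff]
      intro w hw
      by_contra hw0
      exact h (hw_unique hρ hv hv0 hw hw0).1
    rw [this]
    simp

end General

end CellData

section GLWeights

variable {k : ℕ}

/-- Characters of the diagonal torus, extended to all matrices. -/
def glChar (k : ℕ) (a : ℕ → ℕ) (g : GL (Fin k) ℂ) : ℂ := ∏ i : Fin k, (g : Mt k) i i ^ a i

lemma glChar_dg (a : ℕ → ℕ) (d : Fin k → ℂˣ) : glChar k a (dg d) = ∏ i : Fin k, (d i : ℂ) ^ a i := by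
  simp [glChar]

lemma glChar_inj {a b : ℕ → ℕ} (h : ∀ t ∈ (glCell k).T, glChar k a t = glChar k b t) (i : Fin k) :
    a i = b i := by
  have h2 : (2 : ℂ) ≠ 0 := two_ne_zero
  have := h (dg fun j => if j = i then Units.mk0 2 h2 else 1) ⟨_, rfl⟩
  rw [glChar_dg, glChar_dg] at this
  have key : ∀ c : ℕ → ℕ, ∏ j : Fin k, (((if j = i then Units.mk0 2 h2 else 1 : ℂˣ)) : ℂ) ^ c j =
      2 ^ c i := by
    intro c
    rw [Finset.prod_eq_single i]
    · simp
    · intro j _ hj; simp [hj]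
    · simp
  rw [key, key] at this
  exact Nat.pow_right_injective le_rfl (by exact_mod_cast this)

def ht (k : ℕ) (a : ℕ → ℕ) : ℕ := ∑ i : Fin k, (k - (i : ℕ)) * a i

lemma glChar_scale (a : ℕ → ℕ) {m : ℕ} (hm : 1 ≤ m) :
    glChar k a ((glCell k).c m) * (m : ℂ) ^ ht k a = 1 := by
  change glChar k a (glScale k m) * _ = 1
  have hm0 : (m : ℂ) ≠ 0 := by exact_mod_cast (by omega : m ≠ 0)
  rw [glScale, glChar_dg, ht, ← Finset.prod_pow_eq_pow_sum, ← Finset.prod_mul_distrib]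
  refine Finset.prod_eq_one fun i _ => ?_
  rw [pow_mul, ← mul_pow]
  push_cast
  rw [scaleUnit_val hm, ← mul_pow, inv_mul_cancel₀ hm0, one_pow, one_pow]

def permGL (w : Equiv.Perm (Fin k)) : GL (Fin k) ℂ where
  val := of fun i j => if w i = j then 1 else 0
  inv := of fun i j => if w j = i then 1 else 0
  val_inv := by
    ext i j
    simp [Matrix.mul_apply, Matrix.one_apply, eq_comm]
  inv_val := by
    ext i j
    simp only [Matrix.mul_apply, of_apply, Matrix.one_apply, ite_mul, one_mul, zero_mul]
    rw [Finset.sum_eq_single (w.symm i)]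
    · simp
    · intro b _ hb
      rw [if_neg]
      intro h
      exact hb (by rw [← h, w.symm_apply_apply])
    · simp

lemma dg_mul_permGL (w : Equiv.Perm (Fin k)) (d : Fin k → ℂˣ) :
    dg d * permGL w = permGL w * dg fun i => d (w.symm i) := by
  apply Units.ext
  ext i j
  rw [Units.val_mul, Units.val_mul, dg_val, dg_val, diagonal_mul, mul_diagonal]
  simp only [permGL, of_apply]
  split_ifs with h
  · simp [← h]
  · simp

variable {V : Type*} [AddCommGroup V] [Module ℂ V] {ρ : Representation ℂ (GL (Fin k) ℂ) V}

lemma permGL_mem_Wt (w : Equiv.Perm (Fin k)) {a : ℕ → ℕ} {v : V}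
    (hv : v ∈ (glCell k).Wt ρ (glChar k a)) :
    ρ (permGL w) v ∈ (glCell k).Wt ρ (glChar k (permFun w a)) := by
  rintro _ ⟨d, rfl⟩
  rw [← Module.End.mul_apply, ← map_mul, dg_mul_permGL, map_mul, Module.End.mul_apply,
    hv _ ⟨_, rfl⟩, map_smul, glChar_dg, glChar_dg]
  congr 1
  simp only [permFun_fin]
  exact Fintype.prod_equiv w.symm _ _ fun i => by simp

lemma permFun_inv_permFun (w : Equiv.Perm (Fin k)) {a : ℕ → ℕ} (i : Fin k) :
    permFun w⁻¹ (permFun w a) i = a i := by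
  rw [permFun_fin, permFun_fin]
  simp

lemma glChar_congr {a b : ℕ → ℕ} (h : ∀ i : Fin k, a i = b i) : glChar k a = glChar k b := by
  ext g
  exact Finset.prod_congr rfl fun i _ => by rw [h]

lemma finrank_Wt_permFun [FiniteDimensional ℂ V] (w : Equiv.Perm (Fin k)) (a : ℕ → ℕ) :
    finrank ℂ ((glCell k).Wt ρ (glChar k (permFun w a))) =
      finrank ℂ ((glCell k).Wt ρ (glChar k a)) := by
  have key : ∀ (w : Equiv.Perm (Fin k)) (a : ℕ → ℕ),
      finrank ℂ ((glCell k).Wt ρ (glChar k a)) ≤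
      finrank ℂ ((glCell k).Wt ρ (glChar k (permFun w a))) := by
    intro w a
    have hinj : Function.Injective (ρ (permGL w)) := by
      intro x y hxy
      have := congrArg (ρ (permGL w)⁻¹) hxy
      simpa only [← Module.End.mul_apply, ← map_mul, inv_mul_cancel, map_one,
        Module.End.one_apply] using this
    rw [(Submodule.equivMapOfInjective (ρ (permGL w)) hinj _).finrank_eq]
    refine Submodule.finrank_mono ?_
    rintro _ ⟨v, hv, rfl⟩
    exact permGL_mem_Wt w hv
  refine le_antisymm ?_ (key w a)
  refine (key w⁻¹ _).trans (le_of_eq ?_)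
  rw [glChar_congr (permFun_inv_permFun w)]

/-- Polynomial representations, homogeneous of degree `d`: weight functionals with polynomial
weights of size `d` separate points. -/
def HasPolyWeights (d : ℕ) (ρ : Representation ℂ (GL (Fin k) ℂ) V) : Prop :=
  ∃ (ι : Type) (ξ : ι → Dual ℂ V) (w : ι → ℕ → ℕ),
    (∀ i, w i ∈ Finset.piAntidiag (Finset.range k) d) ∧
    (∀ i, ∀ t ∈ (glCell k).T, ∀ v, ξ i (ρ t v) = glChar k (w i) t * ξ i v) ∧
    ∀ v, (∀ i, ξ i v = 0) → v = 0

lemma HasPolyWeights.sub {d : ℕ} (h : HasPolyWeights d ρ) (U : Submodule ℂ V) (hU : IsSubrep ρ U) :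
    HasPolyWeights d (subRep ρ U hU) := by
  obtain ⟨ι, ξ, w, h1, h2, h3⟩ := h
  exact ⟨ι, fun i => (ξ i).comp U.subtype, w, h1, fun i t ht v => h2 i t ht v,
    fun v hv => Subtype.ext (h3 v hv)⟩

lemma mem_piAntidiag_range {d : ℕ} {a : ℕ → ℕ} : a ∈ Finset.piAntidiag (Finset.range k) d ↔
    sz k a = d ∧ ∀ i, k ≤ i → a i = 0 := by
  rw [Finset.mem_piAntidiag, sz, Finset.sum_range]
  refine and_congr_right fun _ => forall_congr' fun i => ?_
  rw [Finset.mem_range, ← not_le, not_imp_comm, not_not]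

lemma ht_swap_lt {a : ℕ → ℕ} {r : ℕ} (hr : r + 1 < k) (h : a r < a (r + 1)) :
    ht k a < ht k (permFun (Equiv.swap ⟨r, by omega⟩ ⟨r + 1, hr⟩) a) := by
  set p : Fin k := ⟨r, by omega⟩
  set q : Fin k := ⟨r + 1, hr⟩
  have hpq : p ≠ q := by simp [p, q]
  simp only [ht, permFun_fin]
  rw [← Finset.add_sum_erase _ _ (Finset.mem_univ p), ← Finset.add_sum_erase _ _ (Finset.mem_univ p),
    ← Finset.add_sum_erase _ _ (Finset.mem_erase.2 ⟨hpq.symm, Finset.mem_univ q⟩),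
    ← Finset.add_sum_erase _ _ (Finset.mem_erase.2 ⟨hpq.symm, Finset.mem_univ q⟩), ← add_assoc,
    ← add_assoc, Equiv.swap_apply_left, Equiv.swap_apply_right]
  have h1 : ∑ x ∈ (Finset.univ.erase p).erase q, (k - (x : ℕ)) * a (Equiv.swap p q x) =
      ∑ x ∈ (Finset.univ.erase p).erase q, (k - (x : ℕ)) * a x := by
    refine Finset.sum_congr rfl fun x hx => ?_
    simp only [Finset.mem_erase] at hx
    rw [Equiv.swap_apply_of_ne_of_ne hx.2.1 hx.1]
  rw [h1]
  refine Nat.add_lt_add_right ?_ _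
  obtain ⟨s, hs⟩ : ∃ s, k = r + 1 + s := ⟨k - (r + 1), by omega⟩
  have e1 : k - (p : ℕ) = s + 1 := by simp only [p]; omega
  have e2 : k - (q : ℕ) = s := by simp only [q]; omega
  rw [e1, e2]
  simp only [p, q]
  nlinarith

theorem HasPolyWeights.exists_max_hw [FiniteDimensional ℂ V] [Nontrivial V] {d : ℕ} (h : HasPolyWeights d ρ) :
    ∃ a, PT k a ∧ sz k a = d ∧ (∃ v, v ≠ 0 ∧ v ∈ (glCell k).HW ρ (glChar k a)) ∧
      (glCell k).Wt ρ (glChar k a) ≤ (glCell k).HW ρ (glChar k a) ∧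
      ∀ b ∈ Finset.piAntidiag (Finset.range k) d, (glCell k).Wt ρ (glChar k b) ≠ ⊥ →
        ht k b ≤ ht k a := by
  classical
  obtain ⟨ι, ξ, w, h1, h2, h3⟩ := h
  set A := (Finset.piAntidiag (Finset.range k) d).filter fun a =>
    (glCell k).Wt ρ (glChar k a) ≠ ⊥
  have hA : ∀ i, ξ i ≠ 0 → w i ∈ A := by
    intro i hi
    obtain ⟨v, hv0, hv⟩ := CellData.exists_weight_of_dual hi (h2 i)
    refine Finset.mem_filter.2 ⟨h1 i, fun hb => hv0 ?_⟩
    rw [hb] at hv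
    exact hv
  have hne : A.Nonempty := by
    obtain ⟨v, hv⟩ := exists_ne (0 : V)
    by_contra hA'
    refine hv (h3 v fun i => ?_)
    by_contra hi
    exact hA' ⟨w i, hA i fun h0 => hi (by rw [h0]; rfl)⟩
  obtain ⟨a, haA, hmax⟩ := Finset.exists_max_image A (ht k) hne
  obtain ⟨had, hab⟩ := Finset.mem_filter.1 haA
  obtain ⟨hsz, hsupp⟩ := mem_piAntidiag_range.1 had
  obtain ⟨v, hv, hv0⟩ := Submodule.exists_mem_ne_zero_of_ne_bot hab
  suffices hle : (glCell k).Wt ρ (glChar k a) ≤ (glCell k).HW ρ (glChar k a) by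
    refine ⟨a, ⟨antitone_nat_of_succ_le fun r => ?_, hsupp⟩, hsz, ⟨v, hv0, hle hv⟩, hle,
      fun b hb hb' => hmax b (Finset.mem_filter.2 ⟨hb, hb'⟩)⟩
    · by_contra hlt
      push Not at hlt
      have hr : r + 1 < k := by
        by_contra hr
        rw [hsupp (r + 1) (by omega)] at hlt
        omega
      refine absurd (hmax (permFun (Equiv.swap ⟨r, by omega⟩ ⟨r + 1, hr⟩) a)
        (Finset.mem_filter.2 ⟨mem_piAntidiag_range.2 ⟨by rw [sz_permFun, hsz], fun i hi => ?_⟩,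
        fun hb => ?_⟩)) (not_le.2 (ht_swap_lt hr hlt))
      · rw [permFun, dif_neg (by omega)]
      · have := permGL_mem_Wt (Equiv.swap ⟨r, by omega⟩ ⟨r + 1, hr⟩) hv
        rw [hb, Submodule.mem_bot] at this
        apply hv0
        have h' := congrArg (ρ (permGL (Equiv.swap ⟨r, by omega⟩ ⟨r + 1, hr⟩))⁻¹) this
        simpa only [← Module.End.mul_apply, ← map_mul, inv_mul_cancel, map_one,
          Module.End.one_apply, map_zero] using h'
  · intro v hv
    refine CellData.mem_HW.2 ⟨fun x hx s => ?_, hv⟩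
    rw [← sub_eq_zero]
    refine h3 _ fun i => ?_
    rw [map_sub, sub_eq_zero]
    by_cases hi : ξ i = 0
    · simp [hi]
    have hle := hmax _ (hA i hi)
    obtain ⟨b, hb, hconj⟩ := (glCell k).up_conj x hx
    have hx' : x ∈ (glCell k).Lo ∪ (glCell k).Up := Or.inr hx
    have hpoly := polyFn_of_isNilpotent (CellData.unipotent (ρ := ρ) hx' s) b (ξ i) v
    set f : ℕ → ℂ := fun m => ξ i ((ρ (x s) ^ (m ^ b)) v) with hf
    have hf0 : f 0 = ξ i v := by simp [hf, zero_pow (by omega : b ≠ 0)]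
    have hf1 : f 1 = ξ i (ρ (x s) v) := by simp [hf]
    have hstep : ∀ m : ℕ, 1 ≤ m → (m : ℂ) ^ ht k a * f m = (m : ℂ) ^ ht k (w i) * f 1 := by
      intro m hm
      have e1 : ρ (x s) ^ (m ^ b) = ρ (((glCell k).c m)⁻¹ * x s * (glCell k).c m) := by
        rw [hconj m hm, ← map_pow]
        congr 1
        have := one_param_pow (X := x) ((glCell k).add x hx') ((glCell k).root_zero hx') s (m ^ b)
        rw [← this]
        push_cast
        rfl
      have hT := (glCell k).hc m
      have e3 := h2 i _ hT (ρ (((glCell k).c m)⁻¹ * x s * (glCell k).c m) v)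
      rw [← Module.End.mul_apply, ← map_mul, mul_assoc, mul_inv_cancel_left] at e3
      have e4 : f m = ξ i (ρ (((glCell k).c m)⁻¹ * x s * (glCell k).c m) v) := by
        rw [hf]; simp only; rw [e1]
      rw [← mul_assoc ((glCell k).c m)⁻¹, ← e4, map_mul, Module.End.mul_apply, hv _ hT, map_smul, map_smul, smul_eq_mul,
        ← hf1] at e3
      have s1 := glChar_scale (k := k) a hm
      have s2 := glChar_scale (k := k) (w i) hm
      linear_combination (-((m : ℂ) ^ ht k a * (m : ℂ) ^ ht k (w i))) * e3 -
        (m : ℂ) ^ ht k a * f m * s2 + (m : ℂ) ^ ht k (w i) * f 1 * s1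
    have hm0 : ∀ m : ℕ, 1 ≤ m → (m : ℂ) ≠ 0 := fun m hm => by exact_mod_cast (by omega : m ≠ 0)
    rw [← hf0, ← hf1]
    rcases hle.eq_or_lt with he | hlt
    · refine (PolyFn.eq_of_const hpoly (f 1) (fun m hm => ?_) 0).symm
      have := hstep m hm
      rw [he] at this
      exact mul_left_cancel₀ (pow_ne_zero _ (hm0 m hm)) this
    · obtain ⟨p, hp⟩ : ∃ p, ht k a = ht k (w i) + (p + 1) :=
        ⟨ht k a - ht k (w i) - 1, by omega⟩
      have hst : ∀ m : ℕ, 1 ≤ m → (m : ℂ) ^ (p + 1) * f m = f 1 := by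
        intro m hm
        have := hstep m hm
        rw [hp, pow_add, mul_assoc] at this
        exact mul_left_cancel₀ (pow_ne_zero _ (hm0 m hm)) this
      have hz := PolyFn.eq_of_const ((PolyFn.natCast.pow (p + 1)).mul hpoly) (f 1) hst 0
      simp only [Nat.cast_zero, zero_pow (Nat.succ_ne_zero p), zero_mul] at hz
      rw [← hz]
      refine (PolyFn.eq_of_const hpoly 0 (fun m hm => ?_) 0).symm
      have := hst m hm
      rw [← hz] at this
      exact (mul_eq_zero.1 this).resolve_left (pow_ne_zero _ (hm0 m hm))

theorem HasPolyWeights.exists_hw [FiniteDimensional ℂ V] [Nontrivial V] {d : ℕ} (h : HasPolyWeights d ρ) :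
    ∃ a, PT k a ∧ sz k a = d ∧ ∃ v, v ≠ 0 ∧ v ∈ (glCell k).HW ρ (glChar k a) :=
  let ⟨a, h1, h2, h3, _⟩ := h.exists_max_hw
  ⟨a, h1, h2, h3⟩

end GLWeights

/-! ### Products of leading minors -/

section HwFun

variable {n : ℕ}

/-- The product of leading minors which is a highest weight function of weight `lam`. -/
def hwFun (lam : ℕ → ℕ) (g : Mt n) : ℂ :=
  ∏ i : Fin n, minor (i + 1) g ^ (lam i - lam (i + 1))

lemma sum_tail_sub {lam : ℕ → ℕ} (h : PT n lam) (j : Fin n) :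
    ∑ i : Fin n, (if (j : ℕ) < i + 1 then lam i - lam (i + 1) else 0) = lam j := by
  have key : ∀ N, (j : ℕ) ≤ N →
      ∑ i ∈ Finset.range N, (if (j : ℕ) < i + 1 then lam i - lam (i + 1) else 0) + lam N = lam j := by
    intro N hN
    induction N, hN using Nat.le_induction with
    | base =>
      rw [Finset.sum_eq_zero, zero_add]
      intro i hi
      rw [if_neg (by have := Finset.mem_range.1 hi; omega)]
    | succ N hN ih =>
      rw [Finset.sum_range_succ, if_pos (by omega)]
      have := h.1 (Nat.le_succ N)
      simp only [Nat.succ_eq_add_one] at this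
      omega
  have := key n j.2.le
  rw [h.2 n le_rfl, add_zero, Finset.sum_range] at this
  exact this

lemma prod_diag_pow {lam : ℕ → ℕ} (h : PT n lam) (t : Fin n → ℂ) :
    ∏ i : Fin n, (∏ j : Fin n, if (j : ℕ) < (i : ℕ) + 1 then t j else 1) ^ (lam i - lam (i + 1)) =
      ∏ j : Fin n, t j ^ lam j := by
  simp only [← Finset.prod_pow]
  rw [Finset.prod_comm]
  refine Finset.prod_congr rfl fun j _ => ?_
  conv_rhs => rw [← sum_tail_sub h j, ← Finset.prod_pow_eq_pow_sum]
  refine Finset.prod_congr rfl fun i _ => ?_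
  split_ifs <;> simp

lemma hwFun_lower_mul {lam : ℕ → ℕ} (h : PT n lam) {l : Mt n}
    (hl : ∀ i j, i < j → l i j = 0) (g : Mt n) :
    hwFun lam (l * g) = (∏ j : Fin n, l j j ^ lam j) * hwFun lam g := by
  rw [← prod_diag_pow h, hwFun, hwFun, ← Finset.prod_mul_distrib]
  refine Finset.prod_congr rfl fun i _ => ?_
  rw [minor_mul_of_lower _ hl, mul_pow, minor_lower hl]

lemma hwFun_transpose (lam : ℕ → ℕ) (g : Mt n) :
    hwFun lam gᵀ = hwFun lam g := by
  simp only [hwFun, minor_transpose]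

lemma hwFun_mul_upper {lam : ℕ → ℕ} (h : PT n lam) {u : Mt n}
    (hu : ∀ i j, j < i → u i j = 0) (g : Mt n) :
    hwFun lam (g * u) = (∏ j : Fin n, u j j ^ lam j) * hwFun lam g := by
  rw [← hwFun_transpose, transpose_mul, hwFun_lower_mul (l := uᵀ) h (fun i j hij => hu j i hij),
    hwFun_transpose]
  rfl

lemma hwFun_one (lam : ℕ → ℕ) : hwFun lam (1 : Mt n) = 1 := by
  simp [hwFun, IsLowerUni.one.minor_eq]

end HwFun

section Ring

open MvPolynomial

variable {k : ℕ}

/-! ### Graded pieces -/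

def Rd (k d₁ d₂ e : ℕ) : Submodule ℂ (Rg k) :=
  restrictSupport ℂ {m | dA m = d₁ ∧ dB m = d₂ ∧ dS m = e}

lemma mem_Rd {d₁ d₂ e : ℕ} {p : Rg k} :
    p ∈ Rd k d₁ d₂ e ↔ ∀ m, coeff m p ≠ 0 → dA m = d₁ ∧ dB m = d₂ ∧ dS m = e := by
  rw [Rd, mem_restrictSupport_iff]
  simp only [Set.subset_def, Finset.mem_coe, mem_support_iff]
  rfl

def scl (r s q : ℂ) : (Vr k → ℂ) →ₗ[ℂ] (Vr k → ℂ) where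
  toFun x := pt (r • mA x) (s • mB x) (q • mS x)
  map_add' x y := by simp only [mA_add, mB_add, mS_add, smul_add, pt_add]
  map_smul' c x := by
    simp only [mA_smul, mB_smul, mS_smul, smul_comm _ c, pt_smul, RingHom.id_apply]

@[simp] lemma mA_scl (r s q : ℂ) (x : Vr k → ℂ) : mA (scl r s q x) = r • mA x := rfl
@[simp] lemma mB_scl (r s q : ℂ) (x : Vr k → ℂ) : mB (scl r s q x) = s • mB x := rfl
@[simp] lemma mS_scl (r s q : ℂ) (x : Vr k → ℂ) : mS (scl r s q x) = q • mS x :=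
  mS_pt (by rw [transpose_smul, mS_symm])

lemma scl_tri (r s q : ℂ) (g h l : Mt k) (x : Vr k → ℂ) :
    scl r s q (tri g h l x) = tri g h l (scl r s q x) := by
  apply pt_ext <;> simp

lemma coeff_scl (r s q : ℂ) (m : Vr k →₀ ℕ) (p : Rg k) :
    coeff m (lsubst (scl r s q) p) = r ^ dA m * s ^ dB m * q ^ dS m * coeff m p := by
  rw [coeff_lsubst_diag _ (Sum.elim (fun _ => r) (Sum.elim (fun _ => s) (fun _ => q)))]
  · rw [Fintype.prod_sum_type, Fintype.prod_sum_type]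
    simp only [Sum.elim_inl, Sum.elim_inr, Finset.prod_pow_eq_pow_sum, dA, dB, dS, mul_assoc]
  · intro x a
    rcases a with a | a | a
    · rfl
    · rfl
    · induction a using Sym2.ind with
      | _ i j => exact congrFun (congrFun (mS_scl r s q x) i) j

lemma mem_Rd_iff_eval {d₁ d₂ e : ℕ} {p : Rg k} : p ∈ Rd k d₁ d₂ e ↔
    ∀ r s q x, eval (scl r s q x) p = r ^ d₁ * s ^ d₂ * q ^ e * eval x p := by
  rw [mem_Rd]
  constructor
  · intro h r s q x
    rw [← eval_lsubst, ← smul_eval]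
    congr 1
    ext m
    rw [coeff_scl, coeff_smul, smul_eq_mul]
    by_cases hm : coeff m p = 0
    · rw [hm, mul_zero, mul_zero]
    · obtain ⟨h1, h2, h3⟩ := h m hm
      rw [h1, h2, h3]
  · intro h m hm
    have key : ∀ r s q : ℂ, r ^ dA m * s ^ dB m * q ^ dS m = r ^ d₁ * s ^ d₂ * q ^ e := by
      intro r s q
      have : lsubst (scl r s q) p = (r ^ d₁ * s ^ d₂ * q ^ e) • p :=
        MvPolynomial.funext fun x => by rw [eval_lsubst, h, smul_eval]
      have := congrArg (coeff m) this
      rw [coeff_scl, coeff_smul, smul_eq_mul] at this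
      exact mul_right_cancel₀ hm this
    have h1 := key 2 1 1
    have h2 := key 1 2 1
    have h3 := key 1 1 2
    simp only [one_pow, mul_one, one_mul] at h1 h2 h3
    refine ⟨?_, ?_, ?_⟩ <;> apply Nat.pow_right_injective le_rfl
    · exact_mod_cast h1
    · exact_mod_cast h2
    · exact_mod_cast h3

lemma triAct_mem_Rd {d₁ d₂ e : ℕ} {p : Rg k} (hp : p ∈ Rd k d₁ d₂ e) (g h l : Mt k) :
    triAct g h l p ∈ Rd k d₁ d₂ e := by
  rw [mem_Rd_iff_eval] at hp ⊢
  intro r s q x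
  rw [eval_triAct, eval_triAct, ← scl_tri, hp]

/-! ### Generators -/

abbrev Vz (k : ℕ) : Type := (Fin k × Fin k) ⊕ (Fin k × Fin k) ⊕ (Fin k × Fin k)

def zg (k : ℕ) : Vz k → Rg k := Sum.elim (fun a => X (Sum.inl a))
  (Sum.elim (fun a => X (Sum.inr (Sum.inl a))) (fun a => X (Sum.inr (Sum.inr s(a.1, a.2)))))

def tauM (g h l : Mt k) : Matrix (Vz k) (Vz k) ℂ :=
  fromBlocks (kroneckerMap (· * ·) g h) 0 0
    (fromBlocks (kroneckerMap (· * ·) g l) 0 0 (kroneckerMap (· * ·) g g))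

lemma tauM_conjTranspose (g h l : Mt k) : (tauM g h l)ᴴ = tauM gᴴ hᴴ lᴴ := by
  rw [tauM, fromBlocks_conjTranspose, fromBlocks_conjTranspose, conjTranspose_zero]
  simp only [conjTranspose_kronecker]
  simp [tauM]

lemma triAct_zg (g h l : Mt k) (j : Vz k) : triAct g h l (zg k j) = ∑ i, tauM g h l i j • zg k i := by
  apply MvPolynomial.funext
  intro x
  rw [eval_triAct]
  simp only [Fintype.sum_sum_type]
  have eA : ∀ (y : Vr k → ℂ) a, eval y (zg k (Sum.inl a)) = mA y a.1 a.2 := fun y a => by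
    simp [zg, mA]
  have eB : ∀ (y : Vr k → ℂ) a, eval y (zg k (Sum.inr (Sum.inl a))) = mB y a.1 a.2 := fun y a => by
    simp [zg, mB]
  have eS : ∀ (y : Vr k → ℂ) a, eval y (zg k (Sum.inr (Sum.inr a))) = mS y a.1 a.2 := fun y a => by
    simp [zg, mS]
  have key : ∀ (P Q M : Mt k) (a : Fin k × Fin k), (Pᵀ * M * Q) a.1 a.2 =
      ∑ b : Fin k × Fin k, P b.1 a.1 * Q b.2 a.2 * M b.1 b.2 := by
    intro P Q M a
    simp only [Matrix.mul_apply, transpose_apply, Finset.sum_mul, Fintype.sum_prod_type]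
    rw [Finset.sum_comm]
    refine Finset.sum_congr rfl fun _ _ => Finset.sum_congr rfl fun _ _ => by ring
  rcases j with j | j | j
  · simp [eA, tauM, key]
  · simp [eB, tauM, key]
  · simp [eS, tauM, key]

lemma mul_mem_monoSpan {ι 𝒜 : Type*} [Fintype ι] [CommRing 𝒜] [Algebra ℂ 𝒜] (z : ι → 𝒜) (j : ι)
    {D : ℕ} {p : 𝒜} (hp : p ∈ monoSpan z D) : z j * p ∈ monoSpan z (D + 1) := by
  refine Submodule.span_induction (p := fun p _ => z j * p ∈ monoSpan z (D + 1)) ?_ ?_ ?_ ?_ hp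
  · rintro _ ⟨I, rfl⟩
    refine Submodule.subset_span ⟨Fin.cons j I, ?_⟩
    simp [Fin.prod_univ_succ]
  · rw [mul_zero]; exact zero_mem _
  · intro a b _ _ ha hb
    rw [mul_add]
    exact add_mem ha hb
  · intro c a _ ha
    rw [mul_smul_comm]
    exact Submodule.smul_mem _ _ ha

lemma monomial_mem_monoSpan {σ ι : Type*} [Fintype σ] [Fintype ι] (z : ι → MvPolynomial σ ℂ)
    (hz : ∀ v, ∃ j, z j = X v) (D : ℕ) (m : σ →₀ ℕ) (hm : ∑ v, m v = D) :
    monomial m 1 ∈ monoSpan z D := by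
  classical
  induction D generalizing m with
  | zero =>
    have : m = 0 := by
      ext v
      exact Finset.sum_eq_zero_iff.1 hm v (Finset.mem_univ v)
    rw [this]
    exact Submodule.subset_span ⟨Fin.elim0, by simp⟩
  | succ D ih =>
    obtain ⟨v, -, hv⟩ : ∃ v ∈ Finset.univ, m v ≠ 0 := by
      by_contra hc
      push Not at hc
      rw [Finset.sum_eq_zero hc] at hm
      omega
    have hle : Finsupp.single v 1 ≤ m := by
      rw [Finsupp.single_le_iff]; omega
    have hsplit : m = Finsupp.single v 1 + (m - Finsupp.single v 1) := (add_tsub_cancel_of_le hle).symm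
    have hmon : (monomial m 1 : MvPolynomial σ ℂ) = X v * monomial (m - Finsupp.single v 1) 1 := by
      conv_lhs => rw [hsplit]
      rw [X, monomial_mul, one_mul]
    obtain ⟨j, hj⟩ := hz v
    rw [hmon, ← hj]
    refine mul_mem_monoSpan z j (ih _ ?_)
    have h1 : ∑ w, (Finsupp.single v 1 : σ →₀ ℕ) w = 1 := by
      simp [Finsupp.single_apply]
    have h2 : ∑ w, m w = ∑ w, (Finsupp.single v 1 : σ →₀ ℕ) w + ∑ w, (m - Finsupp.single v 1 : σ →₀ ℕ) w := by
      rw [← Finset.sum_add_distrib]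
      refine Finset.sum_congr rfl fun w _ => ?_
      conv_lhs => rw [hsplit]
      rfl
    omega

lemma Rd_le_monoSpan (d₁ d₂ e : ℕ) : Rd k d₁ d₂ e ≤ monoSpan (zg k) (d₁ + d₂ + e) := by
  rw [Rd, restrictSupport_eq_span, Submodule.span_le]
  rintro _ ⟨m, ⟨h1, h2, h3⟩, rfl⟩
  refine monomial_mem_monoSpan _ ?_ _ m ?_
  · rintro (a | a | a)
    · exact ⟨Sum.inl a, rfl⟩
    · exact ⟨Sum.inr (Sum.inl a), rfl⟩
    · induction a using Sym2.ind with
      | _ i j => exact ⟨Sum.inr (Sum.inr (i, j)), rfl⟩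
  · rw [← h1, ← h2, ← h3, Fintype.sum_sum_type, Fintype.sum_sum_type, dA, dB, dS, add_assoc]

instance (d₁ d₂ e : ℕ) : FiniteDimensional ℂ (Rd k d₁ d₂ e) :=
  Submodule.finiteDimensional_of_le (Rd_le_monoSpan d₁ d₂ e)

/-- The common features of the three actions. -/
structure IsAct (ρ : Representation ℂ (GL (Fin k) ℂ) (Rg k)) (w : (Vr k →₀ ℕ) → ℕ → ℕ) : Prop where
  tri : ∃ f : Mt k → Mt k × Mt k × Mt k, ∀ g p, ρ g p = triAct (f g).1 (f g).2.1 (f g).2.2 p ∧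
    f gᴴ = ((f g).1ᴴ, (f g).2.1ᴴ, (f g).2.2ᴴ)
  supp : ∀ m i, k ≤ i → w m i = 0
  coeff : ∀ d m p, MvPolynomial.coeff m (ρ (dg d) p) =
    glChar k (w m) (dg d) * MvPolynomial.coeff m p

lemma isAct1 : IsAct (act1 k) wt1 where
  tri := ⟨fun g => (g, 1, 1), fun g p => ⟨rfl, by simp⟩⟩
  supp m i hi := by rw [wt1, dif_neg (by omega)]
  coeff d m p := by
    rw [act1_apply, dg_val, ← diagonal_one, coeff_triAct_diag, glChar_dg]
    simp

lemma isAct2 : IsAct (act2 k) wt2 where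
  tri := ⟨fun g => (1, g, 1), fun g p => ⟨rfl, by simp⟩⟩
  supp m i hi := by rw [wt2, dif_neg (by omega)]
  coeff d m p := by
    rw [act2_apply, dg_val, ← diagonal_one, coeff_triAct_diag, glChar_dg]
    simp

lemma isAct3 : IsAct (act3 k) wt3 where
  tri := ⟨fun g => (1, 1, g), fun g p => ⟨rfl, by simp⟩⟩
  supp m i hi := by rw [wt3, dif_neg (by omega)]
  coeff d m p := by
    rw [act3_apply, dg_val, ← diagonal_one, coeff_triAct_diag, glChar_dg]
    simp

namespace IsAct

variable {ρ : Representation ℂ (GL (Fin k) ℂ) (Rg k)} {w : (Vr k →₀ ℕ) → ℕ → ℕ}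

lemma isSubrep_Rd (h : IsAct ρ w) (d₁ d₂ e : ℕ) : IsSubrep ρ (Rd k d₁ d₂ e) := by
  obtain ⟨f, hf⟩ := h.tri
  intro g p hp
  rw [(hf g p).1]
  exact triAct_mem_Rd hp _ _ _

lemma mem_Wt (h : IsAct ρ w) {a : ℕ → ℕ} {p : Rg k} : p ∈ (glCell k).Wt ρ (glChar k a) ↔
    ∀ m, MvPolynomial.coeff m p ≠ 0 → ∀ i : Fin k, w m i = a i := by
  constructor
  · intro hp m hm
    refine glChar_inj ?_
    rintro _ ⟨d, rfl⟩
    have := congrArg (MvPolynomial.coeff m) (hp (dg d) ⟨d, rfl⟩)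
    rw [h.coeff, coeff_smul, smul_eq_mul] at this
    exact mul_right_cancel₀ hm this
  · rintro hp _ ⟨d, rfl⟩
    ext m
    rw [h.coeff, coeff_smul, smul_eq_mul]
    by_cases hm : MvPolynomial.coeff m p = 0
    · rw [hm, mul_zero, mul_zero]
    · rw [glChar_congr (hp m hm)]

lemma ss (h : IsAct ρ w) {d₁ d₂ e : ℕ} {U : Submodule ℂ (Rg k)} (hU : IsSubrep ρ U)
    (hle : U ≤ Rd k d₁ d₂ e) : SS (subRep ρ U hU) := by
  obtain ⟨f, hf⟩ := h.tri
  refine exists_isCompl_of_starClosed ρ (fun g a b => ?_) (fun g => ?_) (zg k) (fun g => ?_)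
    (d₁ + d₂ + e) hU (hle.trans (Rd_le_monoSpan d₁ d₂ e))
  · simp only [(hf g _).1, map_mul]
  · simp only [(hf g _).1, map_one]
  · refine ⟨tauM (f g).1 (f g).2.1 (f g).2.2, fun j => ?_, star g, fun j => ?_⟩
    · rw [(hf g _).1, triAct_zg]
    · rw [(hf _ _).1, tauM_conjTranspose, Units.coe_star, star_eq_conjTranspose, (hf g 0).2,
        triAct_zg]

lemma hasPolyWeights (h : IsAct ρ w) {d₁ d₂ e d : ℕ} {U : Submodule ℂ (Rg k)} (hU : IsSubrep ρ U)
    (hle : U ≤ Rd k d₁ d₂ e)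
    (hd : ∀ m, dA m = d₁ → dB m = d₂ → dS m = e → sz k (w m) = d) :
    HasPolyWeights d (subRep ρ U hU) := by
  refine ⟨{m : Vr k →₀ ℕ // dA m = d₁ ∧ dB m = d₂ ∧ dS m = e}, fun m =>
    (MvPolynomial.lcoeff ℂ m.1).comp U.subtype, fun m => w m.1, fun m => ?_, ?_, fun v hv => ?_⟩
  · exact mem_piAntidiag_range.2 ⟨hd _ m.2.1 m.2.2.1 m.2.2.2, h.supp _⟩
  · rintro m _ ⟨d, rfl⟩ v
    exact h.coeff d m.1 v
  · ext m
    by_contra hm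
    exact hm (hv ⟨m, mem_Rd.1 (hle v.2) m hm⟩)

end IsAct

end Ring

section Model

open MvPolynomial

variable {k : ℕ}

/-! ### Highest weight polynomials -/

def hwPoly (lam : ℕ → ℕ) (M : Matrix (Fin k) (Fin k) (Rg k)) : Rg k :=
  ∏ s : Fin k, (det (of fun i j : Fin k =>
    if (i : ℕ) < s + 1 ∧ (j : ℕ) < s + 1 then M i j else if i = j then 1 else 0)) ^
      (lam s - lam (s + 1))

lemma eval_hwPoly (lam : ℕ → ℕ) (M : Matrix (Fin k) (Fin k) (Rg k)) (x : Vr k → ℂ) :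
    eval x (hwPoly lam M) = hwFun lam (M.map (eval x)) := by
  rw [hwPoly, hwFun, map_prod]
  refine Finset.prod_congr rfl fun s _ => ?_
  rw [map_pow, RingHom.map_det]
  refine congrArg (· ^ _) (congrArg det (Matrix.ext fun i j => ?_))
  simp only [RingHom.mapMatrix_apply, map_apply, of_apply, trunc_apply]
  split_ifs <;> simp

def XA (k : ℕ) : Matrix (Fin k) (Fin k) (Rg k) := of fun i j => X (Sum.inl (i, j))

def XB (k : ℕ) : Matrix (Fin k) (Fin k) (Rg k) := of fun i j => X (Sum.inr (Sum.inl (i, j)))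

def XS (k : ℕ) : Matrix (Fin k) (Fin k) (Rg k) := of fun i j => X (Sum.inr (Sum.inr s(i, j)))

@[simp] lemma XA_map (x : Vr k → ℂ) : (XA k).map (eval x) = mA x := by
  ext i j; simp [XA, mA]

@[simp] lemma XB_map (x : Vr k → ℂ) : (XB k).map (eval x) = mB x := by
  ext i j; simp [XB, mB]

@[simp] lemma XS_map (x : Vr k → ℂ) : (XS k).map (eval x) = mS x := by
  ext i j; simp [XS, mS]

lemma eval_det_map (M : Matrix (Fin k) (Fin k) (Rg k)) (x : Vr k → ℂ) :
    eval x M.det = (M.map (eval x)).det := by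
  rw [RingHom.map_det]; rfl

lemma hwFun_smul {lam : ℕ → ℕ} (h : PT k lam) (r : ℂ) (g : Mt k) :
    hwFun lam (r • g) = r ^ sz k lam * hwFun lam g := by
  rw [smul_eq_diagonal_mul, hwFun_lower_mul h]
  · simp [sz, Finset.prod_pow_eq_pow_sum]
  · intro i j hij
    rw [diagonal_apply_ne _ hij.ne]

lemma tri_pt (g h l A B S : Mt k) (hS : Sᵀ = S) :
    tri g h l (pt A B S) = pt (gᵀ * A * h) (gᵀ * B * l) (gᵀ * S * g) := by
  apply pt_ext
  · simp
  · simp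
  · rw [mS_tri, mS_pt hS, mS_pt]
    rw [transpose_mul, transpose_mul, hS, transpose_transpose, Matrix.mul_assoc]

lemma IsUpperUni.transpose_lower {u : Mt k} (hu : IsUpperUni u) :
    ∀ i j, i < j → uᵀ i j = 0 := fun i j hij => hu.2 j i hij

lemma glUp_upper {x : ℂ → GL (Fin k) ℂ} (hx : x ∈ (glCell k).Up) (s : ℂ) :
    IsUpperUni (x s : Mt k) := by
  obtain ⟨i, j, hij, rfl⟩ := hx
  exact tv_upper hij s

lemma hwPoly_mem_Rd {lam : ℕ → ℕ} (h : PT k lam) : hwPoly lam (XA k) ∈ Rd k (sz k lam) 0 0 := by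
  rw [mem_Rd_iff_eval]
  intro r s q x
  rw [eval_hwPoly, eval_hwPoly, XA_map, XA_map, mA_scl, hwFun_smul h]
  simp

lemma hwPoly_mem_HW1 {lam : ℕ → ℕ} (h : PT k lam) :
    hwPoly lam (XA k) ∈ (glCell k).HW (act1 k) (glChar k lam) := by
  refine ⟨fun x hx s => ?_, ?_⟩
  · refine MvPolynomial.funext fun y => ?_
    have hu := glUp_upper hx s
    rw [act1_apply, eval_triAct, eval_hwPoly, eval_hwPoly, XA_map, XA_map, mA_tri, Matrix.mul_one,
      hwFun_lower_mul h hu.transpose_lower]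
    simp [hu.1]
  · rintro _ ⟨d, rfl⟩
    refine MvPolynomial.funext fun y => ?_
    rw [act1_apply, eval_triAct, smul_eval, eval_hwPoly, eval_hwPoly, XA_map, XA_map, mA_tri,
      Matrix.mul_one, hwFun_lower_mul h, glChar_dg]
    · simp
    · intro i j hij
      simp [hij.ne']

lemma hwPoly_XA_ne_zero (lam : ℕ → ℕ) : hwPoly lam (XA k) ≠ 0 := by
  intro h
  have := congrArg (eval (pt 1 0 0)) h
  rw [eval_hwPoly, XA_map, mA_pt, hwFun_one, map_zero] at this
  exact one_ne_zero this

/-! ### The model of an irreducible polynomial representation -/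

lemma isSubrep_HW_of_comm {G H V : Type*} [Group G] [Group H] [AddCommGroup V] [Module ℂ V]
    {ρ : Representation ℂ G V} {π : Representation ℂ H V} (hc : ∀ g h v, ρ g (π h v) = π h (ρ g v))
    (C : CellData G) (χ : G → ℂ) : IsSubrep π (C.HW ρ χ) := by
  intro h v hv
  refine ⟨fun x hx s => ?_, fun t ht => ?_⟩
  · rw [hc, hv.1 x hx s]
  · rw [hc, hv.2 t ht, map_smul]

lemma isSubrep_Wt_of_comm {G H V : Type*} [Group G] [Group H] [AddCommGroup V] [Module ℂ V]
    {ρ : Representation ℂ G V} {π : Representation ℂ H V} (hc : ∀ g h v, ρ g (π h v) = π h (ρ g v))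
    (C : CellData G) (χ : G → ℂ) : IsSubrep π (C.Wt ρ χ) := by
  intro h v hv t ht
  rw [hc, hv t ht, map_smul]

def Md (k : ℕ) (lam : ℕ → ℕ) : Submodule ℂ (Rg k) :=
  Rd k (sz k lam) 0 0 ⊓ (glCell k).HW (act1 k) (glChar k lam)

lemma Md_le (lam : ℕ → ℕ) : Md k lam ≤ Rd k (sz k lam) 0 0 := inf_le_left

lemma isSubrep_Md (lam : ℕ → ℕ) : IsSubrep (act2 k) (Md k lam) :=
  (isAct2.isSubrep_Rd _ _ _).inf (isSubrep_HW_of_comm act12_comm _ _)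

instance (lam : ℕ → ℕ) : FiniteDimensional ℂ (Md k lam) :=
  Submodule.finiteDimensional_of_le (Md_le lam)

def Mrep (k : ℕ) (lam : ℕ → ℕ) : Representation ℂ (GL (Fin k) ℂ) (Md k lam) :=
  subRep (act2 k) (Md k lam) (isSubrep_Md lam)

lemma eval_eq_of_Rd {d : ℕ} {y : Rg k} (hy : y ∈ Rd k d 0 0) (x : Vr k → ℂ) :
    eval x y = eval (pt (mA x) 0 0) y := by
  have h1 := mem_Rd_iff_eval.1 hy 1 0 0 x
  have h2 : scl 1 0 0 x = pt (mA x) 0 0 := by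
    apply pt_ext
    · simp
    · simp
    · rw [mS_scl, mS_pt (by simp), zero_smul]
  rw [← h2, h1]
  simp

lemma eq_zero_of_eval_mul {D y : Rg k} (hD : D ≠ 0) (h : ∀ x, eval x D ≠ 0 → eval x y = 0) :
    y = 0 := by
  have : D * y = 0 := by
    refine MvPolynomial.funext fun x => ?_
    rw [map_mul, map_zero]
    by_cases hx : eval x D = 0
    · rw [hx, zero_mul]
    · rw [h x hx, mul_zero]
  exact (mul_eq_zero.1 this).resolve_left hD

lemma XA_det_ne_zero : (XA k).det ≠ 0 := by
  intro h
  have := congrArg (eval (pt 1 0 0)) h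
  rw [eval_det_map, XA_map, mA_pt, det_one, map_zero] at this
  exact one_ne_zero this

lemma XB_det_ne_zero : (XB k).det ≠ 0 := by
  intro h
  have := congrArg (eval (pt 0 1 0)) h
  rw [eval_det_map, XB_map, mB_pt, det_one, map_zero] at this
  exact one_ne_zero this

theorem Mrep_irreducible {lam : ℕ → ℕ} (h : PT k lam) : IsIrreducibleRep (Mrep k lam) ∧
    ∃ v, v ∈ (glCell k).HW (Mrep k lam) (glChar k lam) ∧ v ≠ 0 := by
  have : Nontrivial (Md k lam) :=
    ⟨⟨⟨hwPoly lam (XA k), hwPoly_mem_Rd h, hwPoly_mem_HW1 h⟩, 0, fun h0 =>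
      hwPoly_XA_ne_zero lam (congrArg Subtype.val h0)⟩⟩
  have e2 : ∀ (g : GL (Fin k) ℂ) (p : Rg k),
      eval (pt 1 0 0) (act2 k g p) = eval (pt (g : Mt k) 0 0) p := by
    intro g p
    rw [act2_apply, eval_triAct, tri_pt _ _ _ _ _ _ (by simp)]
    simp
  have e1 : ∀ (g : GL (Fin k) ℂ) (p : Rg k),
      eval (pt 1 0 0) (act1 k g p) = eval (pt (g : Mt k)ᵀ 0 0) p := by
    intro g p
    rw [act1_apply, eval_triAct, tri_pt _ _ _ _ _ _ (by simp)]
    simp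
  let ξ : Dual ℂ (Md k lam) :=
    (MvPolynomial.aeval (pt (1 : Mt k) 0 0)).toLinearMap ∘ₗ (Md k lam).subtype
  have hξ : ∀ y : Md k lam, ξ y = eval (pt 1 0 0) (y : Rg k) := fun y => by
    simp [ξ, MvPolynomial.aeval_eq_eval]
  refine CellData.irreducible_of_coHW (isAct2.ss _ (Md_le lam)) (ξ := ξ) ⟨?_, ?_⟩ ?_
  · rintro _ ⟨i, j, hij, rfl⟩ s y
    rw [hξ, hξ, Mrep, subRep_apply, e2]
    have h1 := y.2.2.1 _ ⟨j, i, hij, rfl⟩ s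
    have hT : (tv i j hij.ne' s : Mt k) = (tv j i hij.ne s : Mt k)ᵀ := by
      ext a b
      rw [transpose_apply, tv_val, tv_val, tv_apply, tv_apply]
      simp only [eq_comm, and_comm]
    conv_rhs => rw [← h1, e1]
    rw [hT]
  · rintro _ ⟨d, rfl⟩ y
    have h1 := y.2.2.2 _ ⟨d, rfl⟩
    rw [hξ, hξ, Mrep, subRep_apply, e2, ← smul_eval, ← h1, e1, dg_val, diagonal_transpose]
  · intro y hy
    apply Subtype.ext
    refine eq_zero_of_eval_mul XA_det_ne_zero fun x hx => ?_
    rw [eval_det_map, XA_map] at hx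
    have := hy (GeneralLinearGroup.mkOfDetNeZero _ hx)
    rw [hξ, Mrep, subRep_apply, e2] at this
    rw [eval_eq_of_Rd y.2.1]
    exact this

/-- Weight multiplicities of the irreducible representation. -/
def dm (k : ℕ) (lam b : ℕ → ℕ) : ℕ :=
  finrank ℂ ((glCell k).Wt (Mrep k lam) (glChar k b))

open scoped Classical in
/-- Partitions of `d` with at most `k` parts. -/
def parts (k d : ℕ) : Finset (ℕ → ℕ) := (Finset.piAntidiag (Finset.range k) d).filter Antitone

lemma mem_parts {d : ℕ} {a : ℕ → ℕ} : a ∈ parts k d ↔ PT k a ∧ sz k a = d := by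
  classical
  rw [parts, Finset.mem_filter, mem_piAntidiag_range, PT]
  tauto

lemma glChar_eq_iff {a b : ℕ → ℕ} (ha : ∀ i, k ≤ i → a i = 0) (hb : ∀ i, k ≤ i → b i = 0) :
    (∀ t ∈ (glCell k).T, glChar k a t = glChar k b t) ↔ a = b := by
  constructor
  · intro h
    funext i
    by_cases hi : i < k
    · exact glChar_inj h ⟨i, hi⟩
    · rw [ha i (by omega), hb i (by omega)]
  · rintro rfl _ _
    rfl

open scoped Classical in
theorem finrank_Wt_eq_sum {V : Type*} [AddCommGroup V] [Module ℂ V] [FiniteDimensional ℂ V]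
    {ρ : Representation ℂ (GL (Fin k) ℂ) V} (hss : SS ρ) {d : ℕ} (hd : HasPolyWeights d ρ)
    (b : ℕ → ℕ) : finrank ℂ ((glCell k).Wt ρ (glChar k b)) =
      ∑ lam ∈ parts k d, finrank ℂ ((glCell k).HW ρ (glChar k lam)) * dm k lam b := by
  induction hN : finrank ℂ V using Nat.strong_induction_on generalizing V with
  | _ N ih =>
  rcases subsingleton_or_nontrivial V with hV | hV
  · rw [Module.finrank_zero_of_subsingleton, Finset.sum_eq_zero]
    intro lam _
    rw [Module.finrank_zero_of_subsingleton, zero_mul]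
  obtain ⟨a, ha, had, v, hv0, hv⟩ := hd.exists_hw
  set S := Submodule.span ℂ (Set.range fun g => ρ g v) with hS
  have hSr : IsSubrep ρ S := isSubrep_span_orbit v
  have hvS : v ∈ S := mem_span_orbit v
  obtain ⟨S', hSr', hc⟩ := hss S hSr
  have hvH : (⟨v, hvS⟩ : S) ∈ (glCell k).HW (subRep ρ S hSr) (glChar k a) :=
    ⟨fun x hx s => Subtype.ext (hv.1 x hx s), fun t ht => Subtype.ext (hv.2 t ht)⟩
  have hv0' : (⟨v, hvS⟩ : S) ≠ 0 := fun h => hv0 (congrArg Subtype.val h)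
  have hirr : IsIrreducibleRep (subRep ρ S hSr) := by
    refine CellData.irreducible_of_generated (hss.sub S hSr) hvH hv0' ?_
    rw [eq_top_iff]
    rintro ⟨x, hx⟩ -
    have : (Submodule.span ℂ (Set.range fun g => subRep ρ S hSr g ⟨v, hvS⟩)).map S.subtype = S := by
      rw [Submodule.map_span, ← Set.range_comp]
      rfl
    rw [← this] at hx
    obtain ⟨y, hy, hyx⟩ := hx
    have : y = ⟨x, this ▸ hx⟩ := Subtype.ext hyx
    rwa [← this]
  obtain ⟨hM, w, hw, hw0⟩ := Mrep_irreducible ha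
  obtain ⟨e, he, -⟩ := CellData.exists_equiv hirr hM hvH hv0' hw hw0
  have h1 : finrank ℂ ((glCell k).Wt (subRep ρ S hSr) (glChar k b)) = dm k a b :=
    CellData.finrank_Wt_equiv e he
  have hlt : finrank ℂ S' < N := by
    rw [← hN]
    have := Submodule.finrank_add_eq_of_isCompl hc
    have h2 : 0 < finrank ℂ S := by
      have := hirr.1
      exact Module.finrank_pos
    omega
  rw [CellData.finrank_Wt_isCompl hc hSr hSr', h1,
    ih _ hlt (hss.sub S' hSr') (hd.sub S' hSr') rfl]
  have h3 : ∀ lam ∈ parts k d, finrank ℂ ((glCell k).HW ρ (glChar k lam)) * dm k lam b =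
      (if a = lam then dm k lam b else 0) +
        finrank ℂ ((glCell k).HW (subRep ρ S' hSr') (glChar k lam)) * dm k lam b := by
    intro lam hlam
    rw [CellData.finrank_HW_isCompl hc hSr hSr', CellData.finrank_HW_irreducible hirr hvH hv0',
      add_mul, ite_mul, one_mul, zero_mul]
    congr 1
    exact if_congr (glChar_eq_iff ha.2 (mem_parts.1 hlam).1.2) rfl rfl
  rw [Finset.sum_congr rfl h3, Finset.sum_add_distrib, Finset.sum_ite_eq,
    if_pos (mem_parts.2 ⟨ha, had⟩)]

end Model

section Counting

open MvPolynomial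

variable {k : ℕ}

/-! ### Counting monomials -/

lemma finrank_restrictSupport {σ : Type*} (s : Set (σ →₀ ℕ)) :
    finrank ℂ (restrictSupport ℂ s) = s.ncard :=
  Module.finrank_eq_nat_card_basis (basisRestrictSupport ℂ s)

lemma finrank_eq_ncard {σ : Type*} (U : Submodule ℂ (MvPolynomial σ ℂ)) (s : Set (σ →₀ ℕ))
    (h : ∀ p, p ∈ U ↔ ∀ m, coeff m p ≠ 0 → m ∈ s) : finrank ℂ U = s.ncard := by
  have : U = restrictSupport ℂ s := by
    ext p
    rw [h, mem_restrictSupport_iff]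
    simp only [Set.subset_def, Finset.mem_coe, mem_support_iff]
  rw [this, finrank_restrictSupport]

/-- The weight of a monomial in the entries of a symmetric matrix. -/
def sw (f : Sym2 (Fin k) → ℕ) (i : ℕ) : ℕ :=
  if h : i < k then ∑ s, smult ⟨i, h⟩ s * f s else 0

lemma sw_fin (f : Sym2 (Fin k) → ℕ) (i : Fin k) : sw f i = ∑ s, smult i s * f s := by
  rw [sw, dif_pos i.2]

/-- The character of the degree `e` polynomials on symmetric matrices. -/
def symChar (k e : ℕ) : Pol k :=
  ∑ f ∈ Finset.piAntidiag (Finset.univ : Finset (Sym2 (Fin k))) e, mono k (sw f)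

def Smon (k : ℕ) (a b c : ℕ → ℕ) (e : ℕ) : Set (Vr k →₀ ℕ) :=
  {m | (∀ i : Fin k, wt1 m i = a i) ∧ (∀ i : Fin k, wt2 m i = b i) ∧
    (∀ i : Fin k, wt3 m i = c i) ∧ dS m = e}

lemma prod_mono {ι : Type*} (s : Finset ι) (f : ι → ℕ → ℕ) :
    ∏ j ∈ s, mono k (f j) = mono k fun i => ∑ j ∈ s, f j i := by
  simp only [mono]
  rw [Finset.prod_comm]
  simp only [Finset.prod_pow_eq_pow_sum]

lemma cf_sum {ι : Type*} (s : Finset ι) (f : ι → Pol k) (c : ℕ → ℕ) :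
    cf k (∑ j ∈ s, f j) c = ∑ j ∈ s, cf k (f j) c := by
  simp only [cf, coeff_sum]

def toMon (x : (Fin k → ℕ → ℕ) × (Fin k → ℕ → ℕ) × (Sym2 (Fin k) → ℕ)) : Vr k →₀ ℕ :=
  Finsupp.equivFunOnFinite.symm (Sum.elim (fun a => x.1 a.2 a.1)
    (Sum.elim (fun a => x.2.1 a.2 a.1) x.2.2))

@[simp] lemma toMon_A (x : (Fin k → ℕ → ℕ) × (Fin k → ℕ → ℕ) × (Sym2 (Fin k) → ℕ)) (a) :
    toMon x (Sum.inl a) = x.1 a.2 a.1 := rfl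
@[simp] lemma toMon_B (x : (Fin k → ℕ → ℕ) × (Fin k → ℕ → ℕ) × (Sym2 (Fin k) → ℕ)) (a) :
    toMon x (Sum.inr (Sum.inl a)) = x.2.1 a.2 a.1 := rfl
@[simp] lemma toMon_S (x : (Fin k → ℕ → ℕ) × (Fin k → ℕ → ℕ) × (Sym2 (Fin k) → ℕ)) (a) :
    toMon x (Sum.inr (Sum.inr a)) = x.2.2 a := rfl

lemma ncard_Smon (a b c : ℕ → ℕ) (e : ℕ) : ((Smon k a b c e).ncard : ℤ) =
    cf k ((∏ j ∈ Finset.range k, hom k (b j)) * (∏ j ∈ Finset.range k, hom k (c j)) *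
      symChar k e) a := by
  classical
  set P : (ℕ → ℕ) → Finset (Fin k → ℕ → ℕ) := fun b =>
    Fintype.piFinset fun j : Fin k => Finset.piAntidiag (Finset.range k) (b j) with hP
  have memP : ∀ b f, f ∈ P b ↔ ∀ j : Fin k, (∑ i : Fin k, f j i = b j) ∧ ∀ i, k ≤ i → f j i = 0 := by
    intro b f
    simp only [hP, Fintype.mem_piFinset, mem_anti]
  set Q := Finset.piAntidiag (Finset.univ : Finset (Sym2 (Fin k))) e with hQ
  have h1 : ∀ b : ℕ → ℕ, ∏ j ∈ Finset.range k, hom k (b j) =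
      ∑ f ∈ P b, mono k fun i => ∑ j, f j i := by
    intro b
    rw [Finset.prod_range]
    simp only [hom]
    rw [Finset.prod_univ_sum]
    refine Finset.sum_congr rfl fun f _ => ?_
    rw [prod_mono]
  have h2 : (∏ j ∈ Finset.range k, hom k (b j)) * (∏ j ∈ Finset.range k, hom k (c j)) *
      symChar k e = ∑ x ∈ P b ×ˢ P c ×ˢ Q,
        mono k ((fun i => ∑ j, x.1 j i) + ((fun i => ∑ j, x.2.1 j i) + sw x.2.2)) := by
    rw [h1, h1, symChar, mul_assoc, Finset.sum_mul_sum (P c), ← Finset.sum_product',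
      Finset.sum_mul_sum, ← Finset.sum_product']
    refine Finset.sum_congr rfl fun x _ => ?_
    rw [mono_add, mono_add]
  rw [h2, cf_sum]
  simp only [cf_mono]
  rw [← Finset.natCast_card_filter]
  norm_cast
  set R := (P b ×ˢ P c ×ˢ Q).filter (fun x => ∀ i : Fin k, ((fun i => ∑ j, x.1 j i) +
    ((fun i => ∑ j, x.2.1 j i) + sw x.2.2)) (i : ℕ) = a i) with hR
  have himg : Smon k a b c e = ↑(R.image toMon) := by
    ext m
    simp only [Finset.coe_image, Set.mem_image, Finset.mem_coe, hR, Finset.mem_filter,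
      Finset.mem_product, memP, hQ, Finset.mem_piAntidiag, Pi.add_apply, sw_fin]
    constructor
    · rintro ⟨ha, hb, hc, he⟩
      refine ⟨(fun j i => if h : i < k then m (Sum.inl (⟨i, h⟩, j)) else 0,
        fun j i => if h : i < k then m (Sum.inr (Sum.inl (⟨i, h⟩, j))) else 0,
        fun s => m (Sum.inr (Sum.inr s))), ⟨⟨fun j => ⟨?_, ?_⟩, fun j => ⟨?_, ?_⟩, ?_, ?_⟩, ?_⟩, ?_⟩
      · rw [← hb, wt2_fin]
        simp
      · intro i hi
        simp only [dif_neg (not_lt.2 hi)]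
      · rw [← hc, wt3_fin]
        simp
      · intro i hi
        simp only [dif_neg (not_lt.2 hi)]
      · rw [← he]; rfl
      · intro i _; exact Finset.mem_univ i
      · intro i
        rw [← ha, wt1_fin]
        simp
      · ext v
        rcases v with v | v | v <;> simp
    · rintro ⟨x, ⟨⟨hx1, hx2, hx3, -⟩, hx⟩, rfl⟩
      refine ⟨fun i => ?_, fun i => ?_, fun i => ?_, ?_⟩
      · rw [wt1_fin, ← hx]; simp
      · rw [wt2_fin, ← (hx1 i).1]; simp
      · rw [wt3_fin, ← (hx2 i).1]; simp
      · rw [← hx3]; rfl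
  rw [himg, Set.ncard_coe_finset, Finset.card_image_of_injOn]
  intro x hx y hy hxy
  have hx' := (Finset.mem_filter.1 (Finset.mem_coe.1 hx)).1
  have hy' := (Finset.mem_filter.1 (Finset.mem_coe.1 hy)).1
  simp only [Finset.mem_product, memP] at hx' hy'
  refine Prod.ext (funext fun j => funext fun i => ?_) (Prod.ext (funext fun j => funext fun i => ?_)
    (funext fun s => ?_))
  · by_cases hi : i < k
    · exact DFunLike.congr_fun hxy (Sum.inl (⟨i, hi⟩, j))
    · rw [(hx'.1 j).2 i (not_lt.1 hi), (hy'.1 j).2 i (not_lt.1 hi)]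
  · by_cases hi : i < k
    · exact DFunLike.congr_fun hxy (Sum.inr (Sum.inl (⟨i, hi⟩, j)))
    · rw [(hx'.2.1 j).2 i (not_lt.1 hi), (hy'.2.1 j).2 i (not_lt.1 hi)]
  · exact DFunLike.congr_fun hxy (Sum.inr (Sum.inr s))

lemma symChar_zero : symChar k 0 = 1 := by
  rw [symChar, Finset.piAntidiag_zero, Finset.sum_singleton, mono]
  simp [sw_fin]

lemma hom_zero : hom k 0 = 1 := by
  rw [hom, Finset.piAntidiag_zero, Finset.sum_singleton, mono]
  simp

lemma sum_Smon_degrees {a b c : ℕ → ℕ} {e : ℕ} {m : Vr k →₀ ℕ} (hm : m ∈ Smon k a b c e) :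
    dA m = sz k b ∧ dB m = sz k c ∧ dS m = e := by
  obtain ⟨-, hb, hc, he⟩ := hm
  refine ⟨?_, ?_, he⟩
  · rw [← sz_wt2]; exact Finset.sum_congr rfl fun i _ => hb i
  · rw [← sz_wt3]; exact Finset.sum_congr rfl fun i _ => hc i

lemma finrank_joint (a b c : ℕ → ℕ) (e : ℕ) :
    (finrank ℂ (Rd k (sz k b) (sz k c) e ⊓ (glCell k).Wt (act1 k) (glChar k a) ⊓
      (glCell k).Wt (act2 k) (glChar k b) ⊓ (glCell k).Wt (act3 k) (glChar k c) :
        Submodule ℂ (Rg k)) : ℤ) =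
    cf k ((∏ j ∈ Finset.range k, hom k (b j)) * (∏ j ∈ Finset.range k, hom k (c j)) *
      symChar k e) a := by
  rw [← ncard_Smon, finrank_eq_ncard _ (Smon k a b c e)]
  intro p
  simp only [Submodule.mem_inf, mem_Rd, isAct1.mem_Wt, isAct2.mem_Wt, isAct3.mem_Wt]
  constructor
  · rintro ⟨⟨⟨h0, h1⟩, h2⟩, h3⟩ m hm
    exact ⟨h1 m hm, h2 m hm, h3 m hm, (h0 m hm).2.2⟩
  · intro h
    exact ⟨⟨⟨fun m hm => sum_Smon_degrees (h m hm), fun m hm => (h m hm).1⟩,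
      fun m hm => (h m hm).2.1⟩, fun m hm => (h m hm).2.2.1⟩

end Counting

section Extraction

open MvPolynomial

variable {k : ℕ}

lemma IsAct.finrank_Wt {ρ : Representation ℂ (GL (Fin k) ℂ) (Rg k)} {w : (Vr k →₀ ℕ) → ℕ → ℕ}
    (h : IsAct ρ w) {d₁ d₂ e d : ℕ} {U : Submodule ℂ (Rg k)} (hU : IsSubrep ρ U)
    (hle : U ≤ Rd k d₁ d₂ e)
    (hd : ∀ m, dA m = d₁ → dB m = d₂ → dS m = e → sz k (w m) = d) (b : ℕ → ℕ) :
    finrank ℂ (U ⊓ (glCell k).Wt ρ (glChar k b) : Submodule ℂ (Rg k)) =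
      ∑ lam ∈ parts k d, finrank ℂ (U ⊓ (glCell k).HW ρ (glChar k lam) :
        Submodule ℂ (Rg k)) * dm k lam b := by
  have : FiniteDimensional ℂ U := Submodule.finiteDimensional_of_le hle
  rw [← CellData.finrank_Wt_subRep hU,
    finrank_Wt_eq_sum (h.ss hU hle) (h.hasPolyWeights hU hle hd)]
  exact Finset.sum_congr rfl fun lam _ => by rw [CellData.finrank_HW_subRep hU]

open scoped Classical in
lemma finrank_HW_Md {lam kp : ℕ → ℕ} (h : PT k lam) (h' : PT k kp) :
    finrank ℂ (Md k lam ⊓ (glCell k).HW (act2 k) (glChar k kp) : Submodule ℂ (Rg k)) =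
      if lam = kp then 1 else 0 := by
  obtain ⟨hi, v, hv, hv0⟩ := Mrep_irreducible h
  rw [← CellData.finrank_HW_subRep (isSubrep_Md lam)]
  refine (CellData.finrank_HW_irreducible hi hv hv0).trans ?_
  exact if_congr (glChar_eq_iff h.2 h'.2) rfl rfl

lemma dm_eq {lam : ℕ → ℕ} (h : PT k lam) (a : ℕ → ℕ) :
    finrank ℂ (Rd k (sz k lam) 0 0 ⊓ (glCell k).Wt (act1 k) (glChar k a) ⊓
      (glCell k).HW (act2 k) (glChar k lam) : Submodule ℂ (Rg k)) = dm k lam a := by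
  classical
  rw [inf_right_comm, isAct1.finrank_Wt (d := sz k lam) (IsSubrep.inf (isAct1.isSubrep_Rd _ _ _)
    (isSubrep_HW_of_comm (fun g h v => (act12_comm h g v).symm) _ _)) inf_le_left
    (fun m h1 h2 h3 => by rw [sz_wt1, h1, h2, h3]; omega)]
  rw [Finset.sum_eq_single lam]
  · rw [inf_right_comm]
    have := finrank_HW_Md h h
    rw [if_pos rfl, Md] at this
    rw [this, one_mul]
  · intro kp hkp hne
    obtain ⟨h1, h2⟩ := mem_parts.1 hkp
    have := finrank_HW_Md h1 h
    rw [if_neg hne, Md, h2] at this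
    rw [inf_right_comm, this, zero_mul]
  · intro hn
    exact absurd (mem_parts.2 ⟨h, rfl⟩) hn

lemma sum_dm_mul_dm (a b : ℕ → ℕ) :
    (∑ lam ∈ parts k (sz k b), (dm k lam a : ℤ) * dm k lam b) =
      cf k (∏ j ∈ Finset.range k, hom k (b j)) a := by
  have h := finrank_joint (k := k) a b 0 0
  have h3 : Rd k (sz k b) (sz k 0) 0 ≤ (glCell k).Wt (act3 k) (glChar k 0) := by
    intro p hp
    refine isAct3.mem_Wt.2 fun m hm i => ?_
    have h1 := ((mem_Rd.1 hp) m hm).2.1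
    rw [← sz_wt3] at h1
    simp only [sz, Pi.zero_apply, Finset.sum_const_zero, Finset.sum_eq_zero_iff] at h1
    exact h1 i (Finset.mem_univ _)
  rw [inf_eq_left.2 (inf_le_left.trans (inf_le_left.trans h3)), symChar_zero, mul_one] at h
  simp only [Pi.zero_apply, hom_zero, Finset.prod_const_one, mul_one] at h
  have hz : sz k 0 = 0 := by simp [sz]
  rw [hz] at h
  rw [← h, isAct2.finrank_Wt (d := sz k b) (IsSubrep.inf (isAct2.isSubrep_Rd _ _ _)
    (isSubrep_Wt_of_comm act12_comm _ _)) inf_le_left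
    (fun m h1 h2 h3 => by rw [sz_wt2, h1])]
  push_cast
  refine Finset.sum_congr rfl fun lam hl => ?_
  obtain ⟨h1, h2⟩ := mem_parts.1 hl
  rw [← h2, dm_eq h1]

def ee (k : ℕ) (lam nu : ℕ → ℕ) : ℤ :=
  ∑ c ∈ Finset.piAntidiag (Finset.range k) (sz k nu), eps k nu c * dm k lam c

lemma multOf_smul (nu : ℕ → ℕ) (r : ℤ) (F : Pol k) : multOf k nu (r • F) = r * multOf k nu F := by
  simp only [multOf, cf, Finset.mul_sum, MvPolynomial.coeff_smul, smul_eq_mul]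
  exact Finset.sum_congr rfl fun _ _ => by ring

lemma sum_ee_sq {nu : ℕ → ℕ} (h : PT k nu) :
    ∑ lam ∈ parts k (sz k nu), ee k lam nu * ee k lam nu = 1 := by
  classical
  have h1 := multOf_schur h h
  rw [if_pos rfl, schur, multOf_sum] at h1
  rw [← h1]
  have h2 : ∀ c ∈ Finset.piAntidiag (Finset.range k) (sz k nu),
      multOf k nu (eps k nu c • ∏ j ∈ Finset.range k, hom k (c j)) =
      ∑ lam ∈ parts k (sz k nu), (eps k nu c * dm k lam c) * ee k lam nu := by
    intro c hc
    have hsz := (mem_piAntidiag_range.1 hc).1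
    rw [multOf_smul]
    simp only [multOf, ee, Finset.mul_sum]
    rw [Finset.sum_comm]
    refine Finset.sum_congr rfl fun b _ => ?_
    rw [← sum_dm_mul_dm, hsz, Finset.mul_sum, Finset.mul_sum]
    exact Finset.sum_congr rfl fun _ _ => by ring
  rw [Finset.sum_congr rfl h2, Finset.sum_comm]
  refine Finset.sum_congr rfl fun lam _ => ?_
  rw [← Finset.sum_mul]
  rfl

lemma dm_top {nu : ℕ → ℕ} (h : PT k nu) : dm k nu nu = 1 ∧
    ∀ c ∈ Finset.piAntidiag (Finset.range k) (sz k nu), dm k nu c ≠ 0 → ht k c ≤ ht k nu := by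
  classical
  obtain ⟨hi, v, hv, hv0⟩ := Mrep_irreducible h
  have := hi.1
  obtain ⟨a, h1, h2, ⟨v', hv0', hv'⟩, h4, h5⟩ := (isAct2.hasPolyWeights (d := sz k nu)
    (isSubrep_Md nu) (Md_le nu) (fun m h1 h2 h3 => by rw [sz_wt2, h1])).exists_max_hw
  obtain rfl : nu = a := (glChar_eq_iff h.2 h1.2).1 (CellData.hw_unique hi hv hv0 hv' hv0').1
  refine ⟨?_, fun c hc hne => h5 c hc fun hb => hne ?_⟩
  · have : (glCell k).Wt (Mrep k nu) (glChar k nu) = (glCell k).HW (Mrep k nu) (glChar k nu) :=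
      le_antisymm h4 fun v hv => hv.2
    rw [dm, this]
    exact (CellData.finrank_HW_irreducible hi hv hv0).trans (if_pos fun _ _ => rfl)
  · change (glCell k).Wt (Mrep k nu) (glChar k c) = ⊥ at hb
    rw [dm, hb, finrank_bot]

lemma ht_permFun_rho {w : Equiv.Perm (Fin k)} (hw : w ≠ 1) :
    ht k (permFun w (rho k)) < ht k (rho k) := by
  by_contra hle
  push Not at hle
  apply hw
  have e1 : ∀ e : ℕ → ℕ, (ht k e : ℤ) = ∑ i : Fin k, (rho k i : ℤ) * e i + ∑ i : Fin k, (e i : ℤ) := by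
    intro e
    rw [ht, ← Finset.sum_add_distrib]
    push_cast
    refine Finset.sum_congr rfl fun i _ => ?_
    have : k - (i : ℕ) = rho k i + 1 := by have := i.2; simp only [rho]; omega
    rw [this]
    push_cast
    ring
  have hle' : (ht k (rho k) : ℤ) ≤ ht k (permFun w (rho k)) := by exact_mod_cast hle
  rw [e1, e1] at hle'
  simp only [permFun_fin] at hle'
  rw [Equiv.sum_comp w fun i : Fin k => ((rho k i : ℕ) : ℤ)] at hle'
  have e2 := Equiv.sum_comp w fun i : Fin k => ((rho k i : ℕ) : ℤ) ^ 2
  have e3 : ∑ i : Fin k, ((rho k i : ℤ) - rho k (w i)) ^ 2 =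
      2 * (∑ i : Fin k, (rho k i : ℤ) * rho k i - ∑ i : Fin k, (rho k i : ℤ) * rho k (w i)) := by
    have : ∀ i : Fin k, ((rho k i : ℤ) - rho k (w i)) ^ 2 = (rho k i : ℤ) * rho k i +
        (rho k (w i) : ℤ) ^ 2 - 2 * ((rho k i : ℤ) * rho k (w i)) := fun i => by ring
    rw [Finset.sum_congr rfl fun i _ => this i, Finset.sum_sub_distrib, Finset.sum_add_distrib, e2,
      ← Finset.mul_sum]
    simp only [sq]
    ring
  have e4 : ∑ i : Fin k, ((rho k i : ℤ) - rho k (w i)) ^ 2 = 0 :=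
    le_antisymm (by rw [e3]; linarith) (Finset.sum_nonneg fun i _ => sq_nonneg _)
  ext i
  have := (Finset.sum_eq_zero_iff_of_nonneg fun i _ => sq_nonneg _).1 e4 i (Finset.mem_univ _)
  have h5 : (rho k i : ℤ) = rho k (w i) := by
    rw [sq_eq_zero_iff] at this
    linarith
  have h6 : rho k i = rho k (w i) := by exact_mod_cast h5
  have := i.2
  have := (w i).2
  simp only [rho] at h6
  simp only [Equiv.Perm.one_apply]
  omega

lemma ht_add (a b : ℕ → ℕ) : ht k (a + b) = ht k a + ht k b := by
  simp [ht, mul_add, Finset.sum_add_distrib]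

lemma ht_congr {a b : ℕ → ℕ} (h : ∀ i : Fin k, a i = b i) : ht k a = ht k b :=
  Finset.sum_congr rfl fun i _ => by rw [h i]

lemma ee_self {nu : ℕ → ℕ} (h : PT k nu) : ee k nu nu = 1 := by
  classical
  obtain ⟨hd, hht⟩ := dm_top h
  have key : ∀ c ∈ Finset.piAntidiag (Finset.range k) (sz k nu), dm k nu c ≠ 0 →
      ∀ w : Equiv.Perm (Fin k), (∀ i : Fin k, permFun w (nu + rho k) i = (c + rho k) i) → w = 1 := by
    intro c hc hne w hw
    by_contra hw1
    have hle := hht (permFun w⁻¹ c) (permFun_mem _ hc) (by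
      rw [dm, finrank_Wt_permFun]; exact hne)
    have h1 : ht k (nu + rho k) = ht k (permFun w⁻¹ c + permFun w⁻¹ (rho k)) := by
      refine ht_congr fun i => ?_
      have := hw (w⁻¹ i)
      rw [permFun_fin] at this
      rw [show w (w⁻¹ i) = i from w.apply_symm_apply i] at this
      rw [Pi.add_apply (permFun w⁻¹ c), permFun_fin, permFun_fin]
      exact this
    rw [ht_add, ht_add] at h1
    have := ht_permFun_rho (k := k) (w := w⁻¹) (by simpa using hw1)
    omega
  rw [ee, Finset.sum_eq_single nu]
  · rw [hd, eps_antitone h h, if_pos rfl]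
    rfl
  · intro c hc hne
    by_cases h0 : dm k nu c = 0
    · rw [h0]; simp
    rw [eps_eq_sum, Finset.sum_eq_zero, zero_mul]
    intro w _
    rw [if_neg, mul_zero]
    intro hw
    obtain rfl := key c hc h0 w hw
    apply hne
    funext i
    by_cases hi : i < k
    · have := hw ⟨i, hi⟩
      rw [permFun_fin] at this
      simpa using this.symm
    · rw [h.2 i (by omega), (mem_piAntidiag_range.1 hc).2 i (by omega)]
  · intro hn
    exact absurd (mem_piAntidiag_range.2 ⟨rfl, h.2⟩) hn

lemma ee_of_ne {lam nu : ℕ → ℕ} (h : PT k nu) (hl : lam ∈ parts k (sz k nu)) (hne : lam ≠ nu) :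
    ee k lam nu = 0 := by
  classical
  have h1 := sum_ee_sq h
  rw [← Finset.add_sum_erase _ _ (mem_parts.2 ⟨h, rfl⟩), ee_self h] at h1
  have h2 : ∑ x ∈ (parts k (sz k nu)).erase nu, ee k x nu * ee k x nu = 0 := by linarith
  have := (Finset.sum_eq_zero_iff_of_nonneg fun i _ => mul_self_nonneg _).1 h2 lam
    (Finset.mem_erase.2 ⟨hne, hl⟩)
  exact mul_self_eq_zero.1 this

/-- Weyl character formula: highest weight multiplicities from weight multiplicities. -/
theorem IsAct.finrank_HW {ρ : Representation ℂ (GL (Fin k) ℂ) (Rg k)} {w : (Vr k →₀ ℕ) → ℕ → ℕ}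
    (h : IsAct ρ w) {d₁ d₂ e : ℕ} {U : Submodule ℂ (Rg k)} (hU : IsSubrep ρ U)
    (hle : U ≤ Rd k d₁ d₂ e) {nu : ℕ → ℕ} (hnu : PT k nu)
    (hd : ∀ m, dA m = d₁ → dB m = d₂ → dS m = e → sz k (w m) = sz k nu) :
    (finrank ℂ (U ⊓ (glCell k).HW ρ (glChar k nu) : Submodule ℂ (Rg k)) : ℤ) =
      ∑ c ∈ Finset.piAntidiag (Finset.range k) (sz k nu), eps k nu c *
        finrank ℂ (U ⊓ (glCell k).Wt ρ (glChar k c) : Submodule ℂ (Rg k)) := by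
  classical
  have h1 : ∀ c, (finrank ℂ (U ⊓ (glCell k).Wt ρ (glChar k c) : Submodule ℂ (Rg k)) : ℤ) =
      ∑ lam ∈ parts k (sz k nu), (finrank ℂ (U ⊓ (glCell k).HW ρ (glChar k lam) :
        Submodule ℂ (Rg k)) : ℤ) * dm k lam c := fun c => by
    rw [h.finrank_Wt hU hle hd c]; push_cast; rfl
  simp only [h1, Finset.mul_sum]
  rw [Finset.sum_comm, Finset.sum_eq_single nu]
  · have := ee_self hnu
    rw [ee] at this
    conv_lhs => rw [← mul_one (finrank ℂ _ : ℤ), ← this, Finset.mul_sum]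
    exact Finset.sum_congr rfl fun _ _ => by ring
  · intro lam hl hne
    have := ee_of_ne hnu hl hne
    rw [ee] at this
    have h2 := congrArg (fun z => (finrank ℂ (U ⊓ (glCell k).HW ρ (glChar k lam) :
        Submodule ℂ (Rg k)) : ℤ) * z) this
    simp only [Finset.mul_sum, mul_zero] at h2
    rw [← h2]
    exact Finset.sum_congr rfl fun _ _ => by ring
  · intro hn
    exact absurd (mem_parts.2 ⟨hnu, rfl⟩) hn

end Extraction

section JointMultiplicity

open MvPolynomial

variable {k : ℕ}

lemma finrank_joint_HW {lam b c : ℕ → ℕ} {e : ℕ} (hl : PT k lam) (hb : PT k b) (hc : PT k c)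
    (hs : sz k lam = sz k b + sz k c + 2 * e) :
    (finrank ℂ (Rd k (sz k b) (sz k c) e ⊓ (glCell k).HW (act1 k) (glChar k lam) ⊓
      (glCell k).HW (act2 k) (glChar k b) ⊓ (glCell k).HW (act3 k) (glChar k c) :
        Submodule ℂ (Rg k)) : ℤ) =
      multOf k lam (schur k b * schur k c * symChar k e) := by
  have c21 : ∀ g h v, act2 k g (act1 k h v) = act1 k h (act2 k g v) :=
    fun g h v => (act12_comm h g v).symm
  have c31 : ∀ g h v, act3 k g (act1 k h v) = act1 k h (act3 k g v) :=
    fun g h v => (act13_comm h g v).symm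
  have c32 : ∀ g h v, act3 k g (act2 k h v) = act2 k h (act3 k g v) :=
    fun g h v => (act23_comm h g v).symm
  have h1 : ∀ b' c', sz k b' = sz k b → sz k c' = sz k c →
      (finrank ℂ (Rd k (sz k b) (sz k c) e ⊓ (glCell k).Wt (act3 k) (glChar k c') ⊓
        (glCell k).Wt (act2 k) (glChar k b') ⊓ (glCell k).HW (act1 k) (glChar k lam) :
          Submodule ℂ (Rg k)) : ℤ) = multOf k lam ((∏ j ∈ Finset.range k, hom k (b' j)) *
            (∏ j ∈ Finset.range k, hom k (c' j)) * symChar k e) := by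
    intro b' c' hb' hc'
    rw [isAct1.finrank_HW (IsSubrep.inf (IsSubrep.inf (isAct1.isSubrep_Rd _ _ _)
      (isSubrep_Wt_of_comm c31 _ _)) (isSubrep_Wt_of_comm c21 _ _))
      (inf_le_left.trans inf_le_left) hl (fun m h1 h2 h3 => by rw [sz_wt1, h1, h2, h3, hs]), multOf]
    refine Finset.sum_congr rfl fun a _ => ?_
    rw [← finrank_joint, hb', hc', inf_right_comm, inf_right_comm (Rd _ _ _ _), inf_right_comm]
  have h2 : ∀ c', sz k c' = sz k c →
      (finrank ℂ (Rd k (sz k b) (sz k c) e ⊓ (glCell k).Wt (act3 k) (glChar k c') ⊓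
        (glCell k).HW (act1 k) (glChar k lam) ⊓ (glCell k).HW (act2 k) (glChar k b) :
          Submodule ℂ (Rg k)) : ℤ) = multOf k lam (schur k b *
            (∏ j ∈ Finset.range k, hom k (c' j)) * symChar k e) := by
    intro c' hc'
    rw [isAct2.finrank_HW (IsSubrep.inf (IsSubrep.inf (isAct2.isSubrep_Rd _ _ _)
      (isSubrep_Wt_of_comm c32 _ _)) (isSubrep_HW_of_comm act12_comm _ _))
      (inf_le_left.trans inf_le_left) hb (fun m h1 h2 h3 => by rw [sz_wt2, h1]), schur,
      Finset.sum_mul, Finset.sum_mul, multOf_sum]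
    refine Finset.sum_congr rfl fun b' hb' => ?_
    rw [smul_mul_assoc, smul_mul_assoc, multOf_smul,
      ← h1 b' c' (mem_piAntidiag_range.1 hb').1 hc', inf_right_comm]
  rw [isAct3.finrank_HW (IsSubrep.inf (IsSubrep.inf (isAct3.isSubrep_Rd _ _ _)
    (isSubrep_HW_of_comm act13_comm _ _)) (isSubrep_HW_of_comm act23_comm _ _))
    (inf_le_left.trans inf_le_left) hc (fun m h1 h2 h3 => by rw [sz_wt3, h2]), schur.eq_def k c,
    Finset.mul_sum, Finset.sum_mul, multOf_sum]
  refine Finset.sum_congr rfl fun c' hc' => ?_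
  rw [mul_smul_comm, smul_mul_assoc, multOf_smul, ← h2 c' (mem_piAntidiag_range.1 hc').1,
    inf_right_comm, inf_right_comm (Rd _ _ _ _)]

/-! ### Symmetric matrices -/

lemma exists_transpose_mul_self {S : GL (Fin k) ℂ} (hS : (S : Mt k)ᵀ = S)
    (hd : glDelta (S : Mt k) ≠ 0) : ∃ d, ∃ u ∈ rootMon (glUp k),
      (S : Mt k) = ((dg d * u : GL (Fin k) ℂ) : Mt k)ᵀ * ((dg d * u : GL (Fin k) ℂ) : Mt k) := by
  obtain ⟨l, hl, _, ⟨t, rfl⟩, u, hu, rfl⟩ := gl_cell hd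
  have hN : IsUpperUni ((l : Mt k)ᵀ * (↑u⁻¹ : Mt k)) :=
    (isUpperUni_transpose.2 (lo_closure_lower hl)).mul (up_closure_upper (inv_mem_up_closure hu))
  set N : Mt k := (l : Mt k)ᵀ * (↑u⁻¹ : Mt k) with hNdef
  have hu1 : (u : Mt k) * (↑u⁻¹ : Mt k) = 1 := by simp
  have hu2 : ((u⁻¹ : GL (Fin k) ℂ) : Mt k) * (u : Mt k) = 1 := by simp
  have hu3 : ((u⁻¹ : GL (Fin k) ℂ) : Mt k)ᵀ * (u : Mt k)ᵀ = 1 := by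
    rw [← transpose_mul, hu1, transpose_one]
  simp only [Units.val_mul, transpose_mul, dg_val, diagonal_transpose] at hS
  have key : diagonal (fun i => (t i : ℂ)) * N = Nᵀ * diagonal (fun i => (t i : ℂ)) := by
    have := congrArg (fun X : Mt k => (↑u⁻¹ : Mt k)ᵀ * X * (↑u⁻¹ : Mt k)) hS
    rw [hNdef, transpose_mul, transpose_transpose]
    calc _ = ((↑u⁻¹ : Mt k)ᵀ * (u : Mt k)ᵀ) * diagonal (fun i => (t i : ℂ)) *
          ((l : Mt k)ᵀ * (↑u⁻¹ : Mt k)) := by rw [hu3, Matrix.one_mul]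
      _ = (↑u⁻¹ : Mt k)ᵀ * ((u : Mt k)ᵀ * (diagonal (fun i => (t i : ℂ)) * (l : Mt k)ᵀ)) *
          (↑u⁻¹ : Mt k) := by simp only [Matrix.mul_assoc]
      _ = _ := by rw [this]
      _ = (↑u⁻¹ : Mt k)ᵀ * l * diagonal (fun i => (t i : ℂ)) * ((u : Mt k) * (↑u⁻¹ : Mt k)) := by
        simp only [Matrix.mul_assoc]
      _ = _ := by rw [hu1, Matrix.mul_one]
  have hN1 : N = 1 := by
    ext i j
    rcases lt_trichotomy i j with h | rfl | h
    · have := congrFun (congrFun key i) j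
      rw [diagonal_mul, mul_diagonal, transpose_apply, hN.2 j i h, zero_mul] at this
      rw [(mul_eq_zero.1 this).resolve_left (t i).ne_zero, one_apply_ne h.ne]
    · rw [hN.1, one_apply_eq]
    · rw [hN.2 i j h, one_apply_ne h.ne']
  have hlu : (l : Mt k) = (u : Mt k)ᵀ := by
    have : (l : Mt k)ᵀ = u := by
      calc (l : Mt k)ᵀ = N * u := by rw [hNdef, Matrix.mul_assoc, hu2, Matrix.mul_one]
        _ = u := by rw [hN1, Matrix.one_mul]
    rw [← this, transpose_transpose]
  choose r hr using fun i => IsAlgClosed.exists_pow_nat_eq (t i : ℂ) (n := 2) two_pos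
  have hr0 : ∀ i, r i ≠ 0 := fun i h0 => (t i).ne_zero (by rw [← hr i, h0]; simp)
  refine ⟨fun i => Units.mk0 (r i) (hr0 i), u, hu, ?_⟩
  have : diagonal (fun i => (t i : ℂ)) = diagonal r * diagonal r := by
    rw [diagonal_mul_diagonal]
    exact congrArg _ (funext fun i => by rw [← hr i, sq])
  simp only [Units.val_mul, dg_val, transpose_mul, diagonal_transpose, Units.val_mk0, hlu, this,
    Matrix.mul_assoc]

lemma glDelta_eq_hwFun (g : Mt k) : glDelta g = minor 0 g * hwFun (fun i => k - i) g := by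
  rw [glDelta, Finset.prod_range_succ', mul_comm, hwFun, ← Fin.prod_univ_eq_prod_range
    (fun s => minor (s + 1) g)]
  refine congrArg _ (Finset.prod_congr rfl fun i _ => ?_)
  rw [show k - (i : ℕ) - (k - ((i : ℕ) + 1)) = 1 by omega, pow_one]

lemma eval_eq_of_Rd_sym {e : ℕ} {y : Rg k} (hy : y ∈ Rd k 0 0 e) (x : Vr k → ℂ) :
    eval x y = eval (pt 0 0 (mS x)) y := by
  have h1 := mem_Rd_iff_eval.1 hy 0 0 1 x
  have h2 : scl 0 0 1 x = pt 0 0 (mS x) := by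
    apply pt_ext
    · simp
    · simp
    · rw [mS_scl, mS_pt (mS_symm x), one_smul]
  rw [← h2, h1]
  simp

lemma eval_sym_ne_zero {nu : ℕ → ℕ} {e : ℕ} {p : Rg k}
    (hp : p ∈ Rd k 0 0 e ⊓ (glCell k).HW (act1 k) (glChar k nu)) (hp0 : p ≠ 0) :
    eval (pt 0 0 1) p ≠ 0 := by
  intro h0
  refine hp0 (eq_zero_of_eval_mul (D := hwPoly (fun i => k - i) (XS k) * (XS k).det)
    (fun h => ?_) fun x hx => ?_)
  · have := congrArg (eval (pt 0 0 1)) h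
    rw [map_mul, eval_hwPoly, XS_map, mS_pt transpose_one, hwFun_one, map_zero, one_mul,
      eval_det_map, XS_map, mS_pt transpose_one, det_one] at this
    exact one_ne_zero this
  · rw [map_mul, eval_hwPoly, XS_map, eval_det_map, XS_map] at hx
    obtain ⟨hx1, hx2⟩ := mul_ne_zero_iff.1 hx
    have hm : minor 0 (mS x) = 1 := by simp [minor, trunc, ← one_apply, show (of fun i j => (1 : Mt k) i j) = 1 from rfl]
    obtain ⟨d, u, hu, hS⟩ := exists_transpose_mul_self
      (S := GeneralLinearGroup.mkOfDetNeZero (mS x) hx2) (mS_symm x)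
      (by rw [glDelta_eq_hwFun]; exact mul_ne_zero (by change minor 0 (mS x) ≠ 0; simp [hm]) hx1)
    have hS' : mS x = ((dg d * u : GL (Fin k) ℂ) : Mt k)ᵀ * ((dg d * u : GL (Fin k) ℂ) : Mt k) := hS
    have hact : act1 k (dg d * u) p = glChar k nu (dg d) • p := by
      rw [map_mul, Module.End.mul_apply, (glCell k).up_word_fix hp.2 hu, hp.2.2 _ ⟨d, rfl⟩]
    have := congrArg (eval (pt 0 0 1)) hact
    rw [act1_apply, eval_triAct, tri_pt _ _ _ _ _ _ transpose_one, smul_eval, h0, mul_zero,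
      Matrix.mul_one, Matrix.mul_one, ← hS'] at this
    rw [eval_eq_of_Rd_sym hp.1, this, mul_zero]

lemma even_of_sym {nu : ℕ → ℕ} {e : ℕ} {p : Rg k}
    (hp : p ∈ Rd k 0 0 e ⊓ (glCell k).HW (act1 k) (glChar k nu)) (hp0 : p ≠ 0) (i : Fin k) :
    Even (nu i) := by
  have h1 := congrArg (eval (pt 0 0 1)) (hp.2.2 (dg (Function.update 1 i (-1))) ⟨_, rfl⟩)
  have hsq : (((dg (Function.update 1 i (-1)) : GL (Fin k) ℂ) : Mt k))ᵀ *
      ((dg (Function.update 1 i (-1)) : GL (Fin k) ℂ) : Mt k) = 1 := by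
    rw [dg_val, diagonal_transpose, diagonal_mul_diagonal, diagonal_eq_one]
    funext j
    rcases eq_or_ne j i with rfl | h <;> simp [*]
  rw [act1_apply, eval_triAct, tri_pt _ _ _ _ _ _ transpose_one, smul_eval,
    Matrix.mul_one, Matrix.mul_one, hsq, Matrix.mul_zero, glChar_dg,
    Finset.prod_eq_single i (fun j _ h => by simp [h]) (by simp)] at h1
  have h2 := mul_right_cancel₀ (eval_sym_ne_zero hp hp0) ((one_mul _).trans h1)
  by_contra hodd
  rw [Nat.not_even_iff_odd] at hodd
  simp [hodd.neg_one_pow] at h2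
  norm_num at h2

lemma hwPoly_sym_mem {del : ℕ → ℕ} (h : PT k del) : hwPoly del (XS k) ∈
    Rd k 0 0 (sz k del) ⊓ (glCell k).HW (act1 k) (glChar k (double del)) := by
  refine ⟨mem_Rd_iff_eval.2 fun r s q x => ?_, fun x hx s => ?_, ?_⟩
  · rw [eval_hwPoly, eval_hwPoly, XS_map, XS_map, mS_scl, hwFun_smul h]
    simp
  · refine MvPolynomial.funext fun y => ?_
    have hu := glUp_upper hx s
    rw [act1_apply, eval_triAct, eval_hwPoly, eval_hwPoly, XS_map, XS_map, mS_tri,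
      hwFun_mul_upper h hu.2, hwFun_lower_mul h hu.transpose_lower]
    simp [hu.1]
  · rintro _ ⟨d, rfl⟩
    refine MvPolynomial.funext fun y => ?_
    rw [act1_apply, eval_triAct, smul_eval, eval_hwPoly, eval_hwPoly, XS_map, XS_map, mS_tri,
      hwFun_mul_upper h, hwFun_lower_mul h, glChar_dg]
    · simp [double, pow_mul, mul_pow, ← mul_assoc, ← Finset.prod_mul_distrib, sq]
    · intro i j hij
      simp [hij.ne']
    · intro i j hij
      simp [hij.ne']

lemma PT.double {del : ℕ → ℕ} : PT k (double del) ↔ PT k del := by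
  simp [PT, Antitone, _root_.double]

lemma sz_double (del : ℕ → ℕ) : sz k (double del) = 2 * sz k del := by
  simp [sz, double, Finset.mul_sum]

open scoped Classical in
lemma finrank_sym {nu : ℕ → ℕ} {e : ℕ} (hnu : PT k nu) (hs : sz k nu = 2 * e) :
    finrank ℂ (Rd k 0 0 e ⊓ (glCell k).HW (act1 k) (glChar k nu) : Submodule ℂ (Rg k)) =
      if nu ∈ (parts k e).image double then 1 else 0 := by
  set U : Submodule ℂ (Rg k) := Rd k 0 0 e ⊓ (glCell k).HW (act1 k) (glChar k nu)
  have : FiniteDimensional ℂ U := Submodule.finiteDimensional_of_le inf_le_left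
  split_ifs with h
  · obtain ⟨del, hd, rfl⟩ := Finset.mem_image.1 h
    obtain ⟨hd', he⟩ := mem_parts.1 hd
    refine le_antisymm ?_ ?_
    · let L : U →ₗ[ℂ] ℂ := (MvPolynomial.aeval (pt (k := k) 0 0 1)).toLinearMap ∘ₗ U.subtype
      have hL : Function.Injective L := by
        rw [injective_iff_map_eq_zero]
        intro p hp
        by_contra h0
        refine eval_sym_ne_zero p.2 (fun h => h0 (Subtype.ext h)) ?_
        simpa [L, MvPolynomial.coe_aeval_eq_eval] using hp
      simpa using LinearMap.finrank_le_finrank_of_injective hL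
    · refine Nat.one_le_iff_ne_zero.2 fun h0 => ?_
      have hb : U = ⊥ := Submodule.finrank_eq_zero.1 h0
      have hm : hwPoly del (XS k) ∈ U := by
        have := hwPoly_sym_mem hd'
        rwa [he] at this
      rw [hb, Submodule.mem_bot] at hm
      have := congrArg (eval (pt 0 0 1)) hm
      rw [eval_hwPoly, XS_map, mS_pt transpose_one, hwFun_one, map_zero] at this
      exact one_ne_zero this
  · rw [Submodule.finrank_eq_zero, Submodule.eq_bot_iff]
    intro p hp
    by_contra hp0
    have he : double (fun i => nu i / 2) = nu := by
      funext i
      rcases lt_or_ge i k with hi | hi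
      · exact Nat.mul_div_cancel' (even_iff_two_dvd.1 (even_of_sym hp hp0 ⟨i, hi⟩))
      · simp [double, hnu.2 i hi]
    refine h (Finset.mem_image.2 ⟨_, mem_parts.2 ⟨PT.double.1 (he.symm ▸ hnu :), ?_⟩, he⟩)
    have := sz_double (k := k) fun i => nu i / 2
    rw [he] at this
    omega

lemma symChar_isSymmetric (e : ℕ) : (symChar k e).IsSymmetric := by
  intro w
  have hsm : ∀ (i : Fin k) (s : Sym2 (Fin k)), smult i (Sym2.map w s) = smult (w⁻¹ i) s := by
    intro i s
    induction s using Sym2.ind with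
    | _ a b => simp [smult, Equiv.eq_symm_apply]
  let M : Sym2 (Fin k) ≃ Sym2 (Fin k) := ⟨Sym2.map w, Sym2.map w.symm,
    fun s => by simp [Sym2.map_map], fun s => by simp [Sym2.map_map]⟩
  let E : (Sym2 (Fin k) → ℕ) ≃ (Sym2 (Fin k) → ℕ) := M.arrowCongr (Equiv.refl ℕ)
  rw [symChar, map_sum]
  refine Finset.sum_equiv E (fun f => ?_) fun f _ => ?_
  · simp only [Finset.mem_piAntidiag]
    refine and_congr ?_ (by simp)
    rw [show ∑ s, E f s = ∑ s, f s from Equiv.sum_comp M.symm f]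
  · have := rename_mono w⁻¹ (sw f)
    rw [inv_inv] at this
    rw [this]
    refine congrArg (mono k) (funext fun i => ?_)
    rcases lt_or_ge i k with hi | hi
    · rw [permFun_fin w⁻¹ _ ⟨i, hi⟩, sw_fin, sw_fin _ ⟨i, hi⟩,
        ← Equiv.sum_comp M (fun s => smult ⟨i, hi⟩ s * E f s)]
      refine Finset.sum_congr rfl fun s _ => ?_
      have h1 : E f (M s) = f s := by simp [E]
      rw [h1]
      exact congrArg (· * f s) (hsm _ s).symm
    · rw [permFun_of_le _ _ hi, sw, dif_neg (by omega)]

open scoped Classical in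
lemma multOf_symChar {nu : ℕ → ℕ} (e : ℕ) (hnu : PT k nu) :
    multOf k nu (symChar k e) = if nu ∈ (parts k e).image double then 1 else 0 := by
  by_cases hs : sz k nu = 2 * e
  · have := finrank_sym hnu hs
    have h0 : sz k 0 = 0 := by simp [sz]
    have hj : ∀ a, (finrank ℂ (Rd k 0 0 e ⊓ (glCell k).Wt (act1 k) (glChar k a) :
        Submodule ℂ (Rg k)) : ℤ) = cf k (symChar k e) a := by
      intro a
      have h := finrank_joint (k := k) a 0 0 e
      have h2 : Rd k (sz k 0) (sz k 0) e ≤ (glCell k).Wt (act2 k) (glChar k 0) := by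
        intro p hp
        refine isAct2.mem_Wt.2 fun m hm i => ?_
        have h1 := ((mem_Rd.1 hp) m hm).1
        rw [← sz_wt2, h0, sz, Finset.sum_eq_zero_iff] at h1
        exact h1 i (Finset.mem_univ _)
      have h3 : Rd k (sz k 0) (sz k 0) e ≤ (glCell k).Wt (act3 k) (glChar k 0) := by
        intro p hp
        refine isAct3.mem_Wt.2 fun m hm i => ?_
        have h1 := ((mem_Rd.1 hp) m hm).2.1
        rw [← sz_wt3, h0, sz, Finset.sum_eq_zero_iff] at h1
        exact h1 i (Finset.mem_univ _)
      rw [inf_eq_left.2 (inf_le_left.trans (inf_le_left.trans h3)),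
        inf_eq_left.2 (inf_le_left.trans h2), h0] at h
      simpa only [Pi.zero_apply, hom_zero, Finset.prod_const_one, one_mul] using h
    have h1 := isAct1.finrank_HW (isAct1.isSubrep_Rd 0 0 e) le_rfl hnu
      (fun m h1 h2 h3 => by rw [sz_wt1, h1, h2, h3, hs]; omega)
    rw [this] at h1
    rw [multOf, ← Finset.sum_congr rfl fun c _ => congrArg (eps k nu c * ·) (hj c), ← h1]
    split_ifs <;> rfl
  · rw [if_neg fun h => hs ?_, multOf]
    · refine Finset.sum_eq_zero fun c hc => ?_
      rw [symChar, cf_sum, Finset.sum_eq_zero, mul_zero]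
      intro f hf
      rw [cf_mono, if_neg]
      intro h
      refine hs ?_
      rw [← (mem_piAntidiag_range.1 hc).1, sz, ← Finset.sum_congr rfl fun i _ => h i]
      simp only [sw_fin]
      rw [Finset.sum_comm]
      simp only [← Finset.sum_mul, sum_smult, ← Finset.mul_sum]
      rw [(Finset.mem_piAntidiag.1 hf).1]
    · obtain ⟨del, hd, rfl⟩ := Finset.mem_image.1 h
      rw [sz_double, (mem_parts.1 hd).2]

lemma double_injective : Function.Injective double := fun a b h => funext fun i => by
  have := congrFun h i
  simp only [double] at this
  omega

lemma symChar_eq (e : ℕ) : symChar k e = ∑ del ∈ parts k e, schur k (double del) := by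
  classical
  rw [eq_sum_schur (symChar_isSymmetric e) ((parts k e).image double) ?_
    (fun nu h h' => by rw [multOf_symChar e h, if_pos h'])
    (fun nu h h' => by rw [multOf_symChar e h, if_neg h']),
    Finset.sum_image fun a _ b _ h => double_injective h]
  intro nu h
  obtain ⟨del, hd, rfl⟩ := Finset.mem_image.1 h
  exact PT.double.2 (mem_parts.1 hd).1

end JointMultiplicity

section LittlewoodRichardsonSum

open MvPolynomial

variable {k : ℕ}

lemma PT.isPartition {a : ℕ → ℕ} (h : PT k a) : IsPartition a :=
  ⟨fun _ _ hij => h.1 hij, k, h.2 k le_rfl⟩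

lemma finsum_ptn (s : Finset (ℕ → ℕ)) (hs : ∀ a ∈ s, IsPartition a) (F : (ℕ → ℕ) → ℕ)
    (hF : ∀ a, IsPartition a → F a ≠ 0 → a ∈ s) : ∑ᶠ g : Ptn, F g.1 = ∑ a ∈ s, F a := by
  classical
  rw [← Finset.sum_subtype_of_mem F hs]
  exact finsum_eq_sum_of_support_subset _ fun g hg =>
    Finset.mem_coe.2 (Finset.mem_subtype.2 (hF g.1 g.2 hg))

lemma schur_mul_schur {b c : ℕ → ℕ} (hb : PT k b) (hc : PT k c) : schur k b * schur k c =
    ∑ g ∈ parts k (sz k b + sz k c), (lrCoeff g b c : ℤ) • schur k g := by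
  classical
  rw [← sub_eq_zero]
  refine eq_zero_of_multOf (((schur_isSymmetric b).mul (schur_isSymmetric c)).sub
    (isSymmetric_sum _ _ fun g _ w => by rw [map_zsmul, schur_isSymmetric g w])) fun nu hnu => ?_
  rw [multOf_sub, multOf_schur_mul hb hc hnu, multOf_sum,
    Finset.sum_congr rfl fun g hg => by rw [multOf_smul, multOf_schur hnu (mem_parts.1 hg).1]]
  simp only [mul_ite, mul_one, mul_zero, Finset.sum_ite_eq]
  split_ifs with h
  · exact sub_self _
  · rw [sub_zero, Nat.cast_eq_zero]
    by_contra h0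
    exact h (mem_parts.2 ⟨hnu, (lrCoeff_ne_zero hnu hb.1 hc.1 h0).2.2⟩)

lemma lr_support {lam b c g d : ℕ → ℕ} (hl : PT k lam) (hb : PT k b) (hc : PT k c)
    (hg : IsPartition g) (hd : IsPartition d) (h : lrCoeff g b c * lrCoeff lam g (double d) ≠ 0) :
    g ∈ parts k (sz k b + sz k c) ∧ PT k d ∧ sz k lam = sz k b + sz k c + 2 * sz k d := by
  obtain ⟨h1, h2⟩ := mul_ne_zero_iff.1 h
  obtain ⟨h3, h4, h5⟩ := lrCoeff_ne_zero hl (m := g) (nu := double d)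
    (fun _ _ h => hg.1 h) (fun _ _ h => Nat.mul_le_mul_left 2 (hd.1 h)) h2
  have h6 := (lrCoeff_ne_zero h3 hb.1 hc.1 h1).2.2
  exact ⟨mem_parts.2 ⟨h3, h6⟩, PT.double.1 h4, by rw [h5, sz_double, h6]⟩

theorem finsum_lr {lam b c : ℕ → ℕ} {e : ℕ} (hl : PT k lam) (hb : PT k b) (hc : PT k c)
    (hs : sz k lam = sz k b + sz k c + 2 * e) :
    ((∑ᶠ (g : Ptn) (d : Ptn), lrCoeff g.1 b c * lrCoeff lam g.1 (double d.1) : ℕ) : ℤ) =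
      multOf k lam (schur k b * schur k c * symChar k e) := by
  have h1 : ∀ g : Ptn, (∑ᶠ d : Ptn, lrCoeff g.1 b c * lrCoeff lam g.1 (double d.1)) =
      ∑ d ∈ parts k e, lrCoeff g.1 b c * lrCoeff lam g.1 (double d) := fun g =>
    finsum_ptn _ (fun a ha => (mem_parts.1 ha).1.isPartition)
      (fun d => lrCoeff g.1 b c * lrCoeff lam g.1 (double d)) fun d hd h => by
        obtain ⟨h1, h2, h3⟩ := lr_support hl hb hc g.2 hd h
        exact mem_parts.2 ⟨h2, by omega⟩
  rw [finsum_congr h1, finsum_ptn (parts k (sz k b + sz k c))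
    (fun a ha => (mem_parts.1 ha).1.isPartition)
    (fun g => ∑ d ∈ parts k e, lrCoeff g b c * lrCoeff lam g (double d)) fun g hg h => ?_]
  · rw [schur_mul_schur hb hc, symChar_eq, Finset.sum_mul, multOf_sum]
    push_cast
    refine Finset.sum_congr rfl fun g hg => ?_
    rw [smul_mul_assoc, multOf_smul, Finset.mul_sum, multOf_sum, Finset.mul_sum]
    exact Finset.sum_congr rfl fun d hd => by
      rw [multOf_schur_mul (mem_parts.1 hg).1 (PT.double.2 (mem_parts.1 hd).1) hl]
  · obtain ⟨d, hd, h0⟩ := Finset.exists_ne_zero_of_sum_ne_zero h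
    exact (lr_support hl hb hc hg (mem_parts.1 hd).1.isPartition h0).1

lemma finsum_lr_eq_zero {lam b c : ℕ → ℕ} (hl : PT k lam) (hb : PT k b) (hc : PT k c)
    (hs : ∀ e, sz k lam ≠ sz k b + sz k c + 2 * e) :
    (∑ᶠ (g : Ptn) (d : Ptn), lrCoeff g.1 b c * lrCoeff lam g.1 (double d.1)) = 0 := by
  rw [finsum_congr (g := fun _ => 0) fun g => ?_, finsum_zero]
  rw [finsum_congr (g := fun _ => 0) fun d => ?_, finsum_zero]
  by_contra h
  exact hs _ (lr_support hl hb hc g.2 d.2 h).2.2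

end LittlewoodRichardsonSum

/-! ### The first rows of a symplectic matrix -/

section Selectors

variable {k n : ℕ} {ι : Type*}

/-- The matrix selecting the first `k` coordinates. -/
def selP (k n : ℕ) : Matrix (Fin k) (Fin n) ℂ := of fun i j => if (j : ℕ) = i then 1 else 0

/-- The matrix selecting the last `k` coordinates, in reversed order. -/
def selQ (k n : ℕ) : Matrix (Fin k) (Fin n) ℂ :=
  of fun i j => if (j : ℕ) = n - 1 - i then 1 else 0

lemma mul_selP (M : Matrix ι (Fin k) ℂ) (i : ι) (j : Fin n) :
    (M * selP k n) i j = if h : (j : ℕ) < k then M i ⟨j, h⟩ else 0 := by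
  rw [Matrix.mul_apply]
  split_ifs with h
  · rw [Finset.sum_eq_single ⟨j, h⟩]
    · simp [selP]
    · intro b _ hb
      have : (j : ℕ) ≠ b := fun h' => hb (Fin.ext h'.symm)
      simp [selP, this]
    · simp
  · refine Finset.sum_eq_zero fun b _ => ?_
    have : (j : ℕ) ≠ b := by omega
    simp [selP, this]

lemma mul_selQ (M : Matrix ι (Fin k) ℂ) (i : ι) (j : Fin n) (hk : 2 * k ≤ n) :
    (M * selQ k n) i j = if h : n - 1 - (j : ℕ) < k then M i ⟨n - 1 - j, h⟩ else 0 := by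
  rw [Matrix.mul_apply]
  split_ifs with h
  · rw [Finset.sum_eq_single ⟨n - 1 - j, h⟩]
    · have : (j : ℕ) = n - 1 - (n - 1 - j) := by omega
      simp [selQ, ← this]
    · intro b _ hb
      have : (j : ℕ) ≠ n - 1 - b := fun h' => hb (Fin.ext (by simp only; omega))
      simp [selQ, this]
    · simp
  · refine Finset.sum_eq_zero fun b _ => ?_
    have : (j : ℕ) ≠ n - 1 - b := by omega
    simp [selQ, this]

lemma selPt_mul (M : Matrix (Fin k) ι ℂ) (i : Fin n) (j : ι) :
    ((selP k n)ᵀ * M) i j = if h : (i : ℕ) < k then M ⟨i, h⟩ j else 0 := by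
  rw [← transpose_apply ((selP k n)ᵀ * M), transpose_mul, transpose_transpose, mul_selP]
  rfl

lemma selQt_mul (M : Matrix (Fin k) ι ℂ) (i : Fin n) (j : ι) (hk : 2 * k ≤ n) :
    ((selQ k n)ᵀ * M) i j = if h : n - 1 - (i : ℕ) < k then M ⟨n - 1 - i, h⟩ j else 0 := by
  rw [← transpose_apply ((selQ k n)ᵀ * M), transpose_mul, transpose_transpose, mul_selQ _ _ _ hk]
  rfl

lemma mul_selPt (hk : 2 * k ≤ n) (M : Matrix ι (Fin n) ℂ) (i : ι) (j : Fin k) :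
    (M * (selP k n)ᵀ) i j = M i ⟨j, by omega⟩ := by
  rw [Matrix.mul_apply, Finset.sum_eq_single ⟨j, by omega⟩]
  · simp [selP]
  · intro b _ hb
    have : (b : ℕ) ≠ j := fun h' => hb (Fin.ext h')
    simp [selP, this]
  · simp

lemma mul_selQt (hk : 2 * k ≤ n) (M : Matrix ι (Fin n) ℂ) (i : ι) (j : Fin k) :
    (M * (selQ k n)ᵀ) i j = M i ⟨n - 1 - j, by omega⟩ := by
  rw [Matrix.mul_apply, Finset.sum_eq_single ⟨n - 1 - j, by omega⟩]
  · simp [selQ]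
  · intro b _ hb
    have : (b : ℕ) ≠ n - 1 - j := fun h' => hb (Fin.ext h')
    simp [selQ, this]
  · simp

lemma selP_mul (hk : 2 * k ≤ n) (M : Matrix (Fin n) ι ℂ) (i : Fin k) (j : ι) :
    (selP k n * M) i j = M ⟨i, by omega⟩ j := by
  rw [← transpose_apply (selP k n * M), transpose_mul, mul_selPt hk]
  rfl

lemma selQ_mul (hk : 2 * k ≤ n) (M : Matrix (Fin n) ι ℂ) (i : Fin k) (j : ι) :
    (selQ k n * M) i j = M ⟨n - 1 - i, by omega⟩ j := by
  rw [← transpose_apply (selQ k n * M), transpose_mul, mul_selQt hk]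
  rfl

lemma selP_selPt (hk : 2 * k ≤ n) : selP k n * (selP k n)ᵀ = 1 := by
  ext i j
  rw [mul_selPt hk]
  simp [selP, one_apply, Fin.ext_iff, eq_comm]

lemma selQ_selQt (hk : 2 * k ≤ n) : selQ k n * (selQ k n)ᵀ = 1 := by
  ext i j
  rw [mul_selQt hk]
  have : (n - 1 - (j : ℕ) = n - 1 - i) ↔ i = j := by rw [Fin.ext_iff]; omega
  simp [selQ, one_apply, this]

lemma selP_selQt (hk : 2 * k ≤ n) : selP k n * (selQ k n)ᵀ = 0 := by
  ext i j
  rw [mul_selQt hk]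
  have : ¬ (n - 1 - (j : ℕ) = i) := by omega
  simp [selP, this]

lemma selQ_selPt (hk : 2 * k ≤ n) : selQ k n * (selP k n)ᵀ = 0 := by
  rw [← transpose_transpose (selQ k n * _), transpose_mul, transpose_transpose, selP_selQt hk,
    transpose_zero]

lemma isUpperUni_one_add {N : Mt n} (h : ∀ i j : Fin n, j ≤ i → N i j = 0) :
    IsUpperUni (1 + N) := by
  refine ⟨fun i => ?_, fun i j hij => ?_⟩
  · rw [Matrix.add_apply, h i i le_rfl, one_apply_eq, add_zero]
  · rw [Matrix.add_apply, h i j hij.le, one_apply_ne (Fin.val_injective.ne_iff.1 hij.ne'), add_zero]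

lemma selP_isUpperUni (hk : 2 * k ≤ n) {N : Matrix (Fin k) (Fin n) ℂ} (hN : N * (selP k n)ᵀ = 0) :
    IsUpperUni (1 + (selP k n)ᵀ * N) := by
  have h0 : ∀ i (j : Fin n), (j : ℕ) < k → N i j = 0 := fun i j hj => by
    have := congrFun (congrFun hN i) ⟨j, hj⟩
    rwa [mul_selPt hk] at this
  refine isUpperUni_one_add fun i j hij => ?_
  rw [selPt_mul]
  split_ifs with h
  · exact h0 _ _ (lt_of_le_of_lt hij h)
  · rfl

lemma selQ_isUpperUni (hk : 2 * k ≤ n) {N : Matrix (Fin k) (Fin n) ℂ} (hN : N * (selQ k n)ᵀ = 0) :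
    IsUpperUni (1 + Nᵀ * selQ k n) := by
  have h0 : ∀ i (j : Fin n), n - 1 - (j : ℕ) < k → N i j = 0 := fun i j hj => by
    have := congrFun (congrFun hN i) ⟨n - 1 - j, hj⟩
    rw [mul_selQt hk] at this
    rw [← show (⟨n - 1 - (n - 1 - j), by omega⟩ : Fin n) = j from Fin.ext (by simp only; omega)]
    exact this
  refine isUpperUni_one_add fun i j hij => ?_
  rw [mul_selQ _ _ _ hk]
  split_ifs with h
  · have : (j : ℕ) ≤ i := hij
    exact h0 _ _ (by omega)
  · rfl

/-- Column reduction of a pair of row blocks to normal form. -/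
lemma exists_normal_form {p q X Y : Matrix (Fin k) (Fin n) ℂ} {A' B' : Mt k}
    (hpp : p * pᵀ = 1) (hqq : q * qᵀ = 1) (hpq : p * qᵀ = 0) (hqp : q * pᵀ = 0)
    (hA : A' * (X * pᵀ) = 1) (hA' : X * pᵀ * A' = 1)
    (hB : B' * (Y * qᵀ) = 1) (hB' : Y * qᵀ * B' = 1) :
    ∃ N N₂ : Matrix (Fin k) (Fin n) ℂ, N * pᵀ = 0 ∧ N₂ * qᵀ = 0 ∧
      X * ((1 - pᵀ * N) * (1 + N₂ᵀ * q)) = X * pᵀ * p ∧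
      Y * ((1 + Nᵀ * p) * (1 - qᵀ * N₂)) = Y * Xᵀ * A'ᵀ * p + Y * qᵀ * q := by
  set N := A' * X - p with hN
  set Y₁ := Y * (1 + Nᵀ * p) with hY₁
  set N₂ := B' * (Y₁ - Y₁ * pᵀ * p) - q with hN₂
  have e1 : N * pᵀ = 0 := by rw [hN, Matrix.sub_mul, Matrix.mul_assoc, hA, hpp, sub_self]
  have e2 : Y₁ * qᵀ = Y * qᵀ := by
    rw [hY₁, Matrix.mul_assoc, Matrix.add_mul, Matrix.mul_assoc, hpq, Matrix.mul_zero, add_zero,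
      Matrix.one_mul]
  have e3 : N₂ * qᵀ = 0 := by
    rw [hN₂, Matrix.sub_mul, Matrix.mul_assoc, Matrix.sub_mul, e2, Matrix.mul_assoc, hpq, Matrix.mul_zero,
      sub_zero, hB, hqq, sub_self]
  have e4 : N₂ * pᵀ = 0 := by
    rw [hN₂, Matrix.sub_mul, Matrix.mul_assoc, Matrix.sub_mul, Matrix.mul_assoc _ p, hpp, Matrix.mul_one,
      sub_self, Matrix.mul_zero, hqp, sub_zero]
  have e5 : p * N₂ᵀ = 0 := by
    rw [← transpose_transpose (p * _), transpose_mul, transpose_transpose, e4, transpose_zero]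
  have e6 : X * (1 - pᵀ * N) = X * pᵀ * p := by
    rw [Matrix.mul_sub, Matrix.mul_one, ← Matrix.mul_assoc, hN, Matrix.mul_sub,
      ← Matrix.mul_assoc _ A', hA', Matrix.one_mul, sub_sub_cancel]
  have e7 : Y₁ * pᵀ = Y * Xᵀ * A'ᵀ := by
    have : p + N = A' * X := by rw [hN]; abel
    rw [hY₁, Matrix.mul_assoc, Matrix.add_mul, Matrix.mul_assoc, hpp, Matrix.one_mul,
      Matrix.mul_one, ← transpose_add, this, transpose_mul, Matrix.mul_assoc]
  refine ⟨N, N₂, e1, e3, ?_, ?_⟩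
  · rw [← Matrix.mul_assoc, e6, Matrix.mul_add, Matrix.mul_one, ← Matrix.mul_assoc,
      Matrix.mul_assoc _ p, e5, Matrix.mul_zero, Matrix.zero_mul, add_zero]
  · rw [← Matrix.mul_assoc, ← hY₁, Matrix.mul_sub, Matrix.mul_one, ← Matrix.mul_assoc, e2, hN₂,
      Matrix.mul_sub, ← Matrix.mul_assoc _ B', hB', Matrix.one_mul, e7]
    abel

/-- Block embedding of a pair of `k × k` matrices at both ends of the diagonal. -/
def embM (n : ℕ) (h m : Mt k) : Mt n :=
  (selP k n)ᵀ * ((h - 1) * selP k n) + (selQ k n)ᵀ * ((m - 1) * selQ k n) + 1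

lemma embM_transpose (h m : Mt k) : (embM n h m)ᵀ = embM n hᵀ mᵀ := by
  simp [embM, transpose_add, transpose_mul, Matrix.mul_assoc]

lemma selP_embM (hk : 2 * k ≤ n) (h m : Mt k) : selP k n * embM n h m = h * selP k n := by
  rw [embM, Matrix.mul_add, Matrix.mul_add, ← Matrix.mul_assoc, ← Matrix.mul_assoc (selP k n),
    selP_selPt hk, selP_selQt hk, Matrix.zero_mul, add_zero, Matrix.one_mul, Matrix.mul_one,
    Matrix.sub_mul, Matrix.one_mul, sub_add_cancel]

lemma selQ_embM (hk : 2 * k ≤ n) (h m : Mt k) : selQ k n * embM n h m = m * selQ k n := by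
  rw [embM, Matrix.mul_add, Matrix.mul_add, ← Matrix.mul_assoc, ← Matrix.mul_assoc (selQ k n),
    selQ_selPt hk, selQ_selQt hk, Matrix.zero_mul, zero_add, Matrix.one_mul, Matrix.mul_one,
    Matrix.sub_mul, Matrix.one_mul, sub_add_cancel]

lemma embM_selPt (hk : 2 * k ≤ n) (h m : Mt k) : embM n h m * (selP k n)ᵀ = (selP k n)ᵀ * h := by
  rw [← transpose_inj, transpose_mul, embM_transpose, transpose_transpose, selP_embM hk,
    transpose_mul, transpose_transpose]

lemma embM_selQt (hk : 2 * k ≤ n) (h m : Mt k) : embM n h m * (selQ k n)ᵀ = (selQ k n)ᵀ * m := by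
  rw [← transpose_inj, transpose_mul, embM_transpose, transpose_transpose, selQ_embM hk,
    transpose_mul, transpose_transpose]

lemma embM_mul_inv (hk : 2 * k ≤ n) {h m h' m' : Mt k} (hh : h * h' = 1) (hm : m * m' = 1) :
    embM n h m * embM n h' m' = 1 := by
  have e1 : ((h - 1) * h' + (h' - 1)) = 0 := by rw [sub_mul, hh, one_mul]; abel
  have e2 : ((m - 1) * m' + (m' - 1)) = 0 := by rw [sub_mul, hm, one_mul]; abel
  calc embM n h m * embM n h' m'
      = (selP k n)ᵀ * ((h - 1) * (selP k n * embM n h' m')) +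
        (selQ k n)ᵀ * ((m - 1) * (selQ k n * embM n h' m')) + embM n h' m' := by
        conv_lhs => rw [embM, Matrix.add_mul, Matrix.add_mul, Matrix.one_mul]
        simp only [Matrix.mul_assoc]
    _ = (selP k n)ᵀ * (((h - 1) * h' + (h' - 1)) * selP k n) +
        (selQ k n)ᵀ * (((m - 1) * m' + (m' - 1)) * selQ k n) + 1 := by
        rw [selP_embM hk, selQ_embM hk, embM]
        simp only [Matrix.add_mul, Matrix.mul_add, Matrix.mul_assoc]
        abel
    _ = 1 := by rw [e1, e2]; simp

lemma embM_apply (hk : 2 * k ≤ n) (h m : Mt k) (i j : Fin n) : embM n h m i j =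
    (if hij : (i : ℕ) < k ∧ (j : ℕ) < k then (h - 1) ⟨i, hij.1⟩ ⟨j, hij.2⟩ else 0) +
      (if hij : n - 1 - (i : ℕ) < k ∧ n - 1 - (j : ℕ) < k then
        (m - 1) ⟨n - 1 - i, hij.1⟩ ⟨n - 1 - j, hij.2⟩ else 0) +
      (1 : Mt n) i j := by
  rw [embM, Matrix.add_apply, Matrix.add_apply, selPt_mul, selQt_mul _ _ _ hk]
  congr 2
  · by_cases h1 : (i : ℕ) < k
    · rw [dif_pos h1, mul_selP]
      simp [h1]
    · simp [h1]
  · by_cases h1 : n - 1 - (i : ℕ) < k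
    · rw [dif_pos h1, mul_selQ _ _ _ hk]
      simp [h1]
    · simp [h1]

lemma embM_isUpperUni (hk : 2 * k ≤ n) {h m : Mt k} (hh : IsUpperUni h) (hm : IsLowerUni m) :
    IsUpperUni (embM n h m) := by
  refine ⟨fun i => ?_, fun i j hij => ?_⟩
  · rw [embM_apply hk, one_apply_eq]
    simp [hh.1, hm.1]
  · have hne : i ≠ j := fun h' => by simp [h'] at hij
    have h1 : ∀ a b : Fin k, (b : ℕ) < a → (h - 1) a b = 0 := fun a b hab => by
      rw [Matrix.sub_apply, hh.2 a b hab, one_apply_ne (fun h' => by simp [h'] at hab), sub_zero]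
    have h2 : ∀ a b : Fin k, (a : ℕ) < b → (m - 1) a b = 0 := fun a b hab => by
      rw [Matrix.sub_apply, hm.2 a b hab, one_apply_ne (fun h' => by simp [h'] at hab), sub_zero]
    rw [embM_apply hk, one_apply_ne hne, add_zero]
    split_ifs with c1 c2 c2
    · rw [h1 _ _ hij, h2 _ _ (by simp only; omega), add_zero]
    · rw [h1 _ _ hij, add_zero]
    · rw [h2 _ _ (by simp only; omega), add_zero]
    · rw [add_zero]

/-- Block embedding `GL_k × GL_k → GL_n`, dual on the second factor. -/
def emb (hk : 2 * k ≤ n) (h l : GL (Fin k) ℂ) : GL (Fin n) ℂ where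
  val := embM n (h : Mt k) (↑l⁻¹ : Mt k)ᵀ
  inv := embM n (↑h⁻¹ : Mt k) (l : Mt k)ᵀ
  val_inv := embM_mul_inv hk (by simp) (by rw [← transpose_mul]; simp)
  inv_val := embM_mul_inv hk (by simp) (by rw [← transpose_mul]; simp)

lemma emb_val (hk : 2 * k ≤ n) (h l : GL (Fin k) ℂ) :
    (emb hk h l : Mt n) = embM n (h : Mt k) (↑l⁻¹ : Mt k)ᵀ := rfl

lemma emb_inv_val (hk : 2 * k ≤ n) (h l : GL (Fin k) ℂ) :
    (↑(emb hk h l)⁻¹ : Mt n) = embM n (↑h⁻¹ : Mt k) (l : Mt k)ᵀ := rfl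

end Selectors

section Rows

variable {k n : ℕ}

/-- The first `k` rows of the first block column. -/
def rowX (k : ℕ) (g : SpGL n) : Matrix (Fin k) (Fin n) ℂ := selP k n * (blk g).toBlocks₁₁

/-- The first `k` rows of the second block column. -/
def rowY (k : ℕ) (g : SpGL n) : Matrix (Fin k) (Fin n) ℂ := selP k n * (blk g).toBlocks₁₂

/-- The basic unipotent invariants of the first `k` rows of a symplectic matrix. -/
def rowPt (k : ℕ) (g : SpGL n) : Vr k → ℂ :=
  pt (rowX k g * (selP k n)ᵀ) (rowY k g * (selQ k n)ᵀ) (rowX k g * (rowY k g)ᵀ)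

lemma blk_mul_symp (g : SpGL n) : blk g * stdJ n * (blk g)ᵀ = stdJ n := by
  have h2 := _root_.mul_eq_one_comm.1 (mul_of_symp (blk_symp g))
  have h3 : blk g * stdJ n * (blk g)ᵀ * stdJ n = -1 := by
    rw [← neg_eq_iff_eq_neg, ← h2]
    simp [Matrix.mul_assoc]
  calc blk g * stdJ n * (blk g)ᵀ = -(blk g * stdJ n * (blk g)ᵀ * stdJ n * stdJ n) := by
        rw [Matrix.mul_assoc _ (stdJ n) (stdJ n), stdJ_mul_self]; simp
    _ = stdJ n := by rw [h3]; simp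

lemma blocks_mul_symm (g : SpGL n) :
    (blk g).toBlocks₁₁ * ((blk g).toBlocks₁₂)ᵀ = (blk g).toBlocks₁₂ * ((blk g).toBlocks₁₁)ᵀ := by
  have h := blk_mul_symp g
  rw [blk_eq_blocks g, stdJ, fromBlocks_transpose, fromBlocks_multiply, fromBlocks_multiply] at h
  have := congrArg toBlocks₁₁ h
  simp only [toBlocks_fromBlocks₁₁, Matrix.mul_zero, Matrix.mul_one,
    Matrix.mul_neg, zero_add, add_zero, Matrix.neg_mul] at this
  rw [neg_add_eq_zero] at this
  exact this.symm

lemma rowX_mul_rowYt (g : SpGL n) : rowX k g * (rowY k g)ᵀ = rowY k g * (rowX k g)ᵀ := by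
  rw [rowX, rowY, transpose_mul, transpose_mul, Matrix.mul_assoc, Matrix.mul_assoc,
    ← Matrix.mul_assoc _ _ (selP k n)ᵀ, ← Matrix.mul_assoc _ _ (selP k n)ᵀ, blocks_mul_symm,
    Matrix.mul_assoc, Matrix.mul_assoc]

lemma rowS_symm (g : SpGL n) : (rowX k g * (rowY k g)ᵀ)ᵀ = rowX k g * (rowY k g)ᵀ := by
  rw [transpose_mul, transpose_transpose, rowX_mul_rowYt]

@[simp] lemma mA_rowPt (g : SpGL n) : mA (rowPt k g) = rowX k g * (selP k n)ᵀ := mA_pt _ _ _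

@[simp] lemma mB_rowPt (g : SpGL n) : mB (rowPt k g) = rowY k g * (selQ k n)ᵀ := mB_pt _ _ _

@[simp] lemma mS_rowPt (g : SpGL n) : mS (rowPt k g) = rowX k g * (rowY k g)ᵀ :=
  mS_pt (rowS_symm g)

lemma rowX_mul (g h : SpGL n) : rowX k (g * h) =
    rowX k g * (blk h).toBlocks₁₁ + rowY k g * (blk h).toBlocks₂₁ := by
  rw [rowX, blk_mul, blk_eq_blocks g, blk_eq_blocks h, fromBlocks_multiply]
  simp [rowX, rowY, Matrix.mul_add, Matrix.mul_assoc]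

lemma rowY_mul (g h : SpGL n) : rowY k (g * h) =
    rowX k g * (blk h).toBlocks₁₂ + rowY k g * (blk h).toBlocks₂₂ := by
  rw [rowY, blk_mul, blk_eq_blocks g, blk_eq_blocks h, fromBlocks_multiply]
  simp [rowX, rowY, Matrix.mul_add, Matrix.mul_assoc]

lemma rowX_mul_spPhi (g : SpGL n) (u : GL (Fin n) ℂ) :
    rowX k (g * spPhi n u) = rowX k g * (u : Mt n) := by
  simp [rowX_mul]

lemma rowY_mul_spPhi (g : SpGL n) (u : GL (Fin n) ℂ) :
    rowY k (g * spPhi n u) = rowY k g * (↑u⁻¹ : Mt n)ᵀ := by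
  simp [rowY_mul]

lemma rowPt_mul_spPhi {u : GL (Fin n) ℂ} {h l : Mt k}
    (hu : (u : Mt n) * (selP k n)ᵀ = (selP k n)ᵀ * h)
    (hl : (↑u⁻¹ : Mt n)ᵀ * (selQ k n)ᵀ = (selQ k n)ᵀ * l) (g : SpGL n) :
    rowPt k (g * spPhi n u) = tri 1 h l (rowPt k g) := by
  refine pt_ext ?_ ?_ ?_
  · simp [rowX_mul_spPhi, Matrix.mul_assoc, hu]
  · rw [mB_rowPt, mB_tri, rowY_mul_spPhi, Matrix.mul_assoc, hl]
    simp [Matrix.mul_assoc]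
  · have : (u : Mt n) * (↑u⁻¹ : Mt n) = 1 := by simp
    rw [mS_rowPt, mS_tri, mS_rowPt, rowX_mul_spPhi, rowY_mul_spPhi, transpose_mul,
      transpose_transpose, Matrix.mul_assoc, ← Matrix.mul_assoc (u : Mt n),
      this]
    simp

lemma rowPt_spPhi_mul {a : GL (Fin n) ℂ} {h : Mt k}
    (ha : selP k n * (a : Mt n) = h * selP k n) (g : SpGL n) :
    rowPt k (spPhi n a * g) = tri hᵀ 1 1 (rowPt k g) := by
  have e1 : rowX k (spPhi n a * g) = h * rowX k g := by
    rw [rowX, blk_mul, blk_eq_blocks g, blk_spPhi, fromBlocks_multiply, toBlocks_fromBlocks₁₁,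
      Matrix.zero_mul, add_zero, ← Matrix.mul_assoc, ha, Matrix.mul_assoc]
    rfl
  have e2 : rowY k (spPhi n a * g) = h * rowY k g := by
    rw [rowY, blk_mul, blk_eq_blocks g, blk_spPhi, fromBlocks_multiply, toBlocks_fromBlocks₁₂,
      Matrix.zero_mul, add_zero, ← Matrix.mul_assoc, ha, Matrix.mul_assoc]
    rfl
  refine pt_ext ?_ ?_ ?_
  · simp [e1, Matrix.mul_assoc]
  · simp [e2, Matrix.mul_assoc]
  · simp [e1, e2, Matrix.mul_assoc]

lemma rowX_nLo_mul (S : Mt n) (g : SpGL n) :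
    rowX k (nLo S * g) = rowX k g ∧ rowY k (nLo S * g) = rowY k g := by
  constructor
  · rw [rowX, rowX, blk_mul, blk_eq_blocks g, blk_nLo, fromBlocks_multiply]
    simp
  · rw [rowY, rowY, blk_mul, blk_eq_blocks g, blk_nLo, fromBlocks_multiply]
    simp

lemma rowPt_nLo_mul (S : Mt n) (g : SpGL n) :
    rowPt k (nLo S * g) = rowPt k g := by
  rw [rowPt, (rowX_nLo_mul S g).1, (rowX_nLo_mul S g).2]
  rfl

lemma rowPt_mul_emb (hk : 2 * k ≤ n) (h l : GL (Fin k) ℂ) (g : SpGL n) :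
    rowPt k (g * spPhi n (emb hk h l)) = tri 1 (h : Mt k) (l : Mt k) (rowPt k g) :=
  rowPt_mul_spPhi (by rw [emb_val, embM_selPt hk])
    (by rw [emb_inv_val, embM_transpose, transpose_transpose, embM_selQt hk]) g

lemma rowPt_emb_mul (hk : 2 * k ≤ n) (h l : GL (Fin k) ℂ) (g : SpGL n) :
    rowPt k (spPhi n (emb hk h l) * g) = tri (h : Mt k)ᵀ 1 1 (rowPt k g) :=
  rowPt_spPhi_mul (by rw [emb_val, selP_embM hk]) g

lemma inv_isUpperUni {u : GL (Fin n) ℂ} (hu : IsUpperUni (u : Mt n)) :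
    IsUpperUni (↑u⁻¹ : Mt n) :=
  up_closure_upper (inv_mem_up_closure (mem_up_closure hu))

lemma upper_mul_selPt (hk : 2 * k ≤ n) {u : Mt n}
    (hu : ∀ i j : Fin n, j < i → u i j = 0) :
    u * (selP k n)ᵀ = (selP k n)ᵀ * (selP k n * u * (selP k n)ᵀ) := by
  ext i j
  rw [mul_selPt hk, selPt_mul]
  split_ifs with h
  · rw [mul_selPt hk, selP_mul hk]
  · exact hu _ _ (Fin.lt_def.2 (by simp only; omega))

lemma lower_mul_selQt (hk : 2 * k ≤ n) {u : Mt n}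
    (hu : ∀ i j : Fin n, i < j → u i j = 0) :
    u * (selQ k n)ᵀ = (selQ k n)ᵀ * (selQ k n * u * (selQ k n)ᵀ) := by
  ext i j
  rw [mul_selQt hk, selQt_mul _ _ _ hk]
  split_ifs with h
  · rw [mul_selQt hk, selQ_mul hk]
    congr 1
    exact Fin.ext (by simp only; omega)
  · exact hu _ _ (Fin.lt_def.2 (by simp only; omega))

lemma selP_mul_lower (hk : 2 * k ≤ n) {u : Mt n}
    (hu : ∀ i j : Fin n, i < j → u i j = 0) :
    selP k n * u = selP k n * u * (selP k n)ᵀ * selP k n := by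
  have := congrArg transpose (upper_mul_selPt hk (u := uᵀ) fun i j h => hu j i h)
  simpa [transpose_mul, Matrix.mul_assoc] using this

lemma selP_conj_upper (hk : 2 * k ≤ n) {u : Mt n} (hu : IsUpperUni u) :
    IsUpperUni (selP k n * u * (selP k n)ᵀ) := by
  refine ⟨fun i => ?_, fun i j hij => ?_⟩
  · rw [mul_selPt hk, selP_mul hk, hu.1]
  · rw [mul_selPt hk, selP_mul hk, hu.2 _ _ hij]

lemma selQ_conj_upper (hk : 2 * k ≤ n) {u : Mt n} (hu : IsLowerUni u) :
    IsUpperUni (selQ k n * u * (selQ k n)ᵀ) := by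
  refine ⟨fun i => ?_, fun i j hij => ?_⟩
  · rw [mul_selQt hk, selQ_mul hk, hu.1]
  · rw [mul_selQt hk, selQ_mul hk, hu.2 _ _ (Fin.lt_def.2 (by simp only; omega))]

lemma rowPt_mul_upper (hk : 2 * k ≤ n) {u : GL (Fin n) ℂ}
    (hu : IsUpperUni (u : Mt n)) (g : SpGL n) :
    ∃ h l, IsUpperUni h ∧ IsUpperUni l ∧ rowPt k (g * spPhi n u) = tri 1 h l (rowPt k g) := by
  have hl : IsLowerUni (↑u⁻¹ : Mt n)ᵀ :=
    isUpperUni_transpose.1 (by rw [transpose_transpose]; exact inv_isUpperUni hu)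
  exact ⟨_, _, selP_conj_upper hk hu, selQ_conj_upper hk hl,
    rowPt_mul_spPhi (upper_mul_selPt hk fun i j h => hu.2 i j h) (lower_mul_selQt hk hl.2) g⟩

lemma rowPt_lower_mul (hk : 2 * k ≤ n) {a : GL (Fin n) ℂ}
    (ha : IsLowerUni (a : Mt n)) (g : SpGL n) :
    ∃ h, IsUpperUni h ∧ rowPt k (spPhi n a * g) = tri h 1 1 (rowPt k g) := by
  refine ⟨_, ?_, rowPt_spPhi_mul (selP_mul_lower hk ha.2) g⟩
  have := selP_conj_upper (k := k) hk (isUpperUni_transpose.2 ha)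
  simpa [transpose_mul, Matrix.mul_assoc] using this

end Rows

section NormalForms

variable {k n : ℕ}

lemma exists_first_normal_form (hk : 2 * k ≤ n) (g : SpGL n)
    (hA : (rowX k g * (selP k n)ᵀ).det ≠ 0) (hB : (rowY k g * (selQ k n)ᵀ).det ≠ 0) :
    ∃ u : GL (Fin n) ℂ, IsUpperUni (u : Mt n) ∧
      rowX k (g * spPhi n u) = rowX k g * (selP k n)ᵀ * selP k n ∧
      rowY k (g * spPhi n u) =
        rowX k g * (rowY k g)ᵀ * ((rowX k g * (selP k n)ᵀ)⁻¹)ᵀ * selP k n +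
          rowY k g * (selQ k n)ᵀ * selQ k n := by
  have hA' := hA.isUnit
  have hB' := hB.isUnit
  obtain ⟨N, N₂, h1, h2, h3, h4⟩ := exists_normal_form (selP_selPt hk) (selQ_selQt hk)
    (selP_selQt hk) (selQ_selPt hk) (nonsing_inv_mul _ hA') (mul_nonsing_inv _ hA')
    (nonsing_inv_mul _ hB') (mul_nonsing_inv _ hB')
  have e1 : (selP k n)ᵀ * N * ((selP k n)ᵀ * N) = 0 := by
    rw [Matrix.mul_assoc, ← Matrix.mul_assoc N, h1]; simp
  have e2 : N₂ᵀ * selQ k n * (N₂ᵀ * selQ k n) = 0 := by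
    rw [Matrix.mul_assoc, ← Matrix.mul_assoc (selQ k n), ← transpose_transpose (selQ k n * _),
      transpose_mul, transpose_transpose, h2]; simp
  have key : (1 - (selP k n)ᵀ * N) * (1 + N₂ᵀ * selQ k n) *
      ((1 - N₂ᵀ * selQ k n) * (1 + (selP k n)ᵀ * N)) = 1 := by
    have e3 : (1 + N₂ᵀ * selQ k n) * (1 - N₂ᵀ * selQ k n) = 1 := by
      rw [mul_sub, add_mul, mul_one, add_mul, e2]; simp
    have e4 : (1 - (selP k n)ᵀ * N) * (1 + (selP k n)ᵀ * N) = 1 := by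
      rw [mul_add, sub_mul, mul_one, sub_mul, e1]; simp
    rw [mul_assoc, ← mul_assoc _ _ (1 + (selP k n)ᵀ * N), e3, one_mul, e4]
  refine ⟨⟨_, _, key, _root_.mul_eq_one_comm.1 key⟩, ?_, ?_, ?_⟩
  · refine IsUpperUni.mul ?_ (selQ_isUpperUni hk h2)
    rw [sub_eq_add_neg, ← Matrix.mul_neg]
    exact selP_isUpperUni hk (by rw [Matrix.neg_mul, h1, neg_zero])
  · rw [rowX_mul_spPhi, ← h3]
  · rw [rowY_mul_spPhi, rowX_mul_rowYt, ← h4]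
    refine congrArg _ ?_
    change ((1 - N₂ᵀ * selQ k n) * (1 + (selP k n)ᵀ * N))ᵀ = _
    simp [transpose_mul]

lemma exists_second_normal_form (hk : 2 * k ≤ n) (g : SpGL n)
    (hA : (rowX k g * (selP k n)ᵀ).det ≠ 0) (hB : (rowY k g * (selQ k n)ᵀ).det ≠ 0) :
    ∃ u : GL (Fin n) ℂ, IsUpperUni (u : Mt n) ∧
      rowX k (g * spPhi n u) =
        rowX k g * (rowY k g)ᵀ * ((rowY k g * (selQ k n)ᵀ)⁻¹)ᵀ * selQ k n +
          rowX k g * (selP k n)ᵀ * selP k n ∧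
      rowY k (g * spPhi n u) = rowY k g * (selQ k n)ᵀ * selQ k n := by
  have hA' := hA.isUnit
  have hB' := hB.isUnit
  obtain ⟨N, N₂, h1, h2, h3, h4⟩ := exists_normal_form (selQ_selQt hk) (selP_selPt hk)
    (selQ_selPt hk) (selP_selQt hk) (nonsing_inv_mul _ hB') (mul_nonsing_inv _ hB')
    (nonsing_inv_mul _ hA') (mul_nonsing_inv _ hA')
  have e1 : (selP k n)ᵀ * N₂ * ((selP k n)ᵀ * N₂) = 0 := by
    rw [Matrix.mul_assoc, ← Matrix.mul_assoc N₂, h2]; simp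
  have e2 : Nᵀ * selQ k n * (Nᵀ * selQ k n) = 0 := by
    rw [Matrix.mul_assoc, ← Matrix.mul_assoc (selQ k n), ← transpose_transpose (selQ k n * _),
      transpose_mul, transpose_transpose, h1]; simp
  have key : (1 + Nᵀ * selQ k n) * (1 - (selP k n)ᵀ * N₂) *
      ((1 + (selP k n)ᵀ * N₂) * (1 - Nᵀ * selQ k n)) = 1 := by
    have e3 : (1 - (selP k n)ᵀ * N₂) * (1 + (selP k n)ᵀ * N₂) = 1 := by
      rw [mul_add, sub_mul, mul_one, sub_mul, e1]; simp
    have e4 : (1 + Nᵀ * selQ k n) * (1 - Nᵀ * selQ k n) = 1 := by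
      rw [mul_sub, add_mul, mul_one, add_mul, e2]; simp
    rw [mul_assoc, ← mul_assoc _ _ (1 - Nᵀ * selQ k n), e3, one_mul, e4]
  refine ⟨⟨_, _, key, _root_.mul_eq_one_comm.1 key⟩, ?_, ?_, ?_⟩
  · refine IsUpperUni.mul (selQ_isUpperUni hk h1) ?_
    rw [sub_eq_add_neg, ← Matrix.mul_neg]
    exact selP_isUpperUni hk (by rw [Matrix.neg_mul, h2, neg_zero])
  · rw [rowX_mul_spPhi, ← h4]
  · rw [rowY_mul_spPhi, ← h3]
    refine congrArg _ ?_
    change ((1 + (selP k n)ᵀ * N₂) * (1 - Nᵀ * selQ k n))ᵀ = _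
    simp [transpose_mul]

lemma exists_rows (hk : 2 * k ≤ n) (A : GL (Fin k) ℂ) (B S : Mt k) (hS : Sᵀ = S) :
    ∃ g : SpGL n, rowX k g = (A : Mt k) * selP k n ∧
      rowY k g = S * (↑A⁻¹ : Mt k)ᵀ * selP k n + B * selQ k n := by
  set Z : Mt n := (selP k n)ᵀ * ((↑A⁻¹ : Mt k) * B) * selQ k n with hZ
  set W : Mt n :=
    (selP k n)ᵀ * ((↑A⁻¹ : Mt k) * S * (↑A⁻¹ : Mt k)ᵀ) * selP k n + (Z + Zᵀ) with hW
  obtain ⟨S', hS'⟩ := exists_nLo_of_isSymm (W := W) (by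
    rw [hW, transpose_add, transpose_add, transpose_transpose, add_comm Zᵀ]
    simp only [transpose_mul, transpose_transpose, hS, Matrix.mul_assoc])
  have hX : selP k n * (emb hk A 1 : Mt n) = (A : Mt k) * selP k n := by
    rw [emb_val, selP_embM hk]
  refine ⟨spPhi n (emb hk A 1) * nUp S', ?_, ?_⟩
  · rw [rowX_mul]
    simp [rowX, rowY, hX]
  · have h1 : selP k n * Z = (↑A⁻¹ : Mt k) * B * selQ k n := by
      rw [hZ, ← Matrix.mul_assoc, ← Matrix.mul_assoc, selP_selPt hk, Matrix.one_mul]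
    have h2 : selP k n * Zᵀ = 0 := by
      rw [hZ, transpose_mul, ← Matrix.mul_assoc, selP_selQt hk, Matrix.zero_mul]
    have h3 : selP k n * W = (↑A⁻¹ : Mt k) * (S * (↑A⁻¹ : Mt k)ᵀ * selP k n + B * selQ k n) := by
      rw [hW, Matrix.mul_add, Matrix.mul_add, h1, h2, add_zero, ← Matrix.mul_assoc,
        ← Matrix.mul_assoc, selP_selPt hk, Matrix.one_mul, Matrix.mul_add]
      simp only [Matrix.mul_assoc]
    have h4 : (A : Mt k) * (↑A⁻¹ : Mt k) = 1 := by simp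
    have h5 : rowX k (spPhi n (emb hk A 1)) = (A : Mt k) * selP k n := by
      rw [rowX, blk_spPhi, toBlocks_fromBlocks₁₁, hX]
    have h6 : rowY k (spPhi n (emb hk A 1)) = 0 := by simp [rowY]
    rw [rowY_mul, h5, h6, blk_nUp, toBlocks_fromBlocks₁₂, hS', Matrix.zero_mul, add_zero,
      Matrix.mul_assoc, h3, ← Matrix.mul_assoc, h4, Matrix.one_mul]

end NormalForms

section Functions

open MvPolynomial

variable {k n : ℕ}

lemma exists_gl_of_upper {h : Mt k} (hh : IsUpperUni h) :
    ∃ u : GL (Fin k) ℂ, (u : Mt k) = h ∧ u ∈ rootMon (glUp k) := by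
  have hdet : h.det = 1 := by rw [← minor_self, hh.minor_eq]
  have hv : ((GeneralLinearGroup.mkOfDetNeZero h (by rw [hdet]; exact one_ne_zero) :
      GL (Fin k) ℂ) : Mt k) = h := rfl
  exact ⟨_, hv, mem_up_closure (by rw [hv]; exact hh)⟩

lemma eval_tri_one {p : Rg k} {χ : GL (Fin k) ℂ → ℂ} (hp : p ∈ (glCell k).HW (act1 k) χ) {h : Mt k}
    (hh : IsUpperUni h) (x : Vr k → ℂ) : eval (tri h 1 1 x) p = eval x p := by
  obtain ⟨u, rfl, hu⟩ := exists_gl_of_upper hh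
  rw [← eval_triAct, ← act1_apply, CellData.up_word_fix hp hu]

/-- Right translation of functions on the symplectic group. -/
def rt (n : ℕ) : Representation ℂ (SpGL n) (SpGL n → ℂ) where
  toFun h := { toFun := fun F g => F (g * h), map_add' := fun _ _ => rfl, map_smul' := fun _ _ => rfl }
  map_one' := by ext F g; simp
  map_mul' h h' := by ext F g; simp [mul_assoc]

lemma rt_apply (h : SpGL n) (F : SpGL n → ℂ) (g : SpGL n) : rt n h F g = F (g * h) := rfl

/-- The entries of the first `k` rows. -/
def rowVar (k n : ℕ) (v : Fin k × (Fin n ⊕ Fin n)) (g : SpGL n) : ℂ :=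
  fromCols (rowX k g) (rowY k g) v.1 v.2

lemma rows_mul (g h : SpGL n) : fromCols (rowX k (g * h)) (rowY k (g * h)) =
    fromCols (rowX k g) (rowY k g) * blk h := by
  rw [rowX_mul, rowY_mul, blk_eq_blocks h, fromCols_mul_fromBlocks]
  simp

open scoped Kronecker in
lemma rt_rowVar (h : SpGL n) (j : Fin k × (Fin n ⊕ Fin n)) : rt n h (rowVar k n j) =
    ∑ i, ((1 : Mt k) ⊗ₖ blk h) i j • rowVar k n i := by
  ext g
  rw [rt_apply, rowVar, rows_mul, Matrix.mul_apply, Finset.sum_apply, Fintype.sum_prod_type,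
    Finset.sum_eq_single j.1]
  · simp [rowVar, mul_comm]
  · intro b _ hb
    simp [Matrix.one_apply_ne hb]
  · simp

open scoped Kronecker in
lemma starClosed_of_conj {G : Type*} [Group G] (f : G →* SpGL n)
    (h : ∀ g, ∃ g', blk (f g') = (blk (f g))ᴴ) : StarClosed ((rt n).comp f) (rowVar k n) := by
  intro g
  obtain ⟨g', hg'⟩ := h g
  refine ⟨(1 : Mt k) ⊗ₖ blk (f g), rt_rowVar _, g', fun j => ?_⟩
  rw [conjTranspose_kronecker, conjTranspose_one, ← hg']
  exact rt_rowVar _ j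

lemma starClosed_rt : StarClosed (rt n) (rowVar k n) := by
  refine starClosed_of_conj (MonoidHom.id _) fun g => ?_
  suffices hg : (blk g)ᴴᵀ * stdJ n * (blk g)ᴴ = stdJ n from ⟨mkSp (blk g)ᴴ hg, blk_mkSp _ hg⟩
  have h := congrArg (fun M : BlockMat n => M.map star) (blk_mul_symp g)
  have hJ : (stdJ n).map star = stdJ n := by
    ext i j
    rcases i with i | i <;> rcases j with j | j <;> simp [stdJ, Matrix.one_apply, apply_ite]
  have hm : ∀ M N : BlockMat n, (M * N).map star = M.map star * N.map star := fun M N =>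
    Matrix.map_mul (f := starRingEnd ℂ)
  simp only [hm, hJ] at h
  exact h

lemma starClosed_rt_spPhi : StarClosed ((rt n).comp (spPhi n)) (rowVar k n) := by
  refine starClosed_of_conj _ fun g => ⟨star g, ?_⟩
  rw [blk_spPhi, blk_spPhi, fromBlocks_conjTranspose]
  simp only [conjTranspose_zero]
  rfl

/-- Polynomials evaluated at the basic invariants, as functions on the symplectic group. -/
def rowEval (k n : ℕ) : Rg k →ₐ[ℂ] (SpGL n → ℂ) := AlgHom.pi fun g => aeval (rowPt k g)

@[simp] lemma rowEval_apply (p : Rg k) (g : SpGL n) : rowEval k n p g = eval (rowPt k g) p := by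
  exact congrFun (congrArg DFunLike.coe (coe_aeval_eq_eval _)) p

instance {ι 𝒜 : Type*} [Fintype ι] [CommRing 𝒜] [Algebra ℂ 𝒜] (z : ι → 𝒜) :
    SetLike.GradedMonoid (monoSpan z) where
  one_mem := Submodule.subset_span ⟨Fin.elim0, by simp⟩
  mul_mem i j a b ha hb := by
    induction ha using Submodule.span_induction with
    | zero => rw [zero_mul]; exact zero_mem _
    | add x y _ _ hx hy => rw [add_mul]; exact add_mem hx hy
    | smul c x _ hx => rw [smul_mul_assoc]; exact Submodule.smul_mem _ c hx
    | mem x hx =>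
      obtain ⟨I, rfl⟩ := hx
      induction i with
      | zero => simpa using hb
      | succ i ih =>
        simp only [Fin.prod_univ_succ, mul_assoc]
        rw [add_right_comm]
        exact mul_mem_monoSpan z _ (ih fun a => I a.succ)

lemma rowVar_mem (v : Fin k × (Fin n ⊕ Fin n)) : rowVar k n v ∈ monoSpan (rowVar k n) 1 :=
  Submodule.subset_span ⟨fun _ => v, by simp⟩

lemma rowEval_X_mem (hk : 2 * k ≤ n) (v : Vr k) : rowEval k n (X v) ∈
    monoSpan (rowVar k n) (Sum.elim (fun _ => 1) (Sum.elim (fun _ => 1) fun _ => 2) v) := by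
  rcases v with ⟨i, j⟩ | ⟨i, j⟩ | v
  · change _ ∈ monoSpan _ 1
    convert rowVar_mem (i, Sum.inl (⟨j, by have := j.2; omega⟩ : Fin n)) using 1
    ext g
    rw [rowEval_apply, eval_X]
    exact mul_selPt hk _ i j
  · change _ ∈ monoSpan _ 1
    convert rowVar_mem (i, Sum.inr (⟨n - 1 - j, by have := j.2; omega⟩ : Fin n)) using 1
    ext g
    rw [rowEval_apply, eval_X]
    exact mul_selQt hk _ i j
  · induction v using Sym2.ind with
    | _ i j =>
    have : rowEval k n (X (Sum.inr (Sum.inr s(i, j)))) =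
        ∑ c : Fin n, rowVar k n (i, Sum.inl c) * rowVar k n (j, Sum.inr c) := by
      ext g
      rw [rowEval_apply, eval_X]
      exact (congrFun₂ (mS_rowPt g) i j).trans (by simp [Matrix.mul_apply, rowVar])
    rw [this]
    exact sum_mem fun c _ => SetLike.mul_mem_graded (A := monoSpan (rowVar k n)) (i := 1) (j := 1)
      (rowVar_mem _) (rowVar_mem _)

lemma rowEval_mem_monoSpan (hk : 2 * k ≤ n) {d₁ d₂ e : ℕ} {p : Rg k} (hp : p ∈ Rd k d₁ d₂ e) :
    rowEval k n p ∈ monoSpan (rowVar k n) (d₁ + d₂ + 2 * e) := by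
  rw [p.as_sum, map_sum]
  refine sum_mem fun m hm => ?_
  obtain ⟨h1, h2, h3⟩ := mem_Rd.1 hp m (mem_support_iff.1 hm)
  rw [show monomial m (coeff m p) = coeff m p • monomial m (1 : ℂ) by simp [smul_monomial], map_smul,
    monomial_eq, C_1, one_mul,
    Finsupp.prod_fintype _ _ (by simp), map_prod]
  simp only [map_pow]
  refine Submodule.smul_mem _ _ ?_
  have := SetLike.prod_pow_mem_graded (monoSpan (rowVar k n)) (n := fun v => m v) (F := Finset.univ)
    _ _ fun v _ => rowEval_X_mem hk v
  convert this using 1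
  rw [← h1, ← h2, ← h3]
  simp [dA, dB, dS, Fintype.sum_sum_type, Finset.mul_sum, mul_comm, add_assoc]

/-- The point determined by the matrices `A`, `B`, `S` occurs as the invariants of some element. -/
lemma exists_rowPt_eq (hk : 2 * k ≤ n) (x : Vr k → ℂ) (hx : (mA x).det ≠ 0) :
    ∃ g : SpGL n, rowPt k g = x ∧ rowX k g = mA x * selP k n ∧
      rowY k g = mS x * ((mA x)⁻¹)ᵀ * selP k n + mB x * selQ k n := by
  obtain ⟨g, h1, h2⟩ := exists_rows hk (GeneralLinearGroup.mkOfDetNeZero (mA x) hx) (mB x) (mS x)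
    (mS_symm x)
  replace h1 : rowX k g = mA x * selP k n := h1
  replace h2 : rowY k g = mS x * ((mA x)⁻¹)ᵀ * selP k n + mB x * selQ k n := by
    rw [h2, coe_units_inv]; rfl
  refine ⟨g, pt_ext ?_ ?_ ?_, h1, h2⟩
  · rw [mA_rowPt, h1, Matrix.mul_assoc, selP_selPt hk, Matrix.mul_one]
  · rw [mB_rowPt, h2, Matrix.add_mul, Matrix.mul_assoc, Matrix.mul_assoc (mB x), selP_selQt hk,
      selQ_selQt hk, Matrix.mul_zero, Matrix.mul_one, zero_add]
  · rw [mS_rowPt, rowX_mul_rowYt, h1, h2, transpose_mul, Matrix.add_mul, Matrix.mul_assoc,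
      ← Matrix.mul_assoc (selP k n), selP_selPt hk, Matrix.mul_assoc (mB x),
      ← Matrix.mul_assoc (selQ k n), selQ_selPt hk, Matrix.zero_mul, Matrix.mul_zero, add_zero,
      Matrix.one_mul, Matrix.mul_assoc, ← transpose_mul,
      mul_nonsing_inv _ (isUnit_iff_ne_zero.2 hx), transpose_one, Matrix.mul_one]

lemma rowEval_injective (hk : 2 * k ≤ n) : Function.Injective (rowEval k n) := by
  refine (injective_iff_map_eq_zero _).2 fun p hp => ?_
  refine eq_zero_of_eval_mul XA_det_ne_zero fun x hx => ?_
  rw [eval_det_map, XA_map] at hx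
  obtain ⟨g, hg, -⟩ := exists_rowPt_eq hk x hx
  rw [← hg, ← rowEval_apply, hp]; rfl

/-- The character of the symplectic torus attached to a weight with at most `k` parts. -/
def spChar (k : ℕ) (a : ℕ → ℕ) (g : SpGL n) : ℂ := ∏ i : Fin k, mA (rowPt k g) i i ^ a i

lemma spChar_dg (hk : 2 * k ≤ n) (a : ℕ → ℕ) (d : Fin n → ℂˣ) :
    spChar k a (spPhi n (dg d)) = ∏ i : Fin k, (d ⟨i, by omega⟩ : ℂ) ^ a i := by
  refine Finset.prod_congr rfl fun i _ => ?_
  rw [mA_rowPt, mul_selPt hk, rowX, selP_mul hk]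
  simp

lemma selP_diagonal (hk : 2 * k ≤ n) (d : Fin n → ℂ) :
    selP k n * diagonal d = diagonal (fun i : Fin k => d ⟨i, by omega⟩) * selP k n := by
  ext i j
  rw [selP_mul hk, mul_selP, diagonal_apply]
  simp only [diagonal_apply, Fin.ext_iff]
  split_ifs <;> first | rfl | omega

/-- Functions on the symplectic group which transform like a highest weight functional
under left translation by lower triangular elements. -/
def Bsp (k n : ℕ) (lam : ℕ → ℕ) : Submodule ℂ (SpGL n → ℂ) where
  carrier := {F | F ∈ monoSpan (rowVar k n) (sz k lam) ∧
    (∀ x ∈ spLo n, ∀ s g, F (x s * g) = F g) ∧ ∀ t ∈ spTorus n, ∀ g, F (t * g) = spChar k lam t * F g}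
  add_mem' := by
    rintro F F' ⟨h1, h2, h3⟩ ⟨h1', h2', h3'⟩
    refine ⟨add_mem h1 h1', fun x hx s g => ?_, fun t ht g => ?_⟩
    · simp only [Pi.add_apply, h2 x hx, h2' x hx]
    · simp only [Pi.add_apply, h3 t ht, h3' t ht, mul_add]
  zero_mem' := ⟨zero_mem _, fun _ _ _ _ => rfl, fun _ _ _ => by simp⟩
  smul_mem' := by
    rintro c F ⟨h1, h2, h3⟩
    refine ⟨Submodule.smul_mem _ c h1, fun x hx s g => ?_, fun t ht g => ?_⟩
    · simp only [Pi.smul_apply, h2 x hx]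
    · simp only [Pi.smul_apply, h3 t ht, smul_eq_mul, mul_left_comm]

lemma rowEval_mem_Bsp (hk : 2 * k ≤ n) {lam : ℕ → ℕ} {d₁ d₂ e : ℕ} {p : Rg k}
    (hp : p ∈ Rd k d₁ d₂ e) (hs : sz k lam = d₁ + d₂ + 2 * e)
    (hw : p ∈ (glCell k).HW (act1 k) (glChar k lam)) : rowEval k n p ∈ Bsp k n lam := by
  refine ⟨hs ▸ rowEval_mem_monoSpan hk hp, ?_, ?_⟩
  · rintro x (⟨y, ⟨i, j, hij, rfl⟩, rfl⟩ | ⟨i, j, rfl⟩) s g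
    · obtain ⟨h, hh, hg⟩ := rowPt_lower_mul hk (a := tv i j hij.ne' s) (tv_lower hij s) g
      rw [rowEval_apply, hg, eval_tri_one hw hh, rowEval_apply]
    · rw [rowEval_apply, rowPt_nLo_mul, rowEval_apply]
  · rintro _ ⟨_, ⟨d, rfl⟩, rfl⟩ g
    have h1 := rowPt_spPhi_mul (k := k) (a := dg d) (by rw [dg_val]; exact selP_diagonal hk _) g
    have h2 := (CellData.mem_HW.1 hw).2 (dg fun i : Fin k => d ⟨i, by omega⟩) ⟨_, rfl⟩
    rw [act1_apply, dg_val] at h2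
    rw [rowEval_apply, h1, diagonal_transpose, ← eval_triAct, h2, smul_eval, glChar_dg,
      spChar_dg hk, rowEval_apply]

lemma isSubrep_Bsp (lam : ℕ → ℕ) : IsSubrep (rt n) (Bsp k n lam) := by
  rintro h F ⟨h1, h2, h3⟩
  refine ⟨?_, fun x hx s g => ?_, fun t ht g => ?_⟩
  · clear h2 h3
    induction h1 using Submodule.span_induction with
    | zero => rw [map_zero]; exact zero_mem _
    | add x y _ _ hx hy => rw [map_add]; exact add_mem hx hy
    | smul c x _ hx => rw [map_smul]; exact Submodule.smul_mem _ c hx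
    | mem x hx =>
      obtain ⟨I, rfl⟩ := hx
      have : rt n h (∏ a, rowVar k n (I a)) = ∏ a, rt n h (rowVar k n (I a)) := by
        ext g; simp [rt_apply, Finset.prod_apply]
      rw [this]
      have := SetLike.prod_mem_graded (monoSpan (rowVar k n)) (fun _ => 1) 
        (fun a => rt n h (rowVar k n (I a))) (F := Finset.univ) fun a _ => by
          rw [rt_rowVar]
          exact sum_mem fun i _ => Submodule.smul_mem _ _ (rowVar_mem i)
      simpa using this
  · rw [rt_apply, rt_apply, mul_assoc, h2 x hx]
  · rw [rt_apply, rt_apply, mul_assoc, h3 t ht]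

lemma rt_mul (h : SpGL n) (F F' : SpGL n → ℂ) : rt n h (F * F') = rt n h F * rt n h F' := rfl

instance (lam : ℕ → ℕ) : FiniteDimensional ℂ (Bsp k n lam) :=
  Submodule.finiteDimensional_of_le (S₂ := monoSpan (rowVar k n) (sz k lam)) fun _ h => h.1

theorem Bsp_irreducible (hk : 2 * k ≤ n) {lam : ℕ → ℕ} (hl : PT k lam) :
    IsIrreducibleRep (subRep (rt n) (Bsp k n lam) (isSubrep_Bsp lam)) ∧
      ∃ v, v ∈ (spCell n).HW (subRep (rt n) (Bsp k n lam) (isSubrep_Bsp lam)) (spChar k lam) ∧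
        v ≠ 0 := by
  have hss := exists_isCompl_of_starClosed (rt n) rt_mul (fun _ => rfl) (rowVar k n) starClosed_rt
    (sz k lam) (isSubrep_Bsp lam) fun _ h => h.1
  have hnt : Nontrivial (Bsp k n lam) := by
    refine ⟨⟨rowEval k n (hwPoly lam (XA k)),
      rowEval_mem_Bsp hk (hwPoly_mem_Rd hl) (by simp) (hwPoly_mem_HW1 hl)⟩, 0, fun h => ?_⟩
    refine hwPoly_XA_ne_zero (k := k) lam (rowEval_injective hk ?_)
    rw [map_zero]
    exact congrArg Subtype.val h
  refine CellData.irreducible_of_coHW hss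
    (ξ := LinearMap.proj (R := ℂ) (φ := fun _ : SpGL n => ℂ) 1 ∘ₗ (Bsp k n lam).subtype)
    ⟨fun x hx s v => ?_, fun t ht v => ?_⟩ fun y hy => ?_
  · change (v : SpGL n → ℂ) (1 * x s) = (v : SpGL n → ℂ) 1
    rw [one_mul, ← mul_one (x s), v.2.2.1 x hx]
  · change (v : SpGL n → ℂ) (1 * t) = _ * (v : SpGL n → ℂ) 1
    rw [one_mul, ← v.2.2.2 t ht, mul_one]
  · ext g
    have := hy g
    change (y : SpGL n → ℂ) (1 * g) = 0 at this
    rwa [one_mul] at this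

lemma ss_Bsp (lam : ℕ → ℕ) (hU : IsSubrep ((rt n).comp (spPhi n)) (Bsp k n lam)) :
    SS (subRep ((rt n).comp (spPhi n)) (Bsp k n lam) hU) :=
  exists_isCompl_of_starClosed ((rt n).comp (spPhi n)) (fun g => rt_mul (spPhi n g)) (fun _ => rfl)
    (rowVar k n) starClosed_rt_spPhi (sz k lam) hU fun _ h => h.1

end Functions

section Division

open MvPolynomial

variable {k n : ℕ}

lemma det_mem_supported {s : Set (Vr k)} {M : Matrix (Fin k) (Fin k) (Rg k)}
    (h : ∀ i j, M i j ∈ supported ℂ s) : M.det ∈ supported ℂ s := by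
  rw [det_apply]
  exact sum_mem fun σ _ => zsmul_mem (prod_mem fun i _ => h _ _) _

lemma isRelPrime_of_supported {σ : Type*} {p q : MvPolynomial σ ℂ} {s t : Set σ}
    (hst : Disjoint s t) (hp : p ∈ supported ℂ s) (hq : q ∈ supported ℂ t) (hp0 : p ≠ 0)
    (hq0 : q ≠ 0) : IsRelPrime p q := by
  have key : ∀ {d p : MvPolynomial σ ℂ}, d ∣ p → p ≠ 0 → d.vars ⊆ p.vars := by
    rintro d _ ⟨c, rfl⟩ h i hi
    rw [mem_vars_iff_degreeOf_ne_zero] at hi ⊢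
    rw [degreeOf_mul_eq (left_ne_zero_of_mul h) (right_ne_zero_of_mul h)]
    omega
  intro d h1 h2
  have hd : d.vars = ∅ := Finset.eq_empty_of_forall_notMem fun i hi =>
    Set.disjoint_left.1 hst (mem_supported.1 hp (key h1 hp0 hi)) (mem_supported.1 hq (key h2 hq0 hi))
  rw [vars_eq_empty_iff_eq_C] at hd
  have h0 : coeff 0 d ≠ 0 := fun h => ne_zero_of_dvd_ne_zero hp0 h1 (by rw [hd, h, map_zero])
  rw [hd]
  exact h0.isUnit.map C

lemma det_XA_pow_dvd {q q' : Rg k} {D : ℕ} (h : q * (XB k).det ^ D = q' * (XA k).det ^ D) :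
    (XA k).det ^ D ∣ q := by
  refine IsRelPrime.dvd_of_dvd_mul_right (z := (XB k).det ^ D) ?_ (h ▸ dvd_mul_left _ _)
  refine isRelPrime_of_supported (s := Set.range Sum.inl) (t := Set.range Sum.inr)
    Set.isCompl_range_inl_range_inr.disjoint (pow_mem (det_mem_supported fun i j => ?_) D)
    (pow_mem (det_mem_supported fun i j => ?_) D) (pow_ne_zero _ XA_det_ne_zero)
    (pow_ne_zero _ XB_det_ne_zero)
  · exact X_mem_supported.2 ⟨_, rfl⟩
  · exact X_mem_supported.2 ⟨_, rfl⟩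

/-- A homogeneous polynomial in the first rows, evaluated on a matrix of polynomials. -/
lemma exists_eval_of_mem_monoSpan {D : ℕ} {F : SpGL n → ℂ} (hF : F ∈ monoSpan (rowVar k n) D)
    (M : Matrix (Fin k) (Fin n ⊕ Fin n) (Rg k)) : ∃ q : Rg k, ∀ y g c,
      M.map (eval y) = c • fromCols (rowX k g) (rowY k g) → eval y q = c ^ D * F g := by
  induction hF using Submodule.span_induction with
  | mem F hF =>
    obtain ⟨I, rfl⟩ := hF
    refine ⟨∏ a, M (I a).1 (I a).2, fun y g c h => ?_⟩
    have h' : ∀ v : Fin k × (Fin n ⊕ Fin n), eval y (M v.1 v.2) = c * rowVar k n v g :=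
      fun v => congrFun (congrFun h v.1) v.2
    simp only [map_prod, h', Finset.prod_mul_distrib, Finset.prod_const, Finset.card_univ,
      Fintype.card_fin, Finset.prod_apply]
  | zero => exact ⟨0, fun y g c _ => by simp⟩
  | add F F' _ _ h h' =>
    obtain ⟨q, hq⟩ := h
    obtain ⟨q', hq'⟩ := h'
    exact ⟨q + q', fun y g c h => by rw [map_add, hq y g c h, hq' y g c h, Pi.add_apply, mul_add]⟩
  | smul a F _ h =>
    obtain ⟨q, hq⟩ := h
    exact ⟨C a * q, fun y g c h => by
      rw [map_mul, hq y g c h, eval_C, Pi.smul_apply, smul_eq_mul, mul_left_comm]⟩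

lemma polyFn_of_mem_monoSpan (hk : 2 * k ≤ n) {D : ℕ} {F : SpGL n → ℂ} (hF : F ∈ monoSpan (rowVar k n) D)
    {P : ℕ → SpGL n} (hP : (spCell n).Path P) (g : SpGL n) : PolyFn fun m => F (P m * g) := by
  induction hF using Submodule.span_induction with
  | mem F hF =>
    obtain ⟨I, rfl⟩ := hF
    simp only [Finset.prod_apply]
    refine PolyFn.prod _ fun a _ => ?_
    simp only [rowVar, rows_mul, mul_apply]
    refine PolyFn.sum _ fun j _ => PolyFn.mul ?_ (PolyFn.const _)
    rcases j with j | j <;> simp only [fromCols_apply_inl, fromCols_apply_inr, rowX, rowY,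
      selP_mul hk] <;> exact sp_path_polyFn hP _ _
  | zero => exact PolyFn.const 0
  | add F F' _ _ h h' => exact h.add h'
  | smul a F _ h => exact (PolyFn.const a).mul h

lemma polyFn_rowEval (hk : 2 * k ≤ n) (p : Rg k) {P : ℕ → SpGL n} (hP : (spCell n).Path P)
    (g : SpGL n) : PolyFn fun m => rowEval k n p (P m * g) := by
  induction p using MvPolynomial.induction_on with
  | C a => simpa using PolyFn.const a
  | add p q hp hq => simpa using hp.add hq
  | mul_X p v hp => simpa using hp.mul (polyFn_of_mem_monoSpan hk (rowEval_X_mem hk v) hP g)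

/-- The matrix of constant polynomials with given entries. -/
def constM (P : Matrix (Fin k) (Fin n) ℂ) : Matrix (Fin k) (Fin n) (Rg k) := P.map C

lemma constM_map (P : Matrix (Fin k) (Fin n) ℂ) (y : Vr k → ℂ) : (constM P).map (eval y) = P := by
  ext; simp [constM]

lemma adjugate_eq_smul_inv {A : Mt k} (hA : A.det ≠ 0) : A.adjugate = A.det • A⁻¹ := by
  rw [Matrix.inv_def, smul_smul, Ring.mul_inverse_cancel _ hA.isUnit, one_smul]

lemma map_clear_denom {A B : Matrix (Fin k) (Fin k) (Rg k)} (P : Matrix (Fin k) (Fin n) ℂ)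
    {y : Vr k → ℂ} (hA : (A.map (eval y)).det ≠ 0) :
    (B * A.adjugateᵀ * constM P).map (eval y) =
      (A.map (eval y)).det • (B.map (eval y) * ((A.map (eval y))⁻¹)ᵀ * P) := by
  rw [Matrix.map_mul, Matrix.map_mul, constM_map, transpose_map, ← RingHom.mapMatrix_apply (eval y) A.adjugate,
    RingHom.map_adjugate, RingHom.mapMatrix_apply, adjugate_eq_smul_inv hA]
  simp

lemma map_det_smul {A B : Matrix (Fin k) (Fin k) (Rg k)} (P : Matrix (Fin k) (Fin n) ℂ)
    {y : Vr k → ℂ} : (A.det • (B * constM P)).map (eval y) =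
      (A.map (eval y)).det • (B.map (eval y) * P) := by
  rw [← eval_det_map]
  ext i j
  have := congrFun (congrFun (Matrix.map_mul (L := B) (M := constM P) (f := eval y)) i) j
  rw [constM_map, map_apply] at this
  simp [this]

/-- Invariant functions are polynomials in the basic invariants, generically. -/
lemma exists_eval_rowPt (hk : 2 * k ≤ n) {D : ℕ} {F : SpGL n → ℂ}
    (hF : F ∈ monoSpan (rowVar k n) D) (hN : ∀ u : GL (Fin n) ℂ,
      IsUpperUni (u : Mt n) → ∀ g, F (g * spPhi n u) = F g) :
    ∃ p : Rg k, ∀ g, (mA (rowPt k g)).det ≠ 0 → (mB (rowPt k g)).det ≠ 0 →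
      F g = rowEval k n p g := by
  obtain ⟨q, hq⟩ := exists_eval_of_mem_monoSpan hF (fromCols ((XA k).det • (XA k * constM (selP k n)))
    (XS k * (XA k).adjugateᵀ * constM (selP k n) + (XA k).det • (XB k * constM (selQ k n))))
  obtain ⟨q', hq'⟩ := exists_eval_of_mem_monoSpan hF (fromCols
    (XS k * (XB k).adjugateᵀ * constM (selQ k n) + (XB k).det • (XA k * constM (selP k n)))
    ((XB k).det • (XB k * constM (selQ k n))))
  have h1 : ∀ g, (mA (rowPt k g)).det ≠ 0 → (mB (rowPt k g)).det ≠ 0 →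
      eval (rowPt k g) q = (mA (rowPt k g)).det ^ D * F g := by
    intro g hA hB
    obtain ⟨u, hu, hX, hY⟩ := exists_first_normal_form hk g (by simpa using hA) (by simpa using hB)
    rw [← hN u hu g]
    refine hq _ _ _ ?_
    rw [hX, hY, fromCols_map, Matrix.map_add _ (map_add _), map_clear_denom _ (by simpa using hA),
      map_det_smul, map_det_smul]
    simp only [XA_map, XB_map, XS_map, mA_rowPt, mB_rowPt, mS_rowPt]
    ext i (j | j) <;> simp [mul_add]
  have h2 : ∀ g, (mA (rowPt k g)).det ≠ 0 → (mB (rowPt k g)).det ≠ 0 →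
      eval (rowPt k g) q' = (mB (rowPt k g)).det ^ D * F g := by
    intro g hA hB
    obtain ⟨u, hu, hX, hY⟩ := exists_second_normal_form hk g (by simpa using hA) (by simpa using hB)
    rw [← hN u hu g]
    refine hq' _ _ _ ?_
    rw [hX, hY, fromCols_map, Matrix.map_add _ (map_add _), map_clear_denom _ (by simpa using hB),
      map_det_smul, map_det_smul]
    simp only [XA_map, XB_map, XS_map, mA_rowPt, mB_rowPt, mS_rowPt]
    ext i (j | j) <;> simp [mul_add]
  obtain ⟨p, hp⟩ : (XA k).det ^ D ∣ q := by
    refine det_XA_pow_dvd (q' := q') (sub_eq_zero.1 ?_)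
    refine eq_zero_of_eval_mul (mul_ne_zero XA_det_ne_zero XB_det_ne_zero) fun y hy => ?_
    rw [map_mul, eval_det_map, eval_det_map, XA_map, XB_map] at hy
    obtain ⟨g, rfl, -⟩ := exists_rowPt_eq hk y (left_ne_zero_of_mul hy)
    have hA := left_ne_zero_of_mul hy
    have hB := right_ne_zero_of_mul hy
    simp only [map_sub, map_mul, map_pow, eval_det_map, XA_map, XB_map, h1 g hA hB, h2 g hA hB]
    ring
  refine ⟨p, fun g hA hB => mul_left_cancel₀ (pow_ne_zero D hA) ?_⟩
  rw [← h1 g hA hB, hp, map_mul, map_pow, eval_det_map, XA_map, rowEval_apply]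

lemma eq_rowEval (hk : 2 * k ≤ n) {D : ℕ} {F : SpGL n → ℂ} (hF : F ∈ monoSpan (rowVar k n) D)
    {p : Rg k} (h : ∀ g, (mA (rowPt k g)).det ≠ 0 → (mB (rowPt k g)).det ≠ 0 →
      F g = rowEval k n p g) : F = rowEval k n p := by
  ext g
  have hdet : ∀ x : Vr k → ℂ, eval x ((XA k).det * (XB k).det) = (mA x).det * (mB x).det := fun x => by
    rw [map_mul, eval_det_map, eval_det_map, XA_map, XB_map]
  have h1 : mA (pt (1 : Mt k) 1 0) = 1 := rfl
  obtain ⟨g₀, hg₀, -⟩ := exists_rowPt_eq hk (pt 1 1 0) (by rw [h1, det_one]; exact one_ne_zero)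
  obtain ⟨P, hP, hP1, hP0⟩ := (spCell n).exists_path (g * g₀⁻¹)
  obtain ⟨_, ⟨d, rfl⟩, hd⟩ := hP0
  have key := PolyFn.eq_zero_of_mul
    ((polyFn_of_mem_monoSpan hk hF hP g₀).add
      ((PolyFn.const (-1)).mul (polyFn_rowEval hk p hP g₀)))
    (polyFn_rowEval hk ((XA k).det * (XB k).det) hP g₀) (fun m => ?_) ?_ 1
  · rw [hP1, inv_mul_cancel_right] at key
    linear_combination key
  · by_cases h0 : rowEval k n ((XA k).det * (XB k).det) (P m * g₀) = 0
    · rw [h0, mul_zero]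
    · rw [rowEval_apply, hdet] at h0
      rw [h _ (left_ne_zero_of_mul h0) (right_ne_zero_of_mul h0)]
      ring
  · rw [rowEval_apply, hdet, ← hd, rowPt_spPhi_mul (selP_diagonal hk fun i => (d i : ℂ)), hg₀]
    have h2 : mB (pt (1 : Mt k) 1 0) = 1 := rfl
    simp [h1, h2, Finset.prod_ne_zero_iff]

end Division

section Branching

open MvPolynomial

variable {k n : ℕ}

/-- The character of the torus given by a pair of partitions. -/
def ratChar (k : ℕ) {n : ℕ} (a b : ℕ → ℕ) (u : GL (Fin n) ℂ) : ℂ :=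
  (∏ i : Fin k, (selP k n * (u : Mt n) * (selP k n)ᵀ) i i ^ a i) *
    ∏ i : Fin k, (selQ k n * (↑u⁻¹ : Mt n)ᵀ * (selQ k n)ᵀ) i i ^ b i

lemma ratChar_emb (hk : 2 * k ≤ n) (a b : ℕ → ℕ) (h l : GL (Fin k) ℂ) :
    ratChar k a b (emb hk h l) = glChar k a h * glChar k b l := by
  rw [ratChar, emb_val, emb_inv_val, embM_transpose, selP_embM hk, selQ_embM hk, Matrix.mul_assoc,
    Matrix.mul_assoc, selP_selPt hk, selQ_selQt hk, transpose_transpose, Matrix.mul_one,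
    Matrix.mul_one]
  rfl

lemma ratChar_dg (hk : 2 * k ≤ n) (a b : ℕ → ℕ) (d : Fin n → ℂˣ) : ratChar k a b (dg d) =
    (∏ i : Fin k, (d ⟨i, by omega⟩ : ℂ) ^ a i) *
      ∏ i : Fin k, (d ⟨n - 1 - i, by omega⟩ : ℂ)⁻¹ ^ b i := by
  simp only [ratChar, mul_selPt hk, mul_selQt hk, selP_mul hk, selQ_mul hk, transpose_apply,
    dg_inv_val, dg_val, diagonal_apply_eq]

lemma emb_tv (hk : 2 * k ≤ n) (i j : Fin k) (h : i ≠ j) (s : ℂ) : emb hk (tv i j h s) 1 =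
    tv ⟨i, by omega⟩ ⟨j, by omega⟩ (by simpa [Fin.ext_iff] using h) s := by
  ext a b
  rw [emb_val, embM_apply hk]
  simp only [tv_val, transvection, add_sub_cancel_left, inv_one, Units.val_one, transpose_one,
    sub_self, Matrix.zero_apply, dite_eq_ite, ite_self, add_zero, Matrix.add_apply, single_apply, Fin.ext_iff]
  have := i.2
  have := j.2
  split_ifs <;> first | (exfalso; omega) | ring

lemma emb_dg (hk : 2 * k ≤ n) (d e : Fin k → ℂˣ) : ∃ f, emb hk (dg d) (dg e) = dg f := by
  refine exists_dg_of_offdiag fun i j hij => ?_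
  have hij' : (i : ℕ) ≠ j := fun h => hij (Fin.ext h)
  rw [emb_val, embM_apply hk]
  simp only [dg_val, dg_inv_val, Matrix.sub_apply, diagonal_apply, one_apply, transpose_apply, Fin.ext_iff]
  have := i.2
  have := j.2
  split_ifs <;> first | (exfalso; omega) | simp

lemma transpose_transvection (i j : Fin k) (s : ℂ) :
    (transvection j i s)ᵀ = transvection i j s := by
  simp [transvection, transpose_add]

lemma spChar_emb (hk : 2 * k ≤ n) (a : ℕ → ℕ) (h l : GL (Fin k) ℂ) :
    spChar k a (spPhi n (emb hk h l)) = glChar k a h := by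
  have h1 : mA (rowPt k (1 : SpGL n)) = 1 := by
    ext i j
    rw [mA_rowPt, mul_selPt hk, rowX, selP_mul hk]
    simp [toBlocks₁₁, blk_one, one_apply, Fin.ext_iff]
  rw [spChar, ← mul_one (spPhi n _), rowPt_emb_mul, mA_tri, h1]
  simp [glChar]

lemma rowEval_act1 (hk : 2 * k ≤ n) {u h : GL (Fin k) ℂ} (hu : (h : Mt k)ᵀ = u) (p : Rg k)
    (g : SpGL n) : rowEval k n (act1 k u p) g = rowEval k n p (spPhi n (emb hk h 1) * g) := by
  rw [rowEval_apply, rowEval_apply, rowPt_emb_mul, hu, act1_apply, eval_triAct]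

lemma rowEval_act2 (hk : 2 * k ≤ n) (u : GL (Fin k) ℂ) (p : Rg k) (g : SpGL n) :
    rowEval k n (act2 k u p) g = rowEval k n p (g * spPhi n (emb hk u 1)) := by
  rw [rowEval_apply, rowEval_apply, rowPt_mul_emb, act2_apply, eval_triAct, Units.val_one]

lemma rowEval_act3 (hk : 2 * k ≤ n) (u : GL (Fin k) ℂ) (p : Rg k) (g : SpGL n) :
    rowEval k n (act3 k u p) g = rowEval k n p (g * spPhi n (emb hk 1 u)) := by
  rw [rowEval_apply, rowEval_apply, rowPt_mul_emb, act3_apply, eval_triAct, Units.val_one]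

lemma emb_isUpperUni (hk : 2 * k ≤ n) {h l : GL (Fin k) ℂ} (hh : IsUpperUni (h : Mt k))
    (hl : IsUpperUni (l : Mt k)) : IsUpperUni (emb hk h l : Mt n) := by
  rw [emb_val]
  refine embM_isUpperUni hk hh (isUpperUni_transpose.1 ?_)
  rw [transpose_transpose]
  exact inv_isUpperUni hl

lemma eval_tri_upper {p : Rg k} {χ ψ : GL (Fin k) ℂ → ℂ} (hp : p ∈ (glCell k).HW (act2 k) χ)
    (hp' : p ∈ (glCell k).HW (act3 k) ψ) {h l : Mt k} (hh : IsUpperUni h) (hl : IsUpperUni l)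
    (x : Vr k → ℂ) : eval (tri 1 h l x) p = eval x p := by
  obtain ⟨u, rfl, hu⟩ := exists_gl_of_upper hh
  obtain ⟨v, rfl, hv⟩ := exists_gl_of_upper hl
  have h1 : tri 1 (u : Mt k) v x = tri 1 (u : Mt k) 1 (tri 1 1 (v : Mt k) x) := by
    rw [tri_tri]; simp
  rw [h1, ← eval_triAct, ← act2_apply, CellData.up_word_fix hp hu, ← eval_triAct, ← act3_apply,
    CellData.up_word_fix hp' hv]

lemma rowEval_mem_HW (hk : 2 * k ≤ n) {b c : ℕ → ℕ} {p : Rg k}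
    (hb : p ∈ (glCell k).HW (act2 k) (glChar k b)) (hc : p ∈ (glCell k).HW (act3 k) (glChar k c)) :
    rowEval k n p ∈ (glCell n).HW ((rt n).comp (spPhi n)) (ratChar k b c) := by
  refine ⟨fun x hx s => ?_, ?_⟩
  · ext g
    obtain ⟨h, l, hh, hl, he⟩ := rowPt_mul_upper hk (glUp_upper hx s) g
    change rowEval k n p (g * spPhi n (x s)) = _
    rw [rowEval_apply, he, eval_tri_upper hb hc hh hl, rowEval_apply]
  · rintro _ ⟨d, rfl⟩
    ext g
    have h1 : ((dg d : GL (Fin n) ℂ) : Mt n) * (selP k n)ᵀ = (selP k n)ᵀ *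
        ((dg fun i : Fin k => d ⟨i, by omega⟩ : GL (Fin k) ℂ) : Mt k) := by
      have := congrArg transpose (selP_diagonal hk fun i => (d i : ℂ))
      simpa using this
    have h2 : (↑(dg d : GL (Fin n) ℂ)⁻¹ : Mt n)ᵀ * (selQ k n)ᵀ = (selQ k n)ᵀ *
        ((dg fun i : Fin k => (d ⟨n - 1 - i, by omega⟩)⁻¹ : GL (Fin k) ℂ) : Mt k) := by
      ext i j
      rw [mul_selQt hk, selQt_mul _ _ _ hk, dg_inv_val, dg_val, transpose_apply]
      simp only [diagonal_apply, Fin.ext_iff]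
      have := i.2
      have := j.2
      split_ifs <;> first | (exfalso; omega) | rfl | skip
      · have h : n - 1 - (n - 1 - (i : ℕ)) = n - 1 - j := by omega
        simp [h]
    change rowEval k n p (g * spPhi n (dg d)) = _ * rowEval k n p g
    have h3 := tri_tri 1 1 (dg fun i : Fin k => (d ⟨n - 1 - i, by omega⟩)⁻¹ : GL (Fin k) ℂ).1 1
      (dg fun i : Fin k => d ⟨i, by omega⟩ : GL (Fin k) ℂ).1 1 (rowPt k g)
    simp only [one_mul, mul_one] at h3
    rw [rowEval_apply, rowPt_mul_spPhi h1 h2, ← h3, ← eval_triAct, ← act2_apply, hb.2 _ ⟨_, rfl⟩,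
      smul_eval, ← eval_triAct, ← act3_apply, hc.2 _ ⟨_, rfl⟩, smul_eval, ratChar_dg hk, glChar_dg,
      glChar_dg, rowEval_apply, mul_assoc]
    simp

lemma eq_rowEval_of_mem (hk : 2 * k ≤ n) {lam b c : ℕ → ℕ} {F : SpGL n → ℂ} (hF : F ∈ Bsp k n lam)
    (hH : F ∈ (glCell n).HW ((rt n).comp (spPhi n)) (ratChar k b c)) :
    ∃ p, F = rowEval k n p ∧ p ∈ (glCell k).HW (act1 k) (glChar k lam) ∧
      p ∈ (glCell k).HW (act2 k) (glChar k b) ∧ p ∈ (glCell k).HW (act3 k) (glChar k c) := by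
  have hN : ∀ u : GL (Fin n) ℂ, IsUpperUni (u : Mt n) →
      ∀ g, F (g * spPhi n u) = F g := fun u hu g =>
    congrFun (CellData.up_word_fix hH (mem_up_closure hu)) g
  have hT : ∀ d e : Fin k → ℂˣ, ∀ g, F (g * spPhi n (emb hk (dg d) (dg e))) =
      glChar k b (dg d) * glChar k c (dg e) * F g := fun d e g => by
    obtain ⟨f, hf⟩ := emb_dg hk d e
    rw [← ratChar_emb hk, hf]
    exact congrFun (hH.2 _ ⟨f, rfl⟩) g
  obtain ⟨p, hp⟩ := exists_eval_rowPt hk hF.1 hN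
  obtain rfl := eq_rowEval hk hF.1 hp
  have h1 : IsUpperUni ((1 : GL (Fin k) ℂ) : Mt k) :=
    ⟨fun i => by simp, fun i j h => by simp [one_apply, Fin.ext_iff, h.ne']⟩
  refine ⟨p, rfl, ⟨?_, ?_⟩, ⟨fun x hx s => ?_, ?_⟩, fun x hx s => ?_, ?_⟩
  · rintro _ ⟨i, j, h, rfl⟩ s
    refine rowEval_injective hk (funext fun g => ?_)
    rw [rowEval_act1 hk (h := tv j i h.ne' s) (u := tv i j h.ne s)
      (transpose_transvection _ _ _), emb_tv hk]
    exact hF.2.1 _ (Or.inl ⟨_, ⟨_, _, by exact h, rfl⟩, rfl⟩) s g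
  · rintro _ ⟨d, rfl⟩
    refine rowEval_injective hk (funext fun g => ?_)
    obtain ⟨f, hf⟩ := emb_dg hk d 1
    rw [map_one] at hf
    rw [rowEval_act1 hk (h := dg d) (by simp), hF.2.2 _ ⟨_, ⟨f, rfl⟩, by rw [← hf]⟩,
      spChar_emb hk, map_smul, Pi.smul_apply, smul_eq_mul]
  · refine rowEval_injective hk (funext fun g => ?_)
    rw [rowEval_act2 hk, hN _ (emb_isUpperUni hk (glUp_upper hx s) h1)]
  · rintro _ ⟨d, rfl⟩
    refine rowEval_injective hk (funext fun g => ?_)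
    have := hT d 1 g
    rw [map_one] at this
    rw [rowEval_act2 hk, this, map_smul, Pi.smul_apply, smul_eq_mul]
    simp [glChar]
  · refine rowEval_injective hk (funext fun g => ?_)
    rw [rowEval_act3 hk, hN _ (emb_isUpperUni hk h1 (glUp_upper hx s))]
  · rintro _ ⟨d, rfl⟩
    refine rowEval_injective hk (funext fun g => ?_)
    have := hT 1 d g
    rw [map_one] at this
    rw [rowEval_act3 hk, this, map_smul, Pi.smul_apply, smul_eq_mul]
    simp [glChar]

/-- The branching multiplicity in the function model. -/
theorem finrank_branching (hk : 2 * k ≤ n) {lam b c : ℕ → ℕ} (hl : PT k lam) (hb : PT k b)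
    (hc : PT k c) : finrank ℂ (Bsp k n lam ⊓
        (glCell n).HW ((rt n).comp (spPhi n)) (ratChar k b c) : Submodule ℂ (SpGL n → ℂ)) =
      ∑ᶠ (g : Ptn) (d : Ptn), lrCoeff g.1 b c * lrCoeff lam g.1 (double d.1) := by
  have hdeg : ∀ p : Rg k, p ∈ (glCell k).HW (act1 k) (glChar k lam) →
      p ∈ (glCell k).HW (act2 k) (glChar k b) → p ∈ (glCell k).HW (act3 k) (glChar k c) →
      ∀ m, coeff m p ≠ 0 → dA m = sz k b ∧ dB m = sz k c ∧ sz k lam = dA m + dB m + 2 * dS m := by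
    intro p h1 h2 h3 m hm
    rw [← sz_wt1, ← sz_wt2, ← sz_wt3]
    exact ⟨Finset.sum_congr rfl fun i _ => isAct2.mem_Wt.1 h2.2 m hm i,
      Finset.sum_congr rfl fun i _ => isAct3.mem_Wt.1 h3.2 m hm i,
      Finset.sum_congr rfl fun i _ => (isAct1.mem_Wt.1 h1.2 m hm i).symm⟩
  by_cases hs : ∃ e, sz k lam = sz k b + sz k c + 2 * e
  · obtain ⟨e, hs⟩ := hs
    have h1 := finrank_joint_HW hl hb hc hs
    rw [← finsum_lr hl hb hc hs] at h1
    rw [← Nat.cast_inj (R := ℤ).1 h1]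
    rw [(Submodule.equivMapOfInjective (rowEval k n).toLinearMap (rowEval_injective hk)
      _).finrank_eq]
    refine LinearEquiv.finrank_eq (LinearEquiv.ofEq _ _ (le_antisymm ?_ ?_))
    · rintro F ⟨hF, hH⟩
      obtain ⟨p, rfl, h1, h2, h3⟩ := eq_rowEval_of_mem hk hF hH
      refine ⟨p, ⟨⟨⟨mem_Rd.2 fun m hm => ?_, h1⟩, h2⟩, h3⟩, rfl⟩
      obtain ⟨h4, h5, h6⟩ := hdeg p h1 h2 h3 m hm
      exact ⟨h4, h5, by omega⟩
    · rintro _ ⟨p, ⟨⟨⟨h0, h1⟩, h2⟩, h3⟩, rfl⟩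
      exact ⟨rowEval_mem_Bsp hk h0 hs h1, rowEval_mem_HW hk h2 h3⟩
  · push Not at hs
    rw [finsum_lr_eq_zero hl hb hc hs]
    refine (Submodule.finrank_eq_zero (M := SpGL n → ℂ)).2 ?_
    rw [eq_bot_iff]
    rintro F ⟨hF, hH⟩
    obtain ⟨p, rfl, h1, h2, h3⟩ := eq_rowEval_of_mem hk hF hH
    have : p = 0 := by
      ext m
      by_contra hm
      obtain ⟨h4, h5, h6⟩ := hdeg p h1 h2 h3 m hm
      exact hs (dS m) (by omega)
    simp [this]

end Branching

section Main

variable {n k : ℕ}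

lemma IsPartition.pT {f : ℕ → ℕ} (h : IsPartition f) (h' : 2 * plen f ≤ n) : PT (n / 2) f := by
  refine ⟨fun i j hij => h.1 hij, fun i hi => Nat.le_zero.mp ?_⟩
  have h0 : f (plen f) = 0 := Nat.sInf_mem (s := {k | f k = 0}) h.2
  exact h0 ▸ h.1 ((by omega : plen f ≤ n / 2).trans hi)

lemma ratWeight_prod (hk : 2 * k ≤ n) {b c : ℕ → ℕ} (hb : PT k b) (hc : PT k c)
    (d : Fin n → ℂˣ) : ∏ i, (d i : ℂ) ^ ratWeight n b c i = ratChar k b c (dg d) := by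
  rw [ratChar_dg hk]
  simp only [ratWeight, zpow_sub₀ (d _).ne_zero, zpow_natCast, div_eq_mul_inv]
  rw [Finset.prod_mul_distrib]
  congr 1
  · symm
    refine Fintype.prod_of_injective (fun i : Fin k => (⟨i, by omega⟩ : Fin n))
      (fun i j h => by simpa [Fin.ext_iff] using h) _ _ (fun i hi => ?_) fun i => rfl
    rw [hb.2 i, pow_zero]
    exact not_lt.mp fun h => hi ⟨⟨i, h⟩, rfl⟩
  · symm
    refine Fintype.prod_of_injective (fun i : Fin k => (⟨n - 1 - i, by omega⟩ : Fin n))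
      (fun i j h => Fin.ext ?_) _ _ (fun i hi => ?_) fun i => ?_
    · have := Fin.ext_iff.mp h
      simp only at this
      omega
    · rw [hc.2, pow_zero, inv_one]
      refine not_lt.mp fun h => hi ⟨⟨n - 1 - i, h⟩, Fin.ext ?_⟩
      simp only
      omega
    · rw [inv_pow]
      congr 3
      simp only
      omega

lemma exists_mem_HW_of_isGLHW (hk : 2 * k ≤ n) {b c : ℕ → ℕ} (hb : PT k b) (hc : PT k c)
    {V : Type*} [AddCommGroup V] [Module ℂ V] {ρ : Representation ℂ (GL (Fin n) ℂ) V}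
    (h : IsGLHW n (ratWeight n b c) ρ) :
    ∃ v ∈ (glCell n).HW ρ (ratChar k b c), v ≠ 0 := by
  obtain ⟨-, -, v, hv0, hv1, hv2⟩ := h
  refine ⟨v, ⟨fun x hx s => hv1 _ (glUp_upper hx s), ?_⟩, hv0⟩
  rintro _ ⟨d, rfl⟩
  rw [hv2 _ _ (dg_val d), ratWeight_prod hk hb hc]

lemma blk_eq_apply (g : SpGL n) (i j : Fin (2 * n)) :
    ((g : GL (Fin (2 * n)) ℂ) : Mt (2 * n)) i j =
      blk g ((polEquiv n).symm i) ((polEquiv n).symm j) := by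
  simp [blk]

lemma isUpperUni_of_blk {g : SpGL n} (h1 : ∀ i, blk g i i = 1)
    (h2 : ∀ i j, (polEquiv n j : ℕ) < polEquiv n i → blk g i j = 0) :
    IsUpperUni ((g : GL (Fin (2 * n)) ℂ) : Mt (2 * n)) :=
  ⟨fun i => by rw [blk_eq_apply, h1], fun i j hij => by
    rw [blk_eq_apply, h2]; simpa using hij⟩

lemma spUp_upper {x : ℂ → SpGL n} (hx : x ∈ (spCell n).Up) (s : ℂ) :
    IsUpperUni ((x s : GL (Fin (2 * n)) ℂ) : Mt (2 * n)) := by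
  rcases hx with ⟨y, ⟨a, b, hab, rfl⟩, rfl⟩ | ⟨a, b, rfl⟩
  · refine isUpperUni_of_blk (fun i => ?_) fun i j hij => ?_
    · rcases i with i | i <;> simp [-coe_units_inv, tv_inv_val, tv_apply] <;> omega
    · rcases i with i | i <;> rcases j with j | j <;>
        simp [-coe_units_inv, tv_inv_val, tv_apply] at hij ⊢ <;> split_ifs <;>
          first | omega | exact add_zero 0
  · refine isUpperUni_of_blk (fun i => ?_) fun i j hij => ?_
    · rcases i with i | i <;> simp
    · rcases i with i | i <;> rcases j with j | j <;> simp [Matrix.one_apply] at hij ⊢ <;> omega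

lemma exists_mem_HW_of_isSpHW (hk : 2 * k ≤ n) {a : ℕ → ℕ} (ha : PT k a)
    {V : Type*} [AddCommGroup V] [Module ℂ V] {ρ : Representation ℂ (SpGL n) V}
    (h : IsSpHW n a ρ) : ∃ v ∈ (spCell n).HW ρ (spChar k a), v ≠ 0 := by
  obtain ⟨-, -, v, hv0, hv1, hv2⟩ := h
  refine ⟨v, ⟨fun x hx s => hv1 _ (spUp_upper hx s), ?_⟩, hv0⟩
  rintro _ ⟨_, ⟨d, rfl⟩, rfl⟩
  rw [hv2 _ (fun i => Sum.elim (fun j => (d j : ℂ)) (fun j => (d j : ℂ)⁻¹) ((polEquiv n).symm i)),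
    spChar_dg hk]
  · congr 1
    symm
    refine Fintype.prod_of_injective (fun i : Fin k => polEquiv n (Sum.inl ⟨i, by omega⟩))
      (fun i j h => Fin.ext ?_) _ _ (fun i hi => ?_) fun i => by simp
    · simpa using h
    · rw [ha.2 i, pow_zero]
      refine not_lt.mp fun h => hi ⟨⟨i, h⟩, Fin.ext ?_⟩
      simp
  · ext i j
    obtain ⟨i, rfl⟩ := (polEquiv n).surjective i
    obtain ⟨j, rfl⟩ := (polEquiv n).surjective j
    rw [blk_eq_apply, blk_spPhi]
    rcases i with i | i <;> rcases j with j | j <;>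
      simp [-coe_units_inv, diagonal_apply, dg_inv_val, eq_comm]

lemma finrank_HW_equiv {G V W : Type*} [Group G] [AddCommGroup V] [Module ℂ V] [AddCommGroup W]
    [Module ℂ W] {ρ : Representation ℂ G V} {π : Representation ℂ G W} (C : CellData G)
    (χ : G → ℂ) (e : V ≃ₗ[ℂ] W) (he : ∀ g x, e (ρ g x) = π g (e x)) :
    finrank ℂ (C.HW ρ χ) = finrank ℂ (C.HW π χ) :=
  CellData.finrank_eq_of_mem_iff e fun y => by
    simp only [CellData.mem_HW, ← he, ← map_smul, e.injective.eq_iff]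

end Main

/-- Stable branching rule for `GL_n ⊂ Sp_{2n}`, polarization.  For
partitions `mp, mm, lam` with at most `⌊n/2⌋` parts, the multiplicity of
`F^{(mp,mm)}_(n)` in the restriction of `V^lam_(2n)` to the polarized `GL_n ⊂ Sp_{2n}`
is `∑ c^γ_{mp mm} c^lam_{γ, 2δ}`, the sum over all pairs of partitions `(γ, δ)`, `2δ`
running over the even partitions. -/
theorem stable_branching_rule_GLn_sub_Sp2n
    (n : ℕ) (mp mm lam : ℕ → ℕ)
    (hmp : IsPartition mp) (hmm : IsPartition mm) (hlam : IsPartition lam)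
    (hmp' : 2 * plen mp ≤ n) (hmm' : 2 * plen mm ≤ n) (hlam' : 2 * plen lam ≤ n)
    (φ : GL (Fin n) ℂ →* SpGL n) (hφ : IsPolarizationEmbed n φ)
    {Vl Vm : Type*} [AddCommGroup Vl] [Module ℂ Vl] [AddCommGroup Vm] [Module ℂ Vm]
    (ρl : Representation ℂ (SpGL n) Vl)
    (ρm : Representation ℂ (GL (Fin n) ℂ) Vm)
    (hρl : IsSpHW n lam ρl)
    (hρm : IsGLHW n (ratWeight n mp mm) ρm) :
    repMult (ρl.comp φ) ρm
      = ∑ᶠ (g : Ptn) (d : Ptn),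
          lrCoeff g.1 mp mm * lrCoeff lam g.1 (double d.1) := by
  have hk : 2 * (n / 2) ≤ n := Nat.mul_div_le n 2
  have hl := hlam.pT hlam'
  have hb := hmp.pT hmp'
  have hc := hmm.pT hmm'
  rw [eq_spPhi hφ]
  have := hρl.2.1
  have := hρm.2.1
  obtain ⟨v, hv, hv0⟩ := exists_mem_HW_of_isSpHW hk hl hρl
  obtain ⟨w, hw, hw0⟩ := exists_mem_HW_of_isGLHW hk hb hc hρm
  obtain ⟨hi, u, hu, hu0⟩ := Bsp_irreducible hk hl
  obtain ⟨e, he, -⟩ := CellData.exists_equiv hi hρl.1 hu hu0 hv hv0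
  have hU : IsSubrep ((rt n).comp (spPhi n)) (Bsp (n / 2) n lam) := fun g x hx =>
    isSubrep_Bsp lam (spPhi n g) x hx
  have he' : ∀ g x, e (subRep ((rt n).comp (spPhi n)) (Bsp (n / 2) n lam) hU g x) =
      (ρl.comp (spPhi n)) g (e x) := fun g x => he (spPhi n g) x
  rw [CellData.repMult_eq_finrank_HW ((ss_Bsp lam hU).of_equiv e he') hρm.1 hw hw0,
    ← finrank_HW_equiv _ _ e he', CellData.finrank_HW_subRep, finrank_branching hk hl hb hc]

end
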